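/- Let m ∈ (m_s, 1), let u be a radial energy solution of the fast diffusion equation with exponent m and extinction time T > 0, and let V be a stationary profile for the same m and T. Then for every integer k ≥ 1, lim_{t → T⁻} sup_{r > 0} | ∂ᵏ/∂rᵏ [ u(r,t) / ( (1 − t/T)^{1/(1−m)} V(r)^{1/m} ) ] | = 0. -/

import Mathlib

open MeasureTheory Set Filter Topology

/-- Membership in the radial energy space `H¹_rad` on hyperbolic space `ℍ^N`:
`v` is locally absolutely continuous on `(0,∞)` (expressed via the fundamental theorem
of calculus for its a.e. derivative) and both `v` and `v'` are square-integrable with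
respect to the weight `(sinh s)^(N-1)`. -/
def MemH1rad (N : ℕ) (v : ℝ → ℝ) : Prop :=
  (∀ a b : ℝ, 0 < a → a ≤ b → v b - v a = ∫ s in a..b, deriv v s) ∧
  MeasureTheory.IntegrableOn (fun s => (v s) ^ 2 * Real.sinh s ^ (N - 1)) (Set.Ioi 0) ∧
  MeasureTheory.IntegrableOn (fun s => (deriv v s) ^ 2 * Real.sinh s ^ (N - 1)) (Set.Ioi 0)

/-- The squared `H¹` norm `‖v‖_2² + ‖v'‖_2²` with weight `(sinh s)^(N-1)`. -/
noncomputable def H1normSq (N : ℕ) (v : ℝ → ℝ) : ℝ :=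
  (∫ s in Set.Ioi (0:ℝ), (v s) ^ 2 * Real.sinh s ^ (N - 1)) +
  (∫ s in Set.Ioi (0:ℝ), (deriv v s) ^ 2 * Real.sinh s ^ (N - 1))

/-- A radial energy solution of the fast diffusion equation `u_t = Δ(u^m)` on `ℍ^N`,
with exponent `m`, extinction time `T` (initial datum `u(·,0)`). -/
structure IsRadialEnergySolution (N : ℕ) (m T : ℝ) (u : ℝ → ℝ → ℝ) : Prop where
  continuousOn : ContinuousOn (fun p : ℝ × ℝ => u p.1 p.2) (Set.Ici 0 ×ˢ Set.Icc 0 T)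
  nonneg : ∀ r ∈ Set.Ici (0:ℝ), ∀ t ∈ Set.Icc (0:ℝ) T, 0 ≤ u r t
  smooth : ContDiffOn ℝ (⊤ : ℕ∞) (fun p : ℝ × ℝ => u p.1 p.2) (Set.Ici 0 ×ˢ Set.Ioo 0 T)
  pos : ∀ r ∈ Set.Ici (0:ℝ), ∀ t ∈ Set.Ioo (0:ℝ) T, 0 < u r t
  pde : ∀ r > (0:ℝ), ∀ t ∈ Set.Ioo (0:ℝ) T,
    deriv (fun τ => u r τ) t
      = deriv (deriv (fun ρ => u ρ t ^ m)) r
        + ((N : ℝ) - 1) * (Real.cosh r / Real.sinh r) * deriv (fun ρ => u ρ t ^ m) r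
  neumann : ∀ t ∈ Set.Ioo (0:ℝ) T, deriv (fun ρ => u ρ t ^ m) 0 = 0
  extinction : ∀ r ∈ Set.Ici (0:ℝ), u r T = 0
  energy : ∀ t ∈ Set.Ioo (0:ℝ) T, MemH1rad N (fun ρ => u ρ t ^ m)
  energy_bdd : ∀ ε ∈ Set.Ioo (0:ℝ) T, ∃ C : ℝ, ∀ t ∈ Set.Ico ε T,
    H1normSq N (fun ρ => u ρ t ^ m) ≤ C
  init_bdd : ∃ M : ℝ, ∀ r ∈ Set.Ici (0:ℝ), u r 0 ≤ M
  init_nonzero : ∃ r ∈ Set.Ici (0:ℝ), u r 0 ≠ 0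
  init_energy : MemH1rad N (fun ρ => u ρ 0 ^ m)

/-- A stationary profile for the fast diffusion equation: a smooth positive radial
energy solution of `-ΔV = V^(1/m)/((1-m)T)` on `ℍ^N`, decaying like `e^{-(N-1)r}`
together with all of its derivatives. -/
structure IsStationaryProfile (N : ℕ) (m T : ℝ) (V : ℝ → ℝ) : Prop where
  smooth : ContDiffOn ℝ (⊤ : ℕ∞) V (Set.Ici 0)
  pos : ∀ r ∈ Set.Ici (0:ℝ), 0 < V r
  deriv_zero : deriv V 0 = 0
  mem : MemH1rad N V
  ode : ∀ r > (0:ℝ),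
    deriv (deriv V) r + ((N : ℝ) - 1) * (Real.cosh r / Real.sinh r) * deriv V r
      + V r ^ (1 / m) / ((1 - m) * T) = 0
  asymp : ∃ l > (0:ℝ), ∀ k : ℕ,
    Filter.Tendsto (fun r => Real.exp (((N : ℝ) - 1) * r) * iteratedDeriv k V r)
      Filter.atTop (nhds ((-1 : ℝ) ^ k * ((N : ℝ) - 1) ^ k * l))

set_option linter.all false

theorem ext0 {f : ℝ → ℝ} (hf : ContinuousOn f (Ici 0)) : Continuous (fun x => f (max x 0)) :=
  hf.comp_continuous (by fun_prop) (fun x => le_max_right x 0)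

theorem ext0_int {f : ℝ → ℝ} {r : ℝ} (hr : 0 ≤ r) :
    ∫ x in (0:ℝ)..r, f x = ∫ x in (0:ℝ)..r, f (max x 0) := by
  apply intervalIntegral.integral_congr
  intro x hx
  rw [uIcc_of_le hr] at hx
  simp [max_eq_left hx.1]

theorem der_int0 {f : ℝ → ℝ} (hf : ContinuousOn f (Ici 0)) {r : ℝ} (hr : 0 < r) :
    HasDerivAt (fun ρ => ∫ x in (0:ℝ)..ρ, f x) (f r) r := by
  have h := ((ext0 hf).integral_hasStrictDerivAt 0 r).hasDerivAt
  rw [max_eq_left hr.le] at h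
  refine h.congr_of_eventuallyEq ?_
  filter_upwards [lt_mem_nhds hr] with y hy
  exact ext0_int hy.le

theorem ii0 {f : ℝ → ℝ} (hf : ContinuousOn f (Ici 0)) {a b : ℝ} (ha : 0 ≤ a) (hb : 0 ≤ b) :
    IntervalIntegrable f volume a b :=
  (hf.mono (fun x hx => le_trans (le_min ha hb) hx.1)).intervalIntegrable

theorem cont_int0 {f : ℝ → ℝ} (hf : ContinuousOn f (Ici 0)) :
    ContinuousOn (fun ρ => ∫ x in (0:ℝ)..ρ, f x) (Ici 0) := by
  have h : Continuous (fun ρ => ∫ x in (0:ℝ)..ρ, f (max x 0)) :=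
    intervalIntegral.continuous_primitive (fun a b => (ext0 hf).intervalIntegrable a b) 0
  exact h.continuousOn.congr (fun x hx => ext0_int hx)

/-- abstract radial solution -/
structure OSol (n : ℕ) (p c : ℝ) (v : ℝ → ℝ) : Prop where
  cont : ContinuousOn v (Ici 0)
  pos : ∀ r, 0 ≤ r → 0 < v r
  der : ∀ r, 0 < r → HasDerivAt v
    (-c * (∫ x in (0:ℝ)..r, v x ^ p * Real.sinh x ^ n) / Real.sinh r ^ n) r
  decay : ∃ C, ∀ r, 0 ≤ r → v r ≤ C * Real.exp (-(n * r))

noncomputable def OF (n : ℕ) (p : ℝ) (v : ℝ → ℝ) (r : ℝ) : ℝ :=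
  ∫ x in (0:ℝ)..r, v x ^ p * Real.sinh x ^ n

noncomputable def OD (n : ℕ) (p c : ℝ) (v : ℝ → ℝ) (r : ℝ) : ℝ :=
  -c * OF n p v r / Real.sinh r ^ n

noncomputable def OB (n p : ℝ) : ℝ := 2 * n / (p + 3)

noncomputable def OJ (n : ℕ) (p c : ℝ) (v : ℝ → ℝ) (r : ℝ) : ℝ :=
  let b := OB n p
  let q := b * (p + 1)
  let S := Real.sinh r
  1/2 * S ^ q * OD n p c v r ^ 2 + b * S ^ (q - 1) * Real.cosh r * v r * OD n p c v r
    + 1/2 * (b * ((n + 1 - q) * S ^ (q - 2) + (n - q) * S ^ q)) * v r ^ 2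
    + S ^ q * c * v r ^ (p + 1) / (p + 1)

noncomputable def OC (n p : ℝ) (r : ℝ) : ℝ :=
  let b := OB n p
  let q := b * (p + 1)
  b * Real.cosh r * Real.sinh r ^ (q - 3) * ((n + 1 - q) * (q - 2) - q * (q - n) * Real.sinh r ^ 2)

namespace OSol
variable {n : ℕ} {p c : ℝ} {v : ℝ → ℝ}

theorem contInt (h : OSol n p c v) : ContinuousOn (fun x => v x ^ p * Real.sinh x ^ n) (Ici 0) :=
  (h.cont.rpow_const (fun x hx => Or.inl (h.pos x hx).ne')).mul (by fun_prop)

theorem hasF (h : OSol n p c v) {r : ℝ} (hr : 0 < r) :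
    HasDerivAt (OF n p v) (v r ^ p * Real.sinh r ^ n) r := der_int0 h.contInt hr

theorem hasV (h : OSol n p c v) {r : ℝ} (hr : 0 < r) : HasDerivAt v (OD n p c v r) r := h.der r hr

theorem hasD (h : OSol n p c v) {r : ℝ} (hr : 0 < r) :
    HasDerivAt (OD n p c v) (-c * v r ^ p - n * (Real.cosh r / Real.sinh r) * OD n p c v r) r := by
  have hs : 0 < Real.sinh r := Real.sinh_pos_iff.2 hr
  have h1 := (((h.hasF hr).const_mul (-c)).div ((Real.hasDerivAt_sinh r).pow n) (pow_pos hs n).ne')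
  refine h1.congr_deriv ?_
  unfold OD
  rcases n with _ | k
  · simp
  · simp only [Pi.pow_apply]
    field_simp
    simp
    ring

theorem hasJ (h : OSol n p c v) (hp : 1 < p) {r : ℝ} (hr : 0 < r) :
    HasDerivAt (OJ n p c v) (1/2 * OC n p r * v r ^ 2) r := by
  have hs : 0 < Real.sinh r := Real.sinh_pos_iff.2 hr
  have hv := h.pos r hr.le
  set b := OB n p with hb
  have hb' : b * (p + 3) = 2 * n := by rw [hb, OB]; field_simp
  set q := b * (p + 1) with hq
  have hS (e : ℝ) : HasDerivAt (fun x => Real.sinh x ^ e) (Real.cosh r * e * Real.sinh r ^ (e - 1)) r :=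
    (Real.hasDerivAt_sinh r).rpow_const (Or.inl hs.ne')
  have hD := h.hasD hr
  have hV := h.hasV hr
  have key := ((((hS q).const_mul (1/2)).mul (hD.pow 2)).add
    (((((hS (q-1)).const_mul b).mul (Real.hasDerivAt_cosh r)).mul hV).mul hD)).add
    ((((((hS (q-2)).const_mul (n + 1 - q)).add ((hS q).const_mul (n - q))).const_mul b).const_mul (1/2)).mul
      (hV.pow 2)) |>.add ((((hS q).mul_const c).mul (hV.rpow_const (p := p+1) (Or.inl hv.ne'))).div_const (p+1))
  refine HasDerivAt.congr_deriv (f := OJ n p c v) key ?_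
  have e0 : Real.sinh r ^ q = Real.sinh r ^ (q-3) * Real.sinh r ^ 3 := by
    rw [← Real.rpow_natCast, ← Real.rpow_add hs]; congr 1; push_cast; ring
  have e1 : Real.sinh r ^ (q-1) = Real.sinh r ^ (q-3) * Real.sinh r ^ 2 := by
    rw [← Real.rpow_natCast, ← Real.rpow_add hs]; congr 1; push_cast; ring
  have e2 : Real.sinh r ^ (q-2) = Real.sinh r ^ (q-3) * Real.sinh r := by
    rw [← Real.rpow_add_one hs.ne']; congr 1; ring
  have e3 : Real.sinh r ^ (q-1-1) = Real.sinh r ^ (q-3) * Real.sinh r := by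
    rw [← e2]; congr 1; ring
  have e4 : Real.sinh r ^ (q-2-1) = Real.sinh r ^ (q-3) := by congr 1; ring
  have e5 : v r ^ (p + 1) = v r ^ p * v r := Real.rpow_add_one hv.ne' p
  have e6 : v r ^ (p + 1 - 1) = v r ^ p := by congr 1; ring
  simp only [Pi.pow_apply, Pi.mul_apply, Pi.add_apply, e0, e1, e2, e3, e4, e5, e6, OC]
  simp only [← hb, ← hq]
  have hc : Real.cosh r ^ 2 = 1 + Real.sinh r ^ 2 := by have := Real.cosh_sq r; linarith
  generalize Real.sinh r ^ (q-3) = X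
  generalize OD n p c v r = d at *
  generalize v r ^ p = vp
  have hp1 : p + 1 ≠ 0 := by linarith
  rw [hq]
  have hn : (n:ℝ) = b * (p+3) / 2 := by linarith
  rw [hn]
  clear_value b q
  generalize Real.sinh r = S at *
  generalize Real.cosh r = K at *
  generalize v r = y at *
  field_simp
  linear_combination (X*S*b*d*y*(-4+2*b*p-2*b)) * hc
theorem Fnn (h : OSol n p c v) {r : ℝ} (hr : 0 ≤ r) : 0 ≤ OF n p v r := by
  apply intervalIntegral.integral_nonneg hr
  intro x hx
  have := Real.sinh_nonneg_iff.2 hx.1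
  have := (h.pos x hx.1).le
  positivity

/-- all bounds -/
theorem bounds (h : OSol n p c v) (hn : 1 ≤ n) (hp : 1 < p) (hc : 0 < c) : ∃ M > 0, ∀ r, 0 < r →
    |OD n p c v r| ≤ M * r ∧ |OD n p c v r| * Real.sinh r ^ n ≤ M ∧
    v r ≤ M ∧ v r * Real.sinh r ^ n ≤ M := by
  obtain ⟨C, hC⟩ := h.decay
  have hC0 : 0 < C := by
    have := hC 0 le_rfl
    have h2 := h.pos 0 le_rfl
    simp at this
    linarith
  have hn' : (1:ℝ) ≤ n := by exact_mod_cast hn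
  have hvC : ∀ r, 0 ≤ r → v r ≤ C := fun r hr => (hC r hr).trans (by
    have : Real.exp (-(n*r)) ≤ 1 := Real.exp_le_one_iff.2 (by nlinarith)
    nlinarith)
  have hse : ∀ r : ℝ, 0 ≤ r → Real.sinh r ≤ Real.exp r := fun r hr => by
    rw [Real.sinh_eq]; have := Real.exp_pos r; have := Real.exp_pos (-r); linarith
  have hve : ∀ r, 0 ≤ r → v r * Real.sinh r ^ n ≤ C := fun r hr => by
    have h1 : Real.sinh r ^ n ≤ Real.exp (n * r) := by
      rw [Real.exp_nat_mul]; exact pow_le_pow_left₀ (Real.sinh_nonneg_iff.2 hr) (hse r hr) n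
    calc v r * Real.sinh r ^ n ≤ (C * Real.exp (-(n*r))) * Real.exp (n*r) :=
          mul_le_mul (hC r hr) h1 (pow_nonneg (Real.sinh_nonneg_iff.2 hr) n) (by positivity)
      _ = C := by rw [mul_assoc, ← Real.exp_add]; simp
  have hF1 : ∀ r, 0 < r → OF n p v r ≤ C ^ p * r * Real.sinh r ^ n := fun r hr => by
    have := intervalIntegral.integral_mono_on (g := fun _ => C ^ p * Real.sinh r ^ n) hr.le
      (ii0 h.contInt le_rfl hr.le) (by simp) (fun x hx => by
        have h3 := Real.sinh_nonneg_iff.2 hx.1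
        exact mul_le_mul (Real.rpow_le_rpow (h.pos x hx.1).le (hvC x hx.1) (by linarith))
          (pow_le_pow_left₀ h3 (Real.sinh_le_sinh.2 hx.2) n) (by positivity) (by positivity))
    refine this.trans (le_of_eq ?_)
    simp; ring
  have hF2 : ∀ r, 0 < r → OF n p v r ≤ C ^ p / (p - 1) := fun r hr => by
    have hint : ∫ x in (0:ℝ)..r, C ^ p * Real.exp (-(p-1) * x)
        = C ^ p / (p-1) * (1 - Real.exp (-(p-1)*r)) := by
      have : ∀ x ∈ uIcc 0 r, HasDerivAt (fun x => -(C^p/(p-1)) * Real.exp (-(p-1) * x))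
          (C ^ p * Real.exp (-(p-1) * x)) x := fun x _ => by
        have h1 := (((hasDerivAt_id x).const_mul (-(p-1))).exp).const_mul (-(C^p/(p-1)))
        refine h1.congr_deriv ?_
        have : p - 1 ≠ 0 := by linarith
        simp; field_simp; ring
      rw [intervalIntegral.integral_eq_sub_of_hasDerivAt this (by
        apply Continuous.intervalIntegrable; fun_prop)]
      simp; ring
    have := intervalIntegral.integral_mono_on (g := fun x => C ^ p * Real.exp (-(p-1) * x)) hr.le
      (ii0 h.contInt le_rfl hr.le) (by apply Continuous.intervalIntegrable; fun_prop) (fun x hx => by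
        have h3 := Real.sinh_nonneg_iff.2 hx.1
        have h4 : v x ^ p ≤ C ^ p * Real.exp (-(n*x)*p) := by
          rw [Real.exp_mul, ← Real.mul_rpow hC0.le (Real.exp_pos _).le]
          exact Real.rpow_le_rpow (h.pos x hx.1).le (hC x hx.1) (by linarith)
        have h1 : Real.sinh x ^ n ≤ Real.exp (n * x) := by
          rw [Real.exp_nat_mul]; exact pow_le_pow_left₀ h3 (hse x hx.1) n
        calc v x ^ p * Real.sinh x ^ n ≤ C ^ p * Real.exp (-(n*x)*p) * Real.exp (n*x) :=
              mul_le_mul h4 h1 (by positivity) (by positivity)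
          _ = C ^ p * Real.exp (-(p-1) * (n*x)) := by
              rw [mul_assoc, ← Real.exp_add]; ring_nf
          _ ≤ _ := by
              gcongr ?_ * ?_
              apply Real.exp_le_exp.2
              have : x ≤ n * x := by nlinarith [hx.1]
              nlinarith)
    refine this.trans (hint.le.trans ?_)
    have : 0 < C ^ p / (p-1) := div_pos (by positivity) (by linarith)
    nlinarith [Real.exp_pos (-(p-1)*r)]
  have hpp : 0 < C ^ p / (p-1) := div_pos (by positivity) (by linarith)
  refine ⟨c * C ^ p + c * (C ^ p / (p-1)) + C, by positivity, fun r hr => ?_⟩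
  have hs : 0 < Real.sinh r ^ n := pow_pos (Real.sinh_pos_iff.2 hr) n
  have hD : |OD n p c v r| = c * OF n p v r / Real.sinh r ^ n := by
    rw [OD, abs_div, abs_of_pos hs, abs_mul, abs_neg, abs_of_pos hc, abs_of_nonneg (h.Fnn hr.le)]
  have hcp : 0 < c * C ^ p := by positivity
  have hcq : 0 < c * (C ^ p / (p-1)) := by positivity
  refine ⟨?_, ?_, ?_, ?_⟩
  · rw [hD, div_le_iff₀ hs]
    have := mul_le_mul_of_nonneg_left (hF1 r hr) hc.le
    have h2 : 0 ≤ (c * (C ^ p / (p-1)) + C) * r * Real.sinh r ^ n := by positivity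
    linarith
  · rw [hD, div_mul_cancel₀ _ hs.ne']
    have := mul_le_mul_of_nonneg_left (hF2 r hr) hc.le
    linarith
  · linarith [hvC r hr.le]
  · linarith [hve r hr.le]

theorem qfacts (hn : 1 ≤ n) (hp : 1 < p) (hsub : p * (n - 1) < n + 3) :
    0 < OB n p ∧ OB n p * (p+1) < 2 * n ∧ n < OB n p * (p+1) ∧ OB n p * (p+1) < n + 1 := by
  have hn' : (1:ℝ) ≤ n := by exact_mod_cast hn
  have e : OB n p * (p+1) = 2 * n * (p+1) / (p+3) := by unfold OB; ring
  have h3 : 0 < p + 3 := by linarith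
  refine ⟨by unfold OB; positivity, ?_, ?_, ?_⟩
  · rw [e, div_lt_iff₀ h3]; nlinarith
  · rw [e, lt_div_iff₀ h3]; nlinarith
  · rw [e, div_lt_iff₀ h3]; nlinarith

theorem Jtop (h : OSol n p c v) (hn : 1 ≤ n) (hp : 1 < p) (hc : 0 < c) (hsub : p * (n - 1) < n + 3) :
    Tendsto (OJ n p c v) atTop (𝓝 0) := by
  obtain ⟨M, hM, hB⟩ := h.bounds hn hp hc
  obtain ⟨hb, hq1, hq2, hq3⟩ := qfacts hn hp hsub
  set b := OB n p with hbd
  set q := b * (p+1) with hqd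
  have hn' : (1:ℝ) ≤ n := by exact_mod_cast hn
  have hsinh : Tendsto Real.sinh atTop atTop :=
    tendsto_atTop_mono' _ (by filter_upwards [eventually_ge_atTop 0] with x hx using Real.self_le_sinh_iff.2 hx) tendsto_id
  have hlim : Tendsto (fun r => (1/2*M^2 + 2*b*M*M + 1/2*(b*((n+1-q) + (q-n)))*M^2 + c*M^2*M^(p-1)/(p+1)) * Real.sinh r ^ (q-2*n)) atTop (𝓝 0) := by
    have := (tendsto_rpow_neg_atTop (y := 2*n-q) (by linarith)).comp hsinh
    simpa using this.const_mul (1/2*M^2 + 2*b*M*M + 1/2*(b*((n+1-q) + (q-n)))*M^2 + c*M^2*M^(p-1)/(p+1))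
  refine squeeze_zero_norm' ?_ hlim
  filter_upwards [eventually_ge_atTop 1] with r hr
  have hr0 : 0 < r := by linarith
  obtain ⟨-, h2, h3, h4⟩ := hB r hr0
  have hS1 : 1 ≤ Real.sinh r := hr.trans (Real.self_le_sinh_iff.2 hr0.le)
  have hS : 0 < Real.sinh r := by linarith
  have hch : Real.cosh r ≤ 2 * Real.sinh r := by
    have := Real.cosh_sq r
    nlinarith [Real.cosh_pos r]
  have hv := h.pos r hr0.le
  set S := Real.sinh r with hSd
  set X := S ^ (q - 2*n) with hX
  have hXp : 0 < X := Real.rpow_pos_of_pos hS _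
  set d := |OD n p c v r| * S ^ n with hd
  set y := v r * S ^ n with hy
  have hd0 : 0 ≤ d := by positivity
  have hy0 : 0 < y := by positivity
  have e0 : S ^ q = X * (S ^ n) ^ 2 := by
    rw [hX, ← pow_mul, ← Real.rpow_natCast, ← Real.rpow_add hS]; congr 1; push_cast; ring
  have e1 : S ^ (q-1) * S = S ^ q := by
    rw [← Real.rpow_add_one hS.ne']; congr 1; ring
  have e2 : S ^ (q-2) ≤ S ^ q := Real.rpow_le_rpow_of_exponent_le hS1 (by linarith)
  have e2p : 0 < S ^ (q-2) := Real.rpow_pos_of_pos hS _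
  have e1p : 0 < S ^ (q-1) := Real.rpow_pos_of_pos hS _
  have e3 : v r ^ (p+1) ≤ v r ^ 2 * M ^ (p-1) := by
    have : v r ^ (p+1) = v r ^ 2 * v r ^ (p-1) := by
      rw [← Real.rpow_natCast, ← Real.rpow_add hv]; congr 1; push_cast; ring
    rw [this]
    gcongr
  have t1 : |1/2 * S ^ q * OD n p c v r ^ 2| ≤ 1/2 * M^2 * X := by
    rw [abs_of_nonneg (by positivity), e0, ← sq_abs (OD n p c v r)]
    have : d ^ 2 ≤ M ^ 2 := pow_le_pow_left₀ hd0 h2 2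
    calc _ = 1/2 * X * d ^ 2 := by rw [hd]; ring
      _ ≤ 1/2 * X * M ^ 2 := by gcongr
      _ = _ := by ring
  have t2 : |b * S ^ (q - 1) * Real.cosh r * v r * OD n p c v r| ≤ 2*b*M*M * X := by
    rw [abs_mul, abs_of_nonneg (by positivity)]
    have : d * y ≤ M * M := mul_le_mul h2 h4 hy0.le hM.le
    calc b * S ^ (q - 1) * Real.cosh r * v r * |OD n p c v r|
        ≤ b * S ^ (q - 1) * (2 * S) * v r * |OD n p c v r| := by gcongr
      _ = 2 * b * X * (d * y) := by rw [hd, hy]; linear_combination (2*b*v r * |OD n p c v r|) * (e1.trans e0)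
      _ ≤ 2 * b * X * (M * M) := by gcongr
      _ = _ := by ring
  have hyM : y ^ 2 ≤ M ^ 2 := pow_le_pow_left₀ hy0.le h4 2
  have hvX : S ^ q * v r ^ 2 ≤ M ^ 2 * X := by
    calc _ = X * y ^ 2 := by rw [e0, hy]; ring
      _ ≤ X * M ^ 2 := by gcongr
      _ = _ := by ring
  have t3 : |1/2 * (b * ((n + 1 - q) * S ^ (q - 2) + (n - q) * S ^ q)) * v r ^ 2|
      ≤ 1/2*(b*((n+1-q) + (q-n)))*M^2 * X := by
    rw [abs_mul, abs_mul, abs_mul, abs_of_pos hb, abs_of_nonneg (sq_nonneg (v r)), abs_of_pos (by norm_num : (0:ℝ) < 1/2)]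
    have : |(n + 1 - q) * S ^ (q - 2) + (n - q) * S ^ q| ≤ ((n+1-q)+(q-n)) * S ^ q := by
      have ha : 0 ≤ n + 1 - q := by linarith
      have hb2 : 0 ≤ q - n := by linarith
      have i1 := mul_nonneg ha e2p.le
      have i2 := mul_le_mul_of_nonneg_left e2 ha
      have i3 := mul_nonneg hb2 (e2p.le.trans e2)
      rw [abs_le]; constructor <;> linarith
    calc _ ≤ 1/2 * (b * (((n+1-q)+(q-n)) * S ^ q)) * v r ^ 2 := by gcongr
      _ = 1/2 * (b * ((n+1-q)+(q-n))) * (S ^ q * v r ^ 2) := by ring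
      _ ≤ 1/2 * (b * ((n+1-q)+(q-n))) * (M^2 * X) :=
        mul_le_mul_of_nonneg_left hvX (by have : 0 ≤ (n+1-q)+(q-n) := by linarith
                                          positivity)
      _ = _ := by ring
  have t4 : |S ^ q * c * v r ^ (p + 1) / (p + 1)| ≤ c*M^2*M^(p-1)/(p+1) * X := by
    rw [abs_of_nonneg (by positivity)]
    calc S ^ q * c * v r ^ (p + 1) / (p + 1) ≤ S ^ q * c * (v r ^ 2 * M ^ (p-1)) / (p+1) := by gcongr
      _ = c * M ^ (p-1) / (p+1) * (S ^ q * v r ^ 2) := by ring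
      _ ≤ c * M ^ (p-1) / (p+1) * (M ^ 2 * X) := by gcongr
      _ = _ := by ring
  rw [Real.norm_eq_abs]
  unfold OJ
  simp only [← hbd, ← hqd, ← hSd]
  rw [abs_le] at t1 t2 t3 t4 ⊢
  obtain ⟨t1, t1'⟩ := t1
  obtain ⟨t2, t2'⟩ := t2
  obtain ⟨t3, t3'⟩ := t3
  obtain ⟨t4, t4'⟩ := t4
  constructor <;> linarith
end OSol

theorem pos_of_anti_top {f f' : ℝ → ℝ} {r : ℝ} (hd : ∀ x, r ≤ x → HasDerivAt f (f' x) x)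
    (hneg : ∀ x, r < x → f' x < 0) (ht : Tendsto f atTop (𝓝 0)) : 0 < f r := by
  have hA : StrictAntiOn f (Ici r) := strictAntiOn_of_deriv_neg (convex_Ici r)
    (fun x hx => (hd x hx).continuousAt.continuousWithinAt)
    (fun x hx => by rw [interior_Ici] at hx; rw [(hd x hx.le).deriv]; exact hneg x hx)
  have h1 : f (r+1) < f r := hA (mem_Ici.2 le_rfl) (by simp) (by linarith)
  have h2 : 0 ≤ f (r+1) := ge_of_tendsto' (x := atTop) (f := fun _ : ℝ => f (r+1)) tendsto_const_nhds (fun _ => by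
    apply le_of_tendsto ht
    filter_upwards [eventually_ge_atTop (r+1)] with x hx
    exact hA.antitoneOn (by simp) (by simp; linarith) hx)
  linarith

theorem pos_of_mono_zero {f f' : ℝ → ℝ} {r : ℝ} (hr : 0 < r) (hd : ∀ x, 0 < x → x ≤ r → HasDerivAt f (f' x) x)
    (hpos : ∀ x, 0 < x → x < r → 0 < f' x) (ht : Tendsto f (𝓝[>] 0) (𝓝 0)) : 0 < f r := by
  have hA : StrictMonoOn f (Ioc 0 r) := strictMonoOn_of_deriv_pos (convex_Ioc 0 r)
    (fun x hx => (hd x hx.1 hx.2).continuousAt.continuousWithinAt)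
    (fun x hx => by rw [interior_Ioc] at hx; rw [(hd x hx.1 hx.2.le).deriv]; exact hpos x hx.1 hx.2)
  have h1 : f (r/2) < f r := hA ⟨by linarith, by linarith⟩ ⟨hr, le_rfl⟩ (by linarith)
  have h2 : 0 ≤ f (r/2) := by
    apply le_of_tendsto ht
    filter_upwards [Ioc_mem_nhdsGT (show (0:ℝ) < r/2 by linarith)] with x hx
    exact hA.monotoneOn ⟨hx.1, by linarith [hx.2]⟩ ⟨by linarith, by linarith⟩ hx.2
  linarith

theorem sinh_rpow_lim {e : ℝ} (he : 0 < e) : Tendsto (fun r => Real.sinh r ^ e) (𝓝[>] 0) (𝓝 0) := by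
  have : ContinuousAt (fun r => Real.sinh r ^ e) 0 :=
    (Real.continuous_sinh.continuousAt).rpow_const (Or.inr he.le)
  have h := this.tendsto
  simp [Real.zero_rpow he.ne'] at h
  exact h.mono_left nhdsWithin_le_nhds

namespace OSol
variable {n : ℕ} {p c : ℝ} {v v1 v2 : ℝ → ℝ}

theorem lim0 (h : OSol n p c v) : Tendsto v (𝓝[>] 0) (𝓝 (v 0)) :=
  (h.cont 0 (by simp)).mono_left (nhdsWithin_mono _ Ioi_subset_Ici_self)

/-- `S^(q-1) * d → 0` -/
theorem limSD (h : OSol n p c v) (hn : 1 ≤ n) (hp : 1 < p) (hc : 0 < c) {q : ℝ} (hq : 0 < q) :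
    Tendsto (fun r => Real.sinh r ^ (q-1) * OD n p c v r) (𝓝[>] 0) (𝓝 0) := by
  obtain ⟨M, hM, hB⟩ := h.bounds hn hp hc
  have := (sinh_rpow_lim hq).const_mul M
  rw [mul_zero] at this
  refine squeeze_zero_norm' ?_ this
  filter_upwards [self_mem_nhdsWithin] with r hr
  have hr : 0 < r := hr
  have hS := Real.sinh_pos_iff.2 hr
  have hS' := Real.self_le_sinh_iff.2 hr.le
  have h1 := (hB r hr).1
  rw [norm_mul, Real.norm_eq_abs, Real.norm_eq_abs, abs_of_pos (by positivity)]
  calc _ ≤ Real.sinh r ^ (q-1) * (M * Real.sinh r) := by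
        gcongr; exact h1.trans (by gcongr)
    _ = M * (Real.sinh r ^ (q-1) * Real.sinh r) := by ring
    _ = _ := by rw [← Real.rpow_add_one hS.ne']; simp

theorem limD (h : OSol n p c v) (hn : 1 ≤ n) (hp : 1 < p) (hc : 0 < c) :
    Tendsto (OD n p c v) (𝓝[>] 0) (𝓝 0) := by
  simpa using h.limSD hn hp hc (q := 1) one_pos

theorem Jpos (h : OSol n p c v) (hn : 1 ≤ n) (hp : 1 < p) (hc : 0 < c) (hsub : p * (n - 1) < n + 3)
    {r : ℝ} (hr : 0 < r) : 0 < OJ n p c v r := by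
  obtain ⟨hb, hq1, hq2, hq3⟩ := qfacts hn hp hsub
  set b := OB n p with hbd
  set q := b * (p+1) with hqd
  have hn' : (1:ℝ) ≤ n := by exact_mod_cast hn
  have hg : 0 < q * (q - n) := mul_pos (by linarith) (by linarith)
  have hJ : ∀ x, 0 < x → HasDerivAt (OJ n p c v) (1/2 * (b * Real.cosh x * Real.sinh x ^ (q - 3) * ((n + 1 - q) * (q - 2) - q * (q - n) * Real.sinh x ^ 2)) * v x ^ 2) x :=
    fun x hx => h.hasJ hp hx
  have hP : ∀ x, 0 < x → 0 < b * Real.cosh x * Real.sinh x ^ (q - 3) := fun x hx => by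
    have := Real.sinh_pos_iff.2 hx
    have := Real.cosh_pos x
    positivity
  by_cases hbr : (n + 1 - q) * (q - 2) - q * (q - n) * Real.sinh r ^ 2 ≤ 0
  · refine pos_of_anti_top (fun x hx => hJ x (hr.trans_le hx)) (fun x hx => ?_) (h.Jtop hn hp hc hsub)
    have h1 := hP x (hr.trans hx)
    have h2 := h.pos x (hr.trans hx).le
    have h3 : Real.sinh r ^ 2 < Real.sinh x ^ 2 :=
      pow_lt_pow_left₀ (Real.sinh_lt_sinh.2 hx) (Real.sinh_nonneg_iff.2 hr.le) (by norm_num)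
    have h4 : (n + 1 - q) * (q - 2) - q * (q - n) * Real.sinh x ^ 2 < 0 := by nlinarith
    have h5 := mul_neg_of_pos_of_neg h1 h4
    have : 0 < v x ^ 2 := by positivity
    nlinarith
  · push Not at hbr
    have hq4 : 2 < q := by
      by_contra hcon
      push Not at hcon
      have : (n + 1 - q) * (q - 2) ≤ 0 := mul_nonpos_of_nonneg_of_nonpos (by linarith) (by linarith)
      nlinarith [sq_nonneg (Real.sinh r), mul_nonneg hg.le (sq_nonneg (Real.sinh r))]
    refine pos_of_mono_zero hr (fun x hx _ => hJ x hx) (fun x hx hxr => ?_) ?_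
    · have h1 := hP x hx
      have h2 := h.pos x hx.le
      have h3 : Real.sinh x ^ 2 < Real.sinh r ^ 2 :=
        pow_lt_pow_left₀ (Real.sinh_lt_sinh.2 hxr) (Real.sinh_nonneg_iff.2 hx.le) (by norm_num)
      have h4 : 0 < (n + 1 - q) * (q - 2) - q * (q - n) * Real.sinh x ^ 2 := by nlinarith
      positivity
    · have l0 := h.lim0
      have lD := h.limD hn hp hc
      have lc : Tendsto Real.cosh (𝓝[>] 0) (𝓝 1) := by
        have := Real.continuous_cosh.tendsto 0
        rw [Real.cosh_zero] at this
        exact this.mono_left nhdsWithin_le_nhds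
      have lq := sinh_rpow_lim (e := q) (by linarith)
      have lq1 := sinh_rpow_lim (e := q-1) (by linarith)
      have lq2 := sinh_rpow_lim (e := q-2) (by linarith)
      have lp : Tendsto (fun r => v r ^ (p+1)) (𝓝[>] 0) (𝓝 (v 0 ^ (p+1))) :=
        l0.rpow_const (Or.inr (by linarith))
      have := ((((lq.const_mul (1/2)).mul (lD.pow 2)).add ((((lq1.const_mul b).mul lc).mul l0).mul lD)).add
        (((((lq2.const_mul (n+1-q)).add (lq.const_mul (n-q))).const_mul b).const_mul (1/2)).mul (l0.pow 2))).add
        (((lq.mul_const c).mul lp).div_const (p+1))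
      refine Tendsto.congr' (Eventually.of_forall fun x => ?_) (this.trans_eq ?_)
      · simp only [OJ, ← hbd, ← hqd]
      · simp

theorem notlt (h1 : OSol n p c v1) (h2 : OSol n p c v2) (hn : 1 ≤ n) (hp : 1 < p) (hc : 0 < c)
    (hsub : p * (n - 1) < n + 3) : ¬ v1 0 < v2 0 := by
  intro hlt
  obtain ⟨hb, hq1, hq2, hq3⟩ := qfacts hn hp hsub
  set b := OB n p with hbd
  set q := b * (p+1) with hqd
  have hn' : (1:ℝ) ≤ n := by exact_mod_cast hn
  set W : ℝ → ℝ := fun r => v2 r / v1 r with hW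
  set W' : ℝ → ℝ := fun r => (OD n p c v2 r * v1 r - v2 r * OD n p c v1 r) / v1 r ^ 2 with hW'
  have dW : ∀ r, 0 < r → HasDerivAt W (W' r) r := fun r hr => (h2.hasV hr).div (h1.hasV hr) (h1.pos r hr.le).ne'
  set om : ℝ → ℝ := fun r => Real.sinh r ^ n * (OD n p c v2 r * v1 r - v2 r * OD n p c v1 r) with hom
  have dom : ∀ r, 0 < r → HasDerivAt om
      (c * Real.sinh r ^ n * (v1 r ^ p * v2 r - v2 r ^ p * v1 r)) r := fun r hr => by
    have hs : 0 < Real.sinh r := Real.sinh_pos_iff.2 hr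
    refine (((Real.hasDerivAt_sinh r).pow n).mul (((h2.hasD hr).mul (h1.hasV hr)).sub
      ((h2.hasV hr).mul (h1.hasD hr)))).congr_deriv ?_
    obtain ⟨k, rfl⟩ : ∃ k, n = k + 1 := ⟨n - 1, by omega⟩
    simp only [Pi.pow_apply, Pi.sub_apply, Pi.mul_apply]
    field_simp
    simp
    ring
  have hWpos : ∀ r, 0 < r → 0 < W r := fun r hr => div_pos (h2.pos r hr.le) (h1.pos r hr.le)
  have hsgn : ∀ r, 0 < r → 1 < W r → c * Real.sinh r ^ n * (v1 r ^ p * v2 r - v2 r ^ p * v1 r) < 0 := fun r hr hw => by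
    have a1 := h1.pos r hr.le
    have a2 := h2.pos r hr.le
    have hs : 0 < Real.sinh r := Real.sinh_pos_iff.2 hr
    have h12 : v1 r < v2 r := by rwa [hW, lt_div_iff₀ a1, one_mul] at hw
    have e1 : v1 r ^ p = v1 r ^ (p-1) * v1 r := by rw [← Real.rpow_add_one a1.ne']; simp
    have e2 : v2 r ^ p = v2 r ^ (p-1) * v2 r := by rw [← Real.rpow_add_one a2.ne']; simp
    have h3 : v1 r ^ (p-1) < v2 r ^ (p-1) := Real.rpow_lt_rpow a1.le h12 (by linarith)
    apply mul_neg_of_pos_of_neg (by positivity)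
    rw [e1, e2]
    nlinarith [mul_pos a1 a2]
  have omW : ∀ r, 0 < r → (om r < 0 ↔ W' r < 0) := fun r hr => by
    have a1 := h1.pos r hr.le
    have hs : 0 < Real.sinh r ^ n := pow_pos (Real.sinh_pos_iff.2 hr) n
    constructor
    · intro h
      exact div_neg_of_neg_of_pos (by by_contra hh; exact absurd h (not_lt.2 (mul_nonneg hs.le (not_lt.1 hh)))) (by positivity)
    · intro h
      refine mul_neg_of_pos_of_neg hs ?_
      rw [hW', div_lt_iff₀ (by positivity), zero_mul] at h
      exact h
  have lom : Tendsto (fun r => -om r) (𝓝[>] 0) (𝓝 0) := by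
    have := ((sinh_rpow_lim (e := n) (by linarith)).mul (((h2.limD hn hp hc).mul h1.lim0).sub (h2.lim0.mul (h1.limD hn hp hc)))).neg
    simpa [hom] using this
  have lW : Tendsto W (𝓝[>] 0) (𝓝 (v2 0 / v1 0)) := h2.lim0.div h1.lim0 (h1.pos 0 le_rfl).ne'
  set Φ : ℝ → ℝ := fun r => OJ n p c v2 r - W r ^ 2 * OJ n p c v1 r with hΦ
  have eΦ : ∀ r, 0 < r → Φ r = 1/2 * Real.sinh r ^ q * (OD n p c v2 r ^ 2 - W r ^ 2 * OD n p c v1 r ^ 2)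
      + b * Real.cosh r * v2 r * (Real.sinh r ^ (q-1) * OD n p c v2 r - W r * (Real.sinh r ^ (q-1) * OD n p c v1 r))
      + Real.sinh r ^ q * c * (v2 r ^ (p+1) - W r ^ 2 * v1 r ^ (p+1)) / (p+1) := fun r hr => by
    have a1 := (h1.pos r hr.le).ne'
    simp only [hΦ, OJ, ← hbd, ← hqd, hW]
    field_simp
    ring
  have dΦ : ∀ r, 0 < r → HasDerivAt Φ (-2 * W r * W' r * OJ n p c v1 r) r := fun r hr => by
    have a1 := (h1.pos r hr.le).ne'
    refine ((h2.hasJ hp hr).sub (((dW r hr).pow 2).mul (h1.hasJ hp hr))).congr_deriv ?_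
    have e : v2 r = W r * v1 r := by rw [hW]; field_simp
    simp only [Pi.pow_apply]
    rw [e]
    push_cast
    ring
  have lc : Tendsto Real.cosh (𝓝[>] 0) (𝓝 1) := by
    have := Real.continuous_cosh.tendsto 0
    rw [Real.cosh_zero] at this
    exact this.mono_left nhdsWithin_le_nhds
  have lΦ : Tendsto Φ (𝓝[>] 0) (𝓝 0) := by
    have lq := sinh_rpow_lim (e := q) (by linarith)
    have lp1 : Tendsto (fun r => v1 r ^ (p+1)) (𝓝[>] 0) (𝓝 (v1 0 ^ (p+1))) :=
      h1.lim0.rpow_const (Or.inr (by linarith))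
    have lp2 : Tendsto (fun r => v2 r ^ (p+1)) (𝓝[>] 0) (𝓝 (v2 0 ^ (p+1))) :=
      h2.lim0.rpow_const (Or.inr (by linarith))
    have hq0 : 0 < q := by linarith
    have := (((lq.const_mul (1/2)).mul (((h2.limD hn hp hc).pow 2).sub ((lW.pow 2).mul ((h1.limD hn hp hc).pow 2)))).add
      (((lc.const_mul b).mul h2.lim0).mul ((h2.limSD hn hp hc hq0).sub (lW.mul (h1.limSD hn hp hc hq0))))).add
      (((lq.mul_const c).mul (lp2.sub ((lW.pow 2).mul lp1))).div_const (p+1))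
    refine Tendsto.congr' ?_ (this.trans_eq ?_)
    · filter_upwards [self_mem_nhdsWithin] with r hr
      exact (eΦ r hr).symm
    · simp
  have J1pos := fun r (hr : 0 < r) => h1.Jpos hn hp hc hsub hr
  -- W' < 0 everywhere
  have hall : ∀ r, 0 < r → om r < 0 := by
    by_contra hcon
    push Not at hcon
    obtain ⟨r1, hr1, ho⟩ := hcon
    -- near 0
    have hW1 : ∀ᶠ r in 𝓝[>] (0:ℝ), 1 < W r := lW.eventually (lt_mem_nhds (by rwa [lt_div_iff₀ (h1.pos 0 le_rfl), one_mul]))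
    obtain ⟨δ, hδ, hδW⟩ := (mem_nhdsGT_iff_exists_Ioc_subset).1 hW1
    have hδ : 0 < δ := hδ
    have near : ∀ r, 0 < r → r ≤ δ → om r < 0 := fun r hr hrδ => by
      have := pos_of_mono_zero (f := fun r => -om r) (f' := fun r => -(c * Real.sinh r ^ n * (v1 r ^ p * v2 r - v2 r ^ p * v1 r))) hr (fun x hx _ => (dom x hx).neg) (fun x hx hxr => by
        have := hsgn x hx (hδW ⟨hx, hxr.le.trans hrδ⟩)
        linarith) lom
      linarith
    set s := {r | δ ≤ r ∧ 0 ≤ om r} with hs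
    have hδr1 : δ ≤ r1 := by
      by_contra hh
      push Not at hh
      linarith [near r1 hr1 hh.le]
    have hsn : s.Nonempty := ⟨r1, hδr1, ho⟩
    have hsb : BddBelow s := ⟨δ, fun x hx => hx.1⟩
    have hcl : IsClosed s := by
      have : s = Ici δ ∩ om ⁻¹' (Ici 0) := by ext; simp [hs]
      rw [this]
      exact ContinuousOn.preimage_isClosed_of_isClosed
        (fun x hx => (dom x (hδ.trans_le hx)).continuousAt.continuousWithinAt) isClosed_Ici isClosed_Ici
    have hr0 := hcl.csInf_mem hsn hsb
    set r0 := sInf s with hr0d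
    have hr0p : 0 < r0 := hδ.trans_le hr0.1
    have bef : ∀ x, 0 < x → x < r0 → om x < 0 := fun x hx hxr => by
      by_contra hh
      push Not at hh
      rcases le_total x δ with h | h
      · linarith [near x hx h]
      · exact absurd (csInf_le hsb ⟨h, hh⟩) (not_le.2 hxr)
    have om0 : om r0 = 0 := by
      apply le_antisymm _ hr0.2
      have hc0 : Tendsto om (𝓝[<] r0) (𝓝 (om r0)) := (dom r0 hr0p).continuousAt.tendsto.mono_left nhdsWithin_le_nhds
      apply le_of_tendsto hc0
      filter_upwards [Ioo_mem_nhdsLT hr0p] with x hx using (bef x hx.1 hx.2).le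
    have Wlt : W r0 < 1 := by
      by_contra hh
      push Not at hh
      have anti : StrictAntiOn W (Ioc 0 r0) := strictAntiOn_of_deriv_neg (convex_Ioc 0 r0)
        (fun x hx => (dW x hx.1).continuousAt.continuousWithinAt)
        (fun x hx => by rw [interior_Ioc] at hx; rw [(dW x hx.1).deriv]; exact (omW x hx.1).1 (bef x hx.1 hx.2))
      have := pos_of_mono_zero (f := fun r => -om r) (f' := fun r => -(c * Real.sinh r ^ n * (v1 r ^ p * v2 r - v2 r ^ p * v1 r))) hr0p (fun x hx _ => (dom x hx).neg) (fun x hx hxr => by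
        have := hsgn x hx (hh.trans_lt (anti ⟨hx, hxr.le⟩ ⟨hr0p, le_rfl⟩ hxr))
        linarith) lom
      linarith
    have Φp : 0 < Φ r0 := pos_of_mono_zero hr0p (fun x hx _ => dΦ x hx) (fun x hx hxr => by
      have a := (omW x hx).1 (bef x hx hxr)
      have b := hWpos x hx
      have d := J1pos x hx
      have : 0 < W x * (-W' x) * OJ n p c v1 x := by
        have : 0 < -W' x := by linarith
        positivity
      linarith) lΦ
    have a1 := h1.pos r0 hr0p.le
    have a2 := h2.pos r0 hr0p.le
    have hs0 : 0 < Real.sinh r0 := Real.sinh_pos_iff.2 hr0p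
    have e : OD n p c v2 r0 = W r0 * OD n p c v1 r0 := by
      have : OD n p c v2 r0 * v1 r0 - v2 r0 * OD n p c v1 r0 = 0 :=
        (mul_eq_zero.1 om0).resolve_left (pow_pos hs0 n).ne'
      rw [hW]; field_simp; linarith
    have e2 : v2 r0 ^ (p+1) - W r0 ^ 2 * v1 r0 ^ (p+1) < 0 := by
      have ev : v2 r0 = W r0 * v1 r0 := by rw [hW]; field_simp
      have hw0 := hWpos r0 hr0p
      have e4 : v2 r0 ^ (p+1) = W r0 ^ (p+1) * v1 r0 ^ (p+1) := by
        rw [ev, Real.mul_rpow hw0.le a1.le]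
      have e3 : W r0 ^ (p+1) < W r0 ^ 2 := by
        rw [← Real.rpow_natCast]
        exact Real.rpow_lt_rpow_of_exponent_gt hw0 Wlt (by push_cast; linarith)
      rw [e4]
      have : 0 < v1 r0 ^ (p+1) := by positivity
      nlinarith
    rw [eΦ r0 hr0p, e] at Φp
    have : Real.sinh r0 ^ q * c * (v2 r0 ^ (p+1) - W r0 ^ 2 * v1 r0 ^ (p+1)) / (p+1) < 0 :=
      div_neg_of_neg_of_pos (mul_neg_of_pos_of_neg (by positivity) e2) (by linarith)
    nlinarith
  have dpos : ∀ x, 0 < x → 0 < -2 * W x * W' x * OJ n p c v1 x := fun x hx => by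
    have a := (omW x hx).1 (hall x hx)
    have b := hWpos x hx
    have d := J1pos x hx
    have : 0 < W x * (-W' x) * OJ n p c v1 x := by
      have : 0 < -W' x := by linarith
      positivity
    linarith
  have Φ1 : 0 < Φ 1 := pos_of_mono_zero one_pos (fun x hx _ => dΦ x hx) (fun x hx _ => dpos x hx) lΦ
  have Wb : ∀ x, 1 ≤ x → W x ≤ W 1 := fun x hx => by
    have anti : AntitoneOn W (Ici 1) := antitoneOn_of_deriv_nonpos (convex_Ici 1)
      (fun x hx => (dW x (lt_of_lt_of_le one_pos hx)).continuousAt.continuousWithinAt)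
      (fun x hx => by rw [interior_Ici] at hx; exact (dW x (lt_trans one_pos hx)).differentiableAt.differentiableWithinAt)
      (fun x hx => by
        rw [interior_Ici] at hx
        have hx0 : 0 < x := lt_trans one_pos hx
        rw [(dW x hx0).deriv]; exact ((omW x hx0).1 (hall x hx0)).le)
    exact anti (by simp) hx hx
  have Φtop : Tendsto Φ atTop (𝓝 0) := by
    have t1 := h1.Jtop hn hp hc hsub
    have t2 := h2.Jtop hn hp hc hsub
    have : Tendsto (fun r => W r ^ 2 * OJ n p c v1 r) atTop (𝓝 0) := by
      have := (t1.norm).const_mul (W 1 ^ 2)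
      simp only [norm_zero, mul_zero] at this
      refine squeeze_zero_norm' ?_ this
      filter_upwards [eventually_ge_atTop 1] with x hx
      rw [norm_mul, Real.norm_eq_abs (W x ^ 2), abs_of_nonneg (sq_nonneg _)]
      have := hWpos x (by linarith)
      have := Wb x hx
      gcongr
    simpa using t2.sub this
  have := pos_of_anti_top (f := fun x => -Φ x) (r := 1) (fun x hx => (dΦ x (by linarith)).neg)
    (fun x hx => by have := dpos x (by linarith); linarith) (by simpa using Φtop.neg)
  linarith

theorem unique (h1 : OSol n p c v1) (h2 : OSol n p c v2) (hn : 1 ≤ n) (hp : 1 < p) (hc : 0 < c)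
    (hsub : p * (n - 1) < n + 3) : ∀ r, 0 ≤ r → v1 r = v2 r := by
  have h0 : v1 0 = v2 0 := le_antisymm (not_lt.1 (h2.notlt h1 hn hp hc hsub)) (not_lt.1 (h1.notlt h2 hn hp hc hsub))
  obtain ⟨M1, hM1, hB1⟩ := h1.bounds hn hp hc
  obtain ⟨M2, hM2, hB2⟩ := h2.bounds hn hp hc
  set M := max M1 M2
  have hMp : 0 < M := lt_max_of_lt_left hM1
  set L := p * M ^ (p-1) with hL
  have hLp : 0 < L := by positivity
  have lip : ∀ x, 0 < x → |v1 x ^ p - v2 x ^ p| ≤ L * |v1 x - v2 x| := fun x hx => by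
    have := Convex.norm_image_sub_le_of_norm_hasDerivWithin_le (f := fun y : ℝ => y ^ p)
      (f' := fun y => p * y ^ (p-1)) (C := L) (s := Icc 0 M)
      (fun y hy => (Real.hasDerivAt_rpow_const (Or.inr hp.le)).hasDerivWithinAt)
      (fun y hy => by
        have := Real.rpow_le_rpow hy.1 hy.2 (show 0 ≤ p-1 by linarith)
        have h3 : 0 ≤ y ^ (p-1) := Real.rpow_nonneg hy.1 _
        rw [Real.norm_eq_abs, abs_of_nonneg (by positivity), hL]; gcongr)
      (convex_Icc 0 M)
      (x := v2 x) (y := v1 x) ⟨(h2.pos x hx.le).le, (hB2 x hx).2.2.1.trans (le_max_right _ _)⟩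
      ⟨(h1.pos x hx.le).le, (hB1 x hx).2.2.1.trans (le_max_left _ _)⟩
    simpa [Real.norm_eq_abs] using this
  have cd : ContinuousOn (fun x => |v1 x - v2 x|) (Ici 0) := (h1.cont.sub h2.cont).abs
  set E : ℝ → ℝ := fun r => ∫ x in (0:ℝ)..r, |v1 x - v2 x| with hE
  have E0 : ∀ r, 0 ≤ r → 0 ≤ E r := fun r hr => intervalIntegral.integral_nonneg hr (fun x _ => abs_nonneg _)
  have Emono : ∀ r s, 0 ≤ r → r ≤ s → E r ≤ E s := fun r s hr hrs => by
    have := intervalIntegral.integral_add_adjacent_intervals (ii0 cd le_rfl hr) (ii0 cd hr (hr.trans hrs))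
    have h3 : 0 ≤ ∫ x in r..s, |v1 x - v2 x| := intervalIntegral.integral_nonneg hrs (fun x _ => abs_nonneg _)
    simp only [hE]; linarith
  -- derivative difference
  have dd : ∀ r, 0 < r → |OD n p c v1 r - OD n p c v2 r| ≤ c * L * E r := fun r hr => by
    have hs : 0 < Real.sinh r ^ n := pow_pos (Real.sinh_pos_iff.2 hr) n
    have e : OD n p c v1 r - OD n p c v2 r = -(c * (OF n p v1 r - OF n p v2 r) / Real.sinh r ^ n) := by
      unfold OD; ring
    rw [e, abs_neg, abs_div, abs_mul, abs_of_pos hc, abs_of_pos hs, div_le_iff₀ hs]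
    have : |OF n p v1 r - OF n p v2 r| ≤ L * Real.sinh r ^ n * E r := by
      unfold OF
      rw [← intervalIntegral.integral_sub (ii0 h1.contInt le_rfl hr.le) (ii0 h2.contInt le_rfl hr.le)]
      refine (intervalIntegral.abs_integral_le_integral_abs hr.le).trans ?_
      rw [hE, ← intervalIntegral.integral_const_mul]
      refine intervalIntegral.integral_mono_on_of_le_Ioo hr.le
        (ii0 (h1.contInt.sub h2.contInt).abs le_rfl hr.le) (ii0 (cd.const_mul _) le_rfl hr.le) (fun x hx => ?_)
      have hsx := Real.sinh_pos_iff.2 hx.1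
      rw [← sub_mul, abs_mul, abs_of_pos (pow_pos hsx n)]
      calc _ ≤ L * |v1 x - v2 x| * Real.sinh r ^ n :=
            mul_le_mul (lip x hx.1) (pow_le_pow_left₀ hsx.le (Real.sinh_le_sinh.2 hx.2.le) n) (by positivity) (by positivity)
        _ = _ := by ring
    calc _ ≤ c * (L * Real.sinh r ^ n * E r) := by gcongr
      _ = _ := by ring
  intro R hR
  rcases hR.eq_or_lt with h | hR
  · rw [← h]; exact h0
  set K := c * L * R with hK
  have hKp : 0 < K := by positivity
  have vd : ∀ r, 0 ≤ r → r ≤ R → |v1 r - v2 r| ≤ K * E r := fun r hr hrR => by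
    have mv : ∀ x ∈ Icc 0 r, |v1 x - v2 x| ≤ c * L * E r * x := by
      intro x hx
      rcases hx.1.eq_or_lt with h | h
      · rw [← h]; simp [h0]
      obtain ⟨ξ, hξ, he⟩ := exists_hasDerivAt_eq_slope (fun x => v1 x - v2 x)
        (fun x => OD n p c v1 x - OD n p c v2 x) h ((h1.cont.sub h2.cont).mono (fun y hy => hy.1))
        (fun y hy => (h1.hasV hy.1).sub (h2.hasV hy.1))
      have h6 := dd ξ hξ.1
      have h7 := Emono ξ r hξ.1.le (hξ.2.le.trans hx.2)
      have h8 : v1 x - v2 x = (OD n p c v1 ξ - OD n p c v2 ξ) * x := by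
        rw [he]; simp only [h0, sub_self, sub_zero]; field_simp
      rw [h8, abs_mul, abs_of_pos h]
      have : c * L * E ξ ≤ c * L * E r := by gcongr
      nlinarith
    refine (mv r ⟨hr, le_rfl⟩).trans ?_
    have := E0 r hr
    calc c * L * E r * r ≤ c * L * E r * R := by gcongr
      _ = _ := by rw [hK]; ring
  have hanti : AntitoneOn (fun r => E r * Real.exp (-(K * r))) (Icc 0 R) := by
    have hd : ∀ x, 0 < x → HasDerivAt (fun r => E r * Real.exp (-(K * r)))
      ((|v1 x - v2 x|) * Real.exp (-(K*x)) + E x * (Real.exp (-(K*x)) * (-(K*1)))) x := fun x hx =>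
      (der_int0 cd hx).mul (((hasDerivAt_id x).const_mul K).neg.exp)
    refine antitoneOn_of_deriv_nonpos (convex_Icc 0 R)
      (((cont_int0 cd).mono (fun y hy => hy.1)).mul (by fun_prop))
      (fun x hx => ?_) (fun x hx => ?_)
    · rw [interior_Icc] at hx
      exact (hd x hx.1).differentiableAt.differentiableWithinAt
    · rw [interior_Icc] at hx
      rw [(hd x hx.1).deriv]
      have := vd x hx.1.le hx.2.le
      nlinarith [Real.exp_pos (-(K*x))]
  have hER : E R ≤ 0 := by
    have := hanti (left_mem_Icc.2 hR.le) (right_mem_Icc.2 hR.le) hR.le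
    simp [hE] at this
    by_contra hh
    push Not at hh
    exact absurd this (not_le.2 (mul_pos hh (Real.exp_pos _)))
  have := vd R hR.le le_rfl
  have h9 : |v1 R - v2 R| ≤ 0 := this.trans (mul_nonpos_of_nonneg_of_nonpos hKp.le hER)
  have := abs_nonpos_iff.1 h9
  linarith
end OSol

/-- explicit majorant of the Green function -/
noncomputable def Gm (n : ℕ) (a : ℝ) (r : ℝ) : ℝ := 1 / a * (Real.sinh r ^ (-a) * Real.cosh r ^ (a - n))

section Gm
variable {n : ℕ} {a : ℝ}

theorem Gm_pos (ha : 0 < a) {r : ℝ} (hr : 0 < r) : 0 < Gm n a r := by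
  have := Real.sinh_pos_iff.2 hr
  have := Real.cosh_pos r
  unfold Gm; positivity

theorem Gm_deriv (ha : 0 < a) {r : ℝ} (hr : 0 < r) : HasDerivAt (Gm n a)
    (1 / a * ((Real.cosh r * (-a) * Real.sinh r ^ (-a - 1)) * Real.cosh r ^ (a - n) +
      Real.sinh r ^ (-a) * (Real.sinh r * (a - n) * Real.cosh r ^ (a - n - 1)))) r := by
  have h1 := Real.sinh_pos_iff.2 hr
  have h2 := Real.cosh_pos r
  exact (((Real.hasDerivAt_sinh r).rpow_const (Or.inl h1.ne')).mul
    ((Real.hasDerivAt_cosh r).rpow_const (Or.inl h2.ne'))).const_mul (1/a)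

theorem Gm_deriv_le (ha : 0 < a) (h1 : (n:ℝ) - 1 ≤ a) (h2 : a ≤ n) {r : ℝ} (hr : 0 < r) :
    deriv (Gm n a) r ≤ -(1 / Real.sinh r ^ n) := by
  have hs := Real.sinh_pos_iff.2 hr
  have hc := Real.cosh_pos r
  have hsc : Real.sinh r ≤ Real.cosh r := by
    have := Real.cosh_sq r
    exact (pow_le_pow_iff_left₀ hs.le hc.le two_ne_zero).1 (by linarith)
  rw [(Gm_deriv ha hr).deriv]
  have e1 : Real.cosh r * Real.cosh r ^ (a - n) = Real.cosh r ^ (a - n + 1) := by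
    rw [Real.rpow_add_one hc.ne']; ring
  have e2 : Real.sinh r ^ (a - n + 1) ≤ Real.cosh r ^ (a - n + 1) :=
    Real.rpow_le_rpow hs.le hsc (by linarith)
  have e3 : Real.sinh r ^ (-a-1) * Real.sinh r ^ (a-n+1) = 1 / Real.sinh r ^ n := by
    rw [← Real.rpow_add hs, show -a - 1 + (a - n + 1) = -(n:ℝ) by ring, Real.rpow_neg hs.le, Real.rpow_natCast, one_div]
  have p1 : 0 < Real.sinh r ^ (-a-1) := by positivity
  have e4 : 1 / Real.sinh r ^ n ≤ Real.sinh r ^ (-a-1) * Real.cosh r ^ (a - n + 1) := by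
    rw [← e3]; gcongr
  have p2 : 0 ≤ 1/a * (Real.sinh r ^ (-a) * (Real.sinh r * (n - a) * Real.cosh r ^ (a - n - 1))) := by
    have : 0 ≤ n - a := by linarith
    positivity
  have e5 : 1 / a * ((Real.cosh r * (-a) * Real.sinh r ^ (-a - 1)) * Real.cosh r ^ (a - n) +
      Real.sinh r ^ (-a) * (Real.sinh r * (a - n) * Real.cosh r ^ (a - n - 1)))
      = -(Real.sinh r ^ (-a-1) * Real.cosh r ^ (a - n + 1)) - 1/a * (Real.sinh r ^ (-a) * (Real.sinh r * (n - a) * Real.cosh r ^ (a - n - 1))) := by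
    rw [← e1]; field_simp; ring
  rw [e5]; linarith

theorem Gm_cont (ha : 0 < a) : ContinuousOn (Gm n a) (Ioi 0) :=
  fun x hx => (Gm_deriv ha hx).continuousAt.continuousWithinAt

theorem Gm_anti (ha : 0 < a) (h1 : (n:ℝ) - 1 ≤ a) (h2 : a ≤ n) : AntitoneOn (Gm n a) (Ioi 0) := by
  refine antitoneOn_of_deriv_nonpos (convex_Ioi 0) (Gm_cont ha) (fun x hx => ?_) (fun x hx => ?_)
  · rw [interior_Ioi] at hx; exact (Gm_deriv ha hx).differentiableAt.differentiableWithinAt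
  · rw [interior_Ioi] at hx
    have := Gm_deriv_le ha h1 h2 hx
    have h3 : 0 < 1 / Real.sinh x ^ n := one_div_pos.2 (pow_pos (Real.sinh_pos_iff.2 hx) n)
    linarith

theorem Gm_le (ha : 0 < a) (h2 : a ≤ n) {r : ℝ} (hr : 0 < r) : Gm n a r ≤ 1 / a * (1 / Real.sinh r ^ n) := by
  have hs := Real.sinh_pos_iff.2 hr
  have hc := Real.cosh_pos r
  have hsc : Real.sinh r ≤ Real.cosh r := by
    have := Real.cosh_sq r
    exact (pow_le_pow_iff_left₀ hs.le hc.le two_ne_zero).1 (by linarith)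
  unfold Gm
  have e2 : Real.cosh r ^ (a - n) ≤ Real.sinh r ^ (a - n) :=
    Real.rpow_le_rpow_of_nonpos hs hsc (by linarith)
  have e3 : Real.sinh r ^ (-a) * Real.sinh r ^ (a-n) = 1 / Real.sinh r ^ n := by
    rw [← Real.rpow_add hs, show -a + (a - n) = -(n:ℝ) by ring, Real.rpow_neg hs.le, Real.rpow_natCast, one_div]
  rw [← e3]; gcongr

theorem Gm_le_pow (ha : 0 < a) (h2 : a ≤ n) {r : ℝ} (hr : 0 < r) : Gm n a r ≤ 1 / a * r ^ (-a) := by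
  have hs := Real.sinh_pos_iff.2 hr
  have hc := Real.one_le_cosh r
  unfold Gm
  have e2 : Real.cosh r ^ (a - n) ≤ 1 := Real.rpow_le_one_of_one_le_of_nonpos hc (by linarith)
  have e3 : Real.sinh r ^ (-a) ≤ r ^ (-a) :=
    Real.rpow_le_rpow_of_nonpos hr (Real.self_le_sinh_iff.2 hr.le) (by linarith)
  have : Real.sinh r ^ (-a) * Real.cosh r ^ (a-n) ≤ r ^ (-a) * 1 := by gcongr
  rw [mul_one] at this
  gcongr

theorem sinh_ge_exp {r : ℝ} (hr : 1 ≤ r) : Real.exp r / 4 ≤ Real.sinh r := by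
  rw [Real.sinh_eq, Real.exp_neg]
  have h1 : 2 ≤ Real.exp r := by have := Real.add_one_le_exp r; linarith
  have h2 : (Real.exp r)⁻¹ ≤ 1/2 := by
    rw [one_div]; exact inv_anti₀ two_pos h1
  linarith

theorem Gm_le_exp (ha : 0 < a) (h2 : a ≤ n) {r : ℝ} (hr : 1 ≤ r) :
    Gm n a r ≤ 4 ^ n / a * Real.exp (-(n * r)) := by
  refine (Gm_le ha h2 (by linarith)).trans ?_
  have := sinh_ge_exp hr
  have h3 : (Real.exp r / 4) ^ n ≤ Real.sinh r ^ n := pow_le_pow_left₀ (by positivity) this n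
  have h4 : 1 / Real.sinh r ^ n ≤ 1 / (Real.exp r / 4) ^ n := one_div_le_one_div_of_le (by positivity) h3
  calc _ ≤ 1/a * (1 / (Real.exp r / 4) ^ n) := by gcongr
    _ = _ := by rw [Real.exp_neg, Real.exp_nat_mul, div_pow]; field_simp

theorem sinh_le_exp {r : ℝ} : Real.sinh r ≤ Real.exp r := by
  rw [Real.sinh_eq]; have := Real.exp_pos r; have := Real.exp_pos (-r); linarith

theorem sinhn_le_exp {r : ℝ} (hr : 0 ≤ r) : Real.sinh r ^ n ≤ Real.exp (n * r) := by
  rw [Real.exp_nat_mul]; exact pow_le_pow_left₀ (Real.sinh_nonneg_iff.2 hr) sinh_le_exp n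

theorem sinh_le_two {r : ℝ} (h0 : 0 ≤ r) (hr : r ≤ 1) : Real.sinh r ≤ 2 * r := by
  have hA : MonotoneOn (fun x => 2 * x - Real.sinh x) (Icc 0 1) := by
    refine monotoneOn_of_deriv_nonneg (convex_Icc 0 1) (by fun_prop) (by fun_prop) (fun x hx => ?_)
    rw [interior_Icc] at hx
    have hd : HasDerivAt (fun x => 2 * x - Real.sinh x) (2 * 1 - Real.cosh x) x :=
      ((hasDerivAt_id x).const_mul 2).sub (Real.hasDerivAt_sinh x)
    rw [hd.deriv]
    have h1 : Real.cosh x ≤ Real.cosh 1 := by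
      rw [Real.cosh_le_cosh, abs_of_pos hx.1, abs_one]; exact hx.2.le
    have h2 : Real.cosh 1 ≤ 2 := by
      rw [Real.cosh_eq]
      have h3 := Real.exp_one_lt_d9
      have h4 : Real.exp (-1) ≤ 1 := Real.exp_le_one_iff.2 (by norm_num)
      linarith
    linarith
  have := hA ⟨le_rfl, zero_le_one⟩ ⟨h0, hr⟩ h0
  simp at this
  linarith

/-- master integrability lemma -/
theorem Gm_int (ha : 0 < a) (hn : 1 ≤ n) (h2 : a ≤ n) {θ σ : ℝ} (hθ : 0 ≤ θ) (hσ : 0 ≤ σ)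
    (h0 : θ * a < n + 1) (h1 : 1 < θ + σ) :
    IntegrableOn (fun x => Gm n a x ^ θ * Real.exp (-(n * x)) ^ σ * Real.sinh x ^ n) (Ioi 0) := by
  have hn' : (1:ℝ) ≤ n := by exact_mod_cast hn
  have hmeas : ContinuousOn (fun x => Gm n a x ^ θ * Real.exp (-(n * x)) ^ σ * Real.sinh x ^ n) (Ioi 0) := by
    refine (((Gm_cont ha).rpow_const (fun x hx => Or.inl (Gm_pos ha hx).ne')).mul
      (ContinuousOn.rpow_const (by fun_prop) (fun x hx => Or.inl (Real.exp_pos _).ne'))).mul (by fun_prop)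
  rw [← Ioc_union_Ioi_eq_Ioi (zero_le_one (α := ℝ))]
  refine IntegrableOn.union ?_ ?_
  · have hi : IntegrableOn (fun x : ℝ => (1/a) ^ θ * 2 ^ n * x ^ ((n:ℝ) - θ * a)) (Ioc 0 1) := by
      have := intervalIntegral.intervalIntegrable_rpow' (a := 0) (b := 1) (r := (n:ℝ) - θ * a) (by linarith)
      exact ((intervalIntegrable_iff_integrableOn_Ioc_of_le zero_le_one).1 this).const_mul _
    refine Integrable.mono' hi ((hmeas.mono Ioc_subset_Ioi_self).aestronglyMeasurable measurableSet_Ioc) ?_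
    refine (ae_restrict_iff' measurableSet_Ioc).2 (Eventually.of_forall fun x hx => ?_)
    have hx0 : 0 < x := hx.1
    have g0 := Gm_pos (n := n) ha hx0
    have hs := Real.sinh_pos_iff.2 hx0
    rw [Real.norm_eq_abs, abs_of_pos (by positivity)]
    have t1 : Gm n a x ^ θ ≤ (1/a) ^ θ * x ^ (-a * θ) := by
      rw [Real.rpow_mul hx0.le, ← Real.mul_rpow (by positivity) (by positivity)]
      exact Real.rpow_le_rpow g0.le (Gm_le_pow ha h2 hx0) hθ
    have t2 : Real.exp (-(n * x)) ^ σ ≤ 1 :=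
      Real.rpow_le_one (Real.exp_pos _).le (Real.exp_le_one_iff.2 (by have : 0 ≤ n * x := by positivity
                                                                      linarith)) hσ
    have t3 : Real.sinh x ^ n ≤ 2 ^ n * x ^ n := by
      rw [← mul_pow]; exact pow_le_pow_left₀ hs.le (sinh_le_two hx0.le hx.2) n
    calc _ ≤ ((1/a) ^ θ * x ^ (-a * θ)) * 1 * (2 ^ n * x ^ n) := by gcongr
      _ = (1/a) ^ θ * 2 ^ n * (x ^ (-a * θ) * x ^ (n:ℝ)) := by rw [Real.rpow_natCast]; ring
      _ = _ := by rw [← Real.rpow_add hx0]; congr 2; ring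
  · have hi : IntegrableOn (fun x : ℝ => (4 ^ n / a) ^ θ * Real.exp (-(n * (θ + σ - 1)) * x)) (Ioi 1) :=
      (exp_neg_integrableOn_Ioi 1 (by have : 0 < θ + σ - 1 := by linarith
                                      positivity)).const_mul _
    refine Integrable.mono' hi ((hmeas.mono (Ioi_subset_Ioi zero_le_one)).aestronglyMeasurable measurableSet_Ioi) ?_
    refine (ae_restrict_iff' measurableSet_Ioi).2 (Eventually.of_forall fun x hx => ?_)
    have hx1 : 1 < x := hx
    have hx0 : 0 < x := by linarith
    have g0 := Gm_pos (n := n) ha hx0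
    have hs := Real.sinh_pos_iff.2 hx0
    rw [Real.norm_eq_abs, abs_of_pos (by positivity)]
    have t1 : Gm n a x ^ θ ≤ (4 ^ n/a) ^ θ * Real.exp (-(n * x)) ^ θ := by
      rw [← Real.mul_rpow (by positivity) (by positivity)]
      exact Real.rpow_le_rpow g0.le (Gm_le_exp ha h2 hx1.le) hθ
    calc _ ≤ ((4 ^ n/a) ^ θ * Real.exp (-(n * x)) ^ θ) * Real.exp (-(n * x)) ^ σ * Real.exp (n * x) := by
          gcongr; exact sinhn_le_exp hx0.le
      _ = (4 ^ n/a) ^ θ * (Real.exp (-(n * x) * θ) * Real.exp (-(n * x) * σ) * Real.exp (n * x)) := by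
          rw [Real.exp_mul (-(n * x)) θ, Real.exp_mul (-(n * x)) σ]; ring
      _ = _ := by rw [← Real.exp_add, ← Real.exp_add]; congr 2; ring

/-- kernel estimate -/
theorem Gm_kernel (ha : 0 < a) (h1 : (n:ℝ) - 1 ≤ a) (h2 : a ≤ n) {f : ℝ → ℝ} (hf : ContinuousOn f (Ici 0))
    (hf0 : ∀ x, 0 ≤ x → 0 ≤ f x) {r R : ℝ} (hr : 0 < r) (hR : r ≤ R) :
    ∫ ρ in r..R, (∫ x in (0:ℝ)..ρ, f x * Real.sinh x ^ n) / Real.sinh ρ ^ n ≤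
      ∫ x in (0:ℝ)..R, min (Gm n a r) (Gm n a x) * (f x * Real.sinh x ^ n) := by
  set g : ℝ → ℝ := fun x => f x * Real.sinh x ^ n with hg
  have hgc : ContinuousOn g (Ici 0) := hf.mul (by fun_prop)
  have hg0 : ∀ x, 0 ≤ x → 0 ≤ g x := fun x hx => mul_nonneg (hf0 x hx) (pow_nonneg (Real.sinh_nonneg_iff.2 hx) n)
  set F : ℝ → ℝ := fun ρ => ∫ x in (0:ℝ)..ρ, g x with hF
  have F0 : ∀ x, 0 ≤ x → 0 ≤ F x := fun x hx => intervalIntegral.integral_nonneg hx (fun y hy => hg0 y hy.1)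
  have hR0 : 0 < R := hr.trans_le hR
  have hsub : uIcc r R ⊆ Ioi 0 := by rw [uIcc_of_le hR]; exact fun x hx => hr.trans_le hx.1
  have hanti := Gm_anti ha h1 h2
  have dcont : ContinuousOn (deriv (Gm n a)) (Ioi 0) := by
    have : ContinuousOn (fun r => 1 / a * ((Real.cosh r * (-a) * Real.sinh r ^ (-a - 1)) * Real.cosh r ^ (a - n) +
      Real.sinh r ^ (-a) * (Real.sinh r * (a - n) * Real.cosh r ^ (a - n - 1)))) (Ioi 0) := by
      have s1 : ∀ e : ℝ, ContinuousOn (fun r => Real.sinh r ^ e) (Ioi 0) := fun e =>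
        Real.continuous_sinh.continuousOn.rpow_const (fun x hx => Or.inl (Real.sinh_pos_iff.2 hx).ne')
      have s2 : ∀ e : ℝ, ContinuousOn (fun r => Real.cosh r ^ e) (Ioi 0) := fun e =>
        Real.continuous_cosh.continuousOn.rpow_const (fun x hx => Or.inl (Real.cosh_pos x).ne')
      have s3 : ContinuousOn Real.sinh (Ioi 0) := Real.continuous_sinh.continuousOn
      have s4 : ContinuousOn Real.cosh (Ioi 0) := Real.continuous_cosh.continuousOn
      exact continuousOn_const.mul ((((s4.mul continuousOn_const).mul (s1 _)).mul (s2 _)).add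
        ((s1 _).mul ((s3.mul continuousOn_const).mul (s2 _))))
    exact this.congr (fun x hx => (Gm_deriv ha hx).deriv)
  have Fc : ContinuousOn F (uIcc r R) := (cont_int0 hgc).mono (hsub.trans Ioi_subset_Ici_self)
  have gi : IntervalIntegrable g volume r R := ii0 hgc hr.le hR0.le
  have di : IntervalIntegrable (deriv (Gm n a)) volume r R := (dcont.mono hsub).intervalIntegrable
  have ibp := intervalIntegral.integral_mul_deriv_eq_deriv_mul (u := F) (u' := g) (v := Gm n a) (v' := deriv (Gm n a))
    (a := r) (b := R) (fun x hx => der_int0 hgc (hsub hx)) (fun x hx => (Gm_deriv ha (hsub hx)).differentiableAt.hasDerivAt) gi di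
  have sc : ContinuousOn (fun ρ => F ρ / Real.sinh ρ ^ n) (uIcc r R) :=
    Fc.div (by fun_prop) (fun x hx => (pow_pos (Real.sinh_pos_iff.2 (hsub hx)) n).ne')
  have step1 : ∫ ρ in r..R, F ρ / Real.sinh ρ ^ n ≤ ∫ ρ in r..R, -(F ρ * deriv (Gm n a) ρ) := by
    refine intervalIntegral.integral_mono_on hR sc.intervalIntegrable (Fc.mul (dcont.mono hsub)).neg.intervalIntegrable (fun x hx => ?_)
    have hx0 : 0 < x := hr.trans_le hx.1
    have := Gm_deriv_le ha h1 h2 hx0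
    have h3 := mul_le_mul_of_nonneg_left this (F0 x hx0.le)
    rw [div_eq_mul_one_div]; linarith
  rw [intervalIntegral.integral_neg, ibp] at step1
  have mi : ∀ A B, 0 ≤ A → 0 ≤ B → IntervalIntegrable (fun x => min (Gm n a r) (Gm n a x) * g x) volume A B := by
    intro A B hA hB
    rw [intervalIntegrable_iff]
    refine Integrable.bdd_mul (c := Gm n a r) (intervalIntegrable_iff.1 (ii0 hgc hA hB)) ?_ ?_
    · have : ContinuousOn (fun x => min (Gm n a r) (Gm n a x)) (Ioi 0) := continuousOn_const.inf (Gm_cont ha)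
      refine (this.mono ?_).aestronglyMeasurable measurableSet_uIoc
      exact fun x hx => (le_min hA hB).trans_lt hx.1
    · refine (ae_restrict_iff' measurableSet_uIoc).2 (Eventually.of_forall fun x hx => ?_)
      have : 0 < x := (le_min hA hB).trans_lt hx.1
      rw [Real.norm_eq_abs, abs_of_pos (lt_min (Gm_pos ha hr) (Gm_pos ha this))]
      exact min_le_left _ _
  rw [← intervalIntegral.integral_add_adjacent_intervals (mi 0 r le_rfl hr.le) (mi r R hr.le hR0.le)]
  have i1 : ∫ x in (0:ℝ)..r, min (Gm n a r) (Gm n a x) * g x = Gm n a r * F r := by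
    rw [hF, ← intervalIntegral.integral_const_mul]
    refine intervalIntegral.integral_congr_ae (Eventually.of_forall fun x hx => ?_)
    rw [uIoc_of_le hr.le] at hx
    rw [min_eq_left (hanti hx.1 hr hx.2)]
  have i2 : ∫ x in r..R, min (Gm n a r) (Gm n a x) * g x = ∫ x in r..R, g x * Gm n a x := by
    refine intervalIntegral.integral_congr (fun x hx => ?_)
    rw [uIcc_of_le hR] at hx
    rw [min_eq_right (hanti hr (hr.trans_le hx.1) hx.1), mul_comm]
  rw [i1, i2]
  have := mul_nonneg (F0 R hR0.le) (Gm_pos (n := n) ha hR0).le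
  linarith

theorem Gm_invint (ha : 0 < a) (h1 : (n:ℝ) - 1 ≤ a) (h2 : a ≤ n) {r R : ℝ} (hr : 0 < r) (hR : r ≤ R) :
    ∫ ρ in r..R, 1 / Real.sinh ρ ^ n ≤ Gm n a r := by
  have hA : AntitoneOn (fun x => (∫ ρ in r..x, 1 / Real.sinh ρ ^ n) + Gm n a x) (Icc r R) := by
    have ci : ContinuousOn (fun ρ => 1 / Real.sinh ρ ^ n) (Ioi 0) :=
      continuousOn_const.div (by fun_prop) (fun x hx => (pow_pos (Real.sinh_pos_iff.2 hx) n).ne')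
    have hd : ∀ x, r ≤ x → HasDerivAt (fun x => (∫ ρ in r..x, 1 / Real.sinh ρ ^ n) + Gm n a x)
        (1 / Real.sinh x ^ n + deriv (Gm n a) x) x := fun x hx => by
      have hx0 : 0 < x := hr.trans_le hx
      have hss : uIcc r x ⊆ Ioi 0 := by rw [uIcc_of_le hx]; exact fun y hy => hr.trans_le hy.1
      exact (intervalIntegral.integral_hasDerivAt_right ((ci.mono hss).intervalIntegrable)
        (ci.stronglyMeasurableAtFilter isOpen_Ioi x hx0) (ci.continuousAt (Ioi_mem_nhds hx0))).add
        (Gm_deriv ha hx0).differentiableAt.hasDerivAt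
    refine antitoneOn_of_deriv_nonpos (convex_Icc r R) (fun x hx => (hd x hx.1).continuousAt.continuousWithinAt)
      (fun x hx => ?_) (fun x hx => ?_)
    · rw [interior_Icc] at hx; exact (hd x hx.1.le).differentiableAt.differentiableWithinAt
    · rw [interior_Icc] at hx
      rw [(hd x hx.1.le).deriv]
      linarith [Gm_deriv_le ha h1 h2 (hr.trans hx.1)]
  have := hA (left_mem_Icc.2 hR) (right_mem_Icc.2 hR) hR
  simp only [intervalIntegral.integral_same, zero_add] at this
  linarith [Gm_pos (n := n) ha (hr.trans_le hR)]

theorem Gm_min (ha : 0 < a) (h2 : a ≤ n) : ∃ C > 0, ∀ r x θ : ℝ, 0 < r → 0 < x → 0 ≤ θ → θ ≤ 1 →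
    min (Gm n a r) (Gm n a x) ≤ C * Real.exp (-(n * r)) ^ θ * (Real.exp (-(n * x)) ^ (1-θ) * (1 + Gm n a x)) := by
  set C := max (4 ^ n / a) (Real.exp n) with hC
  have hC1 : 1 ≤ C := le_max_of_le_right (Real.one_le_exp (by positivity))
  have hm : ∀ r, 0 < r → min 1 (Gm n a r) ≤ C * Real.exp (-(n*r)) := fun r hr => by
    rcases le_total r 1 with h | h
    · refine (min_le_left _ _).trans ?_
      calc (1:ℝ) ≤ Real.exp (n * (1 - r)) := Real.one_le_exp (by have : 0 ≤ 1 - r := by linarith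
                                                                 positivity)
        _ = Real.exp n * Real.exp (-(n * r)) := by rw [← Real.exp_add]; congr 1; ring
        _ ≤ _ := by gcongr; exact le_max_right _ _
    · refine (min_le_right _ _).trans ((Gm_le_exp ha h2 h).trans ?_)
      gcongr; exact le_max_left _ _
  refine ⟨C, by positivity, fun r x θ hr hx h0 h1 => ?_⟩
  have gr := Gm_pos (n := n) ha hr
  have gx := Gm_pos (n := n) ha hx
  have mr : 0 < min 1 (Gm n a r) := lt_min one_pos gr
  have mx : 0 < min 1 (Gm n a x) := lt_min one_pos gx
  have key : min (Gm n a r) (Gm n a x) ≤ min 1 (Gm n a r) ^ θ * min 1 (Gm n a x) ^ (1-θ) * (1 + Gm n a x) := by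
    have e1 : ∀ y : ℝ, 0 < y → y = y ^ θ * y ^ (1-θ) := fun y hy => by rw [← Real.rpow_add hy]; simp
    have le1 : min (Gm n a r) (Gm n a x) ≤ min 1 (Gm n a r) * (1 + Gm n a x) := by
      rcases le_total 1 (Gm n a r) with h | h
      · rw [min_eq_left h]; linarith [min_le_right (Gm n a r) (Gm n a x)]
      · rw [min_eq_right h]
        refine (min_le_left _ _).trans (le_mul_of_one_le_right gr.le (by linarith))
    have le2 : min (Gm n a r) (Gm n a x) ≤ min 1 (Gm n a x) * (1 + Gm n a x) := by
      rcases le_total 1 (Gm n a x) with h | h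
      · rw [min_eq_left h]; linarith [min_le_right (Gm n a r) (Gm n a x)]
      · rw [min_eq_right h]
        refine (min_le_right _ _).trans (le_mul_of_one_le_right gx.le (by linarith))
    have m0 : 0 < min (Gm n a r) (Gm n a x) := lt_min gr gx
    have q1 := Real.rpow_le_rpow m0.le le1 h0
    have q2 := Real.rpow_le_rpow m0.le le2 (show 0 ≤ 1 - θ by linarith)
    rw [Real.mul_rpow mr.le (by positivity)] at q1
    rw [Real.mul_rpow mx.le (by positivity)] at q2
    calc _ = min (Gm n a r) (Gm n a x) ^ θ * min (Gm n a r) (Gm n a x) ^ (1-θ) := e1 _ m0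
      _ ≤ (min 1 (Gm n a r) ^ θ * (1 + Gm n a x) ^ θ) * (min 1 (Gm n a x) ^ (1-θ) * (1 + Gm n a x) ^ (1-θ)) := by gcongr
      _ = min 1 (Gm n a r) ^ θ * min 1 (Gm n a x) ^ (1-θ) * ((1 + Gm n a x) ^ θ * (1 + Gm n a x) ^ (1-θ)) := by ring
      _ = _ := by rw [← e1 _ (by linarith)]
  have k1 := Real.rpow_le_rpow mr.le (hm r hr) h0
  have k2 := Real.rpow_le_rpow mx.le (hm x hx) (show 0 ≤ 1 - θ by linarith)
  rw [Real.mul_rpow (by positivity) (by positivity)] at k1 k2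
  have eC : C ^ θ * C ^ (1-θ) = C := by rw [← Real.rpow_add (by positivity)]; simp
  calc _ ≤ _ := key
    _ ≤ (C ^ θ * Real.exp (-(n * r)) ^ θ) * (C ^ (1-θ) * Real.exp (-(n * x)) ^ (1-θ)) * (1 + Gm n a x) := by gcongr
    _ = (C ^ θ * C ^ (1-θ)) * Real.exp (-(n * r)) ^ θ * (Real.exp (-(n * x)) ^ (1-θ) * (1 + Gm n a x)) := by ring
    _ = _ := by rw [eC]
end Gm

/-- partial derivatives on the half-plane strip -/
noncomputable def dr (I : Set ℝ) (F : ℝ × ℝ → ℝ) : ℝ × ℝ → ℝ := fun p => fderivWithin ℝ F (Ici 0 ×ˢ I) p (1, 0)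
noncomputable def ds (I : Set ℝ) (F : ℝ × ℝ → ℝ) : ℝ × ℝ → ℝ := fun p => fderivWithin ℝ F (Ici 0 ×ˢ I) p (0, 1)
/-- smooth up to r = 0 -/
def Sm (I : Set ℝ) (F : ℝ × ℝ → ℝ) : Prop := ContDiffOn ℝ (⊤ : ℕ∞) F (Ici 0 ×ˢ I)

section Sm
variable {I : Set ℝ} {F G : ℝ × ℝ → ℝ}

theorem Sm.ud (hI : IsOpen I) : UniqueDiffOn ℝ (Ici (0:ℝ) ×ˢ I) := (uniqueDiffOn_Ici 0).prod hI.uniqueDiffOn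

theorem Sm.fd (h : Sm I F) (hI : IsOpen I) (e : ℝ × ℝ) : Sm I (fun p => fderivWithin ℝ F (Ici 0 ×ˢ I) p e) :=
  (h.fderivWithin (Sm.ud hI) (m := (⊤ : ℕ∞)) (by simp)).clm_apply contDiffOn_const

theorem Sm.dr (h : Sm I F) (hI : IsOpen I) : Sm I (dr I F) := h.fd hI _
theorem Sm.ds (h : Sm I F) (hI : IsOpen I) : Sm I (ds I F) := h.fd hI _

theorem Sm.diff (h : Sm I F) {p : ℝ × ℝ} (hp : p ∈ Ici (0:ℝ) ×ˢ I) : HasFDerivWithinAt F (fderivWithin ℝ F (Ici 0 ×ˢ I) p) (Ici 0 ×ˢ I) p :=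
  ((h.differentiableOn (by simp)) p hp).hasFDerivWithinAt

theorem Sm.hr0 (h : Sm I F) {r s : ℝ} (hr : 0 ≤ r) (hs : s ∈ I) :
    HasDerivWithinAt (fun ρ => F (ρ, s)) (_root_.dr I F (r, s)) (Ici 0) r := by
  have h1 := h.diff (p := (r, s)) ⟨hr, hs⟩
  exact h1.comp_hasDerivWithinAt r (f := fun ρ => (ρ, s)) (f' := (1, 0))
    ((hasDerivWithinAt_id r _).prodMk (hasDerivWithinAt_const r _ s)) (fun x hx => ⟨hx, hs⟩)

theorem Sm.hr (h : Sm I F) {r s : ℝ} (hr : 0 < r) (hs : s ∈ I) :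
    HasDerivAt (fun ρ => F (ρ, s)) (_root_.dr I F (r, s)) r := (h.hr0 hr.le hs).hasDerivAt (Ici_mem_nhds hr)

theorem Sm.hs (h : Sm I F) (hI : IsOpen I) {r s : ℝ} (hr : 0 ≤ r) (hs : s ∈ I) :
    HasDerivAt (fun σ => F (r, σ)) (_root_.ds I F (r, s)) s := by
  have h1 := h.diff (p := (r, s)) ⟨hr, hs⟩
  exact (h1.comp_hasDerivWithinAt s (f := fun σ => (r, σ)) (f' := (0, 1)) (s := I)
    ((hasDerivWithinAt_const s _ r).prodMk (hasDerivWithinAt_id s _)) (fun x hx => ⟨hr, hx⟩)).hasDerivAt (hI.mem_nhds hs)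

theorem Sm.comm (h : Sm I F) (hI : IsOpen I) {r s : ℝ} (hr : 0 < r) (hs : s ∈ I) :
    _root_.dr I (_root_.ds I F) (r, s) = _root_.ds I (_root_.dr I F) (r, s) := by
  have hn : Ici (0:ℝ) ×ˢ I ∈ 𝓝 (r, s) := prod_mem_nhds (Ici_mem_nhds hr) (hI.mem_nhds hs)
  have hc : ContDiffAt ℝ (⊤ : ℕ∞) F (r, s) := h.contDiffAt hn
  have hsym : IsSymmSndFDerivAt ℝ F (r, s) := hc.isSymmSndFDerivAt (by simp; exact WithTop.coe_le_coe.2 (le_top (a := (2:ℕ∞))))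
  have hn' : ∀ᶠ p in 𝓝 (r, s), Ici (0:ℝ) ×ˢ I ∈ 𝓝 p := eventually_mem_nhds_iff.2 hn
  have key : ∀ e e' : ℝ × ℝ, fderivWithin ℝ (fun p => fderivWithin ℝ F (Ici 0 ×ˢ I) p e) (Ici 0 ×ˢ I) (r, s) e'
      = fderiv ℝ (fderiv ℝ F) (r, s) e' e := fun e e' => by
    rw [fderivWithin_of_mem_nhds hn]
    have : (fun p => fderivWithin ℝ F (Ici 0 ×ˢ I) p e) =ᶠ[𝓝 (r, s)] fun p => fderiv ℝ F p e := by
      filter_upwards [hn'] with p hp; rw [fderivWithin_of_mem_nhds hp]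
    rw [this.fderiv_eq]
    have hd : DifferentiableAt ℝ (fderiv ℝ F) (r, s) :=
      (hc.fderiv_right (m := 1) (by norm_cast)).differentiableAt one_ne_zero
    rw [fderiv_clm_apply hd (differentiableAt_const _)]; simp
  unfold _root_.dr _root_.ds
  rw [key, key]; exact hsym _ _
end Sm

/-- working form of a solution -/
structure FD (n : ℕ) (m T : ℝ) (U ut vr : ℝ → ℝ → ℝ) : Prop where
  cont : Continuous (fun p : ℝ × ℝ => U p.1 p.2)
  nonneg : ∀ r t, 0 ≤ U r t
  pos : ∀ r, ∀ t ∈ Ioo 0 T, 0 < U r t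
  ext : ∀ r t, T ≤ t → U r t = 0
  utc : ContinuousOn (fun p : ℝ × ℝ => ut p.1 p.2) (univ ×ˢ Ioo 0 T)
  vrc : ContinuousOn (fun p : ℝ × ℝ => vr p.1 p.2) (univ ×ˢ Ioo 0 T)
  hut : ∀ r, ∀ t ∈ Ioo 0 T, HasDerivAt (U r) (ut r t) t
  hvr : ∀ r, 0 < r → ∀ t ∈ Ioo 0 T, HasDerivAt (fun r => U r t ^ m) (vr r t) r
  hfl : ∀ r, 0 < r → ∀ t ∈ Ioo 0 T, HasDerivAt (fun r => Real.sinh r ^ n * vr r t) (Real.sinh r ^ n * ut r t) r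
  en : ∀ ε ∈ Ioo 0 T, ∃ C, ∀ t ∈ Ico ε T, ∀ R, 0 ≤ R → ∫ r in (0:ℝ)..R, vr r t ^ 2 * Real.sinh r ^ n ≤ C
  dec : ∀ ε ∈ Ioo 0 T, ∃ C, ∀ t, ε ≤ t → ∀ r, 0 ≤ r → U r t ^ m ≤ C * Real.exp (-(n * r / 2))

theorem h1_pt {n : ℕ} {v v' : ℝ → ℝ} {C : ℝ} (hv : ∀ r, 0 < r → HasDerivAt v (v' r) r) (hc : ContinuousOn v' (Ioi 0))
    (h1 : IntegrableOn (fun s => v s ^ 2 * Real.sinh s ^ n) (Ioi 0))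
    (h2 : IntegrableOn (fun s => v' s ^ 2 * Real.sinh s ^ n) (Ioi 0))
    (hC : (∫ s in Ioi 0, v s ^ 2 * Real.sinh s ^ n) + (∫ s in Ioi 0, v' s ^ 2 * Real.sinh s ^ n) ≤ C) {r : ℝ} (hr : 0 < r) :
    v r ^ 2 * Real.sinh r ^ n ≤ 2 * C := by
  have hss : Icc r (r+1) ⊆ Ioi 0 := fun x hx => hr.trans_le hx.1
  have vc : ContinuousOn v (Ioi 0) := fun x hx => (hv x hx).continuousAt.continuousWithinAt
  have hd : ∀ x ∈ uIcc r (r+1), HasDerivAt (fun x => (x - (r+1)) * v x ^ 2) (1 * v x ^ 2 + (x - (r+1)) * (2 * v x ^ 1 * v' x)) x := fun x hx => by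
    rw [uIcc_of_le (by linarith)] at hx
    exact ((hasDerivAt_id x).sub_const (r+1)).mul ((hv x (hss hx)).pow 2)
  have c1 : ContinuousOn (fun x => 1 * v x ^ 2 + (x - (r+1)) * (2 * v x ^ 1 * v' x)) (Ioi 0) := by fun_prop
  have c2 : ContinuousOn (fun x => (v x ^ 2 * Real.sinh x ^ n + v' x ^ 2 * Real.sinh x ^ n) * (2 / Real.sinh r ^ n)) (Ioi 0) := by fun_prop
  have hI := intervalIntegral.integral_eq_sub_of_hasDerivAt hd
    ((c1.mono (by rw [uIcc_of_le (by linarith)]; exact hss)).intervalIntegrable)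
  have hw : 0 < Real.sinh r ^ n := pow_pos (Real.sinh_pos_iff.2 hr) n
  have hle : ∫ x in r..(r+1), (1 * v x ^ 2 + (x - (r+1)) * (2 * v x ^ 1 * v' x)) ≤
      ∫ x in r..(r+1), (v x ^ 2 * Real.sinh x ^ n + v' x ^ 2 * Real.sinh x ^ n) * (2 / Real.sinh r ^ n) := by
    refine intervalIntegral.integral_mono_on (by linarith)
      ((c1.mono (by rw [uIcc_of_le (by linarith)]; exact hss)).intervalIntegrable)
      ((c2.mono (by rw [uIcc_of_le (by linarith)]; exact hss)).intervalIntegrable) (fun x hx => ?_)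
    have hw2 : Real.sinh r ^ n ≤ Real.sinh x ^ n :=
      pow_le_pow_left₀ (Real.sinh_pos_iff.2 hr).le (Real.sinh_le_sinh.2 hx.1) n
    have e : (v x ^ 2 * Real.sinh x ^ n + v' x ^ 2 * Real.sinh x ^ n) * (2 / Real.sinh r ^ n)
      = (v x ^ 2 + v' x ^ 2) * 2 * (Real.sinh x ^ n / Real.sinh r ^ n) := by ring
    have e1 : 1 ≤ Real.sinh x ^ n / Real.sinh r ^ n := (one_le_div hw).2 hw2
    rw [e]
    have e2 : (v x ^ 2 + v' x ^ 2) * 2 ≤ (v x ^ 2 + v' x ^ 2) * 2 * (Real.sinh x ^ n / Real.sinh r ^ n) :=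
      le_mul_of_one_le_right (by positivity) e1
    have y0 : 0 ≤ (r + 1 - x) := by linarith [hx.2]
    have y1 : (r + 1 - x) ≤ 1 := by linarith [hx.1]
    have e3 : (x - (r+1)) * (2 * v x ^ 1 * v' x) ≤ v x ^ 2 + v' x ^ 2 := by
      have a1 : (r+1-x) * (v x + v' x)^2 ≥ 0 := by positivity
      have a2 : (r+1-x) * (v x ^ 2+ v' x ^ 2) ≤ 1 * (v x ^ 2+ v' x ^ 2) := by gcongr
      linarith
    linarith [sq_nonneg (v' x)]
  rw [intervalIntegral.integral_mul_const] at hle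
  have hset : ∫ x in Ioc r (r+1), (v x ^ 2 * Real.sinh x ^ n + v' x ^ 2 * Real.sinh x ^ n) ≤ C := by
    refine le_trans (setIntegral_mono_set (h1.add h2) ?_ (Eventually.of_forall (fun x hx => hr.trans hx.1))) ?_
    · refine (ae_restrict_iff' measurableSet_Ioi).2 (Eventually.of_forall fun x hx => ?_)
      have := Real.sinh_pos_iff.2 (mem_Ioi.1 hx)
      simp only [Pi.zero_apply, Pi.add_apply]; positivity
    · rw [← integral_add h1 h2] at hC; exact hC
  rw [hI, intervalIntegral.integral_of_le (by linarith)] at hle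
  have e4 : (r + 1 - (r + 1)) * v (r + 1) ^ 2 - (r - (r + 1)) * v r ^ 2 = v r ^ 2 := by ring
  rw [e4] at hle
  have := hle.trans (mul_le_mul_of_nonneg_right hset (by positivity))
  rw [← mul_div_assoc, le_div_iff₀ hw] at this
  linarith

noncomputable def cU (T : ℝ) (u : ℝ → ℝ → ℝ) : ℝ → ℝ → ℝ := fun r t => u (max r 0) (max 0 (min t T))
noncomputable def cut (T : ℝ) (u : ℝ → ℝ → ℝ) : ℝ → ℝ → ℝ := fun r t => ds (Ioo 0 T) (fun p => u p.1 p.2) (max r 0, t)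
noncomputable def cvr (m T : ℝ) (u : ℝ → ℝ → ℝ) : ℝ → ℝ → ℝ := fun r t => dr (Ioo 0 T) (fun p => u p.1 p.2 ^ m) (max r 0, t)

theorem cU_eq {T : ℝ} {u : ℝ → ℝ → ℝ} {r t : ℝ} (hr : 0 ≤ r) (h0 : 0 ≤ t) (h1 : t ≤ T) : cU T u r t = u r t := by
  unfold cU; rw [max_eq_left hr, min_eq_left h1, max_eq_right h0]

theorem FD.of {N : ℕ} {m T : ℝ} {u : ℝ → ℝ → ℝ} (hN : 2 ≤ N) (hm : 0 < m) (hT : 0 < T) (h : IsRadialEnergySolution N m T u) :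
    FD (N-1) m T (cU T u) (cut T u) (cvr m T u) := by
  have hI : IsOpen (Ioo 0 T) := isOpen_Ioo
  have sU : Sm (Ioo 0 T) (fun p => u p.1 p.2) := h.smooth
  have sV : Sm (Ioo 0 T) (fun p => u p.1 p.2 ^ m) :=
    sU.rpow_const_of_ne (fun p hp => (h.pos p.1 hp.1 p.2 hp.2).ne')
  have hNc : ((N-1:ℕ):ℝ) = (N:ℝ) - 1 := by rw [Nat.cast_sub (by omega)]; simp
  have hcl : ∀ t, max 0 (min t T) ∈ Icc 0 T := fun t => ⟨le_max_left _ _, max_le hT.le (min_le_right _ _)⟩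
  have hcont : Continuous (fun p : ℝ × ℝ => cU T u p.1 p.2) :=
    h.continuousOn.comp_continuous (f := fun p : ℝ × ℝ => (max p.1 0, max 0 (min p.2 T))) (by fun_prop)
      (fun p => ⟨mem_Ici.2 (le_max_right _ _), hcl _⟩)
  have hclt : ∀ t ∈ Ioo 0 T, max 0 (min t T) = t := fun t ht => by rw [min_eq_left ht.2.le, max_eq_right ht.1.le]
  have hV : ∀ r, 0 < r → ∀ t ∈ Ioo 0 T, HasDerivAt (fun ρ => u ρ t ^ m) (cvr m T u r t) r := fun r hr t ht => by
    have := sV.hr hr ht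
    unfold cvr; rw [max_eq_left hr.le]; exact this
  have hV2 : ∀ r, 0 < r → ∀ t ∈ Ioo 0 T, HasDerivAt (fun ρ => cvr m T u ρ t) (dr (Ioo 0 T) (dr (Ioo 0 T) (fun p => u p.1 p.2 ^ m)) (r, t)) r := fun r hr t ht => by
    have := (sV.dr hI).hr hr ht
    refine this.congr_of_eventuallyEq ?_
    filter_upwards [Ioi_mem_nhds hr] with ρ hρ
    unfold cvr; rw [max_eq_left (le_of_lt hρ)]
  have hvc : ContinuousOn (fun p : ℝ × ℝ => cvr m T u p.1 p.2) (univ ×ˢ Ioo 0 T) :=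
    (sV.dr hI).continuousOn.comp (f := fun p : ℝ × ℝ => (max p.1 0, p.2)) (by fun_prop) (fun p hp => ⟨mem_Ici.2 (le_max_right _ _), hp.2⟩)
  have hev : ∀ r, 0 < r → ∀ t ∈ Ioo 0 T, (fun ρ => cU T u ρ t ^ m) =ᶠ[𝓝 r] fun ρ => u ρ t ^ m := fun r hr t ht => by
    filter_upwards [Ioi_mem_nhds hr] with ρ hρ
    rw [cU_eq (le_of_lt hρ) ht.1.le ht.2.le]
  have hder : ∀ t ∈ Ioo 0 T, ∀ r, 0 < r → deriv (fun ρ => u ρ t ^ m) r = cvr m T u r t := fun t ht r hr => (hV r hr t ht).deriv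
  refine ⟨hcont, fun r t => h.nonneg _ (mem_Ici.2 (le_max_right _ _)) _ (hcl _), fun r t ht => ?_, fun r t ht => ?_, ?_, hvc, fun r t ht => ?_,
    fun r hr t ht => ?_, fun r hr t ht => ?_, fun ε hε => ?_, fun ε hε => ?_⟩
  · unfold cU; rw [hclt t ht]; exact h.pos _ (mem_Ici.2 (le_max_right _ _)) _ ht
  · unfold cU; rw [min_eq_right ht, max_eq_right hT.le]; exact h.extinction _ (mem_Ici.2 (le_max_right _ _))
  · exact (sU.ds hI).continuousOn.comp (f := fun p : ℝ × ℝ => (max p.1 0, p.2)) (by fun_prop) (fun p hp => ⟨mem_Ici.2 (le_max_right _ _), hp.2⟩)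
  · refine (sU.hs hI (le_max_right r 0) ht).congr_of_eventuallyEq ?_
    filter_upwards [hI.mem_nhds ht] with τ hτ
    unfold cU; rw [hclt τ hτ]
  · exact (hV r hr t ht).congr_of_eventuallyEq (hev r hr t ht)
  · have hs := Real.sinh_pos_iff.2 hr
    have h1 := ((Real.hasDerivAt_sinh r).pow (N-1)).mul (hV2 r hr t ht)
    have h2 := h.pde r hr t ht
    have h3 : deriv (fun τ => u r τ) t = cut T u r t := by
      rw [(sU.hs hI hr.le ht).deriv]; unfold cut; rw [max_eq_left hr.le]
    have h4 : deriv (deriv (fun ρ => u ρ t ^ m)) r = dr (Ioo 0 T) (dr (Ioo 0 T) (fun p => u p.1 p.2 ^ m)) (r, t) := by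
      rw [← (hV2 r hr t ht).deriv]
      refine Filter.EventuallyEq.deriv_eq ?_
      filter_upwards [Ioi_mem_nhds hr] with ρ hρ
      exact hder t ht ρ hρ
    rw [h3, h4, hder t ht r hr, ← hNc] at h2
    refine HasDerivAt.congr_deriv h1 ?_
    rw [h2]
    obtain ⟨k, hk⟩ : ∃ k, N - 1 = k + 1 := ⟨N - 2, by omega⟩
    rw [hk]; simp only [Pi.pow_apply, Nat.add_sub_cancel]
    field_simp; ring
  · obtain ⟨C, hC⟩ := h.energy_bdd ε hε
    refine ⟨C, fun t ht R hR => ?_⟩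
    have ht' : t ∈ Ioo 0 T := ⟨hε.1.trans_le ht.1, ht.2⟩
    obtain ⟨-, i1, i2⟩ := h.energy t ht'
    have hc := hC t ht
    unfold H1normSq at hc
    have p1 : 0 ≤ ∫ s in Ioi (0:ℝ), (u s t ^ m) ^ 2 * Real.sinh s ^ (N-1) :=
      setIntegral_nonneg measurableSet_Ioi (fun x hx => by have := Real.sinh_pos_iff.2 (mem_Ioi.1 hx); positivity)
    rw [intervalIntegral.integral_of_le hR]
    have e : ∫ r in Ioc 0 R, cvr m T u r t ^ 2 * Real.sinh r ^ (N-1) = ∫ r in Ioc 0 R, deriv (fun ρ => u ρ t ^ m) r ^ 2 * Real.sinh r ^ (N-1) :=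
      setIntegral_congr_fun measurableSet_Ioc (fun x hx => by rw [hder t ht' x hx.1])
    rw [e]
    refine (setIntegral_mono_set i2 ?_ (Eventually.of_forall (fun x hx => hx.1))).trans (by linarith)
    refine (ae_restrict_iff' measurableSet_Ioi).2 (Eventually.of_forall fun x hx => ?_)
    have := Real.sinh_pos_iff.2 (mem_Ioi.1 hx); simp only [Pi.zero_apply]; positivity
  · obtain ⟨C, hC⟩ := h.energy_bdd ε hε
    have hvcont : Continuous (fun p : ℝ × ℝ => cU T u p.1 p.2 ^ m) := hcont.rpow_const (fun _ => Or.inr hm.le)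
    obtain ⟨M, hM⟩ := ((isCompact_Icc (a := (0:ℝ)) (b := 1)).prod (isCompact_Icc (a := (0:ℝ)) (b := T))).exists_bound_of_continuousOn hvcont.continuousOn
    have vz : ∀ r t, T ≤ t → cU T u r t ^ m = 0 := fun r t ht => by
      have : cU T u r t = 0 := by
        unfold cU; rw [min_eq_right ht, max_eq_right hT.le]; exact h.extinction _ (mem_Ici.2 (le_max_right _ _))
      rw [this, Real.zero_rpow hm.ne']
    have C0 : 0 ≤ |M| * Real.exp ((N-1:ℕ)/2) + Real.sqrt (2 * C * 4 ^ (N-1)) := by positivity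
    refine ⟨|M| * Real.exp ((N-1:ℕ)/2) + Real.sqrt (2 * C * 4 ^ (N-1)), fun t ht r hr => ?_⟩
    rcases le_or_gt T t with htT | htT
    · rw [vz r t htT]; positivity
    have ht' : t ∈ Ioo 0 T := ⟨hε.1.trans_le ht, htT⟩
    rcases le_total r 1 with h1 | h1
    · have := hM (r, t) ⟨⟨hr, h1⟩, ht'.1.le, ht'.2.le⟩
      rw [Real.norm_eq_abs] at this
      calc _ ≤ |M| := (le_abs_self _).trans (this.trans (le_abs_self _))
        _ ≤ |M| * (Real.exp ((N-1:ℕ)/2) * Real.exp (-((N-1:ℕ) * r/2))) := by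
            refine le_mul_of_one_le_right (abs_nonneg _) ?_
            rw [← Real.exp_add]
            refine Real.one_le_exp ?_
            have : 0 ≤ ((N-1:ℕ):ℝ) * (1 - r) := by have : 0 ≤ 1 - r := by linarith
                                                   positivity
            linarith
        _ ≤ _ := by rw [add_mul, mul_assoc]; linarith [show 0 ≤ Real.sqrt (2 * C * 4 ^ (N-1)) * Real.exp (-((N-1:ℕ) * r/2)) by positivity]
    · have hr0 : 0 < r := by linarith
      obtain ⟨-, i1, i2⟩ := h.energy t ht'
      have hc := hC t ⟨ht, htT⟩
      unfold H1normSq at hc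
      have eqd : ∀ x ∈ Ioi (0:ℝ), deriv (fun ρ => u ρ t ^ m) x ^ 2 * Real.sinh x ^ (N-1) = cvr m T u x t ^ 2 * Real.sinh x ^ (N-1) :=
        fun x hx => by rw [hder t ht' x hx]
      rw [setIntegral_congr_fun measurableSet_Ioi eqd] at hc
      have i2' := i2.congr_fun eqd measurableSet_Ioi
      have key := h1_pt (n := N-1) (fun r hr => hV r hr t ht') (hvc.comp (f := fun r => (r, t)) (by fun_prop) (fun r hr => ⟨mem_univ _, ht'⟩)) i1 i2' hc hr0
      rw [cU_eq hr ht'.1.le ht'.2.le]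
      have v0 : 0 ≤ u r t ^ m := Real.rpow_nonneg (h.nonneg r hr t ⟨ht'.1.le, ht'.2.le⟩) m
      have hs : (Real.exp r / 4) ^ (N-1) ≤ Real.sinh r ^ (N-1) := pow_le_pow_left₀ (by positivity) (sinh_ge_exp h1) _
      have k2 : (u r t ^ m) ^ 2 ≤ 2 * C * 4 ^ (N-1) * Real.exp (-((N-1:ℕ) * r/2)) ^ 2 := by
        have e1 : Real.exp (-((N-1:ℕ) * r/2)) ^ 2 = (Real.exp r ^ (N-1))⁻¹ := by
          rw [← Real.exp_nat_mul, ← Real.exp_nat_mul, ← Real.exp_neg]; congr 1; push_cast; ring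
        rw [e1, ← div_eq_mul_inv, le_div_iff₀ (by positivity)]
        rw [div_pow] at hs
        have := (mul_le_mul_of_nonneg_left hs (sq_nonneg (u r t ^ m))).trans key
        rw [← mul_div_assoc, div_le_iff₀ (by positivity)] at this
        exact this
      have k3 := Real.le_sqrt_of_sq_le k2
      have CC : 0 ≤ 2 * C * 4 ^ (N-1) := by
        have : 0 ≤ 2 * C := le_trans (by have := Real.sinh_pos_iff.2 hr0; positivity) key
        positivity
      rw [Real.sqrt_mul CC, Real.sqrt_sq (by positivity)] at k3
      rw [add_mul]; linarith [show 0 ≤ |M| * Real.exp ((N-1:ℕ)/2) * Real.exp (-((N-1:ℕ) * r/2)) by positivity]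

noncomputable def Hk (k : ℕ) (x : ℝ) : ℝ := Real.smoothTransition (k * x)
noncomputable def hk (k : ℕ) (x : ℝ) : ℝ := ∫ y in (0:ℝ)..x, Hk k y

theorem Hk_cont (k : ℕ) : Continuous (Hk k) := Real.smoothTransition.continuous.comp (by fun_prop)
theorem hk_deriv (k : ℕ) (x : ℝ) : HasDerivAt (hk k) (Hk k x) x :=
  (Hk_cont k).integral_hasStrictDerivAt 0 x |>.hasDerivAt
theorem Hk_diff (k : ℕ) (x : ℝ) : HasDerivAt (Hk k) (deriv (Hk k) x) x := by
  have : Differentiable ℝ (Hk k) := (Real.smoothTransition.contDiff (n := 1)).differentiable (by simp) |>.comp (by fun_prop)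
  exact (this x).hasDerivAt
theorem Hk_dnn (k : ℕ) (x : ℝ) : 0 ≤ deriv (Hk k) x :=
  Monotone.deriv_nonneg (fun a b hab => Real.smoothTransition.monotone (by gcongr))
theorem Hk_nn (k : ℕ) (x : ℝ) : 0 ≤ Hk k x := Real.smoothTransition.nonneg _
theorem Hk_le (k : ℕ) (x : ℝ) : Hk k x ≤ 1 := Real.smoothTransition.le_one _
theorem Hk_np (k : ℕ) {x : ℝ} (hx : x ≤ 0) : Hk k x = 0 :=
  Real.smoothTransition.zero_of_nonpos (mul_nonpos_of_nonneg_of_nonpos (by positivity) hx)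
theorem hk_np (k : ℕ) {x : ℝ} (hx : x ≤ 0) : hk k x = 0 := by
  unfold hk
  rw [intervalIntegral.integral_congr (g := fun _ => 0)]
  · simp
  · intro y hy; rw [uIcc_of_ge hx] at hy; exact Hk_np k hy.2
theorem hk_nn (k : ℕ) (x : ℝ) : 0 ≤ hk k x := by
  rcases le_total x 0 with h | h
  · rw [hk_np k h]
  · exact intervalIntegral.integral_nonneg h (fun y _ => Hk_nn k y)
theorem hk_le (k : ℕ) (x : ℝ) : hk k x ≤ max x 0 := by
  rcases le_total x 0 with h | h
  · rw [hk_np k h]; exact le_max_right _ _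
  · rw [max_eq_left h]
    have := intervalIntegral.integral_mono_on (μ := volume) h ((Hk_cont k).intervalIntegrable 0 x) intervalIntegrable_const (fun y _ => Hk_le k y)
    simpa [hk] using this
theorem Hk_lim (x : ℝ) : Tendsto (fun k => Hk k x) atTop (𝓝 (if 0 < x then 1 else 0)) := by
  split_ifs with h
  · refine tendsto_const_nhds.congr' ?_
    obtain ⟨K, hK⟩ := exists_nat_gt (1/x)
    filter_upwards [eventually_ge_atTop K] with k hk
    refine (Real.smoothTransition.one_of_one_le ?_).symm
    have : (1/x) < k := hK.trans_le (by exact_mod_cast hk)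
    rw [div_lt_iff₀ h] at this; exact this.le
  · exact tendsto_const_nhds.congr (fun k => (Hk_np k (not_lt.1 h)).symm)
theorem hk_lim (x : ℝ) : Tendsto (fun k => hk k x) atTop (𝓝 (max x 0)) := by
  rcases le_total x 0 with h | h
  · rw [max_eq_right h]; exact tendsto_const_nhds.congr (fun k => (hk_np k h).symm)
  · have : max x 0 = ∫ y in (0:ℝ)..x, (1:ℝ) := by rw [max_eq_left h]; simp
    rw [this]
    refine intervalIntegral.tendsto_integral_filter_of_dominated_convergence (fun _ => 1) (Eventually.of_forall fun k => (Hk_cont k).aestronglyMeasurable)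
      (Eventually.of_forall fun k => Eventually.of_forall fun y _ => ?_) intervalIntegrable_const (Eventually.of_forall fun y hy => ?_)
    · rw [Real.norm_eq_abs, abs_of_nonneg (Hk_nn k y)]; exact Hk_le k y
    · rw [uIoc_of_le h] at hy
      have := Hk_lim y; rw [if_pos hy.1] at this; exact this

/-- weight -/
noncomputable def zt (n : ℕ) (R r : ℝ) : ℝ := ((Real.cosh r ^ n)⁻¹ - (Real.cosh R ^ n)⁻¹) / n

theorem zt_cont (n : ℕ) (R : ℝ) : Continuous (zt n R) := by
  unfold zt
  exact (((Real.continuous_cosh.pow n).inv₀ (fun x => (pow_pos (Real.cosh_pos x) n).ne')).sub continuous_const).div_const _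

theorem zt_nn {n : ℕ} {R r : ℝ} (h0 : 0 ≤ r) (h : r ≤ R) : 0 ≤ zt n R r := by
  unfold zt
  have : Real.cosh r ^ n ≤ Real.cosh R ^ n := pow_le_pow_left₀ (Real.cosh_pos r).le
    (by rw [Real.cosh_le_cosh, abs_of_nonneg h0, abs_of_nonneg (h0.trans h)]; exact h) n
  have := inv_anti₀ (pow_pos (Real.cosh_pos r) n) this
  exact div_nonneg (by linarith) (by positivity)

theorem zt_deriv {n : ℕ} (hn : 1 ≤ n) (R r : ℝ) : HasDerivAt (zt n R) (-(Real.sinh r / Real.cosh r ^ (n+1))) r := by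
  have hc := Real.cosh_pos r
  have h1 := ((((Real.hasDerivAt_cosh r).pow n).inv (pow_pos hc n).ne').sub_const ((Real.cosh R ^ n)⁻¹)).div_const (n:ℝ)
  refine HasDerivAt.congr_deriv h1 ?_
  obtain ⟨k, rfl⟩ : ∃ k, n = k + 1 := ⟨n - 1, by omega⟩
  simp only [Pi.pow_apply, Nat.add_sub_cancel]
  have : ((k+1:ℕ):ℝ) ≠ 0 := by positivity
  field_simp; ring

theorem kato1 {n : ℕ} (hn : 1 ≤ n) {z zr gt : ℝ → ℝ} {R : ℝ} (hR : 0 < R) (zc : Continuous z) (zrc : Continuous zr) (gc : Continuous gt)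
    (hz : ∀ r, 0 < r → HasDerivAt z (zr r) r)
    (hf : ∀ r, 0 < r → HasDerivAt (fun r => Real.sinh r ^ n * zr r) (Real.sinh r ^ n * gt r) r) (k : ℕ) :
    ∫ r in (0:ℝ)..R, Hk k (z r) * gt r * (zt n R r * Real.sinh r ^ n) ≤ max (z R) 0 := by
  have n0 : n ≠ 0 := by omega
  set q : ℝ → ℝ := fun r => Hk k (z r) * gt r * (zt n R r * Real.sinh r ^ n) with hq
  have qc : Continuous q := by
    have := (Hk_cont k).comp zc
    have := zt_cont n R
    exact ((((Hk_cont k).comp zc).mul gc).mul ((zt_cont n R).mul (by fun_prop)))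
  set E : ℝ → ℝ := fun r => Hk k (z r) * (Real.sinh r ^ n * zr r) * zt n R r + hk k (z r) * (Real.sinh r / Real.cosh r) ^ (n+1) with hE
  have Ec : Continuous E := by
    have h1 := (Hk_cont k).comp zc
    have h2 := zt_cont n R
    have h3 : Continuous (hk k) := continuous_iff_continuousAt.2 (fun x => (hk_deriv k x).continuousAt)
    have h4 : Continuous (fun r => (Real.sinh r / Real.cosh r) ^ (n+1)) :=
      (Real.continuous_sinh.div Real.continuous_cosh (fun x => (Real.cosh_pos x).ne')).pow _
    exact ((h1.mul ((Real.continuous_sinh.pow n).mul zrc)).mul h2).add ((h3.comp zc).mul h4)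
  have hM : MonotoneOn (fun r => E r - ∫ x in (0:ℝ)..r, q x) (Icc 0 R) := by
    have hd : ∀ r, 0 < r → HasDerivAt (fun r => E r - ∫ x in (0:ℝ)..r, q x)
       (deriv (Hk k) (z r) * zr r ^ 2 * (Real.sinh r ^ n * zt n R r) + hk k (z r) * ((n+1:ℕ) * (Real.sinh r / Real.cosh r) ^ n * (1 / Real.cosh r ^ 2))) r := fun r hr => by
      have hc := Real.cosh_pos r
      have t1 : HasDerivAt (fun r => Real.sinh r / Real.cosh r) (1 / Real.cosh r ^ 2) r := by
        refine ((Real.hasDerivAt_sinh r).div (Real.hasDerivAt_cosh r) hc.ne').congr_deriv ?_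
        have := Real.cosh_sq r
        rw [show Real.cosh r * Real.cosh r - Real.sinh r * Real.sinh r = 1 by linarith]
      have d1 := ((((Hk_diff k (z r)).comp r (hz r hr)).mul (hf r hr)).mul (zt_deriv hn R r)).add
        (((hk_deriv k (z r)).comp r (hz r hr)).mul (t1.pow (n+1)))
      have d2 := d1.sub (qc.integral_hasStrictDerivAt 0 r).hasDerivAt
      refine HasDerivAt.congr_deriv d2 ?_
      simp only [hq, Function.comp, Pi.mul_apply, Pi.pow_apply, Nat.add_sub_cancel]
      rw [div_pow, div_pow]; field_simp; ring
    refine monotoneOn_of_deriv_nonneg (convex_Icc 0 R) (Ec.sub (intervalIntegral.continuous_primitive (fun a b => qc.intervalIntegrable a b) 0)).continuousOn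
      (fun r hr => ?_) (fun r hr => ?_)
    · rw [interior_Icc] at hr; exact (hd r hr.1).differentiableAt.differentiableWithinAt
    · rw [interior_Icc] at hr; rw [(hd r hr.1).deriv]
      have h1 := Hk_dnn k (z r)
      have h2 := hk_nn k (z r)
      have h3 := zt_nn (n := n) hr.1.le hr.2.le
      have h4 := Real.sinh_pos_iff.2 hr.1
      have h5 := Real.cosh_pos r
      positivity
  have := hM (left_mem_Icc.2 hR.le) (right_mem_Icc.2 hR.le) hR.le
  have ez : zt n R R = 0 := by simp [zt]
  simp only [hE, intervalIntegral.integral_same, ez, Real.sinh_zero, zero_pow n0, zero_div, zero_pow (Nat.succ_ne_zero n), mul_zero, zero_mul, zero_add, sub_zero, add_zero] at this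
  have h6 : (Real.sinh R / Real.cosh R) ^ (n+1) ≤ 1 := by
    have h4 := Real.sinh_pos_iff.2 hR
    refine pow_le_one₀ (by have := Real.cosh_pos R; positivity) ((div_le_one (Real.cosh_pos R)).2 (Real.sinh_lt_cosh R).le)
  have h7 := mul_le_mul_of_nonneg_left h6 (hk_nn k (z R))
  linarith [hk_le k (z R)]

theorem kato2 {n : ℕ} (hn : 1 ≤ n) {z zr g gt : ℝ → ℝ → ℝ} {R t1 t2 : ℝ} (hR : 0 < R) (ht : t1 ≤ t2)
    (zc : Continuous (Function.uncurry z)) (zrc : Continuous (Function.uncurry zr)) (gc : Continuous (Function.uncurry g)) (gtc : Continuous (Function.uncurry gt))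
    (hz : ∀ t ∈ Icc t1 t2, ∀ r, 0 < r → HasDerivAt (fun r => z r t) (zr r t) r)
    (hf : ∀ t ∈ Icc t1 t2, ∀ r, 0 < r → HasDerivAt (fun r => Real.sinh r ^ n * zr r t) (Real.sinh r ^ n * gt r t) r)
    (hg : ∀ r, 0 ≤ r → ∀ t ∈ Ioo t1 t2, HasDerivAt (g r) (gt r t) t)
    (hs : ∀ r t, 0 < g r t ↔ 0 < z r t) (h0 : ∀ r, 0 ≤ r → g r t1 ≤ 0) :
    ∫ r in (0:ℝ)..R, max (g r t2) 0 * (zt n R r * Real.sinh r ^ n) ≤ ∫ t in t1..t2, max (z R t) 0 := by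
  set W : ℝ → ℝ := fun r => zt n R r * Real.sinh r ^ n with hW
  have Wc : Continuous W := (zt_cont n R).mul (by fun_prop)
  have Hz : ∀ k, Continuous (fun p : ℝ × ℝ => Hk k (z p.2 p.1) * gt p.2 p.1 * W p.2) := fun k =>
    (((Hk_cont k).comp (zc.comp continuous_swap)).mul (gtc.comp continuous_swap)).mul (Wc.comp continuous_snd)
  have Hg : ∀ k, Continuous (fun p : ℝ × ℝ => Hk k (g p.2 p.1) * gt p.2 p.1 * W p.2) := fun k =>
    (((Hk_cont k).comp (gc.comp continuous_swap)).mul (gtc.comp continuous_swap)).mul (Wc.comp continuous_snd)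
  have hkc : ∀ k, Continuous (hk k) := fun k => continuous_iff_continuousAt.2 (fun x => (hk_deriv k x).continuousAt)
  have sl : ∀ t : ℝ, Continuous (fun r : ℝ => (r, t)) := fun t => by fun_prop
  have sl2 : ∀ r : ℝ, Continuous (fun t : ℝ => (r, t)) := fun t => by fun_prop
  -- step A
  have A : ∀ k, ∫ t in t1..t2, ∫ r in (0:ℝ)..R, Hk k (z r t) * gt r t * W r ≤ ∫ t in t1..t2, max (z R t) 0 := fun k => by
    refine intervalIntegral.integral_mono_on ht ?_ ?_ (fun t ht' => ?_)
    · exact (intervalIntegral.continuous_parametric_intervalIntegral_of_continuous' (f := fun t r => Hk k (z r t) * gt r t * W r) (Hz k) 0 R).intervalIntegrable _ _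
    · exact ((zc.comp (sl2 R)).max continuous_const).intervalIntegrable _ _
    · exact kato1 hn hR (zc.comp (sl t)) (zrc.comp (sl t)) (gtc.comp (sl t)) (hz t ht') (hf t ht') k
  -- step B
  have B : ∀ k, ∫ t in t1..t2, ∫ r in (0:ℝ)..R, Hk k (g r t) * gt r t * W r = ∫ r in (0:ℝ)..R, hk k (g r t2) * W r := fun k => by
    rw [intervalIntegral_intervalIntegral_swap]
    · refine intervalIntegral.integral_congr (fun r hr => ?_)
      rw [uIcc_of_le hR.le] at hr
      rw [intervalIntegral.integral_mul_const]
      congr 1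
      have := intervalIntegral.integral_eq_sub_of_hasDerivAt_of_le ht (f := fun t => hk k (g r t)) (f' := fun t => Hk k (g r t) * gt r t)
        ((hkc k).comp (gc.comp (sl2 r))).continuousOn (fun t ht' => (hk_deriv k _).comp t (hg r hr.1 t ht'))
        ((((Hk_cont k).comp (gc.comp (sl2 r))).mul (gtc.comp (sl2 r))).intervalIntegrable _ _)
      rw [this, hk_np k (h0 r hr.1), sub_zero]
    · have := (Hg k).continuousOn.integrableOn_compact (μ := volume) ((isCompact_uIcc (a := t1) (b := t2)).prod (isCompact_uIcc (a := (0:ℝ)) (b := R)))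
      exact this.mono_set (prod_mono uIoc_subset_uIcc uIoc_subset_uIcc)
  -- limits
  obtain ⟨M, hM⟩ := ((isCompact_uIcc (a := t1) (b := t2)).prod (isCompact_uIcc (a := (0:ℝ)) (b := R))).exists_bound_of_continuousOn
    (f := fun p : ℝ × ℝ => gt p.2 p.1 * W p.2) ((gtc.comp continuous_swap).mul (Wc.comp continuous_snd)).continuousOn
  have d01 : ∀ k x y, |Hk k x - Hk k y| ≤ 1 := fun k x y => abs_le.2 ⟨by linarith [Hk_nn k x, Hk_le k y], by linarith [Hk_nn k y, Hk_le k x]⟩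
  have bd : ∀ k, ∀ t ∈ uIcc t1 t2, ∀ r ∈ uIcc 0 R, ‖(Hk k (g r t) - Hk k (z r t)) * (gt r t * W r)‖ ≤ M := fun k t ht r hr => by
    rw [norm_mul, Real.norm_eq_abs]
    have h1 := hM (t, r) ⟨ht, hr⟩
    calc _ ≤ 1 * ‖gt r t * W r‖ := by gcongr; exact d01 _ _ _
      _ ≤ M := by rw [one_mul]; exact h1
  have Hd : ∀ k, Continuous (fun p : ℝ × ℝ => (Hk k (g p.2 p.1) - Hk k (z p.2 p.1)) * (gt p.2 p.1 * W p.2)) := fun k =>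
    (((Hk_cont k).comp (gc.comp continuous_swap)).sub ((Hk_cont k).comp (zc.comp continuous_swap))).mul ((gtc.comp continuous_swap).mul (Wc.comp continuous_snd))
  have inner : ∀ t ∈ uIcc t1 t2, Tendsto (fun k => ∫ r in (0:ℝ)..R, (Hk k (g r t) - Hk k (z r t)) * (gt r t * W r)) atTop (𝓝 0) := fun t ht => by
    rw [show 𝓝 (0:ℝ) = 𝓝 (∫ r in (0:ℝ)..R, (0:ℝ)) by simp]
    refine intervalIntegral.tendsto_integral_filter_of_dominated_convergence (fun _ => M) (Eventually.of_forall fun k => ((Hd k).comp (sl2 t)).aestronglyMeasurable)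
      (Eventually.of_forall fun k => Eventually.of_forall fun r hr => bd k t ht r (uIoc_subset_uIcc hr)) intervalIntegrable_const (Eventually.of_forall fun r hr => ?_)
    have h1 := ((Hk_lim (g r t)).sub (Hk_lim (z r t))).mul_const (gt r t * W r)
    simp only [hs r t, sub_self, zero_mul] at h1
    exact h1
  have outer : Tendsto (fun k => ∫ t in t1..t2, ∫ r in (0:ℝ)..R, (Hk k (g r t) - Hk k (z r t)) * (gt r t * W r)) atTop (𝓝 0) := by
    rw [show 𝓝 (0:ℝ) = 𝓝 (∫ t in t1..t2, (0:ℝ)) by simp]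
    refine intervalIntegral.tendsto_integral_filter_of_dominated_convergence (fun _ => M * |R - 0|) (Eventually.of_forall fun k => ?_)
      (Eventually.of_forall fun k => Eventually.of_forall fun t ht => intervalIntegral.norm_integral_le_of_norm_le_const (fun r hr => bd k t (uIoc_subset_uIcc ht) r (uIoc_subset_uIcc hr)))
      intervalIntegrable_const (Eventually.of_forall fun t ht => inner t (uIoc_subset_uIcc ht))
    exact (intervalIntegral.continuous_parametric_intervalIntegral_of_continuous' (f := fun t r => (Hk k (g r t) - Hk k (z r t)) * (gt r t * W r)) (Hd k) 0 R).aestronglyMeasurable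
  have C : ∀ k, ∫ r in (0:ℝ)..R, hk k (g r t2) * W r ≤ (∫ t in t1..t2, max (z R t) 0) +
      ∫ t in t1..t2, ∫ r in (0:ℝ)..R, (Hk k (g r t) - Hk k (z r t)) * (gt r t * W r) := fun k => by
    have e : ∫ t in t1..t2, ∫ r in (0:ℝ)..R, (Hk k (g r t) - Hk k (z r t)) * (gt r t * W r) =
      (∫ t in t1..t2, ∫ r in (0:ℝ)..R, Hk k (g r t) * gt r t * W r) - ∫ t in t1..t2, ∫ r in (0:ℝ)..R, Hk k (z r t) * gt r t * W r := by
      rw [← intervalIntegral.integral_sub]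
      · refine intervalIntegral.integral_congr (fun t ht => ?_)
        refine Eq.trans (intervalIntegral.integral_congr (fun r hr => ?_)) (intervalIntegral.integral_sub (((Hg k).comp (sl2 t)).intervalIntegrable _ _) (((Hz k).comp (sl2 t)).intervalIntegrable _ _))
        exact (by ring : (Hk k (g r t) - Hk k (z r t)) * (gt r t * W r) = Hk k (g r t) * gt r t * W r - Hk k (z r t) * gt r t * W r)
      · exact (intervalIntegral.continuous_parametric_intervalIntegral_of_continuous' (f := fun t r => Hk k (g r t) * gt r t * W r) (Hg k) 0 R).intervalIntegrable _ _
      · exact (intervalIntegral.continuous_parametric_intervalIntegral_of_continuous' (f := fun t r => Hk k (z r t) * gt r t * W r) (Hz k) 0 R).intervalIntegrable _ _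
    rw [e, B k]; linarith [A k]
  have D : Tendsto (fun k => ∫ r in (0:ℝ)..R, hk k (g r t2) * W r) atTop (𝓝 (∫ r in (0:ℝ)..R, max (g r t2) 0 * W r)) := by
    have c0 : Continuous (fun r => max (g r t2) 0 * |W r|) := ((gc.comp (sl t2)).max continuous_const).mul Wc.abs
    refine intervalIntegral.tendsto_integral_filter_of_dominated_convergence (fun r => max (g r t2) 0 * |W r|)
      (Eventually.of_forall fun k => (((hkc k).comp (gc.comp (sl t2))).mul Wc).aestronglyMeasurable)
      (Eventually.of_forall fun k => Eventually.of_forall fun r hr => ?_) (c0.intervalIntegrable _ _)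
      (Eventually.of_forall fun r hr => (hk_lim _).mul_const _)
    rw [norm_mul, Real.norm_eq_abs, Real.norm_eq_abs, abs_of_nonneg (hk_nn _ _)]
    gcongr; exact hk_le _ _
  refine le_of_tendsto_of_tendsto' D ?_ C
  simpa using tendsto_const_nhds.add outer

theorem clampc {a b : ℝ} (hab : a ≤ b) : (∀ t, max a (min t b) ∈ Icc a b) ∧ (∀ t ∈ Icc a b, max a (min t b) = t) :=
  ⟨fun t => ⟨le_max_left _ _, max_le hab (min_le_right _ _)⟩, fun t ht => by rw [min_eq_left ht.2, max_eq_right ht.1]⟩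

/-- Benilan--Crandall type monotonicity -/
theorem FD.bc {n : ℕ} {m T : ℝ} {U ut vr : ℝ → ℝ → ℝ} (h : FD n m T U ut vr) (hn : 1 ≤ n) (hm : 0 < m) (hm1 : m < 1) {ε t1 t2 : ℝ}
    (hε : 0 < ε) (h1 : ε < t1) (h2 : t1 ≤ t2) (h3 : t2 < T) {r : ℝ} (hr : 0 ≤ r) :
    ((t1 - ε) / (t2 - ε)) ^ (1 / (1-m)) * U r t2 ≤ U r t1 := by
  set lam := (t2 - ε) / (t1 - ε) with hl
  have l0 : 0 < t1 - ε := by linarith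
  have l1 : 1 ≤ lam := (one_le_div l0).2 (by linarith)
  set k : ℝ := ((t1 - ε) / (t2 - ε)) ^ (1 / (1-m)) with hk
  have kb : 0 < (t1 - ε) / (t2 - ε) := div_pos l0 (by linarith)
  have k0 : 0 < k := Real.rpow_pos_of_pos kb _
  have kb1 : (t1 - ε) / (t2 - ε) ≤ 1 := (div_le_one (by linarith)).2 (by linarith)
  have m1 : 0 < 1 - m := by linarith
  have k1 : k ≤ 1 := Real.rpow_le_one kb.le kb1 (by positivity)
  have km : k ^ m = k * lam := by
    have : k ^ (1 - m) * lam = 1 := by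
      rw [hk, ← Real.rpow_mul kb.le, one_div_mul_cancel m1.ne', Real.rpow_one, hl]
      have : t2 - ε ≠ 0 := by linarith
      field_simp
    rw [show m = 1 - (1 - m) by ring, Real.rpow_sub k0, Real.rpow_one]
    have p := Real.rpow_pos_of_pos k0 (1-m)
    rw [div_eq_iff p.ne', mul_assoc, mul_comm lam, this, mul_one]
  obtain ⟨c1, c2⟩ := clampc h1.le
  set κ : ℝ → ℝ := fun t => max ε (min t t1) with hκ
  set σ : ℝ → ℝ := fun t => ε + lam * (κ t - ε) with hσ
  have κc : Continuous κ := by fun_prop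
  have σc : Continuous σ := by fun_prop
  have lam1 : lam * (t1 - ε) = t2 - ε := by rw [hl]; field_simp
  have κm : ∀ t, κ t ∈ Ioo 0 T := fun t => ⟨hε.trans_le (c1 t).1, (c1 t).2.trans_lt (h2.trans_lt h3)⟩
  have σm : ∀ t, σ t ∈ Ioo 0 T := fun t => by
    have := c1 t
    have a1 : 0 ≤ lam * (κ t - ε) := mul_nonneg (by linarith) (by linarith [this.1])
    have a2 : lam * (κ t - ε) ≤ lam * (t1 - ε) := mul_le_mul_of_nonneg_left (by linarith [this.2]) (by linarith)
    exact ⟨by simp only [hσ]; linarith, by simp only [hσ]; linarith⟩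
  have vc : Continuous (fun p : ℝ × ℝ => U p.1 p.2 ^ m) := h.cont.rpow_const (fun _ => Or.inr hm.le)
  set z : ℝ → ℝ → ℝ := fun r t => k ^ m * U r (σ t) ^ m - U r (κ t) ^ m with hz
  set zr : ℝ → ℝ → ℝ := fun r t => k ^ m * vr r (σ t) - vr r (κ t) with hzr
  set g : ℝ → ℝ → ℝ := fun r t => k * U r (σ t) - U r (κ t) with hg
  set gt : ℝ → ℝ → ℝ := fun r t => k * lam * ut r (σ t) - ut r (κ t) with hgt
  have pσ : Continuous (fun p : ℝ × ℝ => (p.1, σ p.2)) := by fun_prop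
  have pκ : Continuous (fun p : ℝ × ℝ => (p.1, κ p.2)) := by fun_prop
  have zc : Continuous (Function.uncurry z) := (continuous_const.mul (vc.comp pσ)).sub (vc.comp pκ)
  have zrc : Continuous (Function.uncurry zr) := (continuous_const.mul (h.vrc.comp_continuous pσ (fun p => ⟨mem_univ _, σm _⟩))).sub
    (h.vrc.comp_continuous pκ (fun p => ⟨mem_univ _, κm _⟩))
  have gc : Continuous (Function.uncurry g) := (continuous_const.mul (h.cont.comp pσ)).sub (h.cont.comp pκ)
  have gtc : Continuous (Function.uncurry gt) := (continuous_const.mul (h.utc.comp_continuous pσ (fun p => ⟨mem_univ _, σm _⟩))).sub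
    (h.utc.comp_continuous pκ (fun p => ⟨mem_univ _, κm _⟩))
  have hs : ∀ r t, 0 < g r t ↔ 0 < z r t := fun r t => by
    simp only [hg, hz, sub_pos]
    rw [← Real.mul_rpow k0.le (h.nonneg _ _)]
    exact (Real.rpow_lt_rpow_iff (h.nonneg _ _) (mul_nonneg k0.le (h.nonneg _ _)) hm).symm
  have κε : κ ε = ε := c2 ε ⟨le_rfl, h1.le⟩
  have h0 : ∀ r, 0 ≤ r → g r ε ≤ 0 := fun r _ => by
    simp only [hg, hσ, κε]
    rw [sub_self, mul_zero, add_zero]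
    linarith [mul_le_of_le_one_left (h.nonneg r ε) k1]
  have main : ∀ R, 0 < R → ∫ r in (0:ℝ)..R, max (g r t1) 0 * (zt n R r * Real.sinh r ^ n) ≤ ∫ t in ε..t1, max (z R t) 0 := fun R hR => by
    refine kato2 hn hR h1.le zc zrc gc gtc (fun t ht r hr => ?_) (fun t ht r hr => ?_) (fun r hr t ht => ?_) hs h0
    · exact ((h.hvr r hr _ (σm t)).const_mul _).sub (h.hvr r hr _ (κm t))
    · refine (((h.hfl r hr _ (σm t)).const_mul (k^m)).sub (h.hfl r hr _ (κm t))).congr_of_eventuallyEq (Eventually.of_forall fun x => ?_) |>.congr_deriv ?_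
      · simp only [hzr, Pi.sub_apply]; ring
      · simp only [hgt]; rw [km]; ring
    · have ev : κ =ᶠ[𝓝 t] id := by
        filter_upwards [Ioo_mem_nhds ht.1 ht.2] with x hx; exact c2 x ⟨hx.1.le, hx.2.le⟩
      have dκ : HasDerivAt κ 1 t := (hasDerivAt_id t).congr_of_eventuallyEq ev
      have dσ : HasDerivAt σ (lam * 1) t := ((dκ.sub_const ε).const_mul lam).const_add ε
      refine ((((h.hut r _ (σm t)).comp t dσ).const_mul k).sub ((h.hut r _ (κm t)).comp t dκ)).congr_deriv ?_
      simp only [hgt]; ring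
  obtain ⟨C, hC⟩ := h.dec ε ⟨hε, by linarith⟩
  have zb : ∀ R, 0 < R → ∫ t in ε..t1, max (z R t) 0 ≤ (t1 - ε) * (k ^ m * (|C| * Real.exp (-(n * R / 2)))) := fun R hR => by
    have e : ∫ t in ε..t1, (k ^ m * (|C| * Real.exp (-(n * R / 2)))) = (t1 - ε) * (k ^ m * (|C| * Real.exp (-(n * R / 2)))) := by rw [intervalIntegral.integral_const, smul_eq_mul]
    rw [← e]
    refine intervalIntegral.integral_mono_on h1.le (((zc.comp (by fun_prop : Continuous (fun t : ℝ => (R, t)))).max continuous_const).intervalIntegrable _ _)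
      intervalIntegrable_const (fun t ht => max_le ?_ (by positivity))
    have hσε : ε ≤ σ t := by
      have := mul_nonneg (show 0 ≤ lam by linarith) (sub_nonneg.2 (c1 t).1)
      simp only [hσ]; linarith
    have b1 := (hC (σ t) hσε R hR.le).trans (mul_le_mul_of_nonneg_right (le_abs_self C) (Real.exp_pos _).le)
    have b2 := mul_le_mul_of_nonneg_left b1 (Real.rpow_nonneg k0.le m)
    have b3 : 0 ≤ U R (κ t) ^ m := Real.rpow_nonneg (h.nonneg _ _) _
    simp only [hz]; linarith
  have gt1 : Continuous (fun r => g r t1) := gc.comp (by fun_prop : Continuous (fun r : ℝ => (r, t1)))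
  have gneg : ∀ r, 0 < r → g r t1 ≤ 0 := by
    intro r hr
    by_contra hcon
    push Not at hcon
    set I0 := ∫ x in (0:ℝ)..(r+1), max (g x t1) 0 * (zt n (r+1) x * Real.sinh x ^ n) with hI0
    have ic : ∀ R, Continuous (fun x => max (g x t1) 0 * (zt n R x * Real.sinh x ^ n)) := fun R =>
      (gt1.max continuous_const).mul ((zt_cont n R).mul (by fun_prop))
    have nn : ∀ R x, 0 ≤ x → x ≤ R → 0 ≤ max (g x t1) 0 * (zt n R x * Real.sinh x ^ n) := fun R x hx hxR =>
      mul_nonneg (le_max_right _ _) (mul_nonneg (zt_nn hx hxR) (pow_nonneg (Real.sinh_nonneg_iff.2 hx) n))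
    have Ipos : 0 < I0 := by
      refine intervalIntegral.integral_pos (by linarith) (ic _).continuousOn (fun x hx => nn _ x hx.1.le hx.2) ⟨r, ⟨hr.le, by linarith⟩, ?_⟩
      have z0 : 0 < zt n (r+1) r := by
        unfold zt
        have hlt : Real.cosh r ^ n < Real.cosh (r+1) ^ n := pow_lt_pow_left₀
          (by rw [Real.cosh_lt_cosh, abs_of_nonneg hr.le, abs_of_nonneg (by linarith)]; linarith) (Real.cosh_pos r).le (by omega)
        have := inv_strictAnti₀ (pow_pos (Real.cosh_pos r) n) hlt
        exact div_pos (by linarith) (by positivity)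
      have := Real.sinh_pos_iff.2 hr
      have : 0 < max (g r t1) 0 := lt_max_of_lt_left hcon
      positivity
    have Ile : ∀ R, r + 1 ≤ R → I0 ≤ (t1 - ε) * (k ^ m * (|C| * Real.exp (-(n * R / 2)))) := fun R hR => by
      refine le_trans ?_ ((main R (by linarith)).trans (zb R (by linarith)))
      have s1 : I0 ≤ ∫ x in (0:ℝ)..(r+1), max (g x t1) 0 * (zt n R x * Real.sinh x ^ n) := by
        refine intervalIntegral.integral_mono_on (by linarith) ((ic _).intervalIntegrable _ _) ((ic _).intervalIntegrable _ _) (fun x hx => ?_)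
        have hw : 0 ≤ Real.sinh x ^ n := pow_nonneg (Real.sinh_nonneg_iff.2 hx.1) n
        have hz1 : zt n (r+1) x ≤ zt n R x := by
          have := zt_nn (n := n) (show 0 ≤ r + 1 by linarith) hR
          have e : zt n R x = zt n (r+1) x + zt n R (r+1) := by unfold zt; ring
          linarith
        have := le_max_right (g x t1) 0
        gcongr
      rw [← intervalIntegral.integral_add_adjacent_intervals ((ic R).intervalIntegrable 0 (r+1)) ((ic R).intervalIntegrable (r+1) R)]
      have := intervalIntegral.integral_nonneg hR (fun x hx => nn R x (by linarith [hx.1]) hx.2) (μ := volume)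
      linarith
    have lim : Tendsto (fun R : ℝ => (t1 - ε) * (k ^ m * (|C| * Real.exp (-(n * R / 2))))) atTop (𝓝 ((t1 - ε) * (k ^ m * (|C| * 0)))) := by
      refine ((Tendsto.const_mul _ ?_).const_mul _).const_mul _
      refine Real.tendsto_exp_neg_atTop_nhds_zero.comp (tendsto_id.const_mul_atTop (show (0:ℝ) < n by positivity) |>.atTop_div_const two_pos)
    have := ge_of_tendsto lim (eventually_atTop.2 ⟨r+1, Ile⟩)
    simp at this
    linarith
  have gneg0 : g r t1 ≤ 0 := by
    rcases hr.eq_or_lt with h5 | h5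
    · have hcl : IsClosed {x : ℝ | g x t1 ≤ 0} := isClosed_le gt1 continuous_const
      have : closure (Ioi (0:ℝ)) ⊆ {x : ℝ | g x t1 ≤ 0} := hcl.closure_subset_iff.2 gneg
      rw [closure_Ioi] at this
      exact this (mem_Ici.2 hr)
    · exact gneg r h5
  have κ1 : κ t1 = t1 := c2 t1 ⟨h1.le, le_rfl⟩
  have σ1 : σ t1 = t2 := by simp only [hσ, κ1]; linarith
  simp only [hg, σ1, κ1] at gneg0
  linarith

noncomputable def FF (n : ℕ) (U : ℝ → ℝ → ℝ) (ρ t : ℝ) : ℝ := ∫ x in (0:ℝ)..ρ, U x t * Real.sinh x ^ n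
noncomputable def PP (n : ℕ) (U : ℝ → ℝ → ℝ) (r t : ℝ) : ℝ := ∫ ρ in Ioi r, FF n U ρ t / Real.sinh ρ ^ n
noncomputable def NN (n : ℕ) (U : ℝ → ℝ → ℝ) (t : ℝ) : ℝ := ∫ ρ in Ioi (0:ℝ), FF n U ρ t ^ 2 / Real.sinh ρ ^ n
noncomputable def XX (n : ℕ) (m : ℝ) (U : ℝ → ℝ → ℝ) (t : ℝ) : ℝ := ∫ x in Ioi (0:ℝ), U x t ^ m * U x t * Real.sinh x ^ n

/-- decay package -/
structure DK (n : ℕ) (m : ℝ) (U : ℝ → ℝ → ℝ) (ε a C : ℝ) : Prop where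
  a1 : (n:ℝ) / 2 < a
  a2 : a < n
  C0 : 0 < C
  v : ∀ t, ε ≤ t → ∀ r, 0 ≤ r → U r t ^ m ≤ C * Real.exp (-(n * r / 2))
  u : ∀ t, ε ≤ t → ∀ r, 0 ≤ r → U r t ≤ C * Real.exp (-(a * r))
  F : ∀ t, ε ≤ t → ∀ r, 0 ≤ r → FF n U r t ≤ C * Real.exp ((n - a) * r)
  Fw : ∀ t, ε ≤ t → ∀ r, 0 < r → FF n U r t / Real.sinh r ^ n ≤ C * Real.exp (-(a * r))

theorem swapc {F : ℝ → ℝ → ℝ} {a b c d : ℝ} (h : ContinuousOn (Function.uncurry F) (uIcc a b ×ˢ uIcc c d)) :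
    ∫ x in a..b, ∫ y in c..d, F x y = ∫ y in c..d, ∫ x in a..b, F x y :=
  intervalIntegral_intervalIntegral_swap ((h.integrableOn_compact (isCompact_uIcc.prod isCompact_uIcc)).mono_set
    (prod_mono uIoc_subset_uIcc uIoc_subset_uIcc))

section
variable {n : ℕ} {m T : ℝ} {U ut vr : ℝ → ℝ → ℝ}

theorem wpos {r : ℝ} (hr : 0 < r) (n : ℕ) : 0 < Real.sinh r ^ n := pow_pos (Real.sinh_pos_iff.2 hr) n
theorem wnn {r : ℝ} (hr : 0 ≤ r) (n : ℕ) : 0 ≤ Real.sinh r ^ n := pow_nonneg (Real.sinh_nonneg_iff.2 hr) n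

theorem FD.slc (h : FD n m T U ut vr) (t : ℝ) : Continuous (fun x => U x t) :=
  h.cont.comp (by fun_prop : Continuous (fun x : ℝ => (x, t)))
theorem FD.tlc (h : FD n m T U ut vr) (x : ℝ) : Continuous (fun t => U x t) :=
  h.cont.comp (by fun_prop : Continuous (fun t : ℝ => (x, t)))
theorem FD.uwc (h : FD n m T U ut vr) (t : ℝ) : Continuous (fun x => U x t * Real.sinh x ^ n) := (h.slc t).mul (by fun_prop)
theorem FD.vc (h : FD n m T U ut vr) (hm : 0 < m) : Continuous (fun p : ℝ × ℝ => U p.1 p.2 ^ m) := h.cont.rpow_const (fun _ => Or.inr hm.le)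
theorem FD.vsl (h : FD n m T U ut vr) (hm : 0 < m) (t : ℝ) : Continuous (fun x => U x t ^ m) := (h.slc t).rpow_const (fun _ => Or.inr hm.le)
theorem FD.vtl (h : FD n m T U ut vr) (hm : 0 < m) (x : ℝ) : Continuous (fun t => U x t ^ m) := (h.tlc x).rpow_const (fun _ => Or.inr hm.le)

theorem FD.Fc (h : FD n m T U ut vr) : Continuous (fun p : ℝ × ℝ => FF n U p.1 p.2) := by
  have : Continuous (fun q : (ℝ × ℝ) × ℝ => U q.2 q.1.2 * Real.sinh q.2 ^ n) :=
    (h.cont.comp (by fun_prop : Continuous (fun q : (ℝ × ℝ) × ℝ => (q.2, q.1.2)))).mul (by fun_prop)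
  exact intervalIntegral.continuous_parametric_intervalIntegral_of_continuous (f := fun (p : ℝ × ℝ) x => U x p.2 * Real.sinh x ^ n) this continuous_fst

theorem FD.Fnn (h : FD n m T U ut vr) {r : ℝ} (hr : 0 ≤ r) (t : ℝ) : 0 ≤ FF n U r t :=
  intervalIntegral.integral_nonneg hr (fun x hx => mul_nonneg (h.nonneg _ _) (wnn hx.1 n))

theorem FD.Fder (h : FD n m T U ut vr) (r t : ℝ) : HasDerivAt (fun r => FF n U r t) (U r t * Real.sinh r ^ n) r :=
  ((h.uwc t).integral_hasStrictDerivAt 0 r).hasDerivAt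

theorem FD.Fsl (h : FD n m T U ut vr) (t : ℝ) : Continuous (fun r => FF n U r t) :=
  h.Fc.comp (by fun_prop : Continuous (fun x : ℝ => (x, t)))

theorem FD.flux (h : FD n m T U ut vr) (hn : 1 ≤ n) {r t : ℝ} (hr : 0 ≤ r) (ht : t ∈ Ioo 0 T) :
    ∫ x in (0:ℝ)..r, ut x t * Real.sinh x ^ n = Real.sinh r ^ n * vr r t := by
  have c1 : Continuous (fun x => vr x t) := h.vrc.comp_continuous (by fun_prop : Continuous (fun x : ℝ => (x, t))) (fun x => ⟨mem_univ _, ht⟩)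
  have c2 : Continuous (fun x => ut x t) := h.utc.comp_continuous (by fun_prop : Continuous (fun x : ℝ => (x, t))) (fun x => ⟨mem_univ _, ht⟩)
  have := intervalIntegral.integral_eq_sub_of_hasDerivAt_of_le hr (f := fun r => Real.sinh r ^ n * vr r t) (f' := fun r => ut r t * Real.sinh r ^ n)
    (by fun_prop) (fun x hx => by simpa [mul_comm] using h.hfl x hx.1 t ht) ((c2.mul (by fun_prop)).intervalIntegrable _ _)
  rw [this]; simp [show n ≠ 0 by omega]

theorem FD.Ftd (h : FD n m T U ut vr) (hn : 1 ≤ n) {r t1 t2 : ℝ} (hr : 0 ≤ r) (h0 : 0 < t1) (h1 : t1 ≤ t2) (h2 : t2 < T) :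
    FF n U r t2 - FF n U r t1 = ∫ t in t1..t2, Real.sinh r ^ n * vr r t := by
  have hsub : ∀ t ∈ uIcc t1 t2, t ∈ Ioo 0 T := fun t ht => by
    rw [uIcc_of_le h1] at ht; exact ⟨h0.trans_le ht.1, ht.2.trans_lt h2⟩
  unfold FF
  rw [← intervalIntegral.integral_sub ((h.uwc t2).intervalIntegrable _ _) ((h.uwc t1).intervalIntegrable _ _)]
  have e1 : ∫ x in (0:ℝ)..r, (U x t2 * Real.sinh x ^ n - U x t1 * Real.sinh x ^ n) = ∫ x in (0:ℝ)..r, ∫ t in t1..t2, ut x t * Real.sinh x ^ n := by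
    refine intervalIntegral.integral_congr (fun x hx => ?_)
    rw [intervalIntegral.integral_mul_const, intervalIntegral.integral_eq_sub_of_hasDerivAt (fun t ht => h.hut x t (hsub t ht))]
    · ring
    · exact (h.utc.comp (by fun_prop : ContinuousOn (fun t : ℝ => (x, t)) _) (fun t ht => ⟨mem_univ _, hsub t ht⟩)).intervalIntegrable
  rw [e1, swapc]
  · refine intervalIntegral.integral_congr (fun t ht => ?_)
    exact h.flux hn hr (hsub t ht)
  · exact (h.utc.mono (fun p hp => ⟨mem_univ _, hsub _ hp.2⟩)).mul (by fun_prop)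

theorem FD.dk (h : FD n m T U ut vr) (hn : 1 ≤ n) (hm : 0 < m) (hm1 : m < 1) {ε : ℝ} (hε : ε ∈ Ioo 0 T) :
    ∃ a C, DK n m U ε a C := by
  obtain ⟨C1, hC1⟩ := h.dec ε hε
  have n0 : (0:ℝ) < n := by exact_mod_cast hn
  set p := 1 / m with hp
  have p1 : 1 < p := by rw [hp, lt_div_iff₀ hm]; linarith
  set p' := min p (3/2) with hp'
  have p'1 : 1 < p' := lt_min p1 (by norm_num)
  have p'2 : p' ≤ 3/2 := min_le_right _ _
  set a := p' * n / 2 with ha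
  have a1 : (n:ℝ) / 2 < a := by rw [ha]; have := mul_lt_mul_of_pos_right p'1 n0; linarith
  have a2 : a < n := by rw [ha]; have := mul_le_mul_of_nonneg_right p'2 n0.le; linarith
  set A := |C1| + 1 with hA
  have A0 : 0 < A := by positivity
  have hv : ∀ t, ε ≤ t → ∀ r, 0 ≤ r → U r t ^ m ≤ A * Real.exp (-(n * r / 2)) := fun t ht r hr =>
    (hC1 t ht r hr).trans (by gcongr; linarith [le_abs_self C1])
  have hu : ∀ t, ε ≤ t → ∀ r, 0 ≤ r → U r t ≤ A ^ p * Real.exp (-(a * r)) := fun t ht r hr => by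
    have h1 := Real.rpow_le_rpow (Real.rpow_nonneg (h.nonneg r t) m) (hv t ht r hr) (show 0 ≤ p by linarith)
    rw [← Real.rpow_mul (h.nonneg r t), hp, mul_one_div_cancel hm.ne', Real.rpow_one, ← hp, Real.mul_rpow A0.le (Real.exp_pos _).le, ← Real.exp_mul] at h1
    refine h1.trans ?_
    gcongr
    rw [ha]
    have := mul_le_mul_of_nonneg_right (min_le_left p (3/2)) (show 0 ≤ n * r / 2 by positivity)
    rw [← hp'] at this; linarith
  have Ap : 0 < A ^ p := Real.rpow_pos_of_pos A0 p
  have na : 0 < (n:ℝ) - a := by linarith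
  have hF : ∀ t, ε ≤ t → ∀ r, 0 ≤ r → FF n U r t ≤ A ^ p / (n - a) * Real.exp ((n - a) * r) := fun t ht r hr => by
    have i1 : FF n U r t ≤ ∫ x in (0:ℝ)..r, A ^ p * Real.exp ((n - a) * x) := by
      refine intervalIntegral.integral_mono_on hr ((h.uwc t).intervalIntegrable _ _) ((by fun_prop : Continuous (fun x : ℝ => A ^ p * Real.exp ((n - a) * x))).intervalIntegrable _ _) (fun x hx => ?_)
      calc _ ≤ (A ^ p * Real.exp (-(a * x))) * Real.exp (n * x) := mul_le_mul (hu t ht x hx.1) (sinhn_le_exp hx.1) (wnn hx.1 n) (by positivity)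
        _ = _ := by rw [mul_assoc, ← Real.exp_add]; congr 2; ring
    rw [intervalIntegral.integral_eq_sub_of_hasDerivAt (f := fun x => A ^ p / (n - a) * Real.exp ((n - a) * x))
      (fun x _ => (((hasDerivAt_id x).const_mul ((n:ℝ) - a)).exp.const_mul (A ^ p / (n - a))).congr_deriv (by simp only [id]; field_simp))
      ((by fun_prop : Continuous (fun x : ℝ => A ^ p * Real.exp ((n - a) * x))).intervalIntegrable _ _)] at i1
    have : 0 < A ^ p / (n - a) * Real.exp ((n - a) * 0) := by positivity
    linarith
  set C := A + A ^ p + A ^ p / (n - a) * 4 ^ n + A ^ p * Real.exp a with hC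
  have B1 : 0 < A ^ p / (n - a) := by positivity
  have B3 : A ^ p / (n - a) ≤ A ^ p / (n - a) * 4 ^ n := le_mul_of_one_le_right B1.le (one_le_pow₀ (by norm_num))
  have B2 : 0 < A ^ p * Real.exp a := by positivity
  refine ⟨a, C, a1, a2, by positivity, fun t ht r hr => (hv t ht r hr).trans (by gcongr; linarith), fun t ht r hr => (hu t ht r hr).trans (by gcongr; linarith),
    fun t ht r hr => (hF t ht r hr).trans (by gcongr; linarith), fun t ht r hr => ?_⟩
  rw [div_le_iff₀ (wpos hr n)]
  rcases le_total 1 r with h1 | h1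
  · refine (hF t ht r hr.le).trans ?_
    have hs : (Real.exp r / 4) ^ n ≤ Real.sinh r ^ n := pow_le_pow_left₀ (by positivity) (sinh_ge_exp h1) _
    calc _ = A ^ p / (n - a) * 4 ^ n * Real.exp (-(a * r)) * (Real.exp r / 4) ^ n := by
          rw [div_pow, ← Real.exp_nat_mul, show ((n:ℝ) - a) * r = -(a * r) + n * r by ring, Real.exp_add]; field_simp
      _ ≤ _ := by gcongr; linarith
  · have i1 : FF n U r t ≤ ∫ x in (0:ℝ)..r, A ^ p * Real.sinh r ^ n := by
      refine intervalIntegral.integral_mono_on hr.le ((h.uwc t).intervalIntegrable _ _) intervalIntegrable_const (fun x hx => ?_)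
      refine mul_le_mul ((hu t ht x hx.1).trans (mul_le_of_le_one_right Ap.le (Real.exp_le_one_iff.2 ?_)))
        (pow_le_pow_left₀ (Real.sinh_nonneg_iff.2 hx.1) (Real.sinh_le_sinh.2 hx.2) n) (wnn hx.1 n) Ap.le
      have : 0 ≤ a * x := mul_nonneg (by linarith) hx.1
      linarith
    rw [intervalIntegral.integral_const, smul_eq_mul, sub_zero] at i1
    have w0 := wpos hr n
    calc _ ≤ r * (A ^ p * Real.sinh r ^ n) := i1
      _ ≤ 1 * (A ^ p * Real.sinh r ^ n) := by gcongr
      _ ≤ (A ^ p * (Real.exp a * Real.exp (-(a * r)))) * Real.sinh r ^ n := by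
          rw [one_mul]
          gcongr
          refine le_mul_of_one_le_right Ap.le ?_
          rw [← Real.exp_add]
          refine Real.one_le_exp ?_
          have : 0 ≤ a * (1 - r) := mul_nonneg (by linarith) (by linarith)
          linarith
      _ ≤ _ := by rw [← mul_assoc]; gcongr; linarith
end

section
variable {n : ℕ} {m T : ℝ} {U ut vr : ℝ → ℝ → ℝ} {ε a C : ℝ}

theorem cpar {T : ℝ} {G : ℝ → ℝ → ℝ} (hG : ContinuousOn (fun q : ℝ × ℝ => G q.1 q.2) (univ ×ˢ Ioo 0 T)) (a b : ℝ) :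
    ContinuousOn (fun t => ∫ r in a..b, G r t) (Ioo 0 T) := by
  intro t0 ht0
  obtain ⟨t1, h1, h2⟩ := exists_between ht0.1
  obtain ⟨t2, h3, h4⟩ := exists_between ht0.2
  have hc := clampc (h2.trans h3).le
  have : Continuous (fun q : ℝ × ℝ => G q.2 (max t1 (min q.1 t2))) :=
    hG.comp_continuous (by fun_prop : Continuous (fun q : ℝ × ℝ => (q.2, max t1 (min q.1 t2))))
      (fun q => ⟨mem_univ _, h1.trans_le (hc.1 q.1).1, (hc.1 q.1).2.trans_lt h4⟩)
  have c2 : Continuous (fun t => ∫ r in a..b, G r (max t1 (min t t2))) :=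
    intervalIntegral.continuous_parametric_intervalIntegral_of_continuous' (f := fun t r => G r (max t1 (min t t2))) this a b
  refine (c2.continuousAt.congr ?_).continuousWithinAt
  filter_upwards [Ioo_mem_nhds h2 h3] with t ht
  rw [hc.2 t ⟨ht.1.le, ht.2.le⟩]

theorem FD.clF (h : FD n m T U ut vr) (hk : DK n m U ε a C) {t : ℝ} (ht : ε ≤ t) {r : ℝ} (hr : 0 < r) :
    FF n U r t ^ 2 / Real.sinh r ^ n ≤ C ^ 2 * Real.exp (-(2 * (a - n / 2) * r)) := by
  have h1 := hk.F t ht r hr.le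
  have h2 := hk.Fw t ht r hr
  have h3 := h.Fnn hr.le t
  have := hk.C0
  calc _ = FF n U r t * (FF n U r t / Real.sinh r ^ n) := by ring
    _ ≤ (C * Real.exp ((n - a) * r)) * (C * Real.exp (-(a * r))) := mul_le_mul h1 h2 (div_nonneg h3 (wpos hr n).le) (by positivity)
    _ = C ^ 2 * (Real.exp ((n - a) * r) * Real.exp (-(a * r))) := by ring
    _ = _ := by rw [← Real.exp_add]; congr 2; ring

theorem FD.clX (h : FD n m T U ut vr) (hk : DK n m U ε a C) {t : ℝ} (ht : ε ≤ t) {r : ℝ} (hr : 0 ≤ r) :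
    U r t ^ m * U r t * Real.sinh r ^ n ≤ C ^ 2 * Real.exp (-((a - n / 2) * r)) := by
  have := hk.C0
  calc _ ≤ (C * Real.exp (-(n * r / 2))) * (C * Real.exp (-(a * r))) * Real.exp (n * r) :=
        mul_le_mul (mul_le_mul (hk.v t ht r hr) (hk.u t ht r hr) (h.nonneg _ _) (by positivity)) (sinhn_le_exp hr) (wnn hr n) (by positivity)
    _ = C ^ 2 * (Real.exp (-(n * r / 2)) * Real.exp (-(a * r)) * Real.exp (n * r)) := by ring
    _ = _ := by rw [← Real.exp_add, ← Real.exp_add]; congr 2; ring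

theorem FD.clB (h : FD n m T U ut vr) (hk : DK n m U ε a C) {t : ℝ} (ht : ε ≤ t) {r : ℝ} (hr : 0 ≤ r) :
    FF n U r t * U r t ^ m ≤ C ^ 2 * Real.exp (-((a - n / 2) * r)) := by
  have := hk.C0
  calc _ ≤ (C * Real.exp ((n - a) * r)) * (C * Real.exp (-(n * r / 2))) := mul_le_mul (hk.F t ht r hr) (hk.v t ht r hr) (Real.rpow_nonneg (h.nonneg _ _) _) (by positivity)
    _ = C ^ 2 * (Real.exp ((n - a) * r) * Real.exp (-(n * r / 2))) := by ring
    _ = _ := by rw [← Real.exp_add]; congr 2; ring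

theorem eint {d : ℝ} (hd : 0 < d) (K : ℝ) : IntegrableOn (fun r : ℝ => K * Real.exp (-(d * r))) (Ioi 0) := by
  have := (integrableOn_exp_mul_Ioi (a := -d) (by linarith) 0).const_mul K
  simp only [neg_mul] at this
  exact this

theorem tailb {f : ℝ → ℝ} {d K R : ℝ} (hd : 0 < d) (hR : 0 ≤ R) (hf : IntegrableOn f (Ioi 0)) (h0 : ∀ r, 0 < r → 0 ≤ f r)
    (hb : ∀ r, 0 < r → f r ≤ K * Real.exp (-(d * r))) :
    (∫ r in (0:ℝ)..R, f r) ≤ ∫ r in Ioi 0, f r ∧ (∫ r in Ioi 0, f r) - ∫ r in (0:ℝ)..R, f r ≤ K / d * Real.exp (-(d * R)) := by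
  have e := intervalIntegral.integral_Ioi_sub_Ioi hf hR
  have hf2 : IntegrableOn f (Ioi R) := hf.mono_set (Ioi_subset_Ioi hR)
  have i1 : 0 ≤ ∫ r in Ioi R, f r := setIntegral_nonneg measurableSet_Ioi (fun r hr => h0 r (hR.trans_lt hr))
  have i2 : ∫ r in Ioi R, f r ≤ ∫ r in Ioi R, K * Real.exp (-(d * r)) :=
    setIntegral_mono_on hf2 ((eint hd K).mono_set (Ioi_subset_Ioi hR)) measurableSet_Ioi (fun r hr => hb r (hR.trans_lt hr))
  have i3 : ∫ r in Ioi R, K * Real.exp (-(d * r)) = K / d * Real.exp (-(d * R)) := by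
    rw [integral_const_mul]
    have := integral_exp_mul_Ioi (a := -d) (by linarith) R
    simp only [neg_mul] at this
    rw [this]; field_simp
  constructor <;> linarith

theorem FD.Fwm (h : FD n m T U ut vr) (t : ℝ) : ContinuousOn (fun r => FF n U r t ^ 2 / Real.sinh r ^ n) (Ioi 0) :=
  ((h.Fsl t).pow 2).continuousOn.div (by fun_prop) (fun x hx => (wpos hx n).ne')

theorem FD.Ni (h : FD n m T U ut vr) (hk : DK n m U ε a C) {t : ℝ} (ht : ε ≤ t) :
    IntegrableOn (fun r => FF n U r t ^ 2 / Real.sinh r ^ n) (Ioi 0) := by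
  refine Integrable.mono' (eint (d := 2 * (a - n/2)) (by have := hk.a1; linarith) (C^2)) ((h.Fwm t).aestronglyMeasurable measurableSet_Ioi) ?_
  filter_upwards [ae_restrict_mem measurableSet_Ioi] with r hr
  rw [Real.norm_of_nonneg (div_nonneg (sq_nonneg _) (wpos hr n).le)]
  exact h.clF hk ht hr

theorem FD.Nii (h : FD n m T U ut vr) (hk : DK n m U ε a C) {t R : ℝ} (ht : ε ≤ t) (hR : 0 ≤ R) :
    IntervalIntegrable (fun r => FF n U r t ^ 2 / Real.sinh r ^ n) volume 0 R := by
  rw [intervalIntegrable_iff_integrableOn_Ioc_of_le hR]; exact (h.Ni hk ht).mono_set Ioc_subset_Ioi_self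

theorem FD.Fwi (h : FD n m T U ut vr) (hk : DK n m U ε a C) {t : ℝ} (ht : ε ≤ t) {r : ℝ} (hr : 0 ≤ r) :
    IntegrableOn (fun r => FF n U r t / Real.sinh r ^ n) (Ioi r) := by
  have c : ContinuousOn (fun r => FF n U r t / Real.sinh r ^ n) (Ioi 0) := (h.Fsl t).continuousOn.div (by fun_prop) (fun x hx => (wpos hx n).ne')
  have : IntegrableOn (fun r => FF n U r t / Real.sinh r ^ n) (Ioi 0) := by
    refine Integrable.mono' (eint (d := a) (by have := hk.a1; have : (0:ℝ) ≤ n := by positivity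
                                               linarith) C) (c.aestronglyMeasurable measurableSet_Ioi) ?_
    filter_upwards [ae_restrict_mem measurableSet_Ioi] with r hr
    rw [Real.norm_of_nonneg (div_nonneg (h.Fnn (le_of_lt hr) _) (wpos hr n).le)]
    exact hk.Fw t ht r hr
  exact this.mono_set (Ioi_subset_Ioi hr)

theorem FD.Xc (h : FD n m T U ut vr) (hm : 0 < m) : Continuous (fun q : ℝ × ℝ => U q.1 q.2 ^ m * U q.1 q.2 * Real.sinh q.1 ^ n) :=
  ((h.vc hm).mul h.cont).mul (by fun_prop)

theorem FD.Xi (h : FD n m T U ut vr) (hm : 0 < m) (hk : DK n m U ε a C) {t : ℝ} (ht : ε ≤ t) :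
    IntegrableOn (fun r => U r t ^ m * U r t * Real.sinh r ^ n) (Ioi 0) := by
  have c : Continuous (fun r => U r t ^ m * U r t * Real.sinh r ^ n) := (h.Xc hm).comp (by fun_prop : Continuous (fun r : ℝ => (r, t)))
  refine Integrable.mono' (eint (d := (a - n/2)) (by have := hk.a1; linarith) (C^2)) c.aestronglyMeasurable ?_
  filter_upwards [ae_restrict_mem measurableSet_Ioi] with r hr
  rw [Real.norm_of_nonneg (mul_nonneg (mul_nonneg (Real.rpow_nonneg (h.nonneg _ _) _) (h.nonneg _ _)) (wpos hr n).le)]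
  exact h.clX hk ht (le_of_lt hr)

theorem FD.Ncs (h : FD n m T U ut vr) (hk : DK n m U ε a C) {S : Set ℝ} (hS : MeasurableSet S) (hS0 : S ⊆ Ioi 0) :
    ContinuousOn (fun t => ∫ r in S, FF n U r t ^ 2 / Real.sinh r ^ n) (Ici ε) := by
  refine continuousOn_of_dominated (F := fun t r => FF n U r t ^ 2 / Real.sinh r ^ n) (bound := fun r => C^2 * Real.exp (-(2 * (a - n/2) * r))) (fun t ht => ((h.Fwm t).mono hS0).aestronglyMeasurable hS) (fun t ht => ?_)
    ((eint (d := 2 * (a - n/2)) (by have := hk.a1; linarith) (C^2)).mono_set hS0) ?_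
  · filter_upwards [ae_restrict_mem hS] with r hr
    rw [Real.norm_of_nonneg (div_nonneg (sq_nonneg _) (wpos (hS0 hr) n).le)]
    exact h.clF hk ht (hS0 hr)
  · exact Eventually.of_forall (fun r => (((h.Fc.comp (by fun_prop : Continuous (fun t : ℝ => (r, t)))).pow 2).div_const _).continuousOn)

theorem FD.Xcs (h : FD n m T U ut vr) (hm : 0 < m) (hk : DK n m U ε a C) : ContinuousOn (XX n m U) (Ici ε) := by
  refine continuousOn_of_dominated (F := fun t r => U r t ^ m * U r t * Real.sinh r ^ n) (bound := fun r => C^2 * Real.exp (-((a - n/2) * r)))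
    (fun t ht => ((h.Xc hm).comp (by fun_prop : Continuous (fun r : ℝ => (r, t)))).aestronglyMeasurable) (fun t ht => ?_)
    (eint (d := (a - n/2)) (by have := hk.a1; linarith) (C^2)) ?_
  · filter_upwards [ae_restrict_mem measurableSet_Ioi] with r hr
    rw [Real.norm_of_nonneg (mul_nonneg (mul_nonneg (Real.rpow_nonneg (h.nonneg _ _) _) (h.nonneg _ _)) (wpos hr n).le)]
    exact h.clX hk ht (le_of_lt hr)
  · exact Eventually.of_forall (fun r => ((h.Xc hm).comp (by fun_prop : Continuous (fun t : ℝ => (r, t)))).continuousOn)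

/-- integration by parts identity -/
theorem FD.ibp (h : FD n m T U ut vr) (hm : 0 < m) {t R : ℝ} (ht : t ∈ Ioo 0 T) (hR : 0 ≤ R) :
    ∫ r in (0:ℝ)..R, FF n U r t * vr r t = FF n U R t * U R t ^ m - ∫ r in (0:ℝ)..R, U r t ^ m * U r t * Real.sinh r ^ n := by
  have c1 : Continuous (fun x => vr x t) := h.vrc.comp_continuous (by fun_prop : Continuous (fun x : ℝ => (x, t))) (fun x => ⟨mem_univ _, ht⟩)
  have cX : Continuous (fun r => U r t ^ m * U r t * Real.sinh r ^ n) := (h.Xc hm).comp (by fun_prop : Continuous (fun r : ℝ => (r, t)))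
  have := intervalIntegral.integral_eq_sub_of_hasDerivAt_of_le hR (f := fun r => FF n U r t * U r t ^ m)
    (f' := fun r => FF n U r t * vr r t + U r t ^ m * U r t * Real.sinh r ^ n)
    ((h.Fsl t).mul (h.vsl hm t)).continuousOn (fun x hx => (((h.Fder x t).mul (h.hvr x hx.1 t ht))).congr_deriv (by ring))
    ((((h.Fsl t).mul c1).add cX).intervalIntegrable _ _)
  have cF : Continuous (fun r => FF n U r t * vr r t) := (h.Fsl t).mul c1
  rw [intervalIntegral.integral_add (cF.intervalIntegrable _ _) (cX.intervalIntegrable _ _)] at this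
  have h0 : FF n U 0 t = 0 := by simp [FF]
  rw [h0] at this
  linarith

theorem FD.Ntd (h : FD n m T U ut vr) (hn : 1 ≤ n) (hm : 0 < m) (hε : 0 < ε) (hk : DK n m U ε a C) {t1 t2 : ℝ} (h0 : ε ≤ t1) (h1 : t1 ≤ t2) (h2 : t2 < T) :
    NN n U t2 - NN n U t1 = -2 * ∫ t in t1..t2, XX n m U t := by
  have hsub : ∀ t ∈ uIcc t1 t2, t ∈ Ioo 0 T := fun t ht => by
    rw [uIcc_of_le h1] at ht; exact ⟨hε.trans_le (h0.trans ht.1), ht.2.trans_lt h2⟩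
  have hd : 0 < a - n/2 := by have := hk.a1; linarith
  have hC := hk.C0
  -- finite R identity
  have key : ∀ R, 0 ≤ R → (∫ r in (0:ℝ)..R, FF n U r t2 ^ 2 / Real.sinh r ^ n) - (∫ r in (0:ℝ)..R, FF n U r t1 ^ 2 / Real.sinh r ^ n)
      = ∫ t in t1..t2, 2 * (FF n U R t * U R t ^ m - ∫ r in (0:ℝ)..R, U r t ^ m * U r t * Real.sinh r ^ n) := fun R hR => by
    rw [← intervalIntegral.integral_sub (h.Nii hk (h0.trans h1) hR) (h.Nii hk h0 hR)]
    have cc : ContinuousOn (Function.uncurry fun r t => 2 * (FF n U r t * vr r t)) (uIcc 0 R ×ˢ uIcc t1 t2) :=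
      continuousOn_const.mul (h.Fc.continuousOn.mul (h.vrc.mono (fun p hp => ⟨mem_univ _, hsub _ hp.2⟩)))
    have e1 : ∫ x in (0:ℝ)..R, (FF n U x t2 ^ 2 / Real.sinh x ^ n - FF n U x t1 ^ 2 / Real.sinh x ^ n) = ∫ x in (0:ℝ)..R, ∫ t in t1..t2, 2 * (FF n U x t * vr x t) := by
      refine intervalIntegral.integral_congr_Ioo_of_le hR (fun x hx => ?_)
      have w0 := wpos hx.1 n
      have hF : ∀ t ∈ Ioo t1 t2, HasDerivAt (fun t => FF n U x t) (Real.sinh x ^ n * vr x t) t := fun t ht => by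
        have htT : t ∈ Ioo 0 T := hsub t (by rw [uIcc_of_le h1]; exact ⟨ht.1.le, ht.2.le⟩)
        have c1 : ContinuousOn (fun s => Real.sinh x ^ n * vr x s) (Ioo 0 T) :=
          continuousOn_const.mul (h.vrc.comp (by fun_prop : ContinuousOn (fun s : ℝ => (x, s)) _) (fun s hs => ⟨mem_univ _, hs⟩))
        have d1 : HasDerivAt (fun s => ∫ y in t1..s, Real.sinh x ^ n * vr x y) (Real.sinh x ^ n * vr x t) t := by
          refine intervalIntegral.integral_hasDerivAt_right ?_ (c1.stronglyMeasurableAtFilter isOpen_Ioo t htT) (c1.continuousAt (isOpen_Ioo.mem_nhds htT))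
          exact (c1.mono (fun s hs => hsub s (by rw [uIcc_of_le h1]; rw [uIcc_of_le ht.1.le] at hs; exact ⟨hs.1, hs.2.trans ht.2.le⟩))).intervalIntegrable
        refine (d1.add_const (FF n U x t1)).congr_of_eventuallyEq ?_
        filter_upwards [Ioo_mem_nhds ht.1 ht.2] with s hs
        rw [← h.Ftd hn hx.1.le (hε.trans_le h0) hs.1.le (hs.2.trans h2)]; ring
      have := intervalIntegral.integral_eq_sub_of_hasDerivAt_of_le h1 (f := fun t => FF n U x t ^ 2 / Real.sinh x ^ n)
        (f' := fun t => 2 * (FF n U x t * vr x t))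
        (((h.Fc.comp (by fun_prop : Continuous (fun t : ℝ => (x, t)))).pow 2).div_const _).continuousOn
        (fun t ht => (((hF t ht).pow 2).div_const _).congr_deriv (by field_simp; ring))
        ((cc.comp (by fun_prop : ContinuousOn (fun t : ℝ => (x, t)) _) (fun t ht => ⟨by rw [uIcc_of_le hR]; exact ⟨hx.1.le, hx.2.le⟩, ht⟩)).intervalIntegrable)
      rw [this]
    rw [e1, swapc cc]
    refine intervalIntegral.integral_congr (fun t ht => ?_)
    rw [intervalIntegral.integral_const_mul, h.ibp hm (hsub t ht) hR]
  -- limit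
  have hlim : ∀ t, ε ≤ t → Tendsto (fun R => ∫ r in (0:ℝ)..R, FF n U r t ^ 2 / Real.sinh r ^ n) atTop (𝓝 (NN n U t)) := fun t ht =>
    intervalIntegral_tendsto_integral_Ioi 0 (h.Ni hk ht) tendsto_id
  have ce : Tendsto (fun R => C^2 * Real.exp (-((a - n/2) * R)) ) atTop (𝓝 0) := by
    have : Tendsto (fun R => Real.exp (-((a - n/2) * R))) atTop (𝓝 0) :=
      Real.tendsto_exp_neg_atTop_nhds_zero.comp (tendsto_id.const_mul_atTop hd)
    simpa using this.const_mul (C^2)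
  have hX : ContinuousOn (XX n m U) (uIcc t1 t2) := (h.Xcs hm hk).mono (fun t ht => by rw [uIcc_of_le h1] at ht; exact h0.trans ht.1)
  have l1 := (hlim t2 (h0.trans h1)).sub (hlim t1 h0)
  have l2 : Tendsto (fun R => ∫ t in t1..t2, 2 * (FF n U R t * U R t ^ m - ∫ r in (0:ℝ)..R, U r t ^ m * U r t * Real.sinh r ^ n)) atTop
      (𝓝 (∫ t in t1..t2, 2 * (0 - XX n m U t))) := by
    set K := C^2 + C^2 / (a - n/2) with hK
    have K0 : 0 < C^2 / (a - n/2) := by positivity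
    refine intervalIntegral.tendsto_integral_filter_of_dominated_convergence (fun t => 2 * (K + (XX n m U t))) ?_ ?_ ?_ ?_
    · filter_upwards [eventually_ge_atTop 0] with R hR
      refine Continuous.aestronglyMeasurable ?_
      refine continuous_const.mul (((h.Fc.comp (by fun_prop : Continuous (fun t : ℝ => (R, t)))).mul (h.vtl hm R)).sub ?_)
      exact intervalIntegral.continuous_parametric_intervalIntegral_of_continuous' (f := fun t r => U r t ^ m * U r t * Real.sinh r ^ n) ((h.Xc hm).comp continuous_swap) 0 R
    · filter_upwards [eventually_ge_atTop 0] with R hR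
      refine Eventually.of_forall (fun t ht => ?_)
      rw [uIoc_of_le h1] at ht
      have ht' : ε ≤ t := h0.trans ht.1.le
      have tb := tailb hd hR (h.Xi hm hk ht') (fun r hr => mul_nonneg (mul_nonneg (Real.rpow_nonneg (h.nonneg _ _) _) (h.nonneg _ _)) (wpos hr n).le) (fun r hr => h.clX hk ht' hr.le)
      have b1 := h.clB hk ht' hR
      have b2 : 0 ≤ FF n U R t * U R t ^ m := mul_nonneg (h.Fnn hR t) (Real.rpow_nonneg (h.nonneg _ _) _)
      have b3 : 0 ≤ ∫ r in (0:ℝ)..R, U r t ^ m * U r t * Real.sinh r ^ n := intervalIntegral.integral_nonneg hR (fun r hr => mul_nonneg (mul_nonneg (Real.rpow_nonneg (h.nonneg _ _) _) (h.nonneg _ _)) (wnn hr.1 n))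
      have e1 : Real.exp (-((a - n/2) * R)) ≤ 1 := Real.exp_le_one_iff.2 (by have := mul_nonneg hd.le hR; linarith)
      have e2 : C^2 * Real.exp (-((a - n/2) * R)) ≤ C^2 * 1 := by gcongr
      have e3 : XX n m U t = ∫ r in Ioi (0:ℝ), U r t ^ m * U r t * Real.sinh r ^ n := rfl
      rw [← e3] at tb
      rw [Real.norm_eq_abs, abs_mul, abs_two]
      refine mul_le_mul_of_nonneg_left (abs_le.2 ⟨by linarith [tb.1], by linarith [tb.1]⟩) zero_le_two
    · exact ((continuousOn_const.add hX).const_smul (2:ℝ)).intervalIntegrable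
    · refine Eventually.of_forall (fun t ht => ?_)
      rw [uIoc_of_le h1] at ht
      have ht' : ε ≤ t := h0.trans ht.1.le
      refine Tendsto.const_mul _ (Tendsto.sub ?_ (intervalIntegral_tendsto_integral_Ioi 0 (h.Xi hm hk ht') tendsto_id))
      refine squeeze_zero' ?_ ?_ ce
      · filter_upwards [eventually_ge_atTop 0] with R hR
        exact mul_nonneg (h.Fnn hR t) (Real.rpow_nonneg (h.nonneg _ _) _)
      · filter_upwards [eventually_ge_atTop 0] with R hR
        exact h.clB hk ht' hR
  have l3 := l1.congr' (by filter_upwards [eventually_ge_atTop 0] with R hR; exact key R hR)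
  rw [tendsto_nhds_unique l3 l2, ← intervalIntegral.integral_const_mul]
  refine intervalIntegral.integral_congr (fun t ht => ?_)
  ring

/-- (K) -/
theorem FD.Ptd (h : FD n m T U ut vr) (hn : 1 ≤ n) (hm : 0 < m) (hε : 0 < ε) (hk : DK n m U ε a C) {r t1 t2 : ℝ} (hr : 0 < r) (h0 : ε ≤ t1) (h1 : t1 ≤ t2) (h2 : t2 < T) :
    PP n U r t1 - PP n U r t2 = ∫ t in t1..t2, U r t ^ m := by
  have hsub : ∀ t ∈ uIcc t1 t2, t ∈ Ioo 0 T := fun t ht => by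
    rw [uIcc_of_le h1] at ht; exact ⟨hε.trans_le (h0.trans ht.1), ht.2.trans_lt h2⟩
  have n0 : (0:ℝ) < n := by exact_mod_cast hn
  have hl : ∀ t, ε ≤ t → Tendsto (fun R => ∫ ρ in r..R, FF n U ρ t / Real.sinh ρ ^ n) atTop (𝓝 (PP n U r t)) := fun t ht =>
    intervalIntegral_tendsto_integral_Ioi r (h.Fwi hk ht hr.le) tendsto_id
  have ii : ∀ t, ∀ R, r ≤ R → IntervalIntegrable (fun ρ => FF n U ρ t / Real.sinh ρ ^ n) volume r R := fun t R hR => by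
    refine ContinuousOn.intervalIntegrable ((h.Fsl t).continuousOn.div (by fun_prop) (fun x hx => (wpos ?_ n).ne'))
    rw [uIcc_of_le hR] at hx; exact hr.trans_le hx.1
  have key : ∀ R, r ≤ R → (∫ ρ in r..R, FF n U ρ t1 / Real.sinh ρ ^ n) - (∫ ρ in r..R, FF n U ρ t2 / Real.sinh ρ ^ n)
      = (∫ t in t1..t2, U r t ^ m) - ∫ t in t1..t2, U R t ^ m := fun R hR => by
    rw [← intervalIntegral.integral_sub (ii _ _ hR) (ii _ _ hR), ← intervalIntegral.integral_sub ((h.vtl hm r).intervalIntegrable _ _) ((h.vtl hm R).intervalIntegrable _ _)]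
    have cc : ContinuousOn (Function.uncurry fun r t => -(vr r t)) (uIcc r R ×ˢ uIcc t1 t2) :=
      (h.vrc.mono (fun p hp => ⟨mem_univ _, hsub _ hp.2⟩)).neg
    have e1 : ∫ x in r..R, (FF n U x t1 / Real.sinh x ^ n - FF n U x t2 / Real.sinh x ^ n) = ∫ x in r..R, ∫ t in t1..t2, -(vr x t) := by
      refine intervalIntegral.integral_congr (fun x hx => ?_)
      rw [uIcc_of_le hR] at hx
      have x0 := hr.trans_le hx.1
      have w0 := wpos x0 n
      have := h.Ftd hn x0.le (hε.trans_le h0) h1 h2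
      rw [intervalIntegral.integral_const_mul] at this
      rw [intervalIntegral.integral_neg, div_sub_div_same, div_eq_iff w0.ne']
      linarith
    rw [e1, swapc cc]
    refine intervalIntegral.integral_congr (fun t ht => ?_)
    have c1 : Continuous (fun x => vr x t) := h.vrc.comp_continuous (by fun_prop : Continuous (fun x : ℝ => (x, t))) (fun x => ⟨mem_univ _, hsub t ht⟩)
    rw [intervalIntegral.integral_neg, intervalIntegral.integral_eq_sub_of_hasDerivAt (f := fun r => U r t ^ m) (fun x hx => h.hvr x (by rw [uIcc_of_le hR] at hx; exact hr.trans_le hx.1) t (hsub t ht)) (c1.intervalIntegrable _ _)]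
    ring
  have l2 : Tendsto (fun R => ∫ t in t1..t2, U R t ^ m) atTop (𝓝 0) := by
    have ce : Tendsto (fun R => C * Real.exp (-(n / 2 * R)) * (t2 - t1)) atTop (𝓝 0) := by
      have : Tendsto (fun R => Real.exp (-((n:ℝ)/2 * R))) atTop (𝓝 0) :=
        Real.tendsto_exp_neg_atTop_nhds_zero.comp (tendsto_id.const_mul_atTop (by positivity))
      simpa using (this.const_mul C).mul_const (t2 - t1)
    refine squeeze_zero' (Eventually.of_forall (fun R => intervalIntegral.integral_nonneg h1 (fun t _ => Real.rpow_nonneg (h.nonneg _ _) _))) ?_ ce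
    filter_upwards [eventually_ge_atTop 0] with R hR
    have := intervalIntegral.integral_mono_on h1 ((h.vtl hm R).intervalIntegrable t1 t2) (intervalIntegrable_const (μ := volume) (c := C * Real.exp (-(n/2*R))))
      (fun t ht => (hk.v t (h0.trans ht.1) R hR).trans (le_of_eq (by congr 3; ring)))
    rw [intervalIntegral.integral_const, smul_eq_mul, mul_comm] at this
    exact this
  have l1 := ((hl t1 h0).sub (hl t2 (h0.trans h1))).congr' (by filter_upwards [eventually_ge_atTop r] with R hR; exact key R hR)
  have l3 := l2.const_sub (∫ t in t1..t2, U r t ^ m)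
  rw [sub_zero] at l3
  exact tendsto_nhds_unique l1 l3
end

theorem right_prim {f : ℝ → ℝ} {a b x : ℝ} (hf : ContinuousOn f (Icc a b)) (hx : x ∈ Ico a b) {c : ℝ} (hc : c ∈ Icc a x) :
    HasDerivWithinAt (fun t => ∫ s in c..t, f s) (f x) (Ici x) x := by
  have hi : IntervalIntegrable f volume c x := (hf.mono (by rw [uIcc_of_le hc.2]; exact Icc_subset_Icc hc.1 hx.2.le)).intervalIntegrable
  refine intervalIntegral.integral_hasDerivWithinAt_right hi (s := Ici x) (t := Ioi x) ?_ ?_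
  · refine ⟨Ioo x b, Ioo_mem_nhdsGT hx.2, ?_⟩
    exact (hf.mono (fun y hy => ⟨hx.1.trans hy.1.le, hy.2.le⟩)).aestronglyMeasurable measurableSet_Ioo
  · have := (hf x ⟨hx.1, hx.2.le⟩).mono (show Ioo x b ⊆ Icc a b from fun y hy => ⟨hx.1.trans hy.1.le, hy.2.le⟩)
    exact this.mono_of_mem_nhdsWithin (Ioo_mem_nhdsGT hx.2)

theorem slope_lem {X E e q : ℝ → ℝ} {t1 t2 : ℝ} (h : t1 ≤ t2) (Xc : ContinuousOn X (Icc t1 t2)) (qc : ContinuousOn q (Icc t1 t2)) (ec : ContinuousOn e (Icc t1 t2))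
    (hE : ∀ t ∈ Icc t1 t2, HasDerivAt E (e t) t) (E0 : ∀ t ∈ Icc t1 t2, 0 ≤ E t)
    (hX : ∀ s t, t1 ≤ s → s ≤ t → t ≤ t2 → X t ≤ X s - ∫ y in s..t, q y) :
    X t2 * E t2 ≤ X t1 * E t1 + ∫ t in t1..t2, (X t * e t - q t * E t) := by
  have Ec : ContinuousOn E (Icc t1 t2) := fun t ht => (hE t ht).continuousAt.continuousWithinAt
  have gc : ContinuousOn (fun t => X t * e t - q t * E t) (Icc t1 t2) := (Xc.mul ec).sub (qc.mul Ec)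
  refine image_le_of_liminf_slope_right_le_deriv_boundary (f := fun t => X t * E t) (a := t1) (b := t2) (B := fun x => X t1 * E t1 + ∫ t in t1..x, (X t * e t - q t * E t)) (B' := fun t => X t * e t - q t * E t)
    (Xc.mul Ec) (by simp) ?_ (fun x hx => ?_) (fun x hx r hr => ?_) ⟨h, le_rfl⟩
  · refine continuousOn_const.add ?_
    exact intervalIntegral.continuousOn_primitive_interval' (b₁ := t1) (b₂ := t2) (by
      refine ContinuousOn.intervalIntegrable ?_; rw [uIcc_of_le h]; exact gc) (by simp) |>.mono (by rw [uIcc_of_le h])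
  · exact ((right_prim gc hx ⟨le_rfl, hx.1⟩).const_add _)
  · refine Eventually.frequently ?_
    have d1 := (right_prim qc hx (c := x) ⟨hx.1, le_rfl⟩).mono Ioi_subset_Ici_self
    have l1 : Tendsto (slope (fun t => ∫ s in x..t, q s) x) (𝓝[>] x) (𝓝 (q x)) := by
      have := hasDerivWithinAt_iff_tendsto_slope.1 d1
      rwa [diff_singleton_eq_self (by simp)] at this
    have l2 : Tendsto (slope E x) (𝓝[>] x) (𝓝 (e x)) := by
      have := hasDerivWithinAt_iff_tendsto_slope.1 ((hE x ⟨hx.1, hx.2.le⟩).hasDerivWithinAt (s := Ioi x))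
      rwa [diff_singleton_eq_self (by simp)] at this
    have l3 : Tendsto E (𝓝[>] x) (𝓝 (E x)) := (hE x ⟨hx.1, hx.2.le⟩).continuousAt.tendsto.mono_left nhdsWithin_le_nhds
    have l4 := (l2.const_mul (X x)).sub (l1.mul l3)
    filter_upwards [l4.eventually_lt_const hr, Ioo_mem_nhdsGT hx.2] with z hz hz2
    refine lt_of_le_of_lt ?_ hz
    have hzx : 0 < z - x := by linarith [hz2.1]
    simp only [slope_def_field, intervalIntegral.integral_same, sub_zero]
    rw [mul_div_assoc', div_mul_eq_mul_div, div_sub_div_same]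
    refine div_le_div_of_nonneg_right ?_ hzx.le
    have := mul_le_mul_of_nonneg_right (hX x z hx.1 hz2.1.le hz2.2.le) (E0 z ⟨hx.1.trans hz2.1.le, hz2.2.le⟩)
    linarith

section
variable {n : ℕ} {m T : ℝ} {U ut vr : ℝ → ℝ → ℝ} {ε a C : ℝ}

theorem FD.Xnn (h : FD n m T U ut vr) {r : ℝ} (hr : 0 ≤ r) (t : ℝ) : 0 ≤ U r t ^ m * U r t * Real.sinh r ^ n :=
  mul_nonneg (mul_nonneg (Real.rpow_nonneg (h.nonneg _ _) _) (h.nonneg _ _)) (wnn hr n)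

theorem FD.XRtd (h : FD n m T U ut vr) (hn : 1 ≤ n) (hm : 0 < m) {t1 t2 R : ℝ} (h0 : 0 < t1) (h1 : t1 ≤ t2) (h2 : t2 < T) (hR : 0 ≤ R) :
    (∫ r in (0:ℝ)..R, U r t2 ^ m * U r t2 * Real.sinh r ^ n) - (∫ r in (0:ℝ)..R, U r t1 ^ m * U r t1 * Real.sinh r ^ n)
      = (1 + m) * ∫ t in t1..t2, (U R t ^ m * (Real.sinh R ^ n * vr R t) - ∫ r in (0:ℝ)..R, vr r t ^ 2 * Real.sinh r ^ n) := by
  have hsub : ∀ t ∈ uIcc t1 t2, t ∈ Ioo 0 T := fun t ht => by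
    rw [uIcc_of_le h1] at ht; exact ⟨h0.trans_le ht.1, ht.2.trans_lt h2⟩
  have cX : ∀ t, Continuous (fun r => U r t ^ m * U r t * Real.sinh r ^ n) := fun t => (h.Xc hm).comp (by fun_prop : Continuous (fun r : ℝ => (r, t)))
  rw [← intervalIntegral.integral_sub ((cX _).intervalIntegrable _ _) ((cX _).intervalIntegrable _ _)]
  have cc : ContinuousOn (Function.uncurry fun r t => (1 + m) * (U r t ^ m * (ut r t * Real.sinh r ^ n))) (uIcc 0 R ×ˢ uIcc t1 t2) :=
    continuousOn_const.mul ((h.vc hm).continuousOn.mul ((h.utc.mono (fun p hp => ⟨mem_univ _, hsub _ hp.2⟩)).mul (by fun_prop)))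
  have e1 : ∫ x in (0:ℝ)..R, (U x t2 ^ m * U x t2 * Real.sinh x ^ n - U x t1 ^ m * U x t1 * Real.sinh x ^ n) = ∫ x in (0:ℝ)..R, ∫ t in t1..t2, (1 + m) * (U x t ^ m * (ut x t * Real.sinh x ^ n)) := by
    refine intervalIntegral.integral_congr (fun x hx => ?_)
    have := intervalIntegral.integral_eq_sub_of_hasDerivAt (a := t1) (b := t2) (f := fun t => U x t ^ m * U x t * Real.sinh x ^ n)
        (f' := fun t => (1 + m) * (U x t ^ m * (ut x t * Real.sinh x ^ n)))
        (fun t ht => by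
          have p0 := h.pos x t (hsub t ht)
          refine ((((h.hut x t (hsub t ht)).rpow_const (p := m) (Or.inl p0.ne')).mul (h.hut x t (hsub t ht))).mul_const (Real.sinh x ^ n)).congr_deriv ?_
          have : U x t ^ (m - 1) * U x t = U x t ^ m := by
            rw [← Real.rpow_add_one p0.ne']; congr 1; ring
          linear_combination (ut x t * m * Real.sinh x ^ n) * this)
        ((cc.comp (by fun_prop : ContinuousOn (fun t : ℝ => (x, t)) _) (fun t ht => ⟨hx, ht⟩)).intervalIntegrable)
    rw [this]
  rw [e1, swapc cc, ← intervalIntegral.integral_const_mul]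
  refine intervalIntegral.integral_congr (fun t ht => ?_)
  have htT := hsub t ht
  have c1 : Continuous (fun x => vr x t) := h.vrc.comp_continuous (by fun_prop : Continuous (fun x : ℝ => (x, t))) (fun x => ⟨mem_univ _, htT⟩)
  have c2 : Continuous (fun x => ut x t) := h.utc.comp_continuous (by fun_prop : Continuous (fun x : ℝ => (x, t))) (fun x => ⟨mem_univ _, htT⟩)
  have c3 : Continuous (fun r => vr r t ^ 2 * Real.sinh r ^ n) := by fun_prop
  have c4 : Continuous (fun r => U r t ^ m * (ut r t * Real.sinh r ^ n)) := (h.vsl hm t).mul (by fun_prop)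
  have := intervalIntegral.integral_eq_sub_of_hasDerivAt_of_le hR (f := fun r => U r t ^ m * (Real.sinh r ^ n * vr r t))
    (f' := fun r => vr r t ^ 2 * Real.sinh r ^ n + U r t ^ m * (ut r t * Real.sinh r ^ n))
    ((h.vsl hm t).mul (by fun_prop)).continuousOn (fun x hx => ((h.hvr x hx.1 t htT).mul (h.hfl x hx.1 t htT)).congr_deriv (by ring)) ((c3.add c4).intervalIntegrable _ _)
  rw [intervalIntegral.integral_add (c3.intervalIntegrable _ _) (c4.intervalIntegrable _ _)] at this
  simp only [Real.sinh_zero, zero_pow (show n ≠ 0 by omega), zero_mul, mul_zero, sub_zero] at this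
  rw [intervalIntegral.integral_const_mul]
  congr 1; linarith

theorem FD.Dc (h : FD n m T U ut vr) (R : ℝ) : ContinuousOn (fun t => ∫ r in (0:ℝ)..R, vr r t ^ 2 * Real.sinh r ^ n) (Ioo 0 T) :=
  cpar (G := fun r t => vr r t ^ 2 * Real.sinh r ^ n) ((h.vrc.pow 2).mul (by fun_prop)) 0 R

theorem FD.Xdec (h : FD n m T U ut vr) (hn : 1 ≤ n) (hm : 0 < m) (hε : ε ∈ Ioo 0 T) (hk : DK n m U ε a C) {t1 t2 R0 : ℝ} (h0 : ε ≤ t1) (h1 : t1 ≤ t2) (h2 : t2 < T) (hR0 : 0 ≤ R0) :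
    XX n m U t2 ≤ XX n m U t1 - (1 + m) * ∫ t in t1..t2, ∫ r in (0:ℝ)..R0, vr r t ^ 2 * Real.sinh r ^ n := by
  have hsub : ∀ t ∈ uIcc t1 t2, t ∈ Ioo 0 T := fun t ht => by
    rw [uIcc_of_le h1] at ht; exact ⟨hε.1.trans_le (h0.trans ht.1), ht.2.trans_lt h2⟩
  have Di : ∀ R, IntervalIntegrable (fun t => ∫ r in (0:ℝ)..R, vr r t ^ 2 * Real.sinh r ^ n) volume t1 t2 := fun R =>
    ((h.Dc R).mono hsub).intervalIntegrable
  by_contra hcon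
  push Not at hcon
  set κ := XX n m U t2 - (XX n m U t1 - (1 + m) * ∫ t in t1..t2, ∫ r in (0:ℝ)..R0, vr r t ^ 2 * Real.sinh r ^ n) with hκ
  have κ0 : 0 < κ := by linarith
  obtain ⟨C2, hC2⟩ := h.en ε hε
  have hlim : ∀ t, ε ≤ t → Tendsto (fun R => ∫ r in (0:ℝ)..R, U r t ^ m * U r t * Real.sinh r ^ n) atTop (𝓝 (XX n m U t)) := fun t ht =>
    intervalIntegral_tendsto_integral_Ioi 0 (h.Xi hm hk ht) tendsto_id
  have ev := ((hlim t2 (h0.trans h1)).sub (hlim t1 h0)).eventually_const_lt (show XX n m U t2 - XX n m U t1 - κ/2 < XX n m U t2 - XX n m U t1 by linarith)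
  obtain ⟨R1, hR1⟩ := eventually_atTop.1 ev
  set R2 := max R1 R0 with hR2
  have vrx : ∀ R, IntervalIntegrable (fun t => vr R t) volume t1 t2 := fun R => (h.vrc.comp (by fun_prop : ContinuousOn (fun s : ℝ => (R, s)) (uIcc t1 t2)) (fun s hs => ⟨mem_univ _, hsub s hs⟩)).intervalIntegrable
  have vrxc : ∀ R, ContinuousOn (fun t => vr R t) (uIcc t1 t2) := fun R => h.vrc.comp (by fun_prop : ContinuousOn (fun s : ℝ => (R, s)) (uIcc t1 t2)) (fun s hs => ⟨mem_univ _, hsub s hs⟩)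
  set δ := κ / (4 * (1 + m) * (t2 - t1 + 1)) with hδ
  have t0 : 0 ≤ t2 - t1 := by linarith
  have δ0 : 0 < δ := by positivity
  have C0 := hk.C0
  -- lower bound for each R
  have low : ∀ R, R2 ≤ R → κ / 4 / (1 + m) * (4 * δ / C ^ 2) ≤ ∫ t in t1..t2, vr R t ^ 2 * Real.sinh R ^ n := fun R hR => by
    have hRR0 : R0 ≤ R := (le_max_right _ _).trans hR
    have Rn : 0 ≤ R := hR0.trans hRR0
    have a1 := hR1 R ((le_max_left _ _).trans hR)
    rw [h.XRtd hn hm (hε.1.trans_le h0) h1 h2 Rn] at a1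
    have a2 : ∫ t in t1..t2, (U R t ^ m * (Real.sinh R ^ n * vr R t) - ∫ r in (0:ℝ)..R, vr r t ^ 2 * Real.sinh r ^ n) ≤
        ∫ t in t1..t2, ((δ + C ^ 2 / (4 * δ) * (vr R t ^ 2 * Real.sinh R ^ n)) - ∫ r in (0:ℝ)..R0, vr r t ^ 2 * Real.sinh r ^ n) := by
      refine intervalIntegral.integral_mono_on h1 ?_ ?_ (fun t ht => ?_)
      · exact (((h.vtl hm R).continuousOn.mul (continuousOn_const.mul (vrxc R))).sub ((h.Dc R).mono hsub)).intervalIntegrable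
      · exact ((continuousOn_const.add (continuousOn_const.mul (((vrxc R).pow 2).mul continuousOn_const))).sub ((h.Dc R0).mono hsub)).intervalIntegrable
      · have htT : t ∈ Ioo 0 T := hsub t (by rw [uIcc_of_le h1]; exact ht)
        have c1 : Continuous (fun x => vr x t) := h.vrc.comp_continuous (by fun_prop : Continuous (fun x : ℝ => (x, t))) (fun x => ⟨mem_univ _, htT⟩)
        have c3 : Continuous (fun r => vr r t ^ 2 * Real.sinh r ^ n) := by fun_prop
        have m1 : ∫ r in (0:ℝ)..R0, vr r t ^ 2 * Real.sinh r ^ n ≤ ∫ r in (0:ℝ)..R, vr r t ^ 2 * Real.sinh r ^ n := by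
          rw [← intervalIntegral.integral_add_adjacent_intervals (c3.intervalIntegrable 0 R0) (c3.intervalIntegrable R0 R)]
          have : 0 ≤ ∫ r in R0..R, vr r t ^ 2 * Real.sinh r ^ n := intervalIntegral.integral_nonneg hRR0 (fun r hr => mul_nonneg (sq_nonneg _) (wnn (hR0.trans hr.1) n))
          linarith
        have m2 : U R t ^ m * (Real.sinh R ^ n * vr R t) ≤ δ + C ^ 2 / (4 * δ) * (vr R t ^ 2 * Real.sinh R ^ n) := by
          set W := Real.sinh R ^ n
          have W0 : 0 ≤ W := wnn Rn n
          have hv := hk.v t (h0.trans ht.1) R Rn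
          have v0 : 0 ≤ U R t ^ m := Real.rpow_nonneg (h.nonneg _ _) _
          have hvW : (U R t ^ m) ^ 2 * W ≤ C ^ 2 := by
            calc _ ≤ (C * Real.exp (-(n * R / 2))) ^ 2 * Real.exp (n * R) := mul_le_mul (pow_le_pow_left₀ v0 hv 2) (sinhn_le_exp Rn) W0 (by positivity)
              _ = C ^ 2 * (Real.exp (-(n * R / 2)) ^ 2 * Real.exp (n * R)) := by ring
              _ = C ^ 2 := by rw [← Real.exp_nat_mul, ← Real.exp_add]; convert mul_one _; rw [Real.exp_eq_one_iff]; push_cast; ring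
          set y := U R t ^ m * (W * vr R t)
          have hy2 : y ^ 2 ≤ C ^ 2 * (vr R t ^ 2 * W) := by
            have := mul_le_mul_of_nonneg_right hvW (show 0 ≤ vr R t ^ 2 * W by positivity)
            calc y ^ 2 = (U R t ^ m) ^ 2 * W * (vr R t ^ 2 * W) := by simp only [y]; ring
              _ ≤ _ := this
          have h4 : y ≤ δ + y ^ 2 / (4 * δ) := by
            have : 0 ≤ (y - 2 * δ) ^ 2 / (4 * δ) := by positivity
            have e : (y - 2 * δ) ^ 2 / (4 * δ) = y ^ 2 / (4 * δ) - y + δ := by field_simp; ring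
            linarith
          refine h4.trans ?_
          have := div_le_div_of_nonneg_right hy2 (show 0 ≤ 4 * δ by positivity)
          rw [div_mul_eq_mul_div]; linarith
        linarith
    have ia : IntervalIntegrable (fun t => δ + C ^ 2 / (4 * δ) * (vr R t ^ 2 * Real.sinh R ^ n)) volume t1 t2 :=
      (continuousOn_const.add (continuousOn_const.mul (((vrxc R).pow 2).mul continuousOn_const))).intervalIntegrable
    have ib : IntervalIntegrable (fun t => C ^ 2 / (4 * δ) * (vr R t ^ 2 * Real.sinh R ^ n)) volume t1 t2 :=
      (continuousOn_const.mul (((vrxc R).pow 2).mul continuousOn_const)).intervalIntegrable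
    rw [intervalIntegral.integral_sub ia (Di R0), intervalIntegral.integral_add intervalIntegrable_const ib, intervalIntegral.integral_const, intervalIntegral.integral_const_mul, smul_eq_mul] at a2
    have a3 := mul_le_mul_of_nonneg_left a2 (show 0 ≤ 1 + m by linarith)
    set I := ∫ t in t1..t2, vr R t ^ 2 * Real.sinh R ^ n
    have a4 : (1 + m) * ((t2 - t1) * δ) ≤ κ / 4 := by
      rw [hδ]
      have : (1 + m) * ((t2 - t1) * (κ / (4 * (1 + m) * (t2 - t1 + 1)))) = κ / 4 * ((t2 - t1) / (t2 - t1 + 1)) := by field_simp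
      rw [this]
      have : (t2 - t1) / (t2 - t1 + 1) ≤ 1 := by rw [div_le_one (by linarith)]; linarith
      nlinarith
    have a5 : κ / 4 ≤ (1 + m) * (C ^ 2 / (4 * δ) * I) := by
      have e : (1 + m) * ((t2 - t1) * δ + C ^ 2 / (4 * δ) * I - ∫ t in t1..t2, ∫ r in (0:ℝ)..R0, vr r t ^ 2 * Real.sinh r ^ n) = (1 + m) * ((t2 - t1) * δ) + (1 + m) * (C ^ 2 / (4 * δ) * I) - (1 + m) * ∫ t in t1..t2, ∫ r in (0:ℝ)..R0, vr r t ^ 2 * Real.sinh r ^ n := by ring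
      linarith
    calc κ / 4 / (1 + m) * (4 * δ / C ^ 2) ≤ ((1 + m) * (C ^ 2 / (4 * δ) * I)) / (1 + m) * (4 * δ / C ^ 2) := by gcongr
      _ = I := by field_simp
  set κ' := κ / 4 / (1 + m) * (4 * δ / C ^ 2) with hκ'
  have κ'0 : 0 < κ' := by positivity
  have R20 : 0 ≤ R2 := hR0.trans (le_max_right _ _)
  -- integrate over R
  set L := ((t2 - t1) * |C2| + 1) / κ' with hL
  have L0 : 0 < L := by positivity
  have cc : ContinuousOn (Function.uncurry fun r t => vr r t ^ 2 * Real.sinh r ^ n) (uIcc R2 (R2 + L) ×ˢ uIcc t1 t2) :=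
    ((h.vrc.mono (fun p hp => ⟨mem_univ _, hsub _ hp.2⟩)).pow 2).mul (by fun_prop)
  have cg : ContinuousOn (fun r => ∫ t in t1..t2, vr r t ^ 2 * Real.sinh r ^ n) (uIcc R2 (R2+L)) := by
    have hc := clampc h1
    have : Continuous (fun q : ℝ × ℝ => vr q.1 (max t1 (min q.2 t2)) ^ 2 * Real.sinh q.1 ^ n) :=
      ((h.vrc.comp_continuous (by fun_prop : Continuous (fun q : ℝ × ℝ => (q.1, max t1 (min q.2 t2))))
        (fun q => ⟨mem_univ _, hsub _ (by rw [uIcc_of_le h1]; exact hc.1 _)⟩)).pow 2).mul (by fun_prop)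
    have := intervalIntegral.continuous_parametric_intervalIntegral_of_continuous' (μ := volume) (f := fun r t => vr r (max t1 (min t t2)) ^ 2 * Real.sinh r ^ n) this t1 t2
    refine this.continuousOn.congr (fun r _ => ?_)
    refine intervalIntegral.integral_congr (fun t ht => ?_)
    rw [uIcc_of_le h1] at ht
    simp only [hc.2 t ht]
  have b1 : κ' * L ≤ ∫ r in R2..(R2+L), ∫ t in t1..t2, vr r t ^ 2 * Real.sinh r ^ n := by
    have := intervalIntegral.integral_mono_on (show R2 ≤ R2 + L by linarith) (intervalIntegrable_const (μ := volume) (c := κ')) (cg.intervalIntegrable (μ := volume)) (fun r hr => low r hr.1)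
    rw [intervalIntegral.integral_const, smul_eq_mul] at this
    linarith
  rw [swapc cc] at b1
  have b2 : ∫ t in t1..t2, ∫ r in R2..(R2+L), vr r t ^ 2 * Real.sinh r ^ n ≤ ∫ t in t1..t2, |C2| := by
    refine intervalIntegral.integral_mono_on h1 ?_ intervalIntegrable_const (fun t ht => ?_)
    · exact ((cpar (G := fun r t => vr r t ^ 2 * Real.sinh r ^ n) ((h.vrc.pow 2).mul (by fun_prop)) R2 (R2+L)).mono hsub).intervalIntegrable
    · have htT : t ∈ Ioo 0 T := hsub t (by rw [uIcc_of_le h1]; exact ht)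
      have c1 : Continuous (fun x => vr x t) := h.vrc.comp_continuous (by fun_prop : Continuous (fun x : ℝ => (x, t))) (fun x => ⟨mem_univ _, htT⟩)
      have c3 : Continuous (fun r => vr r t ^ 2 * Real.sinh r ^ n) := by fun_prop
      have := hC2 t ⟨h0.trans ht.1, htT.2⟩ (R2 + L) (by linarith)
      rw [← intervalIntegral.integral_add_adjacent_intervals (c3.intervalIntegrable 0 R2) (c3.intervalIntegrable R2 (R2+L))] at this
      have h0' : 0 ≤ ∫ r in (0:ℝ)..R2, vr r t ^ 2 * Real.sinh r ^ n := intervalIntegral.integral_nonneg R20 (fun r hr => mul_nonneg (sq_nonneg _) (wnn hr.1 n))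
      linarith [le_abs_self C2]
  rw [intervalIntegral.integral_const, smul_eq_mul] at b2
  have : κ' * L = (t2 - t1) * |C2| + 1 := by rw [hL]; field_simp
  linarith
end

noncomputable def dR (n : ℕ) (m : ℝ) (U vr : ℝ → ℝ → ℝ) (R t : ℝ) : ℝ :=
  ∫ r in (0:ℝ)..R, (vr r t + XX n m U t / NN n U t * (FF n U r t / Real.sinh r ^ n)) ^ 2 * Real.sinh r ^ n
noncomputable def RR (n : ℕ) (m : ℝ) (U : ℝ → ℝ → ℝ) (t : ℝ) : ℝ := XX n m U t * NN n U t ^ (-(1 + m) / 2)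

/-- weighted Cauchy--Schwarz -/
theorem wcs {n : ℕ} {a : ℝ} (ha : 0 < a) (h1 : (n:ℝ) - 1 ≤ a) (h2 : a ≤ n) {f : ℝ → ℝ} {r R K : ℝ} (hr : 0 < r) (hR : r < R)
    (hf : ContinuousOn f (Icc r R)) (hK : ∫ x in r..R, f x ^ 2 * Real.sinh x ^ n ≤ K) : (∫ x in r..R, f x) ^ 2 ≤ Gm n a r * K := by
  have hpos : ∀ x ∈ uIcc r R, 0 < Real.sinh x ^ n := fun x hx => by rw [uIcc_of_le hR.le] at hx; exact wpos (hr.trans_le hx.1) n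
  rw [← uIcc_of_le hR.le] at hf
  have ci : ContinuousOn (fun ρ => 1 / Real.sinh ρ ^ n) (uIcc r R) :=
    continuousOn_const.div (by fun_prop) (fun x hx => (hpos x hx).ne')
  set A := ∫ x in r..R, 1 / Real.sinh x ^ n with hA
  set I := ∫ x in r..R, f x with hI
  set B := ∫ x in r..R, f x ^ 2 * Real.sinh x ^ n with hB
  have A0 : 0 < A := intervalIntegral.intervalIntegral_pos_of_pos_on ci.intervalIntegrable (fun x hx => by
    have := wpos (hr.trans hx.1) n; positivity) hR
  have cf2 : ContinuousOn (fun x => f x ^ 2 * Real.sinh x ^ n) (uIcc r R) := (hf.pow 2).mul (by fun_prop)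
  have key : 0 ≤ ∫ x in r..R, (f x ^ 2 * Real.sinh x ^ n - 2 * (I / A) * f x + (I / A) ^ 2 * (1 / Real.sinh x ^ n)) := by
    refine intervalIntegral.integral_nonneg hR.le (fun x hx => ?_)
    have w0 := hpos x (by rw [uIcc_of_le hR.le]; exact hx)
    have : f x ^ 2 * Real.sinh x ^ n - 2 * (I / A) * f x + (I / A) ^ 2 * (1 / Real.sinh x ^ n) = (f x * Real.sinh x ^ n - I / A) ^ 2 / Real.sinh x ^ n := by
      field_simp; ring
    rw [this]; positivity
  have k1 : ContinuousOn (fun x => 2 * (I / A) * f x) (uIcc r R) := continuousOn_const.mul hf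
  have k2 : ContinuousOn (fun x => (I / A) ^ 2 * (1 / Real.sinh x ^ n)) (uIcc r R) := continuousOn_const.mul ci
  have k3 : ContinuousOn (fun x => f x ^ 2 * Real.sinh x ^ n - 2 * (I / A) * f x) (uIcc r R) := cf2.sub k1
  rw [intervalIntegral.integral_add k3.intervalIntegrable k2.intervalIntegrable,
    intervalIntegral.integral_sub cf2.intervalIntegrable k1.intervalIntegrable, intervalIntegral.integral_const_mul, intervalIntegral.integral_const_mul, ← hA, ← hI, ← hB] at key
  have e : B - 2 * (I / A) * I + (I / A) ^ 2 * A = B - I ^ 2 / A := by field_simp; ring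
  rw [e] at key
  have : I ^ 2 ≤ B * A := by rw [← div_le_iff₀ A0]; linarith
  have B0 : 0 ≤ B := intervalIntegral.integral_nonneg hR.le (fun x hx => mul_nonneg (sq_nonneg _) (hpos x (by rw [uIcc_of_le hR.le]; exact hx)).le)
  have := Gm_invint ha h1 h2 hr hR.le
  calc I ^ 2 ≤ B * A := by assumption
    _ ≤ K * Gm n a r := mul_le_mul hK this A0.le (B0.trans hK)
    _ = _ := mul_comm _ _

section
variable {n : ℕ} {m T : ℝ} {U ut vr : ℝ → ℝ → ℝ} {ε a C : ℝ}

theorem FD.Fpos (h : FD n m T U ut vr) {r t : ℝ} (hr : 0 < r) (ht : t ∈ Ioo 0 T) : 0 < FF n U r t :=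
  intervalIntegral.intervalIntegral_pos_of_pos_on ((h.uwc t).intervalIntegrable _ _) (fun x hx => mul_pos (h.pos x t ht) (wpos hx.1 n)) hr

theorem FD.Npos (h : FD n m T U ut vr) (hk : DK n m U ε a C) {t : ℝ} (ht : ε ≤ t) (htT : t ∈ Ioo 0 T) : 0 < NN n U t := by
  have := intervalIntegral.intervalIntegral_pos_of_pos_on (h.Nii hk ht zero_le_one) (fun x hx => by
    have := wpos hx.1 n; have := h.Fpos hx.1 htT; positivity) zero_lt_one
  refine this.trans_le (tailb (d := 2 * (a - n/2)) (by have := hk.a1; linarith) zero_le_one (h.Ni hk ht) (fun r hr => div_nonneg (sq_nonneg _) (wpos hr n).le) (fun r hr => h.clF hk ht hr)).1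

theorem FD.Xpos (h : FD n m T U ut vr) (hm : 0 < m) (hk : DK n m U ε a C) {t : ℝ} (ht : ε ≤ t) (htT : t ∈ Ioo 0 T) : 0 < XX n m U t := by
  have cX : Continuous (fun r => U r t ^ m * U r t * Real.sinh r ^ n) := (h.Xc hm).comp (by fun_prop : Continuous (fun r : ℝ => (r, t)))
  have := intervalIntegral.intervalIntegral_pos_of_pos_on (cX.intervalIntegrable 0 1) (fun x hx => by
    have := wpos hx.1 n; have := h.pos x t htT; positivity) zero_lt_one
  refine this.trans_le (tailb (d := (a - n/2)) (by have := hk.a1; linarith) zero_le_one (h.Xi hm hk ht) (fun r hr => h.Xnn hr.le t) (fun r hr => h.clX hk ht hr.le)).1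

theorem FD.Nd (h : FD n m T U ut vr) (hn : 1 ≤ n) (hm : 0 < m) (hε : 0 < ε) (hk : DK n m U ε a C) {t : ℝ} (ht : t ∈ Ioo ε T) :
    HasDerivAt (NN n U) (-2 * XX n m U t) t := by
  have hX := h.Xcs hm hk
  have d1 : HasDerivAt (fun s => ∫ y in ε..s, XX n m U y) (XX n m U t) t := by
    refine intervalIntegral.integral_hasDerivAt_right ?_ ((hX.mono Ioi_subset_Ici_self).stronglyMeasurableAtFilter isOpen_Ioi t ht.1) (hX.continuousAt (Ici_mem_nhds ht.1))
    exact (hX.mono (by rw [uIcc_of_le ht.1.le]; exact Icc_subset_Ici_self)).intervalIntegrable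
  refine ((d1.const_mul (-2)).add_const (NN n U ε)).congr_of_eventuallyEq ?_
  filter_upwards [Ioo_mem_nhds ht.1 ht.2] with s hs
  rw [← h.Ntd hn hm hε hk le_rfl hs.1.le hs.2]; ring

theorem FD.dReq (h : FD n m T U ut vr) (hm : 0 < m) (hk : DK n m U ε a C) {t R : ℝ} (ht : ε ≤ t) (htT : t ∈ Ioo 0 T) (hR : 0 ≤ R) :
    dR n m U vr R t = (∫ r in (0:ℝ)..R, vr r t ^ 2 * Real.sinh r ^ n) + 2 * (XX n m U t / NN n U t) * (FF n U R t * U R t ^ m - ∫ r in (0:ℝ)..R, U r t ^ m * U r t * Real.sinh r ^ n)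
      + (XX n m U t / NN n U t) ^ 2 * ∫ r in (0:ℝ)..R, FF n U r t ^ 2 / Real.sinh r ^ n := by
  have c1 : Continuous (fun x => vr x t) := h.vrc.comp_continuous (by fun_prop : Continuous (fun x : ℝ => (x, t))) (fun x => ⟨mem_univ _, htT⟩)
  have c3 : Continuous (fun r => vr r t ^ 2 * Real.sinh r ^ n) := by fun_prop
  have cF : Continuous (fun r => FF n U r t * vr r t) := (h.Fsl t).mul c1
  have cF2 : Continuous (fun r => 2 * (XX n m U t / NN n U t) * (FF n U r t * vr r t)) := continuous_const.mul cF
  have cF3 : Continuous (fun r => vr r t ^ 2 * Real.sinh r ^ n + 2 * (XX n m U t / NN n U t) * (FF n U r t * vr r t)) := c3.add cF2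
  rw [← h.ibp hm htT hR, ← intervalIntegral.integral_const_mul, ← intervalIntegral.integral_const_mul,
    ← intervalIntegral.integral_add (c3.intervalIntegrable _ _) (cF2.intervalIntegrable _ _),
    ← intervalIntegral.integral_add (cF3.intervalIntegrable _ _) ((h.Nii hk ht hR).const_mul _)]
  refine intervalIntegral.integral_congr_Ioo_of_le hR (fun x hx => ?_)
  have w0 := wpos hx.1 n
  field_simp
  ring

theorem FD.dRi (h : FD n m T U ut vr) (hk : DK n m U ε a C) {t R : ℝ} (ht : ε ≤ t) (htT : t ∈ Ioo 0 T) (hR : 0 ≤ R) :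
    IntervalIntegrable (fun r => (vr r t + XX n m U t / NN n U t * (FF n U r t / Real.sinh r ^ n)) ^ 2 * Real.sinh r ^ n) volume 0 R := by
  have c1 : Continuous (fun x => vr x t) := h.vrc.comp_continuous (by fun_prop : Continuous (fun x : ℝ => (x, t))) (fun x => ⟨mem_univ _, htT⟩)
  have c3 : Continuous (fun r => vr r t ^ 2 * Real.sinh r ^ n) := by fun_prop
  have cF : Continuous (fun r => FF n U r t * vr r t) := (h.Fsl t).mul c1
  have := (((c3.intervalIntegrable 0 R).add ((cF.const_smul (2 * (XX n m U t / NN n U t))).intervalIntegrable 0 R)).add ((h.Nii hk ht hR).const_mul ((XX n m U t / NN n U t)^2)))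
  rw [intervalIntegrable_iff_integrableOn_Ioo_of_le hR] at this ⊢
  refine this.congr_fun (fun x hx => ?_) measurableSet_Ioo
  have w0 := wpos hx.1 n
  simp only [smul_eq_mul, Pi.add_apply]
  field_simp
  simp only [Pi.smul_apply, smul_eq_mul]; ring

theorem FD.dRmono (h : FD n m T U ut vr) (hk : DK n m U ε a C) {t R1 R2 : ℝ} (ht : ε ≤ t) (htT : t ∈ Ioo 0 T) (hR : 0 ≤ R1) (hR2 : R1 ≤ R2) :
    dR n m U vr R1 t ≤ dR n m U vr R2 t := by
  unfold dR
  refine intervalIntegral.integral_mono_interval le_rfl hR hR2 ?_ (h.dRi hk ht htT (hR.trans hR2))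
  filter_upwards [ae_restrict_mem measurableSet_Ioc] with x hx
  exact mul_nonneg (sq_nonneg _) (wnn hx.1.le n)

theorem FD.dRc (h : FD n m T U ut vr) (hm : 0 < m) (hk : DK n m U ε a C) {t1 t2 R : ℝ} (h00 : 0 < t1) (h0 : ε ≤ t1) (h2 : t2 < T) (hR : 0 ≤ R) :
    ContinuousOn (dR n m U vr R) (Icc t1 t2) := by
  have hs : ∀ t ∈ Icc t1 t2, t ∈ Ioo 0 T := fun t ht => ⟨h00.trans_le ht.1, ht.2.trans_lt h2⟩
  have he : ∀ t ∈ Icc t1 t2, ε ≤ t := fun t ht => h0.trans ht.1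
  have cX := (h.Xcs hm hk).mono he
  have cN : ContinuousOn (NN n U) (Icc t1 t2) := (h.Ncs hk measurableSet_Ioi le_rfl).mono he
  have cNR : ContinuousOn (fun t => ∫ r in (0:ℝ)..R, FF n U r t ^ 2 / Real.sinh r ^ n) (Icc t1 t2) := by
    simp only [intervalIntegral.integral_of_le hR]
    exact (h.Ncs hk measurableSet_Ioc Ioc_subset_Ioi_self).mono he
  have cl : ContinuousOn (fun t => XX n m U t / NN n U t) (Icc t1 t2) := cX.div cN (fun t ht => (h.Npos hk (he t ht) (hs t ht)).ne')
  have cXR : Continuous (fun t => ∫ r in (0:ℝ)..R, U r t ^ m * U r t * Real.sinh r ^ n) :=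
    intervalIntegral.continuous_parametric_intervalIntegral_of_continuous' (f := fun t r => U r t ^ m * U r t * Real.sinh r ^ n) ((h.Xc hm).comp continuous_swap) 0 R
  have cF : Continuous (fun t => FF n U R t * U R t ^ m) := (h.Fc.comp (by fun_prop : Continuous (fun t : ℝ => (R, t)))).mul (h.vtl hm R)
  refine ((((h.Dc R).mono hs).add ((cl.const_smul (2:ℝ)).mul (cF.sub cXR).continuousOn)).add ((cl.pow 2).mul cNR)).congr (fun t ht => ?_)
  rw [h.dReq hm hk (he t ht) (hs t ht) hR]
  simp [smul_eq_mul]; ring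

theorem FD.Xdec2 (h : FD n m T U ut vr) (hn : 1 ≤ n) (hm : 0 < m) (hε : ε ∈ Ioo 0 T) (hk : DK n m U ε a C) {t1 t2 R1 : ℝ} (h0 : ε ≤ t1) (h1 : t1 ≤ t2) (h2 : t2 < T) (hR1 : 0 ≤ R1) :
    XX n m U t2 ≤ XX n m U t1 - ∫ t in t1..t2, (1 + m) * (dR n m U vr R1 t + XX n m U t ^ 2 / NN n U t) := by
  have h00 : 0 < t1 := hε.1.trans_le h0
  have hs : ∀ t ∈ Icc t1 t2, t ∈ Ioo 0 T := fun t ht => ⟨h00.trans_le ht.1, ht.2.trans_lt h2⟩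
  have he : ∀ t ∈ Icc t1 t2, ε ≤ t := fun t ht => h0.trans ht.1
  have cX := (h.Xcs hm hk).mono he
  have cN : ContinuousOn (NN n U) (Icc t1 t2) := (h.Ncs hk measurableSet_Ioi le_rfl).mono he
  have cl : ContinuousOn (fun t => XX n m U t / NN n U t) (Icc t1 t2) := cX.div cN (fun t ht => (h.Npos hk (he t ht) (hs t ht)).ne')
  have cl2 : ContinuousOn (fun t => XX n m U t ^ 2 / NN n U t) (Icc t1 t2) := (cX.pow 2).div cN (fun t ht => (h.Npos hk (he t ht) (hs t ht)).ne')
  have cd := h.dRc hm hk h00 h0 h2 hR1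
  have hd : 0 < a - n/2 := by have := hk.a1; linarith
  set K := C^2 + C^2 / (a - n/2) with hK
  rw [intervalIntegral.integral_const_mul]
  set J := ∫ t in t1..t2, (dR n m U vr R1 t + XX n m U t ^ 2 / NN n U t) with hJ
  set L := ∫ t in t1..t2, (XX n m U t / NN n U t) with hL
  have ii {f : ℝ → ℝ} (hf : ContinuousOn f (Icc t1 t2)) : IntervalIntegrable f volume t1 t2 := by
    refine ContinuousOn.intervalIntegrable ?_; rwa [uIcc_of_le h1]
  have main : ∀ R0, R1 ≤ R0 → XX n m U t2 ≤ XX n m U t1 - (1 + m) * (J - 2 * (K * Real.exp (-((a - n/2) * R0))) * L) := fun R0 hR0 => by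
    have R00 : 0 ≤ R0 := hR1.trans hR0
    refine (h.Xdec hn hm hε hk h0 h1 h2 R00).trans ?_
    gcongr
    have k1 : ContinuousOn (fun t => dR n m U vr R1 t + XX n m U t ^ 2 / NN n U t) (Icc t1 t2) := cd.add cl2
    have k2 : ContinuousOn (fun t => 2 * (K * Real.exp (-((a - n/2) * R0))) * (XX n m U t / NN n U t)) (Icc t1 t2) := continuousOn_const.mul cl
    rw [hJ, hL, ← intervalIntegral.integral_const_mul, ← intervalIntegral.integral_sub (ii k1) (ii k2)]
    refine intervalIntegral.integral_mono_on h1 (ii ((cd.add cl2).sub (continuousOn_const.mul cl))) (ii ((h.Dc R0).mono hs)) (fun t ht => ?_)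
    have e := h.dReq hm hk (he t ht) (hs t ht) R00
    have m1 := h.dRmono hk (he t ht) (hs t ht) hR1 hR0
    have N0 := h.Npos hk (he t ht) (hs t ht)
    have X0 := h.Xpos hm hk (he t ht) (hs t ht)
    have tX := tailb hd R00 (h.Xi hm hk (he t ht)) (fun r hr => h.Xnn hr.le t) (fun r hr => h.clX hk (he t ht) hr.le)
    have tN := (tailb (d := 2 * (a - n/2)) (by linarith) R00 (h.Ni hk (he t ht)) (fun r hr => div_nonneg (sq_nonneg _) (wpos hr n).le) (fun r hr => h.clF hk (he t ht) hr)).1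
    have eX : XX n m U t = ∫ r in Ioi (0:ℝ), U r t ^ m * U r t * Real.sinh r ^ n := rfl
    have eN : NN n U t = ∫ ρ in Ioi (0:ℝ), FF n U ρ t ^ 2 / Real.sinh ρ ^ n := rfl
    rw [← eX] at tX
    rw [← eN] at tN
    have b := h.clB hk (he t ht) R00
    set l := XX n m U t / NN n U t with hl
    have l0 : 0 < l := by positivity
    have q1 : XX n m U t ^ 2 / NN n U t = l * XX n m U t := by rw [hl]; ring
    have q2 : l ^ 2 * (∫ r in (0:ℝ)..R0, FF n U r t ^ 2 / Real.sinh r ^ n) ≤ l * XX n m U t := by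
      have := mul_le_mul_of_nonneg_left tN (sq_nonneg l)
      have e2 : l ^ 2 * NN n U t = l * XX n m U t := by rw [hl]; field_simp
      linarith
    have q3 : l * (FF n U R0 t * U R0 t ^ m - ∫ r in (0:ℝ)..R0, U r t ^ m * U r t * Real.sinh r ^ n) ≤ l * (K * Real.exp (-((a - n/2) * R0)) - XX n m U t) := by
      refine mul_le_mul_of_nonneg_left ?_ l0.le
      rw [hK, add_mul]; linarith [tX.2]
    rw [q1]
    linarith
  have ce : Tendsto (fun R0 => XX n m U t1 - (1 + m) * (J - 2 * (K * Real.exp (-((a - n/2) * R0))) * L)) atTop (𝓝 (XX n m U t1 - (1 + m) * (J - 2 * (K * 0) * L))) := by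
    have : Tendsto (fun R => Real.exp (-((a - n/2) * R))) atTop (𝓝 0) :=
      Real.tendsto_exp_neg_atTop_nhds_zero.comp (tendsto_id.const_mul_atTop hd)
    exact ((((this.const_mul K).const_mul 2).mul_const L).const_sub J |>.const_mul (1+m)).const_sub _
  have := ge_of_tendsto ce (by filter_upwards [eventually_ge_atTop R1] with R hR using main R hR)
  simpa using this

theorem FD.Rmono (h : FD n m T U ut vr) (hn : 1 ≤ n) (hm : 0 < m) (hε : ε ∈ Ioo 0 T) (hk : DK n m U ε a C) {t1 t2 R1 : ℝ} (h0 : ε < t1) (h1 : t1 ≤ t2) (h2 : t2 < T) (hR1 : 0 ≤ R1) :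
    RR n m U t2 + (1 + m) * ∫ t in t1..t2, NN n U t ^ (-(1 + m) / 2) * dR n m U vr R1 t ≤ RR n m U t1 := by
  have h00 : 0 < t1 := hε.1.trans h0
  have hs : ∀ t ∈ Icc t1 t2, t ∈ Ioo 0 T := fun t ht => ⟨h00.trans_le ht.1, ht.2.trans_lt h2⟩
  have he : ∀ t ∈ Icc t1 t2, ε ≤ t := fun t ht => h0.le.trans ht.1
  have cX := (h.Xcs hm hk).mono he
  have cN : ContinuousOn (NN n U) (Icc t1 t2) := (h.Ncs hk measurableSet_Ioi le_rfl).mono he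
  have cl2 : ContinuousOn (fun t => XX n m U t ^ 2 / NN n U t) (Icc t1 t2) := (cX.pow 2).div cN (fun t ht => (h.Npos hk (he t ht) (hs t ht)).ne')
  have cd := h.dRc hm hk h00 h0.le h2 hR1
  have np := fun t (ht : t ∈ Icc t1 t2) => h.Npos hk (he t ht) (hs t ht)
  have key := slope_lem (X := XX n m U) (E := fun t => NN n U t ^ (-(1 + m) / 2)) (e := fun t => -2 * XX n m U t * (-(1 + m) / 2) * NN n U t ^ (-(1 + m) / 2 - 1))
    (q := fun t => (1 + m) * (dR n m U vr R1 t + XX n m U t ^ 2 / NN n U t)) h1 cX (continuousOn_const.mul (cd.add cl2))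
    (((continuousOn_const.mul cX).mul continuousOn_const).mul (cN.rpow_const (fun t ht => Or.inl (np t ht).ne')))
    (fun t ht => (h.Nd hn hm hε.1 hk ⟨h0.trans_le ht.1, (hs t ht).2⟩).rpow_const (Or.inl (np t ht).ne'))
    (fun t ht => (Real.rpow_pos_of_pos (np t ht) _).le)
    (fun s t h1' h2' h3' => h.Xdec2 hn hm hε hk (h0.le.trans h1') h2' (h3'.trans_lt h2) hR1)
  have e : ∫ t in t1..t2, (XX n m U t * (-2 * XX n m U t * (-(1 + m) / 2) * NN n U t ^ (-(1 + m) / 2 - 1)) - (1 + m) * (dR n m U vr R1 t + XX n m U t ^ 2 / NN n U t) * NN n U t ^ (-(1 + m) / 2))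
      = ∫ t in t1..t2, -((1 + m) * (NN n U t ^ (-(1 + m) / 2) * dR n m U vr R1 t)) := by
    refine intervalIntegral.integral_congr (fun t ht => ?_)
    rw [uIcc_of_le h1] at ht
    rw [Real.rpow_sub_one (np t ht).ne']
    have := np t ht
    field_simp
    ring
  rw [e, intervalIntegral.integral_neg, intervalIntegral.integral_const_mul] at key
  unfold RR
  linarith

theorem FD.good (h : FD n m T U ut vr) (hn : 1 ≤ n) (hm : 0 < m) (hε : ε ∈ Ioo 0 T) (hk : DK n m U ε a C) {t1 t2 : ℝ} (h0 : ε < t1) (h1 : t1 < t2) (h2 : t2 < T) :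
    ∃ t ∈ Icc t1 t2, ∀ R, 0 ≤ R → (t2 - t1) * (NN n U t ^ (-(1 + m) / 2) * dR n m U vr R t) ≤ RR n m U t1 - RR n m U t2 := by
  have h00 : 0 < t1 := hε.1.trans h0
  have hs : ∀ t ∈ Icc t1 t2, t ∈ Ioo 0 T := fun t ht => ⟨h00.trans_le ht.1, ht.2.trans_lt h2⟩
  have he : ∀ t ∈ Icc t1 t2, ε ≤ t := fun t ht => h0.le.trans ht.1
  have cN : ContinuousOn (NN n U) (Icc t1 t2) := (h.Ncs hk measurableSet_Ioi le_rfl).mono he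
  have np := fun t (ht : t ∈ Icc t1 t2) => h.Npos hk (he t ht) (hs t ht)
  have cg : ∀ k : ℕ, ContinuousOn (fun t => (t2 - t1) * (NN n U t ^ (-(1 + m) / 2) * dR n m U vr k t)) (Icc t1 t2) := fun k =>
    continuousOn_const.mul ((cN.rpow_const (fun t ht => Or.inl (np t ht).ne')).mul (h.dRc hm hk h00 h0.le h2 (Nat.cast_nonneg k)))
  set κ := RR n m U t1 - RR n m U t2 with hκ
  set S : ℕ → Set ℝ := fun k => Icc t1 t2 ∩ (fun t => (t2 - t1) * (NN n U t ^ (-(1 + m) / 2) * dR n m U vr k t)) ⁻¹' (Iic κ) with hS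
  have hcl : ∀ k, IsClosed (S k) := fun k => (cg k).preimage_isClosed_of_isClosed isClosed_Icc isClosed_Iic
  obtain ⟨t, ht⟩ := IsCompact.nonempty_iInter_of_sequence_nonempty_isCompact_isClosed S (fun k t ht => by
      refine ⟨ht.1, mem_preimage.2 (mem_Iic.2 (le_trans ?_ (mem_Iic.1 (mem_preimage.1 ht.2))))⟩
      have := h.dRmono hk (he t ht.1) (hs t ht.1) (Nat.cast_nonneg k) (show (k:ℝ) ≤ ((k+1 : ℕ):ℝ) by push_cast; linarith)
      have h3 := Real.rpow_pos_of_pos (np t ht.1) (-(1 + m) / 2)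
      exact mul_le_mul_of_nonneg_left (mul_le_mul_of_nonneg_left this h3.le) (by linarith)) (fun k => by
      by_contra hne
      rw [not_nonempty_iff_eq_empty] at hne
      have hgt : ∀ t ∈ Icc t1 t2, κ < (t2 - t1) * (NN n U t ^ (-(1 + m) / 2) * dR n m U vr k t) := fun t ht => by
        by_contra hle
        have : t ∈ S k := ⟨ht, not_lt.1 hle⟩
        rw [hne] at this; exact this
      have hR := h.Rmono hn hm hε hk h0 h1.le h2 (Nat.cast_nonneg k)
      have lt := intervalIntegral.integral_lt_integral_of_continuousOn_of_le_of_exists_lt h1 (continuousOn_const (c := κ)) (cg k) (fun t ht => (hgt t ⟨ht.1.le, ht.2⟩).le) ⟨t1, ⟨le_rfl, h1.le⟩, hgt t1 ⟨le_rfl, h1.le⟩⟩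
      rw [intervalIntegral.integral_const, intervalIntegral.integral_const_mul, smul_eq_mul] at lt
      have lt2 := lt_of_mul_lt_mul_left lt (by linarith : 0 ≤ t2 - t1)
      have nn : 0 ≤ ∫ t in t1..t2, NN n U t ^ (-(1 + m) / 2) * dR n m U vr k t := intervalIntegral.integral_nonneg h1.le (fun t ht =>
        mul_nonneg (Real.rpow_pos_of_pos (np t ht) _).le (intervalIntegral.integral_nonneg (Nat.cast_nonneg k) (fun r hr => mul_nonneg (sq_nonneg _) (wnn hr.1 n))))
      have := mul_nonneg hm.le nn
      linarith) (isCompact_Icc.of_isClosed_subset (hcl 0) inter_subset_left) hcl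
  rw [mem_iInter] at ht
  refine ⟨t, (ht 0).1, fun R hR => ?_⟩
  obtain ⟨k, hkR⟩ := exists_nat_ge R
  refine le_trans ?_ (ht k).2
  have h3 := Real.rpow_pos_of_pos (np t (ht 0).1) (-(1 + m) / 2)
  exact mul_le_mul_of_nonneg_left (mul_le_mul_of_nonneg_left (h.dRmono hk (he t (ht 0).1) (hs t (ht 0).1) hR hkR) h3.le) (by linarith)
end

structure CS (n : ℕ) (p a κ : ℝ) : Prop where
  a0 : 0 < a
  a1 : (n:ℝ) - 1 ≤ a
  a2 : a ≤ n
  k1 : a * (1 + κ / 2) < n + 1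
  k2 : p - 1 < κ
  k3 : κ < p
  k4 : κ < 2 * (p - 1)

theorem cst {n : ℕ} {p : ℝ} (hn : 1 ≤ n) (hp : 1 < p) (hsub : p * (n - 1) < n + 3) : ∃ a κ, CS n p a κ := by
  have hn' : (1:ℝ) ≤ n := by exact_mod_cast hn
  set gap := (n:ℝ) + 1 - (n - 1) * (p + 1) / 2 with hgap
  have g0 : 0 < gap := by rw [hgap]; linarith
  set η := min (1/2) (min ((p-1)/2) (gap / (n + p + 1))) with hη
  have e0 : 0 < η := by
    refine lt_min (by norm_num) (lt_min (by linarith) (by positivity))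
  have e1 : η ≤ 1/2 := min_le_left _ _
  have e2 : η ≤ (p-1)/2 := (min_le_right _ _).trans (min_le_left _ _)
  have e3 : η * (n + p + 1) ≤ gap := by
    rw [← le_div_iff₀ (by positivity)]; exact (min_le_right _ _).trans (min_le_right _ _)
  refine ⟨n - 1 + η, p - 1 + η, by linarith, by linarith, by linarith, ?_, by linarith, by linarith, by linarith⟩
  have e4 : η * (n + p + η) ≤ η * (n + p + 1) := mul_le_mul_of_nonneg_left (by linarith) e0.le
  have : ((n:ℝ) - 1 + η) * (1 + (p - 1 + η)/2) = (n - 1) * (p + 1) / 2 + η * (n + p + η) / 2 := by ring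
  rw [this]; linarith

noncomputable def gg (m T t : ℝ) : ℝ := (1 - t / T) ^ (1 / (1 - m))

theorem gx {T t : ℝ} (hT : 0 < T) (ht : t < T) : 0 < 1 - t / T := by
  have : t / T < 1 := (div_lt_one hT).2 ht
  linarith
theorem gpos {m T t : ℝ} (hT : 0 < T) (ht : t < T) : 0 < gg m T t := Real.rpow_pos_of_pos (gx hT ht) _
theorem gpow {m T t : ℝ} (hm1 : m < 1) (hT : 0 < T) (ht : t < T) : gg m T t ^ (1 - m) = 1 - t / T := by
  unfold gg
  rw [← Real.rpow_mul (gx hT ht).le, one_div, inv_mul_cancel₀ (by linarith), Real.rpow_one]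
theorem gmul {m T t : ℝ} (hm1 : m < 1) (hT : 0 < T) (ht : t < T) : gg m T t ^ m * (1 - t / T) = gg m T t := by
  rw [← gpow hm1 hT ht, ← Real.rpow_add (gpos hT ht)]; simp

section
variable {n : ℕ} {m T : ℝ} {U ut vr : ℝ → ℝ → ℝ} {ε a C : ℝ}

theorem FD.PNR (h : FD n m T U ut vr) (hk : DK n m U ε a C) {t R : ℝ} (ht : ε ≤ t) (hR : 0 ≤ R) :
    ∫ r in (0:ℝ)..R, FF n U r t ^ 2 / Real.sinh r ^ n = ∫ r in (0:ℝ)..R, (∫ ρ in r..R, FF n U ρ t / Real.sinh ρ ^ n) * (U r t * Real.sinh r ^ n) := by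
  have i1 : IntervalIntegrable (fun r => FF n U r t / Real.sinh r ^ n) volume 0 R := by
    rw [intervalIntegrable_iff_integrableOn_Ioc_of_le hR]
    exact (h.Fwi hk ht le_rfl).mono_set Ioc_subset_Ioi_self
  have cP : ContinuousOn (fun r => ∫ ρ in r..R, FF n U ρ t / Real.sinh ρ ^ n) (Icc 0 R) := by
    have : ContinuousOn (fun r => ∫ ρ in R..r, FF n U ρ t / Real.sinh ρ ^ n) (Icc 0 R) := by
      have := intervalIntegral.continuousOn_primitive_interval' i1 (right_mem_uIcc)
      rwa [uIcc_of_le hR] at this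
    refine this.neg.congr (fun r _ => ?_)
    simp only [Pi.neg_apply]
    rw [intervalIntegral.integral_symm]
  have cUw := h.uwc t
  have i2 : IntervalIntegrable (fun r => (∫ ρ in r..R, FF n U ρ t / Real.sinh ρ ^ n) * (U r t * Real.sinh r ^ n)) volume 0 R := by
    refine ContinuousOn.intervalIntegrable ?_
    rw [uIcc_of_le hR]; exact cP.mul cUw.continuousOn
  have i3 := h.Nii hk ht hR
  have key := intervalIntegral.integral_eq_sub_of_hasDerivAt_of_le hR (f := fun r => FF n U r t * ∫ ρ in r..R, FF n U ρ t / Real.sinh ρ ^ n)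
    (f' := fun r => (∫ ρ in r..R, FF n U ρ t / Real.sinh ρ ^ n) * (U r t * Real.sinh r ^ n) - FF n U r t ^ 2 / Real.sinh r ^ n)
    ((h.Fsl t).continuousOn.mul cP) (fun r hr => by
      have c1 : ContinuousOn (fun r => FF n U r t / Real.sinh r ^ n) (Ioi 0) := (h.Fsl t).continuousOn.div (by fun_prop) (fun x hx => (wpos hx n).ne')
      have d := intervalIntegral.integral_hasDerivAt_left (a := r) (b := R) (i1.mono_set (by rw [uIcc_of_le hR, uIcc_of_le hr.2.le]; exact Icc_subset_Icc_left hr.1.le))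
        (c1.stronglyMeasurableAtFilter isOpen_Ioi r hr.1) (c1.continuousAt (Ioi_mem_nhds hr.1))
      refine ((h.Fder r t).mul d).congr_deriv ?_
      ring) (i2.sub i3)
  rw [intervalIntegral.integral_sub i2 i3] at key
  have F0 : FF n U 0 t = 0 := by simp [FF]
  rw [F0] at key
  simp only [intervalIntegral.integral_same] at key
  linarith

theorem FD.Ple (h : FD n m T U ut vr) (hk : DK n m U ε a C) {b κ p : ℝ} (hc : CS n p b κ) {t r R : ℝ} (ht : ε ≤ t) (hr : 0 < r) (hR : r ≤ R) :
    (∫ ρ in r..R, FF n U ρ t / Real.sinh ρ ^ n) ^ 2 ≤ Gm n b r * NN n U t := by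
  have N0 : 0 ≤ NN n U t := setIntegral_nonneg measurableSet_Ioi (fun x hx => div_nonneg (sq_nonneg _) (wpos hx n).le)
  rcases hR.eq_or_lt with rfl | hR
  · simp; exact mul_nonneg (Gm_pos hc.a0 hr).le N0
  refine wcs hc.a0 hc.a1 hc.a2 hr hR ((h.Fsl t).continuousOn.div (by fun_prop) (fun x hx => (wpos (hr.trans_le hx.1) n).ne')) ?_
  rw [intervalIntegral.integral_of_le hR.le]
  have e : ∀ x ∈ Ioc r R, (FF n U x t / Real.sinh x ^ n) ^ 2 * Real.sinh x ^ n = FF n U x t ^ 2 / Real.sinh x ^ n := fun x hx => by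
    have := wpos (hr.trans hx.1) n
    field_simp
  rw [setIntegral_congr_fun measurableSet_Ioc e]
  refine setIntegral_mono_set (h.Ni hk ht) ?_ (Eventually.of_forall (fun x hx => hr.trans hx.1))
  filter_upwards [ae_restrict_mem measurableSet_Ioi] with x hx
  exact div_nonneg (sq_nonneg _) (wpos hx n).le

theorem FD.Pll (h : FD n m T U ut vr) (hk : DK n m U ε a C) {t r : ℝ} (ht : ε ≤ t) (hr : 0 ≤ r) :
    Tendsto (fun R => ∫ ρ in r..R, FF n U ρ t / Real.sinh ρ ^ n) atTop (𝓝 (PP n U r t)) :=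
  intervalIntegral_tendsto_integral_Ioi r (h.Fwi hk ht hr) tendsto_id

theorem FD.PGN (h : FD n m T U ut vr) (hk : DK n m U ε a C) {b κ p : ℝ} (hc : CS n p b κ) {t r : ℝ} (ht : ε ≤ t) (hr : 0 < r) :
    PP n U r t ^ 2 ≤ Gm n b r * NN n U t :=
  le_of_tendsto ((h.Pll hk ht hr.le).pow 2) (by filter_upwards [eventually_ge_atTop r] with R hR using h.Ple hk hc ht hr hR)

theorem young' {m x y k : ℝ} (hm : 0 < m) (hx : 0 ≤ x) (hy : 0 ≤ y) (hk : 0 < k) :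
    x * y ≤ k ^ (1 + m) * x ^ (1 + m) + k ^ (-(1 / m + 1)) * y ^ (1 / m + 1) := by
  have hc : (1 + m).HolderConjugate (1 / m + 1) := by
    rw [Real.holderConjugate_iff]; refine ⟨by linarith, ?_⟩
    field_simp
  have := Real.young_inequality_of_nonneg (mul_nonneg hk.le hx) (div_nonneg hy hk.le) hc
  have e : k * x * (y / k) = x * y := by field_simp
  rw [e, Real.mul_rpow hk.le hx, Real.div_rpow hy hk.le] at this
  have a1 : 0 ≤ k ^ (1 + m) * x ^ (1 + m) := by positivity
  have a2 : 0 ≤ y ^ (1 / m + 1) / k ^ (1 / m + 1) := by positivity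
  have b1 := div_le_self a1 (by linarith : 1 ≤ 1 + m)
  have b2 := div_le_self a2 (by have : 0 < 1 / m := by positivity
                                linarith : 1 ≤ 1 / m + 1)
  rw [Real.rpow_neg hk.le, inv_mul_eq_div]
  linarith

theorem FD.Rlow (h : FD n m T U ut vr) (hn : 1 ≤ n) (hm : 0 < m) (hm1 : m < 1) (hk : DK n m U ε a C) {b κ : ℝ} (hc : CS n (1/m) b κ) :
    ∃ c > 0, ∀ t, ε ≤ t → t ∈ Ioo 0 T → c ≤ RR n m U t := by
  have hp : 1 < 1/m := by rw [lt_div_iff₀ hm]; linarith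
  have hK := Gm_int hc.a0 hn hc.a2 (θ := (1/m+1)/2) (σ := 0) (by positivity) le_rfl (by
    have := hc.k1; have := mul_lt_mul_of_pos_left hc.k2 hc.a0; linarith) (by linarith)
  simp only [Real.rpow_zero, mul_one] at hK
  set K0 := ∫ x in Ioi 0, Gm n b x ^ ((1/m+1)/2) * Real.sinh x ^ n with hK0
  have K00 : 0 ≤ K0 := setIntegral_nonneg measurableSet_Ioi (fun x hx => by have := wpos hx n; have := Gm_pos (n := n) hc.a0 hx; positivity)
  refine ⟨(1 + K0) ^ (-(1 + m)), by positivity, fun t ht htT => ?_⟩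
  have N0 := h.Npos hk ht htT
  have X0 := h.Xpos hm hk ht htT
  have hN := h.Ni hk ht
  have hX := h.Xi hm hk ht
  set N := NN n U t with hNd
  set X := XX n m U t with hXd
  have step : ∀ k > 0, ∀ R, 0 ≤ R → ∫ r in (0:ℝ)..R, FF n U r t ^ 2 / Real.sinh r ^ n ≤ N ^ (1/2:ℝ) * (k ^ (1 + m) * X + k ^ (-(1 / m + 1)) * K0) := fun k hk0 R hR => by
    have iB : IntegrableOn (fun x => N ^ (1/2:ℝ) * (k ^ (1 + m) * (U x t ^ m * U x t * Real.sinh x ^ n) + k ^ (-(1 / m + 1)) * (Gm n b x ^ ((1/m+1)/2) * Real.sinh x ^ n))) (Ioi 0) :=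
      ((hX.const_mul _).add (hK.const_mul _)).const_mul _
    have eB : ∫ x in Ioi 0, N ^ (1/2:ℝ) * (k ^ (1 + m) * (U x t ^ m * U x t * Real.sinh x ^ n) + k ^ (-(1 / m + 1)) * (Gm n b x ^ ((1/m+1)/2) * Real.sinh x ^ n)) = N ^ (1/2:ℝ) * (k ^ (1 + m) * X + k ^ (-(1 / m + 1)) * K0) := by
      rw [integral_const_mul, integral_add (hX.const_mul _) (hK.const_mul _), integral_const_mul, integral_const_mul]; rfl
    have nB : ∀ x, 0 < x → 0 ≤ N ^ (1/2:ℝ) * (k ^ (1 + m) * (U x t ^ m * U x t * Real.sinh x ^ n) + k ^ (-(1 / m + 1)) * (Gm n b x ^ ((1/m+1)/2) * Real.sinh x ^ n)) := fun x hx => by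
      have := wpos hx n; have := Gm_pos (n := n) hc.a0 hx; have := h.nonneg x t; positivity
    rw [h.PNR hk ht hR, intervalIntegral.integral_of_le hR, ← eB]
    refine le_trans (integral_mono_of_nonneg ?_ (iB.mono_set Ioc_subset_Ioi_self) ?_) (setIntegral_mono_set iB ?_ (Eventually.of_forall (fun x hx => hx.1)))
    · filter_upwards [ae_restrict_mem measurableSet_Ioc] with x hx
      exact mul_nonneg (intervalIntegral.integral_nonneg hx.2 (fun y hy => div_nonneg (h.Fnn (hx.1.le.trans hy.1) t) (wnn (hx.1.le.trans hy.1) n))) (mul_nonneg (h.nonneg x t) (wnn hx.1.le n))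
    · filter_upwards [ae_restrict_mem measurableSet_Ioc] with x hx
      have w0 := wpos hx.1 n
      have G0 := Gm_pos (n := n) hc.a0 hx.1
      have u0 := h.nonneg x t
      have b1 : (∫ ρ in x..R, FF n U ρ t / Real.sinh ρ ^ n) ≤ Gm n b x ^ (1/2:ℝ) * N ^ (1/2:ℝ) := by
        rw [← Real.mul_rpow G0.le N0.le, ← Real.sqrt_eq_rpow]
        exact Real.le_sqrt_of_sq_le (h.Ple hk hc ht hx.1 hx.2)
      have b2 := young' hm u0 (Real.rpow_nonneg G0.le (1/2:ℝ)) hk0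
      rw [← Real.rpow_mul G0.le, add_comm 1 m, Real.rpow_add_one' u0 (by linarith), add_comm m 1, show (1/2:ℝ) * (1/m+1) = (1/m+1)/2 by ring] at b2
      have b3 := mul_le_mul_of_nonneg_right b1 (mul_nonneg u0 w0.le)
      have b4 := mul_le_mul_of_nonneg_right b2 (mul_nonneg w0.le (Real.rpow_nonneg N0.le (1/2:ℝ)))
      refine b3.trans (le_of_eq_of_le ?_ (b4.trans_eq ?_)) <;> ring
    · filter_upwards [ae_restrict_mem measurableSet_Ioi] with x hx using nB x hx
  have step2 : ∀ k > 0, N ^ (1/2:ℝ) ≤ k ^ (1 + m) * X + k ^ (-(1 / m + 1)) * K0 := fun k hk0 => by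
    have t1 : Tendsto (fun R => ∫ r in (0:ℝ)..R, FF n U r t ^ 2 / Real.sinh r ^ n) atTop (𝓝 N) := intervalIntegral_tendsto_integral_Ioi 0 hN tendsto_id
    have := le_of_tendsto t1 (by filter_upwards [eventually_ge_atTop 0] with R hR using step k hk0 R hR)
    have e : N = N ^ (1/2:ℝ) * N ^ (1/2:ℝ) := by rw [← Real.rpow_add N0]; norm_num
    nth_rewrite 1 [e] at this
    exact le_of_mul_le_mul_left this (by positivity)
  have s3 := step2 (X ^ (-(m / (1 + m) ^ 2))) (by positivity)
  rw [← Real.rpow_mul X0.le, ← Real.rpow_mul X0.le, ← Real.rpow_add_one X0.ne', show -(m / (1 + m) ^ 2) * (1 + m) + 1 = 1 / (1 + m) by field_simp; ring,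
    show -(m / (1 + m) ^ 2) * (-(1 / m + 1)) = 1 / (1 + m) by field_simp] at s3
  have s4 : N ^ (1/2:ℝ) ≤ (1 + K0) * X ^ (1 / (1 + m)) := by linarith
  have s5 := Real.rpow_le_rpow (by positivity) s4 (by linarith : 0 ≤ 1 + m)
  rw [← Real.rpow_mul N0.le, Real.mul_rpow (by positivity) (by positivity), ← Real.rpow_mul X0.le, one_div_mul_cancel (by linarith), Real.rpow_one] at s5
  unfold RR
  rw [← hNd, ← hXd, show -(1 + m) / 2 = -(1/2 * (1 + m)) by ring, Real.rpow_neg (by positivity), Real.rpow_neg N0.le, inv_eq_one_div, ← div_eq_mul_inv, div_le_div_iff₀ (by positivity) (by positivity)]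
  linarith

/-- two-sided control of `N` -/
theorem FD.yb (h : FD n m T U ut vr) (hn : 1 ≤ n) (hm : 0 < m) (hm1 : m < 1) (hε : ε ∈ Ioo 0 T) (hk : DK n m U ε a C) {b κ : ℝ} (hc : CS n (1/m) b κ) :
    ∃ ρ > 0, Tendsto (RR n m U) (𝓝[<] T) (𝓝 ρ) ∧ ∀ t ∈ Ioo ε T, ρ ≤ RR n m U t ∧ (1 - m) * ρ * (T - t) ≤ NN n U t ^ ((1 - m) / 2) ∧
      NN n U t ^ ((1 - m) / 2) ≤ (1 - m) * RR n m U t * (T - t) := by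
  obtain ⟨c, c0, hcR⟩ := h.Rlow hn hm hm1 hk hc
  have hs : ∀ t ∈ Ioo ε T, t ∈ Ioo 0 T := fun t ht => ⟨hε.1.trans ht.1, ht.2⟩
  have anti : ∀ s ∈ Ioo ε T, ∀ t ∈ Ioo ε T, s ≤ t → RR n m U t ≤ RR n m U s := fun s hs' t ht hst => by
    have := h.Rmono hn hm hε hk hs'.1 hst ht.2 le_rfl
    simpa [dR] using this
  set ρ := sInf (RR n m U '' Ioo ε T) with hρ
  have bb : BddBelow (RR n m U '' Ioo ε T) := ⟨c, by rintro _ ⟨t, ht, rfl⟩; exact hcR t ht.1.le (hs t ht)⟩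
  have hρR : ∀ t ∈ Ioo ε T, ρ ≤ RR n m U t := fun t ht => csInf_le bb ⟨t, ht, rfl⟩
  have hcρ : c ≤ ρ := le_csInf ((nonempty_Ioo.2 hε.2).image _) (by rintro _ ⟨t, ht, rfl⟩; exact hcR t ht.1.le (hs t ht))
  have cN : ContinuousOn (NN n U) (Ici ε) := h.Ncs hk measurableSet_Ioi le_rfl
  have m0 : 0 < 1 - m := by linarith
  have cy : ContinuousOn (fun t => NN n U t ^ ((1 - m) / 2)) (Ici ε) := cN.rpow_const (fun t ht => Or.inr (by linarith))
  have NT : NN n U T = 0 := by simp [NN, FF, h.ext _ T le_rfl]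
  have dy : ∀ t ∈ Ioo ε T, HasDerivAt (fun t => NN n U t ^ ((1 - m) / 2)) (-((1 - m) * RR n m U t)) t := fun t ht => by
    have N0 := h.Npos hk ht.1.le (hs t ht)
    refine ((h.Nd hn hm hε.1 hk ht).rpow_const (Or.inl N0.ne')).congr_deriv ?_
    unfold RR
    rw [show (1 - m) / 2 - 1 = -(1 + m) / 2 by ring]; ring
  refine ⟨ρ, c0.trans_le hcρ, ?_, fun t ht => ⟨hρR t ht, ?_, ?_⟩⟩
  · rw [tendsto_order]
    refine ⟨fun l hl => ?_, fun u hu => ?_⟩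
    · filter_upwards [Ioo_mem_nhdsLT hε.2] with t ht using hl.trans_le (hρR t ht)
    · obtain ⟨_, ⟨s, hs', rfl⟩, hsu⟩ := exists_lt_of_csInf_lt ((nonempty_Ioo.2 hε.2).image _) hu
      filter_upwards [Ioo_mem_nhdsLT hs'.2] with t ht using (anti s hs' t ⟨hs'.1.trans ht.1, ht.2⟩ ht.1.le).trans_lt hsu
  · have A : AntitoneOn (fun s => NN n U s ^ ((1 - m) / 2) - (1 - m) * ρ * (T - s)) (Icc t T) := by
      refine antitoneOn_of_hasDerivWithinAt_nonpos (f' := fun s => -((1 - m) * RR n m U s) - (1 - m) * ρ * (-1)) (convex_Icc t T)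
        ((cy.mono (fun s hs => ht.1.le.trans hs.1)).sub (by fun_prop)) (fun s hs' => ?_) (fun s hs' => ?_)
      · rw [interior_Icc] at hs'
        exact ((dy s ⟨ht.1.trans hs'.1, hs'.2⟩).sub (((hasDerivAt_id s).const_sub T).const_mul ((1-m)*ρ))).hasDerivWithinAt
      · rw [interior_Icc] at hs'
        have := mul_le_mul_of_nonneg_left (hρR s ⟨ht.1.trans hs'.1, hs'.2⟩) m0.le
        linarith
    have := A ⟨le_rfl, ht.2.le⟩ ⟨ht.2.le, le_rfl⟩ ht.2.le
    simp only [NT] at this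
    rw [Real.zero_rpow (by linarith)] at this
    linarith
  · have A : MonotoneOn (fun s => NN n U s ^ ((1 - m) / 2) - (1 - m) * RR n m U t * (T - s)) (Icc t T) := by
      refine monotoneOn_of_hasDerivWithinAt_nonneg (f' := fun s => -((1 - m) * RR n m U s) - (1 - m) * RR n m U t * (-1)) (convex_Icc t T)
        ((cy.mono (fun s hs => ht.1.le.trans hs.1)).sub (by fun_prop)) (fun s hs' => ?_) (fun s hs' => ?_)
      · rw [interior_Icc] at hs'
        exact ((dy s ⟨ht.1.trans hs'.1, hs'.2⟩).sub (((hasDerivAt_id s).const_sub T).const_mul ((1-m)*RR n m U t))).hasDerivWithinAt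
      · rw [interior_Icc] at hs'
        have := mul_le_mul_of_nonneg_left (anti t ht s ⟨ht.1.trans hs'.1, hs'.2⟩ hs'.1.le) m0.le
        linarith
    have := A ⟨le_rfl, ht.2.le⟩ ⟨ht.2.le, le_rfl⟩ ht.2.le
    simp only [NT] at this
    rw [Real.zero_rpow (by linarith)] at this
    linarith

/-- outputs of the energy argument -/
theorem FD.out (h : FD n m T U ut vr) (hn : 1 ≤ n) (hm : 0 < m) (hm1 : m < 1) (hε : ε ∈ Ioo 0 T) (hk : DK n m U ε a C) {b κ : ℝ} (hc : CS n (1/m) b κ) :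
    (∀ t0 ∈ Ioo ε T, ∃ A > 0, ∀ t ∈ Ico t0 T, NN n U t ≤ A * gg m T t ^ 2) ∧ (∃ c > 0, ∀ t ∈ Ioo ε T, c * gg m T t ^ (1 + m) ≤ XX n m U t) ∧
    (∀ hh ∈ Ioo (0:ℝ) 1, ∀ δ > 0, ∃ t0 ∈ Ioo ε T, ∀ t ∈ Ioo t0 T, ∃ t' ∈ Icc t (t + hh * (T - t)), ∃ μ, |μ - 1 / ((1 - m) * T)| ≤ δ ∧
      ∀ r, 0 < r → (U r t' ^ m / gg m T t' ^ m - μ * (PP n U r t' / gg m T t')) ^ 2 ≤ Gm n b r * δ) := by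
  obtain ⟨ρ, ρ0, hlim, hy⟩ := h.yb hn hm hm1 hε hk hc
  have hs : ∀ t ∈ Ioo ε T, t ∈ Ioo 0 T := fun t ht => ⟨hε.1.trans ht.1, ht.2⟩
  have T0 : 0 < T := hε.1.trans hε.2
  have m0 : 0 < 1 - m := by linarith
  have anti : ∀ s ∈ Ioo ε T, ∀ t ∈ Ioo ε T, s ≤ t → RR n m U t ≤ RR n m U s := fun s hs' t ht hst => by
    have := h.Rmono hn hm hε hk hs'.1 hst ht.2 le_rfl
    simpa [dR] using this
  -- sqrt N ≤ A gg
  have up : ∀ t0 ∈ Ioo ε T, ∃ A > 0, ∀ t ∈ Ico t0 T, NN n U t ^ (1/2:ℝ) ≤ A * gg m T t := fun t0 ht0 => by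
    have r0 : 0 < RR n m U t0 := ρ0.trans_le (hy t0 ht0).1
    refine ⟨((1 - m) * RR n m U t0 * T) ^ (1 / (1 - m)), by positivity, fun t ht => ?_⟩
    have ht' : t ∈ Ioo ε T := ⟨ht0.1.trans_le ht.1, ht.2⟩
    have N0 := h.Npos hk ht'.1.le (hs t ht')
    have x0 := gx T0 ht.2
    unfold gg
    rw [← Real.mul_rpow (by positivity) x0.le]
    have e : (1 - m) * RR n m U t0 * T * (1 - t / T) = (1 - m) * RR n m U t0 * (T - t) := by field_simp
    rw [e]
    have := Real.rpow_le_rpow (by positivity) ((hy t ht').2.2.trans (mul_le_mul_of_nonneg_right (mul_le_mul_of_nonneg_left (anti t0 ht0 t ht' ht.1) m0.le) (by linarith [ht.2]))) (by positivity : 0 ≤ 1 / (1 - m))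
    rwa [← Real.rpow_mul N0.le, show (1 - m) / 2 * (1 / (1 - m)) = 1 / 2 by field_simp] at this
  have X_eq : ∀ t ∈ Ioo ε T, XX n m U t = RR n m U t * NN n U t ^ ((1 + m) / 2) := fun t ht => by
    have N0 := h.Npos hk ht.1.le (hs t ht)
    unfold RR
    rw [mul_assoc, ← Real.rpow_add N0]; ring_nf; simp
  refine ⟨fun t0 ht0 => ?_, ⟨ρ * ((1 - m) * ρ * T) ^ ((1 + m) / (1 - m)), by positivity, fun t ht => ?_⟩, fun hh hhh δ hδ => ?_⟩
  · obtain ⟨A, A0, hA⟩ := up t0 ht0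
    refine ⟨A ^ 2, by positivity, fun t ht => ?_⟩
    have N0 := h.Npos hk (ht0.1.le.trans ht.1) (hs t ⟨ht0.1.trans_le ht.1, ht.2⟩)
    have := pow_le_pow_left₀ (by positivity) (hA t ht) 2
    rwa [← Real.rpow_natCast, ← Real.rpow_mul N0.le, show (1/2:ℝ) * ((2:ℕ):ℝ) = 1 by norm_num, Real.rpow_one, mul_pow] at this
  · have N0 := h.Npos hk ht.1.le (hs t ht)
    have x0 := gx T0 ht.2
    rw [X_eq t ht, mul_assoc]
    refine mul_le_mul (hy t ht).1 ?_ (by have := gpos (m := m) T0 ht.2; positivity) (ρ0.le.trans (hy t ht).1)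
    unfold gg
    rw [← Real.rpow_mul x0.le, show 1 / (1 - m) * (1 + m) = (1 + m) / (1 - m) by ring, ← Real.mul_rpow (by positivity) x0.le]
    have e : (1 - m) * ρ * T * (1 - t / T) = (1 - m) * ρ * (T - t) := by field_simp
    rw [e]
    have tt : 0 < T - t := by linarith [ht.2]
    have := Real.rpow_le_rpow (by positivity) (hy t ht).2.1 (by positivity : 0 ≤ (1 + m) / (1 - m))
    rwa [← Real.rpow_mul N0.le, show (1 - m) / 2 * ((1 + m) / (1 - m)) = (1 + m) / 2 by field_simp] at this
  · obtain ⟨A, A0, hA⟩ := up ((ε + T) / 2) ⟨by linarith [hε.2], by linarith [hε.2]⟩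
    set e := min (δ * ((1 - m) * T) * ρ) (δ * (hh * T) / A ^ (1 + m)) with he
    have e0 : 0 < e := lt_min (by positivity) (by have := hhh.1; positivity)
    have ev : ∀ᶠ t in 𝓝[<] T, RR n m U t < ρ + e := hlim.eventually_lt_const (by linarith)
    obtain ⟨l, hl, hlT⟩ := (mem_nhdsLT_iff_exists_Ioo_subset).1 ev
    refine ⟨max l ((ε + T) / 2), ⟨lt_max_of_lt_right (by linarith [hε.2]), max_lt hl (by linarith [hε.2])⟩, fun t ht => ?_⟩
    have t_ε : ε < t := lt_of_le_of_lt (le_trans (by linarith [hε.2]) (le_max_right _ _)) ht.1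
    have t_l : l < t := lt_of_le_of_lt (le_max_left _ _) ht.1
    have t_h : (ε + T) / 2 < t := lt_of_le_of_lt (le_max_right _ _) ht.1
    have tT : 0 < T - t := by linarith [ht.2]
    have q1 : 0 < hh * (T - t) := mul_pos hhh.1 tT
    have q2 : hh * (T - t) < T - t := by have := mul_lt_mul_of_pos_right hhh.2 tT; linarith
    obtain ⟨s, hs1, hs2⟩ := h.good hn hm hε hk t_ε (by linarith : t < t + hh * (T - t)) (by linarith)
    have hsI : s ∈ Ioo ε T := ⟨t_ε.trans_le hs1.1, by linarith [hs1.2]⟩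
    have N0 := h.Npos hk hsI.1.le (hs s hsI)
    have X0 := h.Xpos hm hk hsI.1.le (hs s hsI)
    have g0 : 0 < gg m T s := gpos T0 hsI.2
    have x0 := gx T0 hsI.2
    have ts0 : 0 < T - s := by linarith [hsI.2]
    have Rs : RR n m U s < ρ + e := hlT ⟨t_l.trans_le hs1.1, hsI.2⟩
    have Rt : RR n m U t < ρ + e := hlT ⟨t_l, ht.2⟩
    have Rt2 := (hy (t + hh * (T - t)) ⟨by linarith, by linarith⟩).1
    set y := NN n U s ^ ((1 - m) / 2) with hyd
    have y0 : 0 < y := by positivity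
    set lam := XX n m U s / NN n U s with hlam
    have lam_eq : lam = RR n m U s / y := by
      rw [hlam, X_eq s hsI, hyd, div_eq_div_iff (by positivity) (by positivity), mul_assoc, ← Real.rpow_add N0]
      congr 1; rw [show (1 + m) / 2 + (1 - m) / 2 = 1 by ring, Real.rpow_one]
    refine ⟨s, hs1, lam * (1 - s / T), ?_, fun r hr => ?_⟩
    · have a1 : 1 / ((1 - m) * T) ≤ lam * (1 - s / T) := by
        rw [lam_eq, div_mul_eq_mul_div, div_le_div_iff₀ (by positivity) y0]
        have := (hy s hsI).2.2
        have e2 : RR n m U s * (1 - s / T) * ((1 - m) * T) = (1 - m) * RR n m U s * (T - s) := by field_simp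
        rw [e2]; linarith
      have a2 : lam * (1 - s / T) ≤ 1 / ((1 - m) * T) + δ := by
        have R0 : 0 < RR n m U s := ρ0.trans_le (hy s hsI).1
        have b1 : lam * (1 - s / T) ≤ RR n m U s / ((1 - m) * ρ * T) := by
          rw [lam_eq, div_mul_eq_mul_div, div_le_div_iff₀ y0 (by positivity)]
          have e2 : RR n m U s * (1 - s / T) * ((1 - m) * ρ * T) = RR n m U s * ((1 - m) * ρ * (T - s)) := by field_simp
          rw [e2]; exact mul_le_mul_of_nonneg_left (hy s hsI).2.1 R0.le
        have b2 : RR n m U s / ((1 - m) * ρ * T) ≤ (ρ + δ * ((1 - m) * T) * ρ) / ((1 - m) * ρ * T) := by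
          gcongr; exact Rs.le.trans (by linarith [min_le_left (δ * ((1 - m) * T) * ρ) (δ * (hh * T) / A ^ (1 + m))])
        have b3 : (ρ + δ * ((1 - m) * T) * ρ) / ((1 - m) * ρ * T) = 1 / ((1 - m) * T) + δ := by field_simp
        linarith
      rw [abs_le]; constructor <;> linarith
    · -- pointwise
      set g := gg m T s with hg
      set D := δ * g ^ (2 * m) with hD
      have dle : ∀ R, 0 ≤ R → dR n m U vr R s ≤ D := fun R hR => by
        have k1 := hs2 R hR
        rw [show t + hh * (T - t) - t = hh * (T - t) by ring] at k1
        have k2 : RR n m U t - RR n m U (t + hh * (T - t)) ≤ δ * (hh * T) / A ^ (1 + m) := by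
          have := min_le_right (δ * ((1 - m) * T) * ρ) (δ * (hh * T) / A ^ (1 + m)); linarith
        have k3 : NN n U s ^ ((1 + m) / 2) ≤ A ^ (1 + m) * g ^ (1 + m) := by
          have := Real.rpow_le_rpow (by positivity) (hA s ⟨t_h.le.trans hs1.1, hsI.2⟩) (by linarith : 0 ≤ 1 + m)
          rwa [← Real.rpow_mul N0.le, show (1/2:ℝ) * (1 + m) = (1 + m) / 2 by ring, Real.mul_rpow A0.le g0.le] at this
        have k4 : dR n m U vr R s = NN n U s ^ ((1 + m) / 2) * (NN n U s ^ (-(1 + m) / 2) * dR n m U vr R s) := by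
          rw [← mul_assoc, ← Real.rpow_add N0]; ring_nf; simp
        have d0 : 0 ≤ dR n m U vr R s := intervalIntegral.integral_nonneg hR (fun r hr => mul_nonneg (sq_nonneg _) (wnn hr.1 n))
        have k5 : NN n U s ^ (-(1 + m) / 2) * dR n m U vr R s ≤ δ * T / A ^ (1 + m) / (T - t) := by
          rw [le_div_iff₀ tT]
          have : hh * (NN n U s ^ (-(1 + m) / 2) * dR n m U vr R s * (T - t)) ≤ hh * (δ * T / A ^ (1 + m)) := by
            refine le_of_eq_of_le (by ring) ((k1.trans k2).trans_eq (by ring))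
          exact le_of_mul_le_mul_left this hhh.1
        have k6 : δ * T / A ^ (1 + m) / (T - t) ≤ δ * T / A ^ (1 + m) / (T - s) := by
          gcongr; exact hs1.1
        rw [k4]
        refine (mul_le_mul k3 (k5.trans k6) (by positivity) (by positivity)).trans_eq ?_
        have k7 : g ^ (1 + m) = g ^ (2 * m) * (1 - s / T) := by
          rw [← gpow hm1 T0 hsI.2, ← Real.rpow_add g0]; ring_nf
        rw [k7, hD]
        have : T - s = T * (1 - s / T) := by field_simp
        rw [this]; field_simp
      have lim := ((h.Pll hk hsI.1.le hr.le).const_mul lam)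
      have vlim : Tendsto (fun R => U R s ^ m) atTop (𝓝 0) := by
        have z : Tendsto (fun R : ℝ => C * Real.exp (-(n * R / 2))) atTop (𝓝 (C * 0)) := by
          refine (Real.tendsto_exp_neg_atTop_nhds_zero.comp ?_).const_mul C
          have : (0:ℝ) < n := by exact_mod_cast hn
          exact (tendsto_id.const_mul_atTop this).atTop_div_const two_pos
        rw [mul_zero] at z
        refine squeeze_zero' (Eventually.of_forall fun R => Real.rpow_nonneg (h.nonneg R s) m) ?_ z
        filter_upwards [eventually_ge_atTop 0] with R hR using hk.v s hsI.1.le R hR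
      have lim2 := ((vlim.sub_const (U r s ^ m)).add lim).pow 2
      have key : (0 - U r s ^ m + lam * PP n U r s) ^ 2 ≤ Gm n b r * D := by
        refine le_of_tendsto lim2 ?_
        filter_upwards [eventually_gt_atTop r] with R hR
        have c1 : Continuous (fun x => vr x s) := h.vrc.comp_continuous (by fun_prop : Continuous (fun x : ℝ => (x, s))) (fun x => ⟨mem_univ _, hs s hsI⟩)
        have cF : ContinuousOn (fun x => FF n U x s / Real.sinh x ^ n) (Icc r R) := (h.Fsl s).continuousOn.div (by fun_prop) (fun x hx => (wpos (hr.trans_le hx.1) n).ne')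
        have cF2 : ContinuousOn (fun x => lam * (FF n U x s / Real.sinh x ^ n)) (Icc r R) := continuousOn_const.mul cF
        have := wcs hc.a0 hc.a1 hc.a2 hr hR (f := fun x => vr x s + lam * (FF n U x s / Real.sinh x ^ n)) (K := D) (c1.continuousOn.add cF2) (by
          refine le_trans ?_ (dle R (hr.le.trans hR.le))
          unfold dR
          refine intervalIntegral.integral_mono_interval hr.le hR.le le_rfl ?_ (h.dRi hk hsI.1.le (hs s hsI) (hr.le.trans hR.le))
          filter_upwards [ae_restrict_mem measurableSet_Ioc] with x hx
          exact mul_nonneg (sq_nonneg _) (wnn hx.1.le n))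
        rw [intervalIntegral.integral_add (c1.intervalIntegrable _ _) (by rw [← uIcc_of_le hR.le] at cF2; exact cF2.intervalIntegrable), intervalIntegral.integral_const_mul,
          intervalIntegral.integral_eq_sub_of_hasDerivAt (fun x hx => h.hvr x (by rw [uIcc_of_le hR.le] at hx; exact hr.trans_le hx.1) s (hs s hsI)) (c1.intervalIntegrable _ _)] at this
        exact this
      have e1 : U r s ^ m / g ^ m - lam * (1 - s / T) * (PP n U r s / g) = -(0 - U r s ^ m + lam * PP n U r s) / g ^ m := by
        nth_rewrite 2 [hg]
        rw [← gmul hm1 T0 hsI.2, ← hg]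
        have : 0 < g ^ m := by positivity
        field_simp; ring
      have e2 : g ^ (2 * m) = (g ^ m) ^ 2 := by rw [← Real.rpow_natCast, ← Real.rpow_mul g0.le]; ring_nf
      rw [e1, div_pow, neg_sq, div_le_iff₀ (by positivity)]
      rw [hD, e2] at key
      linarith
end

section
variable {n : ℕ} {m T : ℝ} {U ut vr : ℝ → ℝ → ℝ} {ε a C : ℝ}

theorem FD.bcT (h : FD n m T U ut vr) (hn : 1 ≤ n) (hm : 0 < m) (hm1 : m < 1) (hT : 0 < T) {t1 t2 r : ℝ} (h1 : T / 2 ≤ t1) (h2 : t1 ≤ t2) (h3 : t2 < T) (hr : 0 ≤ r) :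
    U r t2 ^ m ≤ 3 ^ (m / (1 - m)) * U r t1 ^ m := by
  have b := h.bc hn hm hm1 (ε := T / 4) (by linarith) (by linarith) h2 h3 hr
  have b1 : (1/3:ℝ) ^ (1 / (1 - m)) ≤ ((t1 - T/4) / (t2 - T/4)) ^ (1 / (1 - m)) := by
    refine Real.rpow_le_rpow (by norm_num) ?_ (by have : 0 < 1 - m := by linarith
                                                  positivity)
    rw [div_le_div_iff₀ (by norm_num) (by linarith)]; linarith
  have b2 := (mul_le_mul_of_nonneg_right b1 (h.nonneg r t2)).trans b
  have b3 := Real.rpow_le_rpow (mul_nonneg (by positivity) (h.nonneg r t2)) b2 hm.le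
  rw [Real.mul_rpow (by positivity) (h.nonneg r t2), ← Real.rpow_mul (by norm_num), show 1 / (1 - m) * m = m / (1 - m) by ring, one_div, Real.inv_rpow (by norm_num), inv_mul_le_iff₀ (by positivity)] at b3
  exact b3

theorem FD.Pnn (h : FD n m T U ut vr) {r t : ℝ} (hr : 0 ≤ r) : 0 ≤ PP n U r t :=
  setIntegral_nonneg measurableSet_Ioi (fun x hx => div_nonneg (h.Fnn (hr.trans (le_of_lt hx)) t) (wnn (hr.trans (le_of_lt hx)) n))

theorem FD.kb (h : FD n m T U ut vr) (hn : 1 ≤ n) (hm : 0 < m) (hm1 : m < 1) (hT : 0 < T) (hk : DK n m U (T/4) a C) {t1 t2 r : ℝ} (h1 : T / 2 ≤ t1) (h2 : t1 ≤ t2) (h3 : t2 < T) (hr : 0 < r) :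
    (t2 - t1) * U r t2 ^ m ≤ 3 ^ (m / (1 - m)) * PP n U r t1 := by
  have K := h.Ptd hn hm (by linarith : 0 < T/4) hk hr (by linarith) h2 h3
  have cv := h.vtl hm r
  have : ∫ t in t1..t2, U r t2 ^ m ≤ ∫ t in t1..t2, 3 ^ (m / (1 - m)) * U r t ^ m := by
    refine intervalIntegral.integral_mono_on h2 (by simp) ((continuous_const.mul cv).intervalIntegrable _ _) (fun t ht => h.bcT hn hm hm1 hT (h1.trans ht.1) ht.2 h3 hr.le)
  rw [intervalIntegral.integral_const, intervalIntegral.integral_const_mul, ← K, smul_eq_mul] at this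
  refine this.trans (mul_le_mul_of_nonneg_left ?_ (by positivity))
  linarith [h.Pnn (t := t2) hr.le]

/-- kernel bound -/
theorem FD.pker (h : FD n m T U ut vr) (hn : 1 ≤ n) (hm : 0 < m) (hk : DK n m U ε a C) {b κ : ℝ} (hc : CS n (1/m) b κ) :
    ∃ C3 > 0, ∀ t, ε ≤ t → ∀ K δ : ℝ, 0 ≤ K → 0 ≤ δ → (∀ x, 0 < x → U x t ≤ K * (Gm n b x ^ (κ/2) * (Real.exp (-(n * x)) + δ * Real.exp (-(n * x)) ^ (1/2:ℝ)) ^ (1/m - κ))) →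
      ∀ r, 0 < r → PP n U r t ≤ C3 * K * (Real.exp (-(n * r)) + δ * Real.exp (-(n * r)) ^ (1/2:ℝ)) := by
  obtain ⟨Cm, Cm0, hCm⟩ := Gm_min (n := n) hc.a0 hc.a2
  set σ := 1/m - κ with hσ
  have s0 : 0 < σ := by have := hc.k3; linarith
  have s1 : σ < 1 := by have := hc.k2; linarith
  have hn0 : (0:ℝ) < n := by exact_mod_cast hn
  have κ0 : 0 < κ := by
    have := hc.k2; have := hc.k4; linarith
  have i1 := Gm_int hc.a0 hn hc.a2 (θ := κ/2) (σ := σ) (by positivity) s0.le (by have := hc.k1; linarith [hc.a0]) (by have := hc.k4; linarith)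
  have i2 := Gm_int hc.a0 hn hc.a2 (θ := 1 + κ/2) (σ := σ) (by positivity) s0.le (by have := hc.k1; linarith [hc.a0]) (by linarith)
  have i3 : IntegrableOn (fun x => (1 + Gm n b x) * (Gm n b x ^ (κ/2) * Real.exp (-(n * x)) ^ σ * Real.sinh x ^ n)) (Ioi 0) := by
    refine (i1.add i2).congr_fun (fun x hx => ?_) measurableSet_Ioi
    have := Gm_pos (n := n) hc.a0 hx
    simp only [Pi.add_apply]
    rw [Real.rpow_add this, Real.rpow_one]; ring
  set I0 := ∫ x in Ioi 0, (1 + Gm n b x) * (Gm n b x ^ (κ/2) * Real.exp (-(n * x)) ^ σ * Real.sinh x ^ n) with hI0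
  have I00 : 0 ≤ I0 := setIntegral_nonneg measurableSet_Ioi (fun x hx => by
    have := wpos hx n; have := Gm_pos (n := n) hc.a0 hx; positivity)
  refine ⟨2 * (Cm * I0) + 1, by positivity, fun t ht K δ hK hδ hU r hr => ?_⟩
  have E0 : ∀ x : ℝ, 0 < Real.exp (-(n * x)) := fun x => Real.exp_pos _
  set φ := Real.exp (-(n * r)) with hφ
  have φ0 : 0 < φ := Real.exp_pos _
  set Φ := φ + δ * φ ^ (1/2:ℝ) with hΦ
  have Φ0 : 0 < Φ := by positivity
  have fin : δ ^ σ * φ ^ (1 - σ/2) ≤ Φ := by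
    have e : δ ^ σ * φ ^ (1 - σ/2) = φ ^ (1 - σ) * (δ * φ ^ (1/2:ℝ)) ^ σ := by
      rw [Real.mul_rpow hδ (by positivity), ← Real.rpow_mul φ0.le, mul_left_comm, ← Real.rpow_add φ0]; ring_nf
    have e2 : Φ = Φ ^ (1 - σ) * Φ ^ σ := by rw [← Real.rpow_add Φ0]; ring_nf; simp
    rw [e, e2]
    have q : 0 ≤ δ * φ ^ (1/2:ℝ) := by positivity
    refine mul_le_mul (Real.rpow_le_rpow φ0.le (by linarith) (by linarith)) (Real.rpow_le_rpow q (by linarith) s0.le) (by positivity) (by positivity)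
  -- integrand bound
  have pb : ∀ x, 0 < x → min (Gm n b r) (Gm n b x) * (U x t * Real.sinh x ^ n) ≤ (2 * (Cm * K) * Φ) * ((1 + Gm n b x) * (Gm n b x ^ (κ/2) * Real.exp (-(n * x)) ^ σ * Real.sinh x ^ n)) := fun x hx => by
    have G0 := Gm_pos (n := n) hc.a0 hx
    have Gr := Gm_pos (n := n) hc.a0 hr
    have w0 := wpos hx n
    set X := Real.exp (-(n * x)) with hX
    have X0 : 0 < X := Real.exp_pos _
    have sub : (X + δ * X ^ (1/2:ℝ)) ^ σ ≤ X ^ σ + δ ^ σ * X ^ (σ/2) := by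
      refine (Real.rpow_add_le_add_rpow X0.le (by positivity) s0.le s1.le).trans_eq ?_
      rw [Real.mul_rpow hδ (by positivity), ← Real.rpow_mul X0.le]; ring_nf
    have m1 := hCm r x 1 hr hx zero_le_one le_rfl
    have m2 := hCm r x (1 - σ/2) hr hx (by linarith) (by linarith)
    simp only [sub_self, Real.rpow_zero, Real.rpow_one, one_mul] at m1
    rw [show 1 - (1 - σ/2) = σ/2 by ring] at m2
    set M := min (Gm n b r) (Gm n b x) with hM
    have M0 : 0 ≤ M := le_min Gr.le G0.le
    have u1 := (hU x hx).trans (mul_le_mul_of_nonneg_left (mul_le_mul_of_nonneg_left sub (by positivity)) hK)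
    calc M * (U x t * Real.sinh x ^ n) ≤ M * ((K * (Gm n b x ^ (κ/2) * (X ^ σ + δ ^ σ * X ^ (σ/2)))) * Real.sinh x ^ n) := by gcongr
      _ = K * Gm n b x ^ (κ/2) * Real.sinh x ^ n * (M * X ^ σ + M * (δ ^ σ * X ^ (σ/2))) := by ring
      _ ≤ K * Gm n b x ^ (κ/2) * Real.sinh x ^ n * ((Cm * φ * (1 + Gm n b x)) * X ^ σ + (Cm * φ ^ (1 - σ/2) * (X ^ (σ/2) * (1 + Gm n b x))) * (δ ^ σ * X ^ (σ/2))) := by gcongr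
      _ = Cm * K * (φ + δ ^ σ * φ ^ (1 - σ/2)) * ((1 + Gm n b x) * (Gm n b x ^ (κ/2) * X ^ σ * Real.sinh x ^ n)) := by
        rw [show X ^ σ = X ^ (σ/2) * X ^ (σ/2) by rw [← Real.rpow_add X0]; ring_nf]; ring
      _ ≤ Cm * K * (2 * Φ) * ((1 + Gm n b x) * (Gm n b x ^ (κ/2) * X ^ σ * Real.sinh x ^ n)) := by
        gcongr
        have : 0 ≤ δ * φ ^ (1/2:ℝ) := by positivity
        linarith
      _ = _ := by ring
  refine le_trans (le_of_tendsto (b := 2 * (Cm * K) * Φ * I0) (h.Pll hk ht hr.le) ?_) ?_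
  · filter_upwards [eventually_ge_atTop r] with R hR
    refine (Gm_kernel hc.a0 hc.a1 hc.a2 (h.slc t).continuousOn (fun x _ => h.nonneg x t) hr hR).trans ?_
    rw [intervalIntegral.integral_of_le (hr.le.trans hR), hI0, ← integral_const_mul]
    have i4 := i3.const_mul (2 * (Cm * K) * Φ)
    refine le_trans (integral_mono_of_nonneg ?_ (IntegrableOn.mono_set i4 Ioc_subset_Ioi_self) ?_) (setIntegral_mono_set i4 ?_ (Eventually.of_forall (fun x hx => hx.1)))
    · filter_upwards [ae_restrict_mem measurableSet_Ioc] with x hx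
      exact mul_nonneg (le_min (Gm_pos hc.a0 hr).le (Gm_pos hc.a0 hx.1).le) (mul_nonneg (h.nonneg x t) (wnn hx.1.le n))
    · filter_upwards [ae_restrict_mem measurableSet_Ioc] with x hx using pb x hx.1
    · filter_upwards [ae_restrict_mem measurableSet_Ioi] with x hx
      have := wpos hx n; have := Gm_pos (n := n) hc.a0 hx
      simp only [Pi.zero_apply]; positivity
  · have : 0 ≤ K * Φ := by positivity
    linarith

theorem FD.vg (h : FD n m T U ut vr) (hn : 1 ≤ n) (hm : 0 < m) (hm1 : m < 1) (hT : 0 < T) (hk : DK n m U (T/4) a C) {b κ : ℝ} (hc : CS n (1/m) b κ) :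
    ∃ CA > 0, ∀ t ∈ Ico (3*T/4) T, ∀ r, 0 < r → U r t ^ m / gg m T t ^ m ≤ CA * Gm n b r ^ (1/2:ℝ) := by
  obtain ⟨A, A0, hA⟩ := (h.out hn hm hm1 (ε := T/4) ⟨by linarith, by linarith⟩ hk hc).1 (T/2) ⟨by linarith, by linarith⟩
  have m0 : 0 < 1 - m := by linarith
  refine ⟨3 ^ (m / (1 - m)) * (A ^ (1/2:ℝ) * 2 ^ (1 / (1 - m))) / T, by positivity, fun t ht r hr => ?_⟩
  have b1 := h.kb hn hm hm1 hT hk (t1 := 2 * t - T) (t2 := t) (by linarith [ht.1]) (by linarith [ht.2]) ht.2 hr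
  have G0 := Gm_pos (n := n) hc.a0 hr
  have t1T : 2 * t - T < T := by linarith [ht.2]
  have g1 : 0 < gg m T (2*t-T) := gpos hT t1T
  have g2 : 0 < gg m T t := gpos hT ht.2
  have b2 : PP n U r (2*t-T) ≤ Gm n b r ^ (1/2:ℝ) * (A ^ (1/2:ℝ) * gg m T (2*t-T)) := by
    have q := (h.PGN hk hc (by linarith [ht.1] : T/4 ≤ 2*t-T) hr).trans (mul_le_mul_of_nonneg_left (hA (2*t-T) ⟨by linarith [ht.1], t1T⟩) G0.le)
    have := Real.le_sqrt_of_sq_le q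
    rwa [Real.sqrt_mul G0.le, Real.sqrt_mul A0.le, Real.sqrt_sq g1.le, Real.sqrt_eq_rpow, Real.sqrt_eq_rpow] at this
  have g3 : gg m T (2*t-T) = 2 ^ (1 / (1 - m)) * gg m T t := by
    unfold gg
    rw [← Real.mul_rpow (by norm_num) (gx hT ht.2).le]
    congr 1; field_simp; ring
  have x0 := gx hT ht.2
  rw [show t - (2 * t - T) = T * (1 - t / T) by field_simp; ring] at b1
  rw [div_le_iff₀ (by positivity)]
  have b3 := b1.trans (mul_le_mul_of_nonneg_left b2 (by positivity))
  rw [g3, ← gmul hm1 hT ht.2] at b3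
  have : (T * (1 - t/T)) * U r t ^ m ≤ (T * (1 - t/T)) * (3 ^ (m / (1 - m)) * (A ^ (1/2:ℝ) * 2 ^ (1 / (1 - m))) / T * Gm n b r ^ (1/2:ℝ) * gg m T t ^ m) := by
    refine b3.trans_eq ?_
    field_simp
  exact le_of_mul_le_mul_left this (by positivity)

theorem FD.vub (h : FD n m T U ut vr) (hn : 1 ≤ n) (hm : 0 < m) (hm1 : m < 1) (hT : 0 < T) (hk : DK n m U (T/4) a C) {b κ : ℝ} (hc : CS n (1/m) b κ) :
    ∃ K > 0, ∀ t ∈ Ico (7*T/8) T, ∀ r, 0 < r → U r t ^ m / gg m T t ^ m ≤ K * Real.exp (-(n * r)) := by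
  obtain ⟨CA, CA0, hCA⟩ := h.vg hn hm hm1 hT hk hc
  obtain ⟨C3, C30, hC3⟩ := h.pker hn hm hk hc
  set σ := 1/m - κ with hσ
  have s0 : 0 < σ := by have := hc.k3; linarith
  have s1 : σ < 1 := by have := hc.k2; linarith
  have κ0 : 0 < κ := by
    have := hc.k2; have := hc.k4; linarith
  have m0 : 0 < 1 - m := by linarith
  set ω := 1 / (1 - σ) with hω
  have s1' : 0 < 1 - σ := by linarith
  have ω0 : 0 < ω := by positivity
  have ωe : ω = 1 + ω * σ := by rw [hω]; field_simp; ring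
  set B := (3:ℝ) ^ (m / (1 - m)) with hB
  have B0 : 0 < B := by positivity
  set C2 := 2 * B * C3 * CA ^ κ * 2 ^ (ω * σ) * 2 ^ (1 / (1 - m)) / T with hC2
  have C20 : 0 < C2 := by positivity
  have main : ∀ t ∈ Ico (7*T/8) T, ∀ δ > 0, ∀ r, 0 < r → U r t ^ m / gg m T t ^ m ≤ 2 ^ ω * C2 ^ ω * (Real.exp (-(n * r)) + δ * Real.exp (-(n * r)) ^ (1/2:ℝ)) := fun te hte δ hδ => by
    set t0 := 2 * te - T with ht0
    have tt0 : 3*T/4 ≤ t0 := by linarith [hte.1]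
    have t0T : t0 < te := by linarith [hte.2]
    have τ0 : 0 < T - t0 := by linarith [hte.2]
    have Φ0 : ∀ r : ℝ, 0 < Real.exp (-(n * r)) + δ * Real.exp (-(n * r)) ^ (1/2:ℝ) := fun r => by positivity
    set f : ℝ × ℝ → ℝ := fun q => ((q.2 - t0) / (T - t0)) ^ ω * (U q.1 q.2 ^ m / gg m T q.2 ^ m) / (Real.exp (-(n * q.1)) + δ * Real.exp (-(n * q.1)) ^ (1/2:ℝ)) with hf
    set S := Ioi (0:ℝ) ×ˢ Ioc t0 te with hS
    have bdd : BddAbove (f '' S) := by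
      refine ⟨C / gg m T te ^ m / δ, ?_⟩
      rintro _ ⟨⟨r, t⟩, ⟨hr, ht⟩, rfl⟩
      simp only [mem_Ioi] at hr
      simp only at ht
      simp only [hf]
      have ge : 0 < gg m T te := gpos hT hte.2
      have gle : gg m T te ≤ gg m T t := by
        unfold gg
        exact Real.rpow_le_rpow (gx hT hte.2).le (by have := div_le_div_of_nonneg_right ht.2 hT.le; linarith) (by positivity)
      have a1 : ((t - t0) / (T - t0)) ^ ω ≤ 1 := Real.rpow_le_one (div_nonneg (by linarith [ht.1]) τ0.le) ((div_le_one τ0).2 (by linarith [ht.2, hte.2])) ω0.le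
      have a2 := hk.v t (by linarith [ht.1]) r hr.le
      have a3 : Real.exp (-(n * r / 2)) = Real.exp (-(n * r)) ^ (1/2:ℝ) := by rw [← Real.exp_mul]; ring_nf
      rw [a3] at a2
      set e := Real.exp (-(n * r)) ^ (1/2:ℝ) with he
      have e0 : 0 < e := by positivity
      have u0 := h.nonneg r t
      have a4 : U r t ^ m / gg m T t ^ m ≤ C * e / gg m T te ^ m := by
        have := hk.C0
        gcongr
      have a0 : 0 ≤ ((t - t0) / (T - t0)) ^ ω := Real.rpow_nonneg (div_nonneg (by linarith [ht.1]) τ0.le) _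
      rw [div_le_iff₀ (Φ0 r)]
      calc ((t - t0) / (T - t0)) ^ ω * (U r t ^ m / gg m T t ^ m) ≤ 1 * (C * e / gg m T te ^ m) := mul_le_mul a1 a4 (div_nonneg (by positivity) (Real.rpow_nonneg (ge.le.trans gle) _)) zero_le_one
        _ = C / gg m T te ^ m / δ * (δ * e) := by field_simp
        _ ≤ _ := by
          have := hk.C0
          gcongr; linarith [Real.exp_pos (-(n * r))]
    set A := sSup (f '' S) with hA
    have fA : ∀ r t, 0 < r → t ∈ Ioc t0 te → f (r, t) ≤ A := fun r t hr ht => le_csSup bdd ⟨(r, t), ⟨hr, ht⟩, rfl⟩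
    have fpos : ∀ r t, 0 < r → t ∈ Ioc t0 te → 0 < f (r, t) := fun r t hr ht => by
      have tT : t < T := ht.2.trans_lt hte.2
      have := h.pos r t ⟨by linarith [ht.1], tT⟩
      have := gpos (m := m) hT tT
      have : 0 < (t - t0) / (T - t0) := div_pos (by linarith [ht.1]) τ0
      have := Φ0 r
      simp only [hf]; positivity
    have A0 : 0 < A := (fpos 1 te one_pos ⟨t0T, le_rfl⟩).trans_le (fA 1 te one_pos ⟨t0T, le_rfl⟩)
    have step : ∀ r t, 0 < r → t ∈ Ioc t0 te → f (r, t) ≤ C2 * A ^ σ := fun r t hr ht => by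
      have tT : t < T := ht.2.trans_lt hte.2
      set s := (t0 + t) / 2 with hs
      have s_1 : t0 < s := by linarith [ht.1]
      have s_2 : s < t := by linarith [ht.1]
      have sT : s < T := s_2.trans tT
      set θ := (s - t0) / (T - t0) with hθ
      have θ0 : 0 < θ := div_pos (by linarith) τ0
      have θ2 : (t - t0) / (T - t0) = 2 * θ := by rw [hθ, hs]; ring
      have gs0 : 0 < gg m T s := gpos hT sT
      have gt0 : 0 < gg m T t := gpos hT tT
      have ub : ∀ x, 0 < x → U x s ≤ (gg m T s * CA ^ κ * (A / θ ^ ω) ^ σ) * (Gm n b x ^ (κ/2) * (Real.exp (-(n * x)) + δ * Real.exp (-(n * x)) ^ (1/2:ℝ)) ^ σ) := fun x hx => by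
        have u0 := h.nonneg x s
        have G0 := Gm_pos (n := n) hc.a0 hx
        set V := U x s ^ m / gg m T s ^ m with hV
        have V0 : 0 ≤ V := by positivity
        have uV : U x s = gg m T s * (V ^ κ * V ^ σ) := by
          rw [← Real.rpow_add' V0 (by rw [hσ]; ring_nf; positivity), hσ, add_sub_cancel, hV, Real.div_rpow (by positivity) (by positivity), ← Real.rpow_mul u0, ← Real.rpow_mul gs0.le, mul_one_div_cancel hm.ne', Real.rpow_one, Real.rpow_one]
          field_simp
        have v1 := hCA s ⟨by linarith, sT⟩ x hx
        have v2 := fA x s hx ⟨s_1, by linarith [ht.2]⟩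
        simp only [hf] at v2
        rw [← hV, ← hθ, div_le_iff₀ (Φ0 x)] at v2
        have v3 : V ≤ A / θ ^ ω * (Real.exp (-(n * x)) + δ * Real.exp (-(n * x)) ^ (1/2:ℝ)) := by
          rw [div_mul_eq_mul_div, le_div_iff₀ (by positivity)]; linarith
        have w1 := Real.rpow_le_rpow V0 v1 κ0.le
        have w2 := Real.rpow_le_rpow V0 v3 s0.le
        rw [Real.mul_rpow CA0.le (by positivity), ← Real.rpow_mul G0.le, show 1/2 * κ = κ/2 by ring] at w1
        rw [Real.mul_rpow (by positivity) (Φ0 x).le] at w2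
        rw [uV]
        refine (mul_le_mul_of_nonneg_left (mul_le_mul w1 w2 (by positivity) (by positivity)) gs0.le).trans_eq (by ring)
      have p1 := hC3 s (by linarith) _ δ (by positivity) hδ.le ub r hr
      have k1 := h.kb hn hm hm1 hT hk (t1 := s) (t2 := t) (by linarith) s_2.le tT hr
      have k2 := k1.trans (mul_le_mul_of_nonneg_left p1 B0.le)
      set Φ := Real.exp (-(n * r)) + δ * Real.exp (-(n * r)) ^ (1/2:ℝ) with hΦ
      have hΦ0 : 0 < Φ := Φ0 r
      have gle : gg m T s ≤ 2 ^ (1 / (1 - m)) * gg m T t := by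
        unfold gg
        rw [← Real.mul_rpow (by norm_num) (gx hT tT).le]
        refine Real.rpow_le_rpow (gx hT sT).le ?_ (by positivity)
        have : 0 ≤ (T - 2 * t + s) / T := div_nonneg (by linarith [ht.2]) hT.le
        have e : (T - 2 * t + s) / T = 1 - 2 * (t/T) + s/T := by field_simp
        linarith
      have xle : 1 - t / T ≤ (T - t0) / T := by
        rw [sub_div, div_self hT.ne']; have := div_le_div_of_nonneg_right ht.1.le hT.le; linarith
      simp only [hf]
      rw [← hΦ, div_le_iff₀ hΦ0, θ2]
      have ts : t - s = θ * (T - t0) := by rw [hθ, hs]; field_simp; ring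
      rw [ts] at k2
      have k3 : U r t ^ m / gg m T t ^ m ≤ B * (C3 * CA ^ κ * (A / θ ^ ω) ^ σ * Φ) * 2 ^ (1 / (1 - m)) / (T * θ) := by
        rw [div_le_div_iff₀ (by positivity) (by positivity)]
        have k4 : gg m T s * T ≤ 2 ^ (1 / (1 - m)) * gg m T t ^ m * (T - t0) := by
          have q1 : gg m T s ≤ 2 ^ (1 / (1 - m)) * (gg m T t ^ m * ((T - t0) / T)) := by
            refine gle.trans (mul_le_mul_of_nonneg_left ?_ (by positivity))
            calc gg m T t = gg m T t ^ m * (1 - t/T) := (gmul hm1 hT tT).symm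
              _ ≤ _ := mul_le_mul_of_nonneg_left xle (by positivity)
          have := mul_le_mul_of_nonneg_right q1 hT.le
          refine this.trans_eq ?_
          field_simp
        have q : (T - t0) * (U r t ^ m * (T * θ)) ≤ (T - t0) * (B * (C3 * CA ^ κ * (A / θ ^ ω) ^ σ * Φ) * 2 ^ (1 / (1 - m)) * gg m T t ^ m) := by
          calc (T - t0) * (U r t ^ m * (T * θ)) = (θ * (T - t0) * U r t ^ m) * T := by ring
            _ ≤ B * (C3 * (gg m T s * CA ^ κ * (A / θ ^ ω) ^ σ) * Φ) * T := by gcongr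
            _ = B * (C3 * CA ^ κ * (A / θ ^ ω) ^ σ * Φ) * (gg m T s * T) := by ring
            _ ≤ B * (C3 * CA ^ κ * (A / θ ^ ω) ^ σ * Φ) * (2 ^ (1 / (1 - m)) * gg m T t ^ m * (T - t0)) := by gcongr
            _ = _ := by ring
        exact le_of_mul_le_mul_left q τ0
      refine (mul_le_mul_of_nonneg_left k3 (by positivity)).trans_eq ?_
      rw [Real.mul_rpow (by norm_num) θ0.le, Real.div_rpow A0.le (by positivity), ← Real.rpow_mul θ0.le, hC2]
      have e1 : θ ^ ω = θ * θ ^ (ω * σ) := by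
        nth_rewrite 1 [ωe]
        rw [Real.rpow_add θ0, Real.rpow_one]
      have e2 : (2:ℝ) ^ ω = 2 * 2 ^ (ω * σ) := by
        nth_rewrite 1 [ωe]
        rw [Real.rpow_add two_pos, Real.rpow_one]
      have : 0 < θ ^ (ω * σ) := by positivity
      rw [e1, e2]; field_simp
    have A1 : A ≤ C2 * A ^ σ := csSup_le ⟨f (1, te), (1, te), ⟨(one_pos : (0:ℝ) < 1), t0T, le_rfl⟩, rfl⟩ (by
      rintro _ ⟨⟨r, t⟩, ⟨hr, ht⟩, rfl⟩; exact step r t hr ht)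
    have A2 : A ≤ C2 ^ ω := by
      have : A ^ (1 - σ) ≤ C2 := by
        rw [Real.rpow_sub A0, Real.rpow_one, div_le_iff₀ (by positivity)]; exact A1
      have := Real.rpow_le_rpow (by positivity) this ω0.le
      rwa [← Real.rpow_mul A0.le, hω, mul_one_div_cancel s1'.ne', Real.rpow_one] at this
    intro r hr
    have q := (fA r te hr ⟨t0T, le_rfl⟩).trans A2
    simp only [hf] at q
    rw [show (te - t0) / (T - t0) = 1 / 2 by rw [ht0]; rw [div_eq_div_iff (by linarith) two_ne_zero]; ring, div_le_iff₀ (Φ0 r), one_div, Real.inv_rpow (by norm_num), inv_mul_le_iff₀ (by positivity)] at q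
    linarith
  refine ⟨2 ^ ω * C2 ^ ω, by positivity, fun t ht r hr => ?_⟩
  have l : Tendsto (fun δ : ℝ => 2 ^ ω * C2 ^ ω * (Real.exp (-(n * r)) + δ * Real.exp (-(n * r)) ^ (1/2:ℝ))) (𝓝[>] 0) (𝓝 (2 ^ ω * C2 ^ ω * (Real.exp (-(n * r)) + 0 * Real.exp (-(n * r)) ^ (1/2:ℝ)))) :=
    (Continuous.tendsto (by fun_prop) 0).mono_left nhdsWithin_le_nhds
  have := ge_of_tendsto l (by filter_upwards [self_mem_nhdsWithin] with δ hδ using main t ht δ hδ r hr)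
  simpa using this
end

section
variable {n : ℕ} {p K : ℝ}

/-- potential -/
noncomputable def YP (n : ℕ) (p : ℝ) (y : ℝ → ℝ) (r : ℝ) : ℝ := ∫ ρ in Ioi r, OF n p y ρ / Real.sinh ρ ^ n

theorem phw (hn : 1 ≤ n) (hp : 1 < p) : IntegrableOn (fun x : ℝ => Real.exp (-(n * x)) ^ p * Real.sinh x ^ n) (Ioi 0) := by
  have hn0 : (0:ℝ) < n := by exact_mod_cast hn
  refine (Gm_int (n := n) (a := n) hn0 hn le_rfl (θ := 0) (σ := p) le_rfl (by linarith) (by linarith) (by linarith)).congr_fun (fun x hx => ?_) measurableSet_Ioi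
  simp

structure YB (n : ℕ) (K : ℝ) (y : ℝ → ℝ) : Prop where
  c : Continuous y
  nn : ∀ x, 0 ≤ y x
  ub : ∀ x, 0 < x → y x ≤ K * Real.exp (-(n * x))

theorem YB.pc {y : ℝ → ℝ} (h : YB n K y) (hp : 1 < p) : Continuous (fun x => y x ^ p * Real.sinh x ^ n) :=
  (h.c.rpow_const (fun _ => Or.inr (by linarith))).mul (by fun_prop)

theorem YB.pub {y : ℝ → ℝ} (h : YB n K y) (hK : 0 < K) (hp : 1 < p) {x : ℝ} (hx : 0 < x) :
    y x ^ p * Real.sinh x ^ n ≤ K ^ p * (Real.exp (-(n * x)) ^ p * Real.sinh x ^ n) := by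
  have := Real.rpow_le_rpow (h.nn x) (h.ub x hx) (by linarith : 0 ≤ p)
  rw [Real.mul_rpow hK.le (Real.exp_pos _).le] at this
  have w := wnn hx.le n
  rw [← mul_assoc]; gcongr

theorem YB.OFc {y : ℝ → ℝ} (h : YB n K y) (hp : 1 < p) : Continuous (OF n p y) :=
  intervalIntegral.continuous_primitive (fun a b => (h.pc hp).intervalIntegrable a b) 0

theorem YB.OFnn {y : ℝ → ℝ} (h : YB n K y) {r : ℝ} (hr : 0 ≤ r) : 0 ≤ OF n p y r :=
  intervalIntegral.integral_nonneg hr (fun x hx => mul_nonneg (Real.rpow_nonneg (h.nn x) _) (wnn hx.1 n))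

theorem ofb (hn : 1 ≤ n) (hp : 1 < p) (hK : 0 < K) : ∃ B > 0, ∀ y : ℝ → ℝ, YB n K y → ∀ ρ, 0 < ρ → OF n p y ρ / Real.sinh ρ ^ n ≤ B * Real.exp (-(n * ρ)) := by
  have hn0 : (0:ℝ) < n := by exact_mod_cast hn
  set I := ∫ x in Ioi (0:ℝ), Real.exp (-(n * x)) ^ p * Real.sinh x ^ n with hI
  have I0 : 0 ≤ I := setIntegral_nonneg measurableSet_Ioi (fun x hx => mul_nonneg (by positivity) (wpos hx n).le)
  have Kp : 0 < K ^ p := by positivity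
  refine ⟨K ^ p * Real.exp n + K ^ p * I * 4 ^ n, by positivity, fun y h ρ hρ => ?_⟩
  have w0 := wpos hρ n
  rw [div_le_iff₀ w0]
  rcases le_total ρ 1 with h1 | h1
  · have : OF n p y ρ ≤ ∫ x in (0:ℝ)..ρ, K ^ p * Real.sinh ρ ^ n := by
      unfold OF
      refine intervalIntegral.integral_mono_on_of_le_Ioo hρ.le ((h.pc hp).intervalIntegrable _ _) (by simp) (fun x hx => ?_)
      refine (h.pub hK hp hx.1).trans ?_
      have e1 : Real.exp (-(n * x)) ^ p ≤ 1 := Real.rpow_le_one (Real.exp_pos _).le (by rw [Real.exp_le_one_iff]; have := mul_pos hn0 hx.1; linarith) (by linarith)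
      have e2 : Real.sinh x ^ n ≤ Real.sinh ρ ^ n := pow_le_pow_left₀ (Real.sinh_nonneg_iff.2 hx.1.le) (Real.sinh_le_sinh.2 hx.2.le) n
      have := wnn hx.1.le n
      calc K ^ p * (Real.exp (-(n * x)) ^ p * Real.sinh x ^ n) ≤ K ^ p * (1 * Real.sinh ρ ^ n) := by gcongr
        _ = _ := by ring
    rw [intervalIntegral.integral_const, smul_eq_mul] at this
    have e : 1 ≤ Real.exp n * Real.exp (-(n * ρ)) := by
      rw [← Real.exp_add]; refine Real.one_le_exp ?_; nlinarith
    have q : (ρ - 0) * (K ^ p * Real.sinh ρ ^ n) ≤ 1 * (K ^ p * Real.sinh ρ ^ n) := mul_le_mul_of_nonneg_right (by linarith) (by positivity)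
    have q2 : K ^ p * Real.sinh ρ ^ n * 1 ≤ K ^ p * Real.sinh ρ ^ n * (Real.exp n * Real.exp (-(n * ρ))) := mul_le_mul_of_nonneg_left e (by positivity)
    have q3 : 0 ≤ K ^ p * I * 4 ^ n * Real.exp (-(n * ρ)) * Real.sinh ρ ^ n := by positivity
    linarith
  · have : OF n p y ρ ≤ K ^ p * I := by
      unfold OF
      rw [intervalIntegral.integral_of_le hρ.le, hI, ← integral_const_mul]
      have i := (phw hn hp).const_mul (K ^ p)
      refine le_trans (integral_mono_of_nonneg ?_ (IntegrableOn.mono_set i Ioc_subset_Ioi_self) ?_) (setIntegral_mono_set i ?_ (Eventually.of_forall (fun x hx => hx.1)))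
      · filter_upwards [ae_restrict_mem measurableSet_Ioc] with x hx
        exact mul_nonneg (Real.rpow_nonneg (h.nn x) _) (wnn hx.1.le n)
      · filter_upwards [ae_restrict_mem measurableSet_Ioc] with x hx using h.pub hK hp hx.1
      · filter_upwards [ae_restrict_mem measurableSet_Ioi] with x hx
        have := wpos hx n
        simp only [Pi.zero_apply]; positivity
    have e : 1 ≤ 4 ^ n * Real.exp (-(n * ρ)) * Real.sinh ρ ^ n := by
      have := pow_le_pow_left₀ (by positivity) (sinh_ge_exp h1) n
      rw [div_pow, ← Real.exp_nat_mul, div_le_iff₀ (by positivity)] at this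
      have e3 : Real.exp (-(n * ρ)) * Real.exp (n * ρ) = 1 := by rw [← Real.exp_add]; simp
      have := mul_le_mul_of_nonneg_left this (Real.exp_pos (-(n * ρ))).le
      linarith
    have q := mul_le_mul_of_nonneg_left e (by positivity : 0 ≤ K ^ p * I)
    have q2 : 0 ≤ K ^ p * Real.exp n * Real.exp (-(n * ρ)) * Real.sinh ρ ^ n := by positivity
    linarith

variable {B : ℝ}

theorem YB.wc {y : ℝ → ℝ} (h : YB n K y) (hp : 1 < p) : ContinuousOn (fun ρ => OF n p y ρ / Real.sinh ρ ^ n) (Ioi 0) :=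
  (h.OFc hp).continuousOn.div (by fun_prop) (fun x hx => (wpos hx n).ne')

theorem YB.wi {y : ℝ → ℝ} (h : YB n K y) (hn : 1 ≤ n) (hp : 1 < p) (hB : ∀ ρ, 0 < ρ → OF n p y ρ / Real.sinh ρ ^ n ≤ B * Real.exp (-(n * ρ))) :
    IntegrableOn (fun ρ => OF n p y ρ / Real.sinh ρ ^ n) (Ioi 0) := by
  have hn0 : (0:ℝ) < n := by exact_mod_cast hn
  refine Integrable.mono' (eint hn0 B) ((h.wc hp).aestronglyMeasurable measurableSet_Ioi) ?_
  filter_upwards [ae_restrict_mem measurableSet_Ioi] with x hx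
  rw [Real.norm_of_nonneg (div_nonneg (h.OFnn (le_of_lt hx)) (wpos hx n).le)]
  exact hB x hx

theorem YB.diff {y : ℝ → ℝ} (h : YB n K y) (hn : 1 ≤ n) (hp : 1 < p) (hB : ∀ ρ, 0 < ρ → OF n p y ρ / Real.sinh ρ ^ n ≤ B * Real.exp (-(n * ρ))) {r R : ℝ} (hr : 0 ≤ r) (hR : r ≤ R) :
    YP n p y r - YP n p y R = ∫ ρ in r..R, OF n p y ρ / Real.sinh ρ ^ n := by
  have i := h.wi hn hp hB
  unfold YP
  rw [intervalIntegral.integral_of_le hR]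
  have := setIntegral_union (μ := volume) (f := fun ρ => OF n p y ρ / Real.sinh ρ ^ n) (Ioc_disjoint_Ioi (a := r) (le_refl R)) measurableSet_Ioi (i.mono_set (fun x hx => hr.trans_lt hx.1)) (i.mono_set (fun x hx => hr.trans_lt (hR.trans_lt hx)))
  rw [Ioc_union_Ioi_eq_Ioi hR] at this
  linarith

theorem YB.lip {y : ℝ → ℝ} (h : YB n K y) (hn : 1 ≤ n) (hp : 1 < p) (hB0 : 0 < B) (hB : ∀ ρ, 0 < ρ → OF n p y ρ / Real.sinh ρ ^ n ≤ B * Real.exp (-(n * ρ))) {r R : ℝ} (hr : 0 ≤ r) (hR : 0 ≤ R) :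
    |YP n p y r - YP n p y R| ≤ B * |r - R| := by
  wlog hle : r ≤ R generalizing r R
  · rw [abs_sub_comm, abs_sub_comm r]; exact this hR hr (le_of_not_ge hle)
  have hn0 : (0:ℝ) < n := by exact_mod_cast hn
  rw [h.diff hn hp hB hr hle, ← Real.norm_eq_abs]
  refine (intervalIntegral.norm_integral_le_of_norm_le_const (C := B) (fun x hx => ?_)).trans_eq (by rw [abs_sub_comm])
  rw [uIoc_of_le hle] at hx
  have hx0 := hr.trans_lt hx.1
  rw [Real.norm_of_nonneg (div_nonneg (h.OFnn hx0.le) (wpos hx0 n).le)]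
  refine (hB x hx0).trans (mul_le_of_le_one_right hB0.le ?_)
  rw [Real.exp_le_one_iff]; have := mul_pos hn0 hx0; linarith

theorem YB.bd {y : ℝ → ℝ} (h : YB n K y) (hn : 1 ≤ n) (hp : 1 < p) (hB : ∀ ρ, 0 < ρ → OF n p y ρ / Real.sinh ρ ^ n ≤ B * Real.exp (-(n * ρ))) {r : ℝ} (hr : 0 ≤ r) :
    YP n p y r ∈ Icc 0 (∫ ρ in Ioi (0:ℝ), B * Real.exp (-(n * ρ))) := by
  have hn0 : (0:ℝ) < n := by exact_mod_cast hn
  have nn : ∀ x : ℝ, 0 < x → 0 ≤ OF n p y x / Real.sinh x ^ n := fun x hx => div_nonneg (h.OFnn hx.le) (wpos hx n).le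
  refine ⟨setIntegral_nonneg measurableSet_Ioi (fun x hx => nn x (hr.trans_lt hx)), ?_⟩
  refine (setIntegral_mono_set (h.wi hn hp hB) ?_ (Eventually.of_forall (fun x hx => hr.trans_lt hx))).trans
    (setIntegral_mono_on (h.wi hn hp hB) (eint hn0 B) measurableSet_Ioi (fun x hx => hB x hx))
  filter_upwards [ae_restrict_mem measurableSet_Ioi] with x hx using nn x hx

/-- compactness -/
theorem ysub (hn : 1 ≤ n) (hp : 1 < p) (hK : 0 < K) {y : ℕ → ℝ → ℝ} (h : ∀ k, YB n K (y k)) :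
    ∃ (L : ℝ → ℝ) (ns : ℕ → ℕ), StrictMono ns ∧ ∀ r, 0 ≤ r → Tendsto (fun k => YP n p (y (ns k)) r) atTop (𝓝 (L r)) := by
  obtain ⟨B, B0, hB⟩ := ofb (n := n) (p := p) hn hp hK
  have cpt : IsCompact (Set.pi univ (fun _ : ℚ => Icc (0:ℝ) (∫ ρ in Ioi (0:ℝ), B * Real.exp (-(n * ρ))))) := isCompact_univ_pi (fun _ => isCompact_Icc)
  obtain ⟨l, -, ns, hns, hl⟩ := cpt.tendsto_subseq (x := fun k (q : ℚ) => YP n p (y k) (max (q:ℝ) 0)) (fun k q _ => (h k).bd hn hp (hB _ (h k)) (le_max_right _ _))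
  rw [tendsto_pi_nhds] at hl
  have key : ∀ r, 0 ≤ r → ∃ a, Tendsto (fun k => YP n p (y (ns k)) r) atTop (𝓝 a) := fun r hr => by
    refine cauchySeq_tendsto_of_complete (Metric.cauchySeq_iff.2 fun ε hε => ?_)
    obtain ⟨q, q1, q2⟩ := exists_rat_btwn (show r < r + ε / (3 * B) by have : 0 < ε / (3 * B) := by positivity
                                                                       linarith)
    have c := (hl q).cauchySeq
    obtain ⟨k0, hk0⟩ := Metric.cauchySeq_iff.1 c (ε / 3) (by positivity)
    refine ⟨k0, fun i hi j hj => ?_⟩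
    have e := hk0 i hi j hj
    simp only [Function.comp_apply] at e
    rw [max_eq_left (hr.trans q1.le), Real.dist_eq] at e
    have l1 := (h (ns i)).lip hn hp B0 (hB _ (h _)) hr (hr.trans q1.le)
    have l2 := (h (ns j)).lip hn hp B0 (hB _ (h _)) (hr.trans q1.le) hr
    have e1 : B * |r - q| < ε / 3 := by
      rw [abs_sub_comm, abs_of_pos (by linarith)]
      calc B * (q - r) < B * (ε / (3 * B)) := by gcongr; linarith
        _ = _ := by field_simp
    rw [abs_sub_comm (q:ℝ) r] at l2
    rw [Real.dist_eq]
    have := abs_add_le (YP n p (y (ns i)) r - YP n p (y (ns i)) q) (YP n p (y (ns i)) q - YP n p (y (ns j)) q)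
    have := abs_add_le (YP n p (y (ns i)) r - YP n p (y (ns i)) q + (YP n p (y (ns i)) q - YP n p (y (ns j)) q)) (YP n p (y (ns j)) q - YP n p (y (ns j)) r)
    rw [show YP n p (y (ns i)) r - YP n p (y (ns j)) r = YP n p (y (ns i)) r - YP n p (y (ns i)) q + (YP n p (y (ns i)) q - YP n p (y (ns j)) q) + (YP n p (y (ns j)) q - YP n p (y (ns j)) r) by ring]
    linarith
  choose! L hL using key
  exact ⟨L, ns, hns, hL⟩
end

section
variable {n : ℕ} {p K c c0 : ℝ}

theorem yid (hn : 1 ≤ n) (hp : 1 < p) (hc : 0 < c) (hsub : p * (n - 1) < n + 3) (hK : 0 < K) {V : ℝ → ℝ} (hV : OSol n p c V)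
    {y : ℕ → ℝ → ℝ} (h : ∀ k, YB n K (y k)) {L : ℝ → ℝ} (hL : ∀ r, 0 ≤ r → Tendsto (fun k => YP n p (y k) r) atTop (𝓝 (L r)))
    {μ : ℕ → ℝ} (hμ : Tendsto μ atTop (𝓝 c)) (hy : ∀ r, 0 < r → Tendsto (fun k => y k r - μ k * YP n p (y k) r) atTop (𝓝 0))
    (h0 : 0 < c0) (hX : ∀ k, c0 ≤ ∫ x in Ioi (0:ℝ), y k x ^ p * Real.sinh x ^ n * y k x) :
    ∀ r, 0 < r → Tendsto (fun k => y k r) atTop (𝓝 (V r)) := by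
  have hn0 : (0:ℝ) < n := by exact_mod_cast hn
  obtain ⟨B, B0, hB⟩ := ofb (n := n) (p := p) hn hp hK
  set v : ℝ → ℝ := fun r => c * L (max r 0) with hv
  have Ll : ∀ r R, 0 ≤ r → 0 ≤ R → |L r - L R| ≤ B * |r - R| := fun r R hr hR =>
    le_of_tendsto ((hL r hr).sub (hL R hR)).abs (Eventually.of_forall fun k => (h k).lip hn hp B0 (hB _ (h k)) hr hR)
  have Lc : ContinuousOn L (Ici 0) := by
    have : LipschitzOnWith (Real.toNNReal B) L (Ici 0) := LipschitzOnWith.of_dist_le_mul (fun r hr R hR => by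
      rw [Real.dist_eq, Real.dist_eq, Real.coe_toNNReal _ B0.le]; exact Ll r R hr hR)
    exact this.continuousOn
  have vc : Continuous v := continuous_const.mul (ext0 Lc)
  have Lnn : ∀ r, 0 ≤ r → 0 ≤ L r := fun r hr => ge_of_tendsto (hL r hr) (Eventually.of_forall fun k => ((h k).bd hn hp (hB _ (h k)) hr).1)
  have hlim : ∀ r, 0 < r → Tendsto (fun k => y k r) atTop (𝓝 (v r)) := fun r hr => by
    have := (hy r hr).add (hμ.mul (hL r hr.le))
    simp only [hv, max_eq_left hr.le]
    rw [zero_add] at this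
    refine this.congr (fun k => by ring)
  have vb : YB n K v := ⟨vc, fun x => mul_nonneg hc.le (Lnn _ (le_max_right _ _)), fun x hx => le_of_tendsto (hlim x hx) (Eventually.of_forall fun k => (h k).ub x hx)⟩
  have hF : ∀ ρ, 0 ≤ ρ → Tendsto (fun k => OF n p (y k) ρ) atTop (𝓝 (OF n p v ρ)) := fun ρ hρ => by
    unfold OF
    refine intervalIntegral.tendsto_integral_filter_of_dominated_convergence (fun x => K ^ p * (Real.exp (-(n * x)) ^ p * Real.sinh x ^ n)) ?_ ?_ ?_ ?_
    · exact Eventually.of_forall fun k => ((h k).pc hp).aestronglyMeasurable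
    · refine Eventually.of_forall fun k => Eventually.of_forall fun x hx => ?_
      rw [uIoc_of_le hρ] at hx
      rw [Real.norm_of_nonneg (mul_nonneg (Real.rpow_nonneg ((h k).nn x) _) (wnn hx.1.le n))]
      exact (h k).pub hK hp hx.1
    · rw [intervalIntegrable_iff_integrableOn_Ioc_of_le hρ]
      exact IntegrableOn.mono_set ((phw hn hp).const_mul _) Ioc_subset_Ioi_self
    · refine Eventually.of_forall fun x hx => ?_
      rw [uIoc_of_le hρ] at hx
      exact ((hlim x hx.1).rpow_const (Or.inr (by linarith))).mul_const _
  have hP : ∀ r, 0 ≤ r → L r = YP n p v r := fun r hr => by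
    refine tendsto_nhds_unique (hL r hr) ?_
    unfold YP
    refine tendsto_integral_of_dominated_convergence (fun x => B * Real.exp (-(n * x))) ?_ ?_ ?_ ?_
    · exact fun k => ((h k).wc hp).mono (fun x hx => hr.trans_lt hx) |>.aestronglyMeasurable measurableSet_Ioi
    · exact (eint hn0 B).mono_set (fun x hx => hr.trans_lt hx)
    · intro k
      filter_upwards [ae_restrict_mem measurableSet_Ioi] with x hx
      have hx0 := hr.trans_lt hx
      rw [Real.norm_of_nonneg (div_nonneg ((h k).OFnn hx0.le) (wpos hx0 n).le)]
      exact hB _ (h k) x hx0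
    · filter_upwards [ae_restrict_mem measurableSet_Ioi] with x hx
      exact (hF x (hr.trans_lt hx).le).div_const _
  have hvP : ∀ r, 0 ≤ r → v r = c * YP n p v r := fun r hr => by simp only [hv, max_eq_left hr]; rw [hP r hr]
  have hXv : c0 ≤ ∫ x in Ioi (0:ℝ), v x ^ p * Real.sinh x ^ n * v x := by
    refine ge_of_tendsto (tendsto_integral_of_dominated_convergence (fun x => K ^ p * (Real.exp (-(n * x)) ^ p * Real.sinh x ^ n) * K) ?_ ?_ ?_ ?_) (Eventually.of_forall hX)
    · exact fun k => (((h k).pc hp).mul (h k).c).aestronglyMeasurable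
    · exact ((phw hn hp).const_mul _).mul_const _
    · intro k
      filter_upwards [ae_restrict_mem measurableSet_Ioi] with x hx
      have q := mul_nonneg (Real.rpow_nonneg ((h k).nn x) p) (wnn (le_of_lt hx) n)
      rw [Real.norm_of_nonneg (mul_nonneg q ((h k).nn x))]
      refine mul_le_mul ((h k).pub hK hp hx) (((h k).ub x hx).trans (mul_le_of_le_one_right hK.le ?_)) ((h k).nn x) (q.trans ((h k).pub hK hp hx))
      rw [Real.exp_le_one_iff]; have := mul_pos hn0 hx; linarith
    · filter_upwards [ae_restrict_mem measurableSet_Ioi] with x hx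
      exact (((hlim x hx).rpow_const (Or.inr (by linarith))).mul_const _).mul (hlim x hx)
  obtain ⟨x0, hx0, vx0⟩ : ∃ x0, 0 < x0 ∧ 0 < v x0 := by
    by_contra hcon
    push Not at hcon
    have : ∫ x in Ioi (0:ℝ), v x ^ p * Real.sinh x ^ n * v x = 0 := by
      refine setIntegral_eq_zero_of_forall_eq_zero (fun x hx => ?_)
      rw [le_antisymm (hcon x hx) (vb.nn x), mul_zero]
    linarith
  have nn : ∀ x : ℝ, 0 < x → 0 ≤ OF n p v x / Real.sinh x ^ n := fun x hx => div_nonneg (vb.OFnn hx.le) (wpos hx n).le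
  have anti : ∀ r R, 0 ≤ r → r ≤ R → v R ≤ v r := fun r R hr hR => by
    rw [hvP r hr, hvP R (hr.trans hR)]
    refine mul_le_mul_of_nonneg_left ?_ hc.le
    have := vb.diff hn hp (hB _ vb) hr hR
    have q : 0 ≤ ∫ ρ in r..R, OF n p v ρ / Real.sinh ρ ^ n := by
      rw [intervalIntegral.integral_of_le hR]
      exact setIntegral_nonneg measurableSet_Ioc (fun x hx => nn x (hr.trans_lt hx.1))
    linarith
  have Fpos : ∀ ρ, 0 < ρ → 0 < OF n p v ρ := fun ρ hρ => by
    unfold OF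
    have m0 : 0 < min ρ x0 := lt_min hρ hx0
    refine intervalIntegral.integral_pos hρ ((vb.pc hp).continuousOn) (fun x hx => mul_nonneg (Real.rpow_nonneg (vb.nn x) _) (wnn hx.1.le n)) ⟨min ρ x0, ⟨m0.le, min_le_left _ _⟩, ?_⟩
    exact mul_pos (Real.rpow_pos_of_pos (vx0.trans_le (anti _ _ m0.le (min_le_right _ _))) _) (wpos m0 n)
  have wi := vb.wi hn hp (hB _ vb)
  have vpos : ∀ r, 0 ≤ r → 0 < v r := fun r hr => by
    rw [hvP r hr]
    refine mul_pos hc ?_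
    have d := vb.diff hn hp (hB _ vb) hr (by linarith : r ≤ r + 1)
    have b := (vb.bd hn hp (hB _ vb) (by linarith : 0 ≤ r + 1)).1
    have : 0 < ∫ ρ in r..(r+1), OF n p v ρ / Real.sinh ρ ^ n := by
      refine intervalIntegral.intervalIntegral_pos_of_pos_on ?_ (fun x hx => div_pos (Fpos x (hr.trans_lt hx.1)) (wpos (hr.trans_lt hx.1) n)) (by linarith)
      rw [intervalIntegrable_iff_integrableOn_Ioc_of_le (by linarith)]
      exact wi.mono_set (fun x hx => hr.trans_lt hx.1)
    linarith
  have os : OSol n p c v := by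
    refine ⟨vc.continuousOn, vpos, fun r hr => ?_, ⟨max K (v 0), fun r hr => ?_⟩⟩
    · have hss : uIcc (r/2) r ⊆ Ioi 0 := by rw [uIcc_of_le (by linarith)]; exact fun x hx => (half_pos hr).trans_le hx.1
      have d := intervalIntegral.integral_hasDerivAt_right (((vb.wc hp).mono hss).intervalIntegrable) ((vb.wc hp).stronglyMeasurableAtFilter isOpen_Ioi r hr) ((vb.wc hp).continuousAt (Ioi_mem_nhds hr))
      have d2 := ((d.const_sub (YP n p v (r/2))).const_mul c)
      have : v =ᶠ[𝓝 r] fun x => c * (YP n p v (r/2) - ∫ ρ in (r/2)..x, OF n p v ρ / Real.sinh ρ ^ n) := by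
        filter_upwards [lt_mem_nhds (half_lt_self hr)] with x hx
        rw [← vb.diff hn hp (hB _ vb) (by linarith) hx.le, hvP x (by linarith)]; ring
      refine (d2.congr_of_eventuallyEq this).congr_deriv ?_
      unfold OF; ring
    · rcases hr.eq_or_lt with rfl | hr
      · simp
      · exact (vb.ub r hr).trans (mul_le_mul_of_nonneg_right (le_max_left _ _) (Real.exp_pos _).le)
  intro r hr
  rw [← os.unique hV hn hp hc hsub r hr.le]
  exact hlim r hr
end

section
variable {n : ℕ} {p K c : ℝ}

theorem YPlim {y : ℝ → ℝ} (h : YB n K y) (hn : 1 ≤ n) (hp : 1 < p) (hK : 0 < K) {r : ℝ} (hr : 0 ≤ r) :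
    Tendsto (fun R => ∫ ρ in r..R, OF n p y ρ / Real.sinh ρ ^ n) atTop (𝓝 (YP n p y r)) := by
  obtain ⟨B, B0, hB⟩ := ofb (n := n) (p := p) hn hp hK
  exact intervalIntegral_tendsto_integral_Ioi r ((h.wi hn hp (hB _ h)).mono_set (fun x hx => hr.trans_lt hx)) tendsto_id

theorem g1i (hn : 1 ≤ n) (hp : 1 < p) {b κ : ℝ} (hc : CS n p b κ) : IntegrableOn (fun x => (1 + Gm n b x) * (Real.exp (-(n * x)) ^ p * Real.sinh x ^ n)) (Ioi 0) := by
  have k1 := hc.k1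
  have k2 := hc.k2
  have a0 := hc.a0
  have i2 := Gm_int hc.a0 hn hc.a2 (θ := 1) (σ := p) zero_le_one (by linarith) (by nlinarith) (by linarith)
  refine ((phw hn hp).add i2).congr_fun (fun x hx => ?_) measurableSet_Ioi
  simp only [Pi.add_apply, Real.rpow_one]; ring

theorem YB.ad {y z : ℝ → ℝ} (hy : YB n K y) (hz : YB n K z) (hK : 0 < K) (hp : 1 < p) {x : ℝ} (hx : 0 < x) :
    |y x ^ p - z x ^ p| * Real.sinh x ^ n ≤ K ^ p * (Real.exp (-(n * x)) ^ p * Real.sinh x ^ n) := by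
  have w := wpos hx n
  have q1 := hy.pub hK hp hx
  have q2 := hz.pub hK hp hx
  have q3 : 0 ≤ y x ^ p * Real.sinh x ^ n := mul_nonneg (Real.rpow_nonneg (hy.nn x) _) w.le
  have q4 : 0 ≤ z x ^ p * Real.sinh x ^ n := mul_nonneg (Real.rpow_nonneg (hz.nn x) _) w.le
  rw [← abs_of_pos w, ← abs_mul, abs_of_pos w, sub_mul, abs_le]; constructor <;> linarith

theorem yerr (hn : 1 ≤ n) (hp : 1 < p) (hK : 0 < K) {b κ : ℝ} (hc : CS n p b κ) : ∃ Cm > 0, ∀ y z : ℝ → ℝ, YB n K y → YB n K z → ∀ r, 0 < r →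
    |YP n p y r - YP n p z r| ≤ Cm * Real.exp (-(n * r)) * ∫ x in Ioi (0:ℝ), (1 + Gm n b x) * (|y x ^ p - z x ^ p| * Real.sinh x ^ n) := by
  obtain ⟨Cm, Cm0, hCm⟩ := Gm_min (n := n) hc.a0 hc.a2
  refine ⟨Cm, Cm0, fun y z hy hz r hr => ?_⟩
  have ac : Continuous (fun x => |y x ^ p - z x ^ p|) := ((hy.c.rpow_const (fun _ => Or.inr (by linarith))).sub (hz.c.rpow_const (fun _ => Or.inr (by linarith)))).abs
  have awc : Continuous (fun x => |y x ^ p - z x ^ p| * Real.sinh x ^ n) := ac.mul (by fun_prop)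
  have i : IntegrableOn (fun x => (1 + Gm n b x) * (|y x ^ p - z x ^ p| * Real.sinh x ^ n)) (Ioi 0) := by
    refine Integrable.mono' ((g1i hn hp hc).const_mul (K ^ p)) (((continuousOn_const.add (Gm_cont hc.a0)).mul awc.continuousOn).aestronglyMeasurable measurableSet_Ioi) ?_
    filter_upwards [ae_restrict_mem measurableSet_Ioi] with x hx
    have G := Gm_pos (n := n) hc.a0 hx
    have w := wpos hx n
    have := hy.ad hz hK hp hx
    rw [Real.norm_of_nonneg (by positivity)]
    calc _ ≤ (1 + Gm n b x) * (K ^ p * (Real.exp (-(n * x)) ^ p * Real.sinh x ^ n)) := by gcongr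
      _ = _ := by ring
  refine le_of_tendsto ((YPlim hy hn hp hK hr.le).sub (YPlim hz hn hp hK hr.le)).abs ?_
  filter_upwards [eventually_ge_atTop r] with R hR
  have hss : uIcc r R ⊆ Ioi 0 := by rw [uIcc_of_le hR]; exact fun x hx => hr.trans_le hx.1
  rw [← intervalIntegral.integral_sub ((hy.wc hp).mono hss).intervalIntegrable ((hz.wc hp).mono hss).intervalIntegrable]
  refine (intervalIntegral.abs_integral_le_integral_abs hR).trans ?_
  have step : ∫ x in r..R, |OF n p y x / Real.sinh x ^ n - OF n p z x / Real.sinh x ^ n| ≤ ∫ ρ in r..R, (∫ x in (0:ℝ)..ρ, |y x ^ p - z x ^ p| * Real.sinh x ^ n) / Real.sinh ρ ^ n := by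
    have c2 : ContinuousOn (fun ρ => (∫ x in (0:ℝ)..ρ, |y x ^ p - z x ^ p| * Real.sinh x ^ n) / Real.sinh ρ ^ n) (Ioi 0) :=
      (intervalIntegral.continuous_primitive (fun a b => awc.intervalIntegrable a b) 0).continuousOn.div (by fun_prop) (fun x hx => (wpos hx n).ne')
    refine intervalIntegral.integral_mono_on hR ((((hy.wc hp).sub (hz.wc hp)).abs.mono hss).intervalIntegrable) ((c2.mono hss).intervalIntegrable) (fun ρ hρ => ?_)
    have ρ0 := hr.trans_le hρ.1
    have w := wpos ρ0 n
    rw [← sub_div, abs_div, abs_of_pos w]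
    refine div_le_div_of_nonneg_right ?_ w.le
    unfold OF
    rw [← intervalIntegral.integral_sub ((hy.pc hp).intervalIntegrable _ _) ((hz.pc hp).intervalIntegrable _ _)]
    refine (intervalIntegral.abs_integral_le_integral_abs ρ0.le).trans_eq (intervalIntegral.integral_congr (fun x hx => ?_))
    rw [uIcc_of_le ρ0.le] at hx
    rw [← abs_of_nonneg (wnn hx.1 n), ← abs_mul, abs_of_nonneg (wnn hx.1 n), sub_mul]
  refine step.trans ((Gm_kernel hc.a0 hc.a1 hc.a2 ac.continuousOn (fun x _ => abs_nonneg _) hr hR).trans ?_)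
  rw [intervalIntegral.integral_of_le (hr.le.trans hR), ← integral_const_mul]
  have i4 := i.const_mul (Cm * Real.exp (-(n * r)))
  refine le_trans (integral_mono_of_nonneg ?_ (IntegrableOn.mono_set i4 Ioc_subset_Ioi_self) ?_) (setIntegral_mono_set i4 ?_ (Eventually.of_forall (fun x hx => hx.1)))
  · filter_upwards [ae_restrict_mem measurableSet_Ioc] with x hx
    exact mul_nonneg (le_min (Gm_pos hc.a0 hr).le (Gm_pos hc.a0 hx.1).le) (mul_nonneg (abs_nonneg _) (wnn hx.1.le n))
  · filter_upwards [ae_restrict_mem measurableSet_Ioc] with x hx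
    have m1 := hCm r x 1 hr hx.1 zero_le_one le_rfl
    simp only [sub_self, Real.rpow_zero, Real.rpow_one, one_mul] at m1
    have w := wpos hx.1 n
    calc _ ≤ (Cm * Real.exp (-(n * r)) * (1 + Gm n b x)) * (|y x ^ p - z x ^ p| * Real.sinh x ^ n) := by gcongr
      _ = _ := by ring
  · filter_upwards [ae_restrict_mem measurableSet_Ioi] with x hx
    have := wpos hx n; have := Gm_pos (n := n) hc.a0 hx
    simp only [Pi.zero_apply]; positivity

theorem OSol.yp {V : ℝ → ℝ} (hV : OSol n p c V) (hn : 1 ≤ n) (hp : 1 < p) (hc : 0 < c) : ∃ K > 0, YB n K (fun x => V (max x 0)) ∧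
    ∀ r, 0 < r → c * YP n p (fun x => V (max x 0)) r = V r := by
  have hn0 : (0:ℝ) < n := by exact_mod_cast hn
  obtain ⟨C, hC⟩ := hV.decay
  have yb : YB n (|C| + 1) (fun x => V (max x 0)) := ⟨ext0 hV.cont, fun x => (hV.pos _ (le_max_right _ _)).le, fun x hx => by
    simp only [max_eq_left hx.le]
    exact (hC x hx.le).trans (mul_le_mul_of_nonneg_right (by linarith [le_abs_self C]) (Real.exp_pos _).le)⟩
  refine ⟨|C| + 1, by positivity, yb, fun r hr => ?_⟩
  obtain ⟨B, B0, hB⟩ := ofb (n := n) (p := p) hn hp (by positivity : 0 < |C| + 1)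
  have wi := (yb.wi hn hp (hB _ yb)).mono_set (Ioi_subset_Ioi hr.le)
  have t0 : Tendsto V atTop (𝓝 0) := by
    refine squeeze_zero' (g := fun r => C * Real.exp (-(n * r))) ?_ ?_ ?_
    · filter_upwards [eventually_ge_atTop 0] with x hx using (hV.pos x hx).le
    · filter_upwards [eventually_ge_atTop 0] with x hx using hC x hx
    · have : Tendsto (fun r : ℝ => Real.exp (-(n * r))) atTop (𝓝 0) := Real.tendsto_exp_neg_atTop_nhds_zero.comp (tendsto_id.const_mul_atTop hn0)
      simpa using this.const_mul C
  have e : ∀ x, 0 < x → -c * (∫ y in (0:ℝ)..x, V y ^ p * Real.sinh y ^ n) / Real.sinh x ^ n = -c * (OF n p (fun x => V (max x 0)) x / Real.sinh x ^ n) := fun x hx => by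
    rw [mul_div_assoc]; congr 2
    unfold OF
    refine intervalIntegral.integral_congr (fun y hy => ?_)
    rw [uIcc_of_le hx.le] at hy
    simp only [max_eq_left hy.1]
  have := integral_Ioi_of_hasDerivAt_of_tendsto' (f := V) (a := r) (fun x hx => (hV.der x (hr.trans_le hx)).congr_deriv (e x (hr.trans_le hx))) (wi.const_mul (-c)) t0
  rw [integral_const_mul] at this
  unfold YP
  linarith
end

section
variable {n : ℕ} {m T : ℝ} {U ut vr : ℝ → ℝ → ℝ} {a C : ℝ}

theorem gpm {m x g : ℝ} (hm : 0 < m) (hx : 0 ≤ x) (hg : 0 < g) : (x ^ m / g ^ m) ^ (1/m) = x / g := by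
  rw [← Real.div_rpow hx hg.le, ← Real.rpow_mul (div_nonneg hx hg.le), mul_one_div_cancel hm.ne', Real.rpow_one]

theorem FD.OFe (h : FD n m T U ut vr) (hm : 0 < m) {t g : ℝ} (hg : 0 < g) (ρ : ℝ) :
    OF n (1/m) (fun x => U x t ^ m / g ^ m) ρ = FF n U ρ t / g := by
  unfold OF FF
  rw [← intervalIntegral.integral_div]
  refine intervalIntegral.integral_congr (fun x hx => ?_)
  simp only [gpm hm (h.nonneg x t) hg]; ring

theorem FD.YPe (h : FD n m T U ut vr) (hm : 0 < m) {t g : ℝ} (hg : 0 < g) (r : ℝ) :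
    YP n (1/m) (fun x => U x t ^ m / g ^ m) r = PP n U r t / g := by
  unfold YP PP
  rw [← integral_div]
  refine integral_congr_ae (Eventually.of_forall fun x => ?_)
  simp only [h.OFe hm hg]; ring

theorem FD.XXe (h : FD n m T U ut vr) (hm : 0 < m) {t g : ℝ} (hg : 0 < g) :
    ∫ x in Ioi (0:ℝ), (U x t ^ m / g ^ m) ^ (1/m) * Real.sinh x ^ n * (U x t ^ m / g ^ m) = XX n m U t / g ^ (1 + m) := by
  unfold XX
  rw [← integral_div]
  refine integral_congr_ae (Eventually.of_forall fun x => ?_)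
  simp only [gpm hm (h.nonneg x t) hg]
  rw [Real.rpow_add hg, Real.rpow_one]; field_simp

theorem FD.lemG (h : FD n m T U ut vr) (hn : 1 ≤ n) (hm : 0 < m) (hm1 : m < 1) (hT : 0 < T) (hsub : 1/m * (n - 1) < n + 3) (hk : DK n m U (T/4) a C) {b κ : ℝ} (hc : CS n (1/m) b κ)
    {V : ℝ → ℝ} (hV : OSol n (1/m) (1 / ((1 - m) * T)) V) {η : ℝ} (hη : 0 < η) :
    ∃ δ > 0, ∃ t0 < T, ∀ t ∈ Ioo t0 T, ∀ μ, |μ - 1 / ((1 - m) * T)| ≤ δ → (∀ r, 0 < r → (U r t ^ m / gg m T t ^ m - μ * (PP n U r t / gg m T t)) ^ 2 ≤ Gm n b r * δ) →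
      ∀ r, 0 < r → |1 / ((1 - m) * T) * (PP n U r t / gg m T t) - V r| ≤ η * Real.exp (-(n * r)) := by
  have hp : 1 < 1/m := by rw [lt_div_iff₀ hm]; linarith
  have c0 : 0 < 1 / ((1 - m) * T) := by have : 0 < 1 - m := by linarith
                                        positivity
  set c := 1 / ((1 - m) * T) with hcd
  obtain ⟨K1, K10, hK1⟩ := h.vub hn hm hm1 hT hk hc
  obtain ⟨K2, K20, hVb, hVP⟩ := hV.yp hn hp c0
  obtain ⟨-, ⟨x0, x00, hx0⟩, -⟩ := h.out hn hm hm1 (ε := T/4) ⟨by linarith, by linarith⟩ hk hc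
  set K := max K1 K2 with hKd
  have K0 : 0 < K := lt_max_of_lt_left K10
  have Vb : YB n K (fun x => V (max x 0)) := ⟨hVb.c, hVb.nn, fun x hx => (hVb.ub x hx).trans (mul_le_mul_of_nonneg_right (le_max_right _ _) (Real.exp_pos _).le)⟩
  obtain ⟨Cm, Cm0, hCm⟩ := yerr (n := n) hn hp K0 hc
  by_contra hcon
  push Not at hcon
  have ex : ∀ k : ℕ, ∃ t ∈ Ioo (T - T/8/(k+1)) T, ∃ μ, |μ - c| ≤ 1/((k:ℝ)+1) ∧ (∀ r, 0 < r → (U r t ^ m / gg m T t ^ m - μ * (PP n U r t / gg m T t)) ^ 2 ≤ Gm n b r * (1/((k:ℝ)+1))) ∧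
      ∃ r, 0 < r ∧ η * Real.exp (-(n * r)) < |c * (PP n U r t / gg m T t) - V r| := fun k =>
    hcon (1/((k:ℝ)+1)) (by positivity) (T - T/8/(k+1)) (sub_lt_self _ (by positivity))
  choose t ht μ hμ hgd r hr hbad using ex
  have tT : ∀ k, t k < T := fun k => (ht k).2
  have t78 : ∀ k, 7*T/8 ≤ t k := fun k => by
    have := (ht k).1
    have : T/8/((k:ℝ)+1) ≤ T/8 := div_le_self (by positivity) (by have := Nat.cast_nonneg (α := ℝ) k; linarith)
    linarith
  have g0 : ∀ k, 0 < gg m T (t k) := fun k => gpos hT (tT k)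
  set y : ℕ → ℝ → ℝ := fun k x => U x (t k) ^ m / gg m T (t k) ^ m with hy
  have yb : ∀ k, YB n K (y k) := fun k => ⟨(h.vsl hm _).div_const _, fun x => div_nonneg (Real.rpow_nonneg (h.nonneg _ _) _) (Real.rpow_nonneg (g0 k).le _), fun x hx =>
    (hK1 (t k) ⟨t78 k, tT k⟩ x hx).trans (mul_le_mul_of_nonneg_right (le_max_left _ _) (Real.exp_pos _).le)⟩
  have yp : ∀ k r, YP n (1/m) (y k) r = PP n U r (t k) / gg m T (t k) := fun k r => h.YPe hm (g0 k) r
  obtain ⟨L, ns, hns, hL⟩ := ysub hn hp K0 yb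
  have l1 : Tendsto (fun k : ℕ => 1/((k:ℝ)+1)) atTop (𝓝 0) := tendsto_one_div_add_atTop_nhds_zero_nat
  have l1' := l1.comp hns.tendsto_atTop
  have hμl : Tendsto (fun k => μ (ns k)) atTop (𝓝 c) := by
    rw [tendsto_iff_dist_tendsto_zero]
    exact squeeze_zero (fun k => dist_nonneg) (fun k => by rw [Real.dist_eq]; exact hμ (ns k)) l1'
  have hyl : ∀ r, 0 < r → Tendsto (fun k => y (ns k) r - μ (ns k) * YP n (1/m) (y (ns k)) r) atTop (𝓝 0) := fun r hr => by
    have sq : Tendsto (fun k => (y (ns k) r - μ (ns k) * YP n (1/m) (y (ns k)) r) ^ 2) atTop (𝓝 0) := by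
      refine squeeze_zero (g := fun k => Gm n b r * (1/(((ns k : ℕ):ℝ)+1))) (fun k => sq_nonneg _) (fun k => ?_) ?_
      · rw [yp]; have := hgd (ns k) r hr; simpa using this
      · have := l1'.const_mul (Gm n b r)
        simpa [Function.comp_def] using this
    have := sq.sqrt
    simp only [Real.sqrt_sq_eq_abs, Real.sqrt_zero] at this
    exact (tendsto_zero_iff_abs_tendsto_zero _).2 this
  have hX : ∀ k, x0 ≤ ∫ x in Ioi (0:ℝ), y (ns k) x ^ (1/m) * Real.sinh x ^ n * y (ns k) x := fun k => by
    have e := h.XXe hm (g0 (ns k)) (t := t (ns k))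
    simp only [hy]; rw [e, le_div_iff₀ (Real.rpow_pos_of_pos (g0 _) _)]
    exact hx0 _ ⟨by linarith [t78 (ns k)], tT _⟩
  have hlim := yid hn hp c0 hsub K0 hV (fun k => yb (ns k)) hL hμl hyl x00 hX
  have E0 : Tendsto (fun k => ∫ x in Ioi (0:ℝ), (1 + Gm n b x) * (|y (ns k) x ^ (1/m) - V (max x 0) ^ (1/m)| * Real.sinh x ^ n)) atTop (𝓝 0) := by
    rw [show 𝓝 (0:ℝ) = 𝓝 (∫ x in Ioi (0:ℝ), (0:ℝ)) by simp]
    refine tendsto_integral_of_dominated_convergence (fun x => K ^ (1/m) * ((1 + Gm n b x) * (Real.exp (-(n * x)) ^ (1/m) * Real.sinh x ^ n))) ?_ ((g1i hn hp hc).const_mul _) ?_ ?_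
    · intro k
      have c1 : Continuous (fun x => |y (ns k) x ^ (1/m) - V (max x 0) ^ (1/m)| * Real.sinh x ^ n) :=
        (((yb (ns k)).c.rpow_const (fun _ => Or.inr (by linarith))).sub (hVb.c.rpow_const (fun _ => Or.inr (by linarith)))).abs.mul (by fun_prop)
      exact ((continuousOn_const.add (Gm_cont hc.a0)).mul c1.continuousOn).aestronglyMeasurable measurableSet_Ioi
    · intro k
      filter_upwards [ae_restrict_mem measurableSet_Ioi] with x hx
      have G := Gm_pos (n := n) hc.a0 hx
      have w := wpos hx n
      have := (yb (ns k)).ad Vb K0 hp hx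
      rw [Real.norm_of_nonneg (by positivity)]
      calc _ ≤ (1 + Gm n b x) * (K ^ (1/m) * (Real.exp (-(n * x)) ^ (1/m) * Real.sinh x ^ n)) := by gcongr
        _ = _ := by ring
    · filter_upwards [ae_restrict_mem measurableSet_Ioi] with x hx
      have l := (((((hlim x hx).rpow_const (p := 1/m) (Or.inr (by linarith))).sub_const (V (max x 0) ^ (1/m))).abs).mul_const (Real.sinh x ^ n)).const_mul (1 + Gm n b x)
      rw [max_eq_left (le_of_lt hx)] at l ⊢
      simpa using l
  obtain ⟨k, hk⟩ := (E0.eventually (gt_mem_nhds (show 0 < η / (c * Cm) by positivity))).exists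
  have b1 := hCm _ _ (yb (ns k)) Vb (r (ns k)) (hr _)
  have b2 := hbad (ns k)
  rw [← yp, ← hVP _ (hr _), ← mul_sub, abs_mul, abs_of_pos c0] at b2
  have ep := Real.exp_pos (-(n * r (ns k)))
  have b3 : c * |YP n (1/m) (y (ns k)) (r (ns k)) - YP n (1/m) (fun x => V (max x 0)) (r (ns k))| ≤ c * (Cm * Real.exp (-(n * r (ns k))) * (η / (c * Cm))) :=
    mul_le_mul_of_nonneg_left (b1.trans (mul_le_mul_of_nonneg_left hk.le (by positivity))) c0.le
  have : c * (Cm * Real.exp (-(n * r (ns k))) * (η / (c * Cm))) = η * Real.exp (-(n * r (ns k))) := by field_simp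
  linarith
end

theorem tang {α x z : ℝ} (hα : 1 ≤ α) (hx : 0 < x) (hz : 0 < z) : x ^ α + α * x ^ (α - 1) * (z - x) ≤ z ^ α := by
  have b := one_add_mul_self_le_rpow_one_add (s := z / x - 1) (by have := div_pos hz hx; linarith) hα
  rw [add_sub_cancel, Real.div_rpow hz.le hx.le, le_div_iff₀ (by positivity)] at b
  refine le_trans (le_of_eq ?_) b
  rw [Real.rpow_sub hx, Real.rpow_one]; field_simp

section
variable {n : ℕ} {m T : ℝ} {U ut vr : ℝ → ℝ → ℝ} {a C : ℝ}

theorem ggm {t : ℝ} (hm1 : m < 1) (hT : 0 < T) (ht : t < T) : gg m T t ^ m = (1 - t/T) ^ (m / (1 - m)) := by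
  unfold gg; rw [← Real.rpow_mul (gx hT ht).le]; congr 1; ring

theorem ggt {t1 t2 : ℝ} (hm : 0 < m) (hm1 : m < 1) (hT : 0 < T) (h1 : t1 < T) (h2 : t2 < T) :
    gg m T t1 - gg m T t2 ≤ 1 / ((1 - m) * T) * (t2 - t1) * gg m T t1 ^ m := by
  have q : 0 < 1 - m := by linarith
  have := tang (α := 1 / (1 - m)) (by rw [le_div_iff₀ q]; linarith) (gx hT h1) (gx hT h2)
  rw [ggm hm1 hT h1]
  unfold gg
  rw [show 1 / (1 - m) - 1 = m / (1 - m) by field_simp; ring] at this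
  have e : 1 / ((1 - m) * T) * (t2 - t1) * (1 - t1/T) ^ (m / (1 - m)) = - (1 / (1 - m) * (1 - t1/T) ^ (m / (1 - m)) * (1 - t2/T - (1 - t1/T))) := by
    field_simp; ring
  linarith

theorem FD.bcv (h : FD n m T U ut vr) (hn : 1 ≤ n) (hm : 0 < m) (hm1 : m < 1) (hT : 0 < T) {t1 t2 r d : ℝ} (h1 : 3 * T / 4 ≤ t1) (h2 : t1 ≤ t2) (h3 : t2 < T) (hr : 0 ≤ r)
    (hd : d < 1) (h4 : t2 - t1 ≤ d * (T / 2)) (hd0 : 0 ≤ d) : (1 - d) ^ (m / (1 - m)) * U r t2 ^ m ≤ U r t1 ^ m := by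
  have b := h.bc hn hm hm1 (ε := T / 4) (by linarith) (by linarith) h2 h3 hr
  have q : 0 < 1 - m := by linarith
  have b1 : (1 - d) ^ (1 / (1 - m)) ≤ ((t1 - T/4) / (t2 - T/4)) ^ (1 / (1 - m)) := by
    refine Real.rpow_le_rpow (by linarith) ?_ (by positivity)
    rw [le_div_iff₀ (by linarith)]
    have : d * (T/2) ≤ d * (t2 - T/4) := mul_le_mul_of_nonneg_left (by linarith) hd0
    linarith
  have b2 := (mul_le_mul_of_nonneg_right b1 (h.nonneg r t2)).trans b
  have b3 := Real.rpow_le_rpow (mul_nonneg (Real.rpow_nonneg (by linarith) _) (h.nonneg r t2)) b2 hm.le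
  rw [Real.mul_rpow (Real.rpow_nonneg (by linarith) _) (h.nonneg r t2), ← Real.rpow_mul (by linarith), show 1 / (1 - m) * m = m / (1 - m) by ring] at b3
  exact b3

theorem hsel {ω ε : ℝ} (hε : 0 < ε) : ∃ h : ℝ, 0 < h ∧ h < 1/6 ∧ (1 + 3 * h) ^ ω / (1 - 3 * h) ^ ω ≤ 1 + ε / 2 ∧ 1 - ε / 2 ≤ (1 - 3 * h) ^ ω * (1 - 3 * h) ^ ω := by
  have c1 : ContinuousAt (fun h : ℝ => (1 + 3 * h) ^ ω) 0 := ContinuousAt.rpow_const (by fun_prop) (Or.inl (by norm_num))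
  have c2 : ContinuousAt (fun h : ℝ => (1 - 3 * h) ^ ω) 0 := ContinuousAt.rpow_const (by fun_prop) (Or.inl (by norm_num))
  have l1 := (c1.div c2 (by norm_num)).tendsto
  have l2 := (c2.mul c2).tendsto
  norm_num at l1 l2
  have e1 := l1.eventually (gt_mem_nhds (show (1:ℝ) < 1 + ε/2 by linarith))
  have e2 := l2.eventually (lt_mem_nhds (show 1 - ε/2 < (1:ℝ) by linarith))
  have e3 : ∀ᶠ h in 𝓝[>] (0:ℝ), h < 1/6 := nhdsWithin_le_nhds (gt_mem_nhds (by norm_num))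
  obtain ⟨h, ⟨h1, h2, h3⟩, h4⟩ := (((e1.filter_mono nhdsWithin_le_nhds).and ((e2.filter_mono nhdsWithin_le_nhds).and e3)).and (self_mem_nhdsWithin (s := Ioi (0:ℝ)))).exists
  exact ⟨h, h4, h3, h1.le, h2.le⟩

theorem upalg {ε c q A hh T τ d Y G Gm G1 G2 G1m B x P1 P2 η : ℝ} (hε : 0 < ε) (c0 : 0 < c) (qp : 0 < q) (A0 : 0 < A) (hh0 : 0 < hh) (hT : 0 < T) (τ0 : 0 < τ)
    (b3 : hh * τ ≤ d) (V0 : 0 < Y) (g0 : 0 < G) (gm0 : 0 < Gm) (gT : G * T = Gm * τ) (g21 : G2 ≤ G1) (g1 : G1 ≤ A * G) (g1m : G1m ≤ B * Gm) (gd : G1 - G2 ≤ c * d * G1m)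
    (L : q * x * d ≤ P1 - P2) (p1 : c * P1 - G1 * Y ≤ η * (G1 * Y)) (p2 : -(η * (G2 * Y)) ≤ c * P2 - G2 * Y) (s1 : B / q ≤ 1 + ε / 2)
    (hη : η = ε / 2 * q * (c * hh * T) / (2 * A)) : x / Gm ≤ (1 + ε) * Y := by
  have η0 : 0 < η := by rw [hη]; positivity
  have d0 : 0 < d := lt_of_lt_of_le (mul_pos hh0 τ0) b3
  have m1 : c * (q * x * d) ≤ Y * (G1 - G2 + 2 * η * G1) := by
    have := mul_le_mul_of_nonneg_left L c0.le
    have : η * (G2 * Y) ≤ η * (G1 * Y) := by gcongr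
    linarith
  have m2 : 2 * η * G1 ≤ d * (2 * η * A / (hh * T)) * Gm := by
    calc 2 * η * G1 ≤ 2 * η * (A * G) := by gcongr
      _ = 2 * η * A / T * (G * T) := by field_simp
      _ = (hh * τ) * (2 * η * A / (hh * T)) * Gm := by rw [gT]; field_simp
      _ ≤ _ := by gcongr
  have m3 : c * d * G1m ≤ c * d * (B * Gm) := mul_le_mul_of_nonneg_left g1m (by positivity)
  have e2 : 2 * η * A / (hh * T) = c * (ε / 2 * q) := by rw [hη]; field_simp
  rw [e2] at m2
  have m4 : (c * d) * (q * x) ≤ (c * d) * (Y * (Gm * (B + ε / 2 * q))) := by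
    have := mul_le_mul_of_nonneg_left (add_le_add (gd.trans m3) m2) V0.le
    linarith
  have m5 := le_of_mul_le_mul_left m4 (by positivity)
  rw [div_le_iff₀ gm0]
  rw [div_le_iff₀ qp] at s1
  have m6 : q * x ≤ q * ((1 + ε) * Y * Gm) := by
    refine m5.trans ?_
    calc Y * (Gm * (B + ε / 2 * q)) ≤ Y * (Gm * ((1 + ε / 2) * q + ε / 2 * q)) := by gcongr
      _ = _ := by ring
  exact le_of_mul_le_mul_left m6 qp

theorem loalg {ε c q A hh T τ d Y G Gm G1 G2 G2m x P1 P2 η : ℝ} (hε : 0 < ε) (c0 : 0 < c) (qp : 0 < q) (q1 : q ≤ 1) (A1 : 1 ≤ A) (hh0 : 0 < hh) (hT : 0 < T) (τ0 : 0 < τ)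
    (b3 : hh * τ ≤ d) (V0 : 0 < Y) (g0 : 0 < G) (gm0 : 0 < Gm) (gT : G * T = Gm * τ) (g21 : G2 ≤ G1) (g1 : G1 ≤ G) (g2m : q * Gm ≤ G2m) (gd : G2 - G1 ≤ c * (-d) * G2m)
    (L : q * (P1 - P2) ≤ x * d) (p1 : -(η * (G1 * Y)) ≤ c * P1 - G1 * Y) (p2 : c * P2 - G2 * Y ≤ η * (G2 * Y)) (s2 : 1 - ε / 2 ≤ q * q)
    (hη : η = ε / 2 * q * (c * hh * T) / (2 * A)) : (1 - ε) * Y ≤ x / Gm := by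
  have A0 : 0 < A := by linarith
  have η0 : 0 < η := by rw [hη]; positivity
  have d0 : 0 < d := lt_of_lt_of_le (mul_pos hh0 τ0) b3
  have m1 : Y * (G1 - G2 - 2 * η * G) ≤ c * (P1 - P2) := by
    have : η * (G2 * Y) ≤ η * (G1 * Y) := by gcongr
    have : η * (G1 * Y) ≤ η * (G * Y) := by gcongr
    linarith
  have m2 : 2 * η * G ≤ d * (2 * η / (hh * T)) * Gm := by
    calc 2 * η * G = 2 * η / T * (G * T) := by field_simp
      _ = (hh * τ) * (2 * η / (hh * T)) * Gm := by rw [gT]; field_simp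
      _ ≤ _ := by gcongr
  have e2 : 2 * η / (hh * T) = c * (ε / 2 * (q / A)) := by rw [hη]; field_simp
  rw [e2] at m2
  have m3 : c * d * (q * Gm) ≤ c * d * G2m := mul_le_mul_of_nonneg_left g2m (by positivity)
  have m4 : (c * d) * (q * (Y * (Gm * (q - ε / 2 * (q / A))))) ≤ (c * d) * x := by
    have k1 : c * d * (q * Gm) - d * (c * (ε / 2 * (q / A))) * Gm ≤ G1 - G2 - 2 * η * G := by linarith
    have k2 := mul_le_mul_of_nonneg_left (mul_le_mul_of_nonneg_left k1 V0.le) qp.le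
    have k3 := mul_le_mul_of_nonneg_left m1 qp.le
    have k4 := mul_le_mul_of_nonneg_left L c0.le
    linarith
  have m5 := le_of_mul_le_mul_left m4 (by positivity)
  rw [le_div_iff₀ gm0]
  refine le_trans ?_ m5
  have qA : q / A ≤ q := div_le_self qp.le A1
  have k5 : 1 - ε ≤ q * (q - ε / 2 * (q / A)) := by
    have : q * (ε / 2 * (q / A)) ≤ 1 * (ε / 2 * 1) := by gcongr; linarith
    linarith
  calc (1 - ε) * Y * Gm ≤ (q * (q - ε / 2 * (q / A))) * Y * Gm := by gcongr
    _ = _ := by ring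

theorem FD.goodw (h : FD n m T U ut vr) (hn : 1 ≤ n) (hm : 0 < m) (hm1 : m < 1) (hT : 0 < T) (hsub : 1/m * (n - 1) < n + 3)
    {V : ℝ → ℝ} (hV : OSol n (1/m) (1 / ((1 - m) * T)) V) {kV : ℝ} (kV0 : 0 < kV) (hVl : ∀ r, 0 < r → kV * Real.exp (-(n * r)) ≤ V r) {η hh : ℝ} (η0 : 0 < η) (hh0 : 0 < hh) (hh1 : hh < 1/6) :
    ∃ tS, 3 * T / 4 ≤ tS ∧ tS < T ∧ ∀ s, tS < s → s < T → ∃ t' ∈ Icc s (s + hh/2 * (T - s)), t' < T ∧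
      ∀ r, 0 < r → |1 / ((1 - m) * T) * PP n U r t' - gg m T t' * V r| ≤ η * (gg m T t' * V r) := by
  have hp : 1 < 1/m := by rw [lt_div_iff₀ hm]; linarith
  obtain ⟨a, C, hk⟩ := h.dk hn hm hm1 (ε := T/4) ⟨by linarith, by linarith⟩
  obtain ⟨b, κ, hc⟩ := cst (n := n) (p := 1/m) hn hp hsub
  obtain ⟨δ, δ0, tG, tGT, hG⟩ := h.lemG hn hm hm1 hT hsub hk hc hV (η := η * kV) (by positivity)
  obtain ⟨-, -, out⟩ := h.out hn hm hm1 (ε := T/4) ⟨by linarith, by linarith⟩ hk hc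
  obtain ⟨tO, htO, hO⟩ := out (hh/2) ⟨by linarith, by linarith⟩ δ δ0
  refine ⟨max (max tO tG) (3 * T / 4), le_max_right _ _, max_lt (max_lt htO.2 tGT) (by linarith), fun s hs hsT => ?_⟩
  obtain ⟨t', ht', μ, hμ, hg⟩ := hO s ⟨(le_max_left _ _ |>.trans (le_max_left _ _)).trans_lt hs, hsT⟩
  have tT' : t' < T := by
    have : hh/2 * (T - s) < 1 * (T - s) := mul_lt_mul_of_pos_right (by linarith) (by linarith)
    linarith [ht'.2]
  refine ⟨t', ht', tT', fun r hr => ?_⟩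
  have g0 : 0 < gg m T t' := gpos hT tT'
  have := hG t' ⟨((le_max_right tO tG).trans (le_max_left _ _)).trans_lt (hs.trans_le ht'.1), tT'⟩ μ hμ hg r hr
  have e : 1 / ((1 - m) * T) * PP n U r t' - gg m T t' * V r = gg m T t' * (1 / ((1 - m) * T) * (PP n U r t' / gg m T t') - V r) := by field_simp
  rw [e, abs_mul, abs_of_pos g0]
  calc _ ≤ gg m T t' * (η * (kV * Real.exp (-(n * r)))) := mul_le_mul_of_nonneg_left (by linarith) g0.le
    _ ≤ gg m T t' * (η * V r) := mul_le_mul_of_nonneg_left (mul_le_mul_of_nonneg_left (hVl r hr) η0.le) g0.le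
    _ = _ := by ring

theorem FD.unif (h : FD n m T U ut vr) (hn : 1 ≤ n) (hm : 0 < m) (hm1 : m < 1) (hT : 0 < T) (hsub : 1/m * (n - 1) < n + 3)
    {V : ℝ → ℝ} (hV : OSol n (1/m) (1 / ((1 - m) * T)) V) {kV : ℝ} (kV0 : 0 < kV) (hVl : ∀ r, 0 < r → kV * Real.exp (-(n * r)) ≤ V r) {ε : ℝ} (hε : 0 < ε) :
    ∃ t0 ∈ Ioo 0 T, ∀ t ∈ Ico t0 T, ∀ r, 0 < r → |U r t ^ m / gg m T t ^ m - V r| ≤ ε * V r := by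
  have q1 : 0 < 1 - m := by linarith
  have c0 : 0 < 1 / ((1 - m) * T) := by positivity
  obtain ⟨a, C, hk⟩ := h.dk hn hm hm1 (ε := T/4) ⟨by linarith, by linarith⟩
  obtain ⟨hh, hh0, hh1, s1, s2⟩ := hsel (ω := m / (1 - m)) hε
  have α0 : 0 < 1 / (1 - m) := by positivity
  have ω0 : 0 < m / (1 - m) := by positivity
  have d0 : 0 < 1 - 3 * hh := by linarith
  obtain ⟨q, hq⟩ : ∃ q, q = (1 - 3 * hh) ^ (m / (1 - m)) := ⟨_, rfl⟩
  have qp : 0 < q := by rw [hq]; positivity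
  have qle : q ≤ 1 := by rw [hq]; exact Real.rpow_le_one d0.le (by linarith) ω0.le
  obtain ⟨A, hA⟩ : ∃ A, A = (1 + 3 * hh) ^ (1 / (1 - m)) := ⟨_, rfl⟩
  have A1 : 1 ≤ A := by rw [hA]; exact Real.one_le_rpow (by linarith) α0.le
  have A0 : 0 < A := by linarith
  rw [← hq] at s1 s2
  obtain ⟨c, hcd⟩ : ∃ c, c = 1 / ((1 - m) * T) := ⟨_, rfl⟩
  have good' := fun (η : ℝ) (η0 : 0 < η) => h.goodw hn hm hm1 hT hsub hV kV0 hVl η0 hh0 hh1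
  rw [← hcd] at c0 hV
  simp only [← hcd] at good'
  obtain ⟨η, hη⟩ : ∃ η, η = ε / 2 * q * (c * hh * T) / (2 * A) := ⟨_, rfl⟩
  obtain ⟨tS, tS34, tST, good⟩ := good' η (by rw [hη]; positivity)
  clear good'
  refine ⟨(T + tS) / 2, ⟨by linarith, by linarith⟩, fun t ht r hr => ?_⟩
  have tT := ht.2
  obtain ⟨τ, hτ⟩ : ∃ τ, τ = T - t := ⟨_, rfl⟩
  have τ0 : 0 < τ := by linarith
  have hτ' : 0 < hh * τ := by positivity
  have h6 : hh * τ < τ / 6 := by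
    have := mul_lt_mul_of_pos_right hh1 τ0; linarith
  have tt : tS ≤ t - τ := by rw [hτ]; linarith [ht.1]
  have V0 := hV.pos r hr.le
  have g0 : 0 < gg m T t := gpos hT tT
  have gm0 : 0 < gg m T t ^ m := by positivity
  have gT : gg m T t * T = gg m T t ^ m * τ := by
    have := gmul hm1 hT tT
    have e : (1 - t/T) * T = τ := by rw [hτ]; field_simp
    rw [← e, ← mul_assoc, this]
  have X0 := gx hT tT
  have eX : 1 - t/T = τ / T := by rw [hτ]; field_simp
  have v0 : 0 ≤ U r t ^ m := Real.rpow_nonneg (h.nonneg _ _) _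
  have up : U r t ^ m / gg m T t ^ m ≤ (1 + ε) * V r := by
    obtain ⟨t1, ht1, t1T, hP1⟩ := good (t - 3 * (hh * τ)) (by linarith) (by linarith)
    obtain ⟨t2, ht2, t2T, hP2⟩ := good (t - hh * τ) (by linarith) (by linarith)
    have b1 : t1 ≤ t - 2 * (hh * τ) := by
      have e : T - (t - 3 * (hh * τ)) = τ + 3 * (hh * τ) := by rw [hτ]; ring
      have := ht1.2; rw [e] at this
      have : hh/2 * (τ + 3 * (hh * τ)) ≤ hh/2 * (2 * τ) := mul_le_mul_of_nonneg_left (by linarith) (by linarith)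
      linarith
    have b2 : t2 ≤ t := by
      have e : T - (t - hh * τ) = τ + hh * τ := by rw [hτ]; ring
      have := ht2.2; rw [e] at this
      have : hh/2 * (τ + hh * τ) ≤ hh/2 * (2 * τ) := mul_le_mul_of_nonneg_left (by linarith) (by linarith)
      linarith
    have b3 : hh * τ ≤ t2 - t1 := by linarith [ht2.1]
    have b4 : 0 < t2 - t1 := by linarith
    have Kd := h.Ptd hn hm (by linarith : 0 < T/4) hk hr (by linarith [ht1.1] : T/4 ≤ t1) (by linarith : t1 ≤ t2) t2T
    have L : q * U r t ^ m * (t2 - t1) ≤ PP n U r t1 - PP n U r t2 := by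
      rw [Kd, hq]
      have := intervalIntegral.integral_mono_on (μ := volume) (f := fun _ => (1 - 3 * hh) ^ (m / (1 - m)) * U r t ^ m) (by linarith : t1 ≤ t2) (continuous_const.intervalIntegrable _ _) ((h.vtl hm r).intervalIntegrable t1 t2) (fun s hs => h.bcv hn hm hm1 hT (d := 3 * hh) (r := r) (by linarith [ht1.1, hs.1]) (hs.2.trans b2) tT hr.le (by linarith) (by
        have : 3 * (hh * τ) ≤ 3 * hh * (T/2) := by
          rw [← mul_assoc]; exact mul_le_mul_of_nonneg_left (by linarith) (by linarith)
        linarith [ht1.1, hs.1]) (by linarith))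
      rw [intervalIntegral.integral_const, smul_eq_mul] at this
      exact (le_of_eq (by ring)).trans this
    have p1 := (abs_le.1 (hP1 r hr)).2
    have p2 := (abs_le.1 (hP2 r hr)).1
    have x1 : 1 - t1/T ≤ (1 + 3 * hh) * (1 - t/T) := by
      have : 0 ≤ (t1 - (t - 3 * (hh * τ))) / T := div_nonneg (by linarith [ht1.1]) hT.le
      have e : (t1 - (t - 3 * (hh * τ))) / T = t1/T - t/T + 3 * hh * (τ / T) := by ring
      rw [e, ← eX] at this; linarith
    have g1 : gg m T t1 ≤ A * gg m T t := by
      unfold gg; rw [hA, ← Real.mul_rpow (by linarith) X0.le]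
      exact Real.rpow_le_rpow (gx hT t1T).le x1 α0.le
    have g1m : gg m T t1 ^ m ≤ (1 + 3 * hh) ^ (m / (1 - m)) * gg m T t ^ m := by
      rw [ggm hm1 hT t1T, ggm hm1 hT tT, ← Real.mul_rpow (by linarith) X0.le]
      exact Real.rpow_le_rpow (gx hT t1T).le x1 ω0.le
    have g21 : gg m T t2 ≤ gg m T t1 := Real.rpow_le_rpow (gx hT t2T).le (by have := div_le_div_of_nonneg_right (by linarith : t1 ≤ t2) hT.le; linarith) α0.le
    have gd := ggt hm hm1 hT t1T t2T
    rw [← hcd] at gd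
    exact upalg hε c0 qp A0 hh0 hT τ0 b3 V0 g0 gm0 gT g21 g1 g1m gd L p1 p2 s1 hη
  have lo : (1 - ε) * V r ≤ U r t ^ m / gg m T t ^ m := by
    have h3T : 3 * (hh * τ) < τ := by linarith
    obtain ⟨t1, ht1, t1T, hP1⟩ := good t (by linarith) tT
    obtain ⟨t2, ht2, t2T, hP2⟩ := good (t + 2 * (hh * τ)) (by linarith) (by linarith)
    have b1 : t1 ≤ t + hh * τ := by
      have := ht1.2; rw [← hτ] at this; linarith
    have b2 : t2 ≤ t + 3 * (hh * τ) := by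
      have e : T - (t + 2 * (hh * τ)) = τ - 2 * (hh * τ) := by rw [hτ]; ring
      have := ht2.2; rw [e] at this
      have : hh/2 * (τ - 2 * (hh * τ)) ≤ hh/2 * (2 * τ) := mul_le_mul_of_nonneg_left (by linarith) (by linarith)
      linarith
    have b3 : hh * τ ≤ t2 - t1 := by linarith [ht2.1]
    have b4 : 0 < t2 - t1 := by linarith
    have Kd := h.Ptd hn hm (by linarith : 0 < T/4) hk hr (by linarith [ht1.1] : T/4 ≤ t1) (by linarith : t1 ≤ t2) t2T
    have L : q * (PP n U r t1 - PP n U r t2) ≤ U r t ^ m * (t2 - t1) := by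
      rw [Kd, ← intervalIntegral.integral_const_mul]
      have := intervalIntegral.integral_mono_on (μ := volume) (by linarith : t1 ≤ t2) (g := fun _ => U r t ^ m) ((continuous_const.mul (h.vtl hm r)).intervalIntegrable t1 t2) (continuous_const.intervalIntegrable _ _) (fun s hs => h.bcv hn hm hm1 hT (d := 3 * hh) (r := r) (t1 := t) (t2 := s) (by linarith [ht1.1, hs.1]) (ht1.1.trans hs.1) (hs.2.trans_lt t2T) hr.le (by linarith) (by
        have : 3 * (hh * τ) ≤ 3 * hh * (T/2) := by
          rw [← mul_assoc]; exact mul_le_mul_of_nonneg_left (by linarith) (by linarith)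
        linarith [ht1.1, hs.2]) (by linarith))
      rw [intervalIntegral.integral_const, smul_eq_mul] at this
      rw [hq]; exact this.trans (le_of_eq (by ring))
    have p1 := (abs_le.1 (hP1 r hr)).1
    have p2 := (abs_le.1 (hP2 r hr)).2
    have x2 : (1 - 3 * hh) * (1 - t/T) ≤ 1 - t2/T := by
      have : 0 ≤ (t + 3 * (hh * τ) - t2) / T := div_nonneg (by linarith) hT.le
      have e : (t + 3 * (hh * τ) - t2) / T = t/T - t2/T + 3 * hh * (τ / T) := by ring
      rw [e, ← eX] at this; linarith
    have g1 : gg m T t1 ≤ gg m T t := Real.rpow_le_rpow (gx hT t1T).le (by have := div_le_div_of_nonneg_right ht1.1 hT.le; linarith) α0.le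
    have g2m : q * gg m T t ^ m ≤ gg m T t2 ^ m := by
      rw [ggm hm1 hT t2T, ggm hm1 hT tT, hq, ← Real.mul_rpow d0.le X0.le]
      exact Real.rpow_le_rpow (by positivity) x2 ω0.le
    have g21 : gg m T t2 ≤ gg m T t1 := Real.rpow_le_rpow (gx hT t2T).le (by have := div_le_div_of_nonneg_right (by linarith : t1 ≤ t2) hT.le; linarith) α0.le
    have gd := ggt hm hm1 hT t2T t1T
    rw [← hcd, show t1 - t2 = -(t2 - t1) by ring] at gd
    exact loalg hε c0 qp qle A1 hh0 hT τ0 b3 V0 g0 gm0 gT g21 g1 g2m gd L p1 p2 s2 hη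
  rw [abs_le]; constructor <;> linarith
end

noncomputable def Vd (V : ℝ → ℝ) (k : ℕ) (r : ℝ) : ℝ := iteratedDerivWithin k V (Ici 0) r

/-- working form of the profile -/
structure PV (n : ℕ) (p c : ℝ) (V : ℝ → ℝ) : Prop where
  n1 : 1 ≤ n
  p1 : 1 < p
  c0 : 0 < c
  sm : ContDiffOn ℝ (⊤ : ℕ∞) V (Ici 0)
  pos : ∀ r, 0 ≤ r → 0 < V r
  hd : ∀ k r, 0 < r → HasDerivAt (Vd V k) (Vd V (k+1) r) r
  bd : ∀ k, ∃ C, ∀ r, 0 ≤ r → |Vd V k r| ≤ C * V r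
  ode : ∀ r, 0 < r → Vd V 2 r + n * (Real.cosh r / Real.sinh r) * Vd V 1 r + c * V r ^ p = 0
  up : ∃ C, 0 < C ∧ ∀ r, 0 ≤ r → V r ≤ C * Real.exp (-(n * r))
  lo : ∃ C, 0 < C ∧ ∀ r, 0 ≤ r → C * Real.exp (-(n * r)) ≤ V r

theorem bdlim {f : ℝ → ℝ} {l : ℝ} (hf : ContinuousOn f (Ici 0)) (h : Tendsto f atTop (𝓝 l)) : ∃ C, ∀ r, 0 ≤ r → |f r| ≤ C := by
  have e := h.abs.eventually (gt_mem_nhds (show |l| < |l| + 1 by linarith))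
  obtain ⟨R, hR⟩ := eventually_atTop.1 e
  obtain ⟨C, hC⟩ := isCompact_Icc.exists_bound_of_continuousOn (hf.mono (Icc_subset_Ici_self : Icc 0 (max R 0) ⊆ Ici 0))
  refine ⟨max C (|l| + 1), fun r hr => ?_⟩
  rcases le_total R r with h1 | h1
  · exact (hR r h1).le.trans (le_max_right _ _)
  · exact (hC r ⟨hr, h1.trans (le_max_left _ _)⟩).trans (le_max_left _ _)

theorem Vd0 (V : ℝ → ℝ) : Vd V 0 = V := by funext r; simp [Vd]

theorem PV.of {N : ℕ} {m T : ℝ} {V : ℝ → ℝ} (hN : 2 ≤ N) (hm : 0 < m) (hm1 : m < 1) (hT : 0 < T) (h : IsStationaryProfile N m T V) :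
    PV (N - 1) (1/m) (1 / ((1 - m) * T)) V := by
  have ncast : ((N - 1 : ℕ) : ℝ) = (N:ℝ) - 1 := by rw [Nat.cast_sub (by omega)]; simp
  have q : 0 < 1 - m := by linarith
  have ud := uniqueDiffOn_Ici (0:ℝ)
  have hcd : ∀ r, 0 < r → ContDiffAt ℝ (⊤ : ℕ∞) V r := fun r hr => h.smooth.contDiffAt (Ici_mem_nhds hr)
  have hc : ∀ k, ContinuousOn (Vd V k) (Ici 0) := fun k => h.smooth.continuousOn_iteratedDerivWithin (by exact_mod_cast le_top) ud
  have heq : ∀ k r, 0 < r → Vd V k r = iteratedDeriv k V r := fun k r hr =>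
    iteratedDerivWithin_eq_iteratedDeriv ud ((hcd r hr).of_le (by exact_mod_cast le_top)) hr.le
  have hd : ∀ k r, 0 < r → HasDerivAt (Vd V k) (Vd V (k+1) r) r := fun k r hr => by
    have hdd : DifferentiableOn ℝ (Vd V k) (Ici 0) := h.smooth.differentiableOn_iteratedDerivWithin (by exact_mod_cast (WithTop.coe_lt_top _)) ud
    have := (hdd r hr.le).hasDerivWithinAt
    rw [show derivWithin (Vd V k) (Ici 0) r = Vd V (k+1) r by unfold Vd; rw [iteratedDerivWithin_succ]] at this
    exact this.hasDerivAt (Ici_mem_nhds hr)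
  obtain ⟨l, l0, has⟩ := h.asymp
  have hlim : ∀ k, Tendsto (fun r => Real.exp (((N - 1 : ℕ) : ℝ) * r) * Vd V k r) atTop (𝓝 ((-1 : ℝ) ^ k * ((N : ℝ) - 1) ^ k * l)) := fun k => by
    refine (has k).congr' ?_
    filter_upwards [eventually_gt_atTop 0] with r hr
    rw [heq k r hr, ncast]
  have h0 := hlim 0
  simp only [pow_zero, one_mul, Vd0] at h0
  have hVp : ∀ r, 0 ≤ r → 0 < V r := fun r hr => h.pos r hr
  have hVc : ContinuousOn V (Ici 0) := h.smooth.continuousOn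
  have hE : Continuous (fun r : ℝ => Real.exp (((N - 1 : ℕ) : ℝ) * r)) := by fun_prop
  refine ⟨by omega, by rw [lt_div_iff₀ hm]; linarith, by positivity, h.smooth, hVp, hd, fun k => ?_, fun r hr => ?_, ?_, ?_⟩
  · have c1 : ContinuousOn (fun r => Vd V k r / V r) (Ici 0) := (hc k).div hVc (fun r hr => (hVp r hr).ne')
    have l1 : Tendsto (fun r => Vd V k r / V r) atTop (𝓝 ((-1 : ℝ) ^ k * ((N : ℝ) - 1) ^ k * l / l)) := by
      refine ((hlim k).div h0 l0.ne').congr (fun r => ?_)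
      exact mul_div_mul_left _ _ (Real.exp_pos _).ne'
    obtain ⟨C, hC⟩ := bdlim c1 l1
    refine ⟨C, fun r hr => ?_⟩
    have := hC r hr
    rwa [abs_div, abs_of_pos (hVp r hr), div_le_iff₀ (hVp r hr)] at this
  · have := h.ode r hr
    rw [heq 2 r hr, heq 1 r hr, ncast, iteratedDeriv_succ, iteratedDeriv_one]
    rw [← this]; ring
  · obtain ⟨C, hC⟩ := bdlim (hE.continuousOn.mul hVc) h0
    refine ⟨max C 1, by positivity, fun r hr => ?_⟩
    have h1 := (le_abs_self _).trans ((hC r hr).trans (le_max_left C 1))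
    rw [Real.exp_neg, ← div_eq_mul_inv, le_div_iff₀ (Real.exp_pos _), mul_comm]; exact h1
  · obtain ⟨C, hC⟩ := bdlim ((hE.continuousOn.mul hVc).inv₀ (fun r hr => (mul_pos (Real.exp_pos _) (hVp r hr)).ne')) (h0.inv₀ l0.ne')
    refine ⟨(max C 1)⁻¹, by positivity, fun r hr => ?_⟩
    have h1 := (le_abs_self _).trans ((hC r hr).trans (le_max_left C 1))
    have h2 := inv_le_of_inv_le₀ (mul_pos (Real.exp_pos _) (hVp r hr)) h1
    rw [Real.exp_neg, ← div_eq_mul_inv, div_le_iff₀ (Real.exp_pos _), mul_comm]; exact h2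

theorem PV.os {n : ℕ} {p c : ℝ} {V : ℝ → ℝ} (h : PV n p c V) : OSol n p c V := by
  have ud := uniqueDiffOn_Ici (0:ℝ)
  have hVc : ContinuousOn V (Ici 0) := h.sm.continuousOn
  have hc : ContinuousOn (Vd V 1) (Ici 0) := h.sm.continuousOn_iteratedDerivWithin (by exact_mod_cast le_top) ud
  have hd0 : ∀ r, 0 < r → HasDerivAt V (Vd V 1 r) r := fun r hr => by have := h.hd 0 r hr; rwa [Vd0] at this
  obtain ⟨C, C0, hC⟩ := h.up
  refine ⟨hVc, h.pos, fun r hr => ?_, C, hC⟩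
  have cF : ContinuousOn (fun x => V x ^ p * Real.sinh x ^ n) (Ici 0) := by
    refine ContinuousOn.mul (hVc.rpow_const (fun x hx => Or.inl (h.pos x hx).ne')) (by fun_prop)
  have sp := Real.sinh_pos_iff.2 hr
  have ft : ∫ x in (0:ℝ)..r, -c * (V x ^ p * Real.sinh x ^ n) = Real.sinh r ^ n * Vd V 1 r - Real.sinh 0 ^ n * Vd V 1 0 := by
    refine intervalIntegral.integral_eq_sub_of_hasDerivAt_of_le hr.le (f := fun x => Real.sinh x ^ n * Vd V 1 x) ?_ (fun x hx => ?_) ?_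
    · exact ContinuousOn.mul (by fun_prop) (hc.mono Icc_subset_Ici_self)
    · have h1 := ((Real.hasDerivAt_sinh x).pow n).mul (h.hd 1 x hx.1)
      refine HasDerivAt.congr_deriv h1 ?_
      have s0 := (Real.sinh_pos_iff.2 hx.1).ne'
      have o := h.ode x hx.1
      have : Vd V (1+1) x = -(n * (Real.cosh x / Real.sinh x) * Vd V 1 x + c * V x ^ p) := by linarith
      simp only [Pi.pow_apply]
      rw [this]
      obtain ⟨k, rfl⟩ : ∃ k, n = k + 1 := ⟨n - 1, by have := h.n1; omega⟩
      rw [Nat.add_sub_cancel, pow_succ]; field_simp; ring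
    · exact ((continuousOn_const.mul cF).mono (by rw [uIcc_of_le hr.le]; exact Icc_subset_Ici_self)).intervalIntegrable
  rw [intervalIntegral.integral_const_mul, Real.sinh_zero, zero_pow (by have := h.n1; omega), zero_mul, sub_zero] at ft
  refine HasDerivAt.congr_deriv (hd0 r hr) ?_
  rw [ft]; field_simp

theorem mx1 {a ρ : ℝ} {G Gr ω E : ℝ → ℝ} (hρ : a < ρ) (hG : ∀ r ∈ Ioo a ρ, G r ≤ G a) (cG : ContinuousOn G (Ico a ρ))
    (dG : ∀ r ∈ Ioo a ρ, HasDerivAt G (Gr r) r) (cω : ContinuousOn (fun r => ω r * Gr r) (Ico a ρ)) (z : ω a * Gr a = 0)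
    (ωp : ∀ r ∈ Ioo a ρ, 0 < ω r) (dω : ∀ r ∈ Ioo a ρ, HasDerivAt (fun r => ω r * Gr r) (ω r * E r) r) (Ep : ∀ r ∈ Ioo a ρ, 0 < E r) : False := by
  have m1 : StrictMonoOn (fun r => ω r * Gr r) (Ico a ρ) := by
    refine strictMonoOn_of_hasDerivWithinAt_pos (convex_Ico a ρ) cω (f' := fun r => ω r * E r) (fun r hr => ?_) (fun r hr => ?_)
    · rw [interior_Ico] at hr; exact (dω r hr).hasDerivWithinAt
    · rw [interior_Ico] at hr; exact mul_pos (ωp r hr) (Ep r hr)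
  have g1 : ∀ r ∈ Ioo a ρ, 0 < Gr r := fun r hr => by
    have := m1 ⟨le_rfl, hρ⟩ ⟨hr.1.le, hr.2⟩ hr.1
    simp only [z] at this
    exact (mul_pos_iff_of_pos_left (ωp r hr)).1 this
  have m2 : StrictMonoOn G (Ico a ρ) := by
    refine strictMonoOn_of_hasDerivWithinAt_pos (convex_Ico a ρ) cG (f' := Gr) (fun r hr => ?_) (fun r hr => ?_)
    · rw [interior_Ico] at hr; exact (dG r hr).hasDerivWithinAt
    · rw [interior_Ico] at hr; exact g1 r hr
  have h1 : (a + ρ)/2 ∈ Ioo a ρ := ⟨by linarith, by linarith⟩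
  exact absurd (m2 ⟨le_rfl, hρ⟩ ⟨h1.1.le, h1.2⟩ h1.1) (not_lt.2 (hG _ h1))

theorem tmax {g : ℝ → ℝ} {g' a s : ℝ} (h : HasDerivAt g g' s) (ha : a < s) (hm : ∀ σ ∈ Icc a s, g σ ≤ g s) : 0 ≤ g' := by
  have h1 : IsLocalMaxOn g (Icc a s) s := by
    filter_upwards [self_mem_nhdsWithin] with σ hσ using hm σ hσ
  have h2 := h1.hasFDerivWithinAt_nonpos (h.hasDerivWithinAt.hasFDerivWithinAt) (y := a - s)
    (mem_posTangentConeAt_of_segment_subset (by rw [add_sub_cancel, segment_symm, segment_eq_Icc ha.le]))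
  simp at h2
  nlinarith

/-- algebra in the maximum lemma -/
theorem mxalg {χ χr χrr χs F Fr Frr Fs β b c0 C0 C1 : ℝ} (hc0 : 0 < c0) (hC0 : 0 ≤ C0) (χ0 : 0 < χ) (χ1 : χ ≤ 1) (hF : 0 ≤ F)
    (hL : β * Fs - Frr - b * Fr ≤ -c0 * F ^ 2 + C0) (hC : 2 * χr ^ 2 / χ + |χrr| + |b * χr| + β * χs ≤ C1) (hM : 1 + (C0 + C1) / c0 < χ * F) (hC1 : 0 ≤ C1) :
    c0 + β * (χs * F + χ * Fs) + 2 * χr * (χr * F + χ * Fr) / χ ≤ χrr * F + 2 * χr * Fr + χ * Frr + b * (χr * F + χ * Fr) := by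
  have e : 2 * χr * (χr * F + χ * Fr) / χ = 2 * χr ^ 2 / χ * F + 2 * χr * Fr := by field_simp
  have a1 := neg_abs_le χrr
  have a2 := neg_abs_le (b * χr)
  have a3 : (2 * χr ^ 2 / χ - χrr - b * χr + β * χs) * F ≤ C1 * F := mul_le_mul_of_nonneg_right (by linarith) hF
  have a4 := mul_le_mul_of_nonneg_left hL χ0.le
  have G1 : 1 ≤ χ * F := by have : 0 ≤ (C0 + C1)/c0 := by positivity
                            linarith
  have a5 : c0 + C1 * F ≤ χ * (c0 * F ^ 2 - C0) := by
    have k : c0 + C0 + C1 < c0 * (χ * F) := by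
      have : 1 + (C0 + C1)/c0 = (c0 + C0 + C1)/c0 := by field_simp; ring
      rw [this, div_lt_iff₀ hc0] at hM; linarith
    have F1 : 1 ≤ F := G1.trans (by nlinarith)
    have k2 := mul_le_mul_of_nonneg_right k.le hF
    nlinarith
  rw [e]; nlinarith

theorem maxl {I : Set ℝ} (hI : IsOpen I) {F : ℝ × ℝ → ℝ} (hF : Sm I F) {R0 ν s0 ϑ : ℝ} (hϑ : 0 < ϑ) (hν : 0 < ν) (hR : R0 = 0 ∨ ν < R0)
    (hsub : Icc s0 (s0 + ϑ) ⊆ I) (hF0 : ∀ p, 0 ≤ F p) {β : ℝ × ℝ → ℝ} {b ω : ℝ → ℝ} {c0 C0 K K' : ℝ} (hc0 : 0 < c0) (hC0 : 0 ≤ C0) (hK' : 0 ≤ K')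
    (hω : ∀ r, 0 < r → HasDerivAt ω (b r * ω r) r) (ωp : ∀ r, 0 < r → 0 < ω r) (cω : ContinuousOn ω (Ici 0)) (ω0 : ω 0 = 0)
    (hβ : ∀ r s, 0 < r → |r - R0| < ν → s ∈ Ioc s0 (s0 + ϑ) → 0 ≤ β (r, s) ∧ β (r, s) ≤ K * ϑ)
    (hb : ∀ r, 0 < r → |r - R0| < ν → |b r| * |r - R0| ≤ K')
    (hL : ∀ r s, 0 < r → |r - R0| < ν → s ∈ Ioc s0 (s0 + ϑ) → β (r, s) * ds I F (r, s) - dr I (dr I F) (r, s) - b r * dr I F (r, s) ≤ -c0 * F (r, s) ^ 2 + C0) :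
    ∀ r, 0 < r → |r - R0| ≤ ν / 2 → F (r, s0 + ϑ) ≤ 2 * (1 + (C0 + (K + (4 * K' + 40) / ν ^ 2)) / c0) := by
  have R00 : 0 ≤ R0 := by rcases hR with h | h <;> linarith
  obtain ⟨C1, hC1⟩ : ∃ C1, C1 = K + (4 * K' + 40) / ν ^ 2 := ⟨_, rfl⟩
  rw [← hC1]
  have K0 : 0 ≤ K := by
    have h1 := hβ (R0 + ν/2) (s0 + ϑ) (by linarith) (by rw [add_sub_cancel_left, abs_of_pos] <;> linarith) ⟨by linarith, le_rfl⟩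
    exact nonneg_of_mul_nonneg_left (h1.1.trans h1.2) hϑ
  have C10 : 0 ≤ C1 := by rw [hC1]; positivity
  -- the cut-off
  obtain ⟨q, hq⟩ : ∃ q : ℝ → ℝ, q = fun r => 1 - ((r - R0)/ν)^2 := ⟨_, rfl⟩
  have cq : Continuous q := by rw [hq]; fun_prop
  have dq : ∀ r, HasDerivAt q (-2 * ((r - R0)/ν) / ν) r := fun r => by
    rw [hq]
    refine HasDerivAt.congr_deriv (((((hasDerivAt_id r).sub_const R0).div_const ν).pow 2).const_sub 1) ?_
    simp; ring
  obtain ⟨σ, hσ⟩ : ∃ σ : ℝ → ℝ, σ = fun s => (s - s0)/ϑ := ⟨_, rfl⟩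
  have cσ : Continuous σ := by rw [hσ]; fun_prop
  have cF : ContinuousOn F (Ici 0 ×ˢ I) := hF.continuousOn
  obtain ⟨Kc, hKc⟩ : ∃ Kc : Set (ℝ × ℝ), Kc = Icc (max 0 (R0 - ν)) (R0 + ν) ×ˢ Icc s0 (s0 + ϑ) := ⟨_, rfl⟩
  have Ksub : Kc ⊆ Ici 0 ×ˢ I := by
    rw [hKc]; exact prod_mono (fun x hx => (le_max_left _ _).trans hx.1) hsub
  have cG : ContinuousOn (fun p : ℝ × ℝ => σ p.2 * q p.1 ^ 2 * F p) (Ici 0 ×ˢ I) := ContinuousOn.mul (by fun_prop) cF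
  have mle : max 0 (R0 - ν) ≤ R0 + ν := max_le (by linarith) (by linarith)
  have Kne : Kc.Nonempty := by
    rw [hKc]; exact ⟨(R0 + ν, s0), ⟨mle, le_rfl⟩, ⟨le_rfl, by linarith⟩⟩
  obtain ⟨⟨a, s⟩, has, hmax⟩ := (by rw [hKc]; exact isCompact_Icc.prod isCompact_Icc : IsCompact Kc).exists_isMaxOn Kne (cG.mono Ksub)
  have hmax' : ∀ r τ, max 0 (R0 - ν) ≤ r → r ≤ R0 + ν → s0 ≤ τ → τ ≤ s0 + ϑ → σ τ * q r ^ 2 * F (r, τ) ≤ σ s * q a ^ 2 * F (a, s) := fun r τ h1 h2 h3 h4 =>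
    hmax (show ((r, τ) : ℝ × ℝ) ∈ Kc by rw [hKc]; exact ⟨⟨h1, h2⟩, h3, h4⟩)
  -- key claim
  have key : σ s * q a ^ 2 * F (a, s) ≤ 1 + (C0 + C1) / c0 := by
    by_contra hcon
    push Not at hcon
    rw [hKc] at has
    obtain ⟨⟨ha1, ha2⟩, hs1, hs2⟩ := has
    simp only at ha1 ha2 hs1 hs2
    have a0 : 0 ≤ a := (le_max_left _ _).trans ha1
    have Gp : 0 < σ s * q a ^ 2 * F (a, s) := lt_of_le_of_lt (by positivity) hcon
    have hs1' : s0 < s := by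
      rcases hs1.lt_or_eq with h | h
      · exact h
      · rw [← h] at Gp; simp [hσ] at Gp
    have sI : s ∈ I := hsub ⟨hs1, hs2⟩
    have σ0 : 0 < σ s := by rw [hσ]; exact div_pos (by linarith) hϑ
    have σ1 : σ s ≤ 1 := by rw [hσ]; exact (div_le_one hϑ).2 (by linarith)
    have qa : q a ≠ 0 := fun h => by rw [h] at Gp; simp at Gp
    have ha3 : a < R0 + ν := by
      rcases ha2.lt_or_eq with h | h
      · exact h
      · exfalso; apply qa; rw [h, hq]; simp [hν.ne']
    have ha4 : R0 - ν < a := by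
      rcases ((le_max_right 0 (R0 - ν)).trans ha1).lt_or_eq with h | h
      · exact h
      · exfalso; apply qa; rw [← h, hq]; simp [hν.ne']
    -- spatial functions at time s
    have cr : ∀ {H : ℝ × ℝ → ℝ}, Sm I H → ContinuousOn (fun r => H (r, s)) (Ici 0) := fun hH =>
      hH.continuousOn.comp (by fun_prop) (fun r hr => ⟨hr, sI⟩)
    have c_0 := cr hF
    have c_r := cr (hF.dr hI)
    have c_s := cr (hF.ds hI)
    obtain ⟨χr, hχr⟩ : ∃ χr : ℝ → ℝ, χr = fun r => σ s * (2 * q r * (-2 * ((r - R0)/ν) / ν)) := ⟨_, rfl⟩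
    have cχr : Continuous χr := by rw [hχr]; fun_prop
    have dχ : ∀ r, HasDerivAt (fun r => σ s * q r ^ 2) (χr r) r := fun r => by
      rw [hχr]; refine HasDerivAt.congr_deriv (((dq r).pow 2).const_mul (σ s)) ?_
      simp
    obtain ⟨χrr, hχrr⟩ : ∃ χrr : ℝ → ℝ, χrr = fun r => σ s * (8 * ((r - R0)/ν)^2 - 4 * q r) / ν^2 := ⟨_, rfl⟩
    have dχr : ∀ r, HasDerivAt χr (χrr r) r := fun r => by
      rw [hχr, hχrr]
      have h1 := (((dq r).const_mul 2).mul (((((hasDerivAt_id r).sub_const R0).div_const ν).const_mul (-2)).div_const ν)).const_mul (σ s)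
      refine HasDerivAt.congr_deriv h1 ?_
      simp; field_simp; ring
    obtain ⟨Gr, hGr⟩ : ∃ Gr : ℝ → ℝ, Gr = fun r => χr r * F (r, s) + σ s * q r ^ 2 * dr I F (r, s) := ⟨_, rfl⟩
    have cGr : ContinuousOn Gr (Ici 0) := by
      rw [hGr]; exact (cχr.continuousOn.mul c_0).add (ContinuousOn.mul (by fun_prop) c_r)
    have dG : ∀ r, 0 < r → HasDerivAt (fun r => σ s * q r ^ 2 * F (r, s)) (Gr r) r := fun r hr => by
      rw [hGr]; exact (dχ r).mul (hF.hr hr sI)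
    obtain ⟨E, hE⟩ : ∃ E : ℝ → ℝ, E = fun r => χrr r * F (r, s) + 2 * χr r * dr I F (r, s) + σ s * q r ^ 2 * dr I (dr I F) (r, s) + b r * Gr r := ⟨_, rfl⟩
    have dω : ∀ r, 0 < r → HasDerivAt (fun r => ω r * Gr r) (ω r * E r) r := fun r hr => by
      have h1 := ((dχr r).mul (hF.hr hr sI)).add ((dχ r).mul ((hF.dr hI).hr hr sI))
      have h2 : HasDerivAt Gr (χrr r * F (r, s) + χr r * dr I F (r, s) + (χr r * dr I F (r, s) + σ s * q r ^ 2 * dr I (dr I F) (r, s))) r := by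
        rw [hGr]; exact h1
      refine HasDerivAt.congr_deriv ((hω r hr).mul h2) ?_
      rw [hE]; ring
    -- value at a
    have za : χr a * Gr a = 0 ∧ ω a * Gr a = 0 := by
      rcases a0.lt_or_eq with h | h
      · have : Gr a = 0 := by
          refine IsLocalMax.hasDerivAt_eq_zero (f := fun r => σ s * q r ^ 2 * F (r, s)) ?_ (dG a h)
          filter_upwards [Ioo_mem_nhds ha4 ha3, lt_mem_nhds h] with r hr hr0
          exact hmax' r s (max_le hr0.le hr.1.le) hr.2.le hs1 hs2
        rw [this]; simp
      · rw [← h]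
        have : R0 = 0 := by
          rcases hR with h' | h'
          · exact h'
          · linarith
        rw [ω0, hχr, this]; simp
    have Gs0 : 0 ≤ q a ^ 2 / ϑ * F (a, s) + σ s * q a ^ 2 * ds I F (a, s) := by
      have h1 : HasDerivAt (fun τ => σ τ * q a ^ 2) (q a ^ 2 / ϑ) s := by
        rw [hσ]; refine HasDerivAt.congr_deriv ((((hasDerivAt_id s).sub_const s0).div_const ϑ).mul_const (q a ^ 2)) ?_
        ring
      exact tmax (h1.mul (hF.hs hI a0 sI)) hs1' (fun τ hτ => hmax' a τ ha1 ha2 hτ.1 (hτ.2.trans hs2))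
    -- neighbourhood
    obtain ⟨Gs, hGs⟩ : ∃ Gs : ℝ → ℝ, Gs = fun r => q r ^ 2 / ϑ * F (r, s) + σ s * q r ^ 2 * ds I F (r, s) := ⟨_, rfl⟩
    have cGs : ContinuousOn Gs (Ici 0) := by
      rw [hGs]; exact (ContinuousOn.mul (by fun_prop) c_0).add (ContinuousOn.mul (by fun_prop) c_s)
    have aI : a ∈ Ici (0:ℝ) := a0
    have qa2 : 0 < σ s * q a ^ 2 := by positivity
    have e1 : ∀ᶠ r in 𝓝[Ici 0] a, 1 + (C0 + C1) / c0 < σ s * q r ^ 2 * F (r, s) :=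
      ((ContinuousOn.mul (by fun_prop) c_0 : ContinuousOn (fun r => σ s * q r ^ 2 * F (r, s)) (Ici 0)) a aI).eventually (lt_mem_nhds hcon)
    have e2 : ∀ᶠ r in 𝓝[Ici 0] a, -(c0 / (4 * (K * ϑ + 1))) < Gs r := by
      refine (cGs a aI).eventually (lt_mem_nhds ?_)
      rw [hGs]; have : 0 < c0 / (4 * (K * ϑ + 1)) := by positivity
      simp only; linarith
    have e3 : ∀ᶠ r in 𝓝[Ici 0] a, -(c0/4) < 2 * χr r * Gr r / (σ s * q r ^ 2) := by
      have c3 : ContinuousWithinAt (fun r => 2 * χr r * Gr r / (σ s * q r ^ 2)) (Ici 0) a :=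
        ((continuousOn_const.mul cχr.continuousOn).mul cGr a aI).div (Continuous.continuousWithinAt (by fun_prop)) qa2.ne'
      refine c3.eventually (lt_mem_nhds ?_)
      show -(c0/4) < 2 * χr a * Gr a / (σ s * q a ^ 2)
      rw [mul_assoc, za.1]; simp; linarith
    obtain ⟨ε, ε0, hε⟩ := Metric.mem_nhdsWithin_iff.1 (e1.and (e2.and e3))
    have hρ : a < min (a + ε) (R0 + ν) := lt_min (by linarith) ha3
    refine mx1 (G := fun r => σ s * q r ^ 2 * F (r, s)) (Gr := Gr) (ω := ω) (E := E) hρ (fun r hr => ?_) ?_ (fun r hr => dG r (a0.trans_lt hr.1)) ?_ za.2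
      (fun r hr => ωp r (a0.trans_lt hr.1)) (fun r hr => dω r (a0.trans_lt hr.1)) (fun r hr => ?_)
    · exact hmax' r s (ha1.trans hr.1.le) (hr.2.le.trans (min_le_right _ _)) hs1 hs2
    · exact (ContinuousOn.mul (by fun_prop) c_0).mono (fun r hr => a0.trans hr.1)
    · exact (cω.mul cGr).mono (fun r hr => a0.trans hr.1)
    · have r0 : 0 < r := a0.trans_lt hr.1
      obtain ⟨f1, f2, f3⟩ := hε (show r ∈ Metric.ball a ε ∩ Ici 0 from ⟨by
        rw [Metric.mem_ball, Real.dist_eq, abs_of_pos] <;> linarith [hr.1, hr.2.trans_le (min_le_left _ _)], r0.le⟩)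
      have rR : |r - R0| < ν := abs_lt.2 ⟨by linarith [hr.1], by linarith [hr.2.trans_le (min_le_right _ _)]⟩
      have hsI : s ∈ Ioc s0 (s0 + ϑ) := ⟨hs1', hs2⟩
      obtain ⟨b1, b2⟩ := hβ r s r0 rR hsI
      obtain ⟨x, hx⟩ : ∃ x, x = (r - R0)/ν := ⟨_, rfl⟩
      have x1 : |x| < 1 := by rw [hx, abs_div, abs_of_pos hν, div_lt_one hν]; exact rR
      have x2 : x^2 < 1 := (sq_lt_one_iff_abs_lt_one x).2 x1
      have qe : q r = 1 - x^2 := by rw [hq, hx]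
      have q0 : 0 < q r := by rw [qe]; linarith
      have q1 : q r ≤ 1 := by rw [qe]; linarith [sq_nonneg x]
      have χ0 : 0 < σ s * q r ^ 2 := by positivity
      have χ1 : σ s * q r ^ 2 ≤ 1 := mul_le_one₀ σ1 (by positivity) (pow_le_one₀ q0.le q1)
      have hC : 2 * (χr r) ^ 2 / (σ s * q r ^ 2) + |χrr r| + |b r * χr r| + β (r, s) * (q r ^ 2 / ϑ) ≤ C1 := by
        have k1 : 2 * (χr r) ^ 2 / (σ s * q r ^ 2) ≤ 32 / ν^2 := by
          have : 2 * (χr r) ^ 2 / (σ s * q r ^ 2) = 32 * (σ s * x^2) / ν^2 := by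
            rw [hχr]; simp only; rw [← hx]; field_simp; ring
          rw [this]; gcongr
          have := mul_le_one₀ σ1 (sq_nonneg x) x2.le; linarith
        have k2 : |χrr r| ≤ 8 / ν^2 := by
          rw [hχrr]; simp only; rw [← hx, abs_div, abs_mul, abs_of_pos σ0, abs_of_pos (by positivity : 0 < ν^2)]
          gcongr
          have : |8 * x ^ 2 - 4 * q r| ≤ 8 := abs_le.2 ⟨by rw [qe]; linarith [sq_nonneg x], by linarith⟩
          calc σ s * |8 * x ^ 2 - 4 * q r| ≤ 1 * 8 := by gcongr
            _ = 8 := by ring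
        have k3 : |b r * χr r| ≤ 4 * K' / ν^2 := by
          have : |b r * χr r| = σ s * q r * 4 * (|b r| * |r - R0|) / ν^2 := by
            rw [hχr]; simp only; rw [abs_mul, abs_mul, abs_mul, abs_div, abs_mul, abs_mul, abs_div, abs_of_pos σ0, abs_of_pos hν, abs_of_pos q0]
            norm_num; field_simp; norm_num; ring
          rw [this]; refine div_le_div_of_nonneg_right ?_ (by positivity)
          have := hb r r0 rR
          calc σ s * q r * 4 * (|b r| * |r - R0|) ≤ 1 * 1 * 4 * K' := by gcongr
            _ = 4 * K' := by ring
        have k4 : β (r, s) * (q r ^ 2 / ϑ) ≤ K := by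
          calc β (r, s) * (q r ^ 2 / ϑ) ≤ (K * ϑ) * (1 / ϑ) := by
                gcongr; exact pow_le_one₀ q0.le q1
            _ = K := by field_simp
        have : C1 = 32 / ν^2 + 8 / ν^2 + 4 * K' / ν^2 + K := by rw [hC1]; ring
        rw [this]; linarith
      have al := mxalg (β := β (r, s)) hc0 hC0 χ0 χ1 (hF0 (r, s)) (hL r s r0 rR hsI) hC f1 C10
      have g1 : -(c0/4) ≤ β (r, s) * Gs r := by
        have : 0 < c0 / (4 * (K * ϑ + 1)) := by positivity
        calc -(c0/4) ≤ -(β (r, s) * (c0 / (4 * (K * ϑ + 1)))) := by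
              apply neg_le_neg
              calc β (r, s) * (c0 / (4 * (K * ϑ + 1))) ≤ (K * ϑ + 1) * (c0 / (4 * (K * ϑ + 1))) := by gcongr; linarith
                _ = c0/4 := by field_simp
          _ = β (r, s) * (-(c0 / (4 * (K * ϑ + 1)))) := by ring
          _ ≤ _ := mul_le_mul_of_nonneg_left f2.le b1
      have e4 : Gr r = χr r * F (r, s) + σ s * q r ^ 2 * dr I F (r, s) := by rw [hGr]
      have e5 : Gs r = q r ^ 2 / ϑ * F (r, s) + σ s * q r ^ 2 * ds I F (r, s) := by rw [hGs]
      rw [← e4, ← e5] at al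
      rw [hE]; simp only; linarith
  intro r hr hrR
  have h1 := hmax' r (s0 + ϑ) (max_le hr.le (by linarith [(abs_le.1 hrR).1])) (by linarith [(abs_le.1 hrR).2]) (by linarith) le_rfl
  have σe : σ (s0 + ϑ) = 1 := by rw [hσ]; simp [hϑ.ne']
  have x2 : ((r - R0)/ν)^2 ≤ 1/4 := by
    rw [div_pow, div_le_iff₀ (by positivity)]
    have := sq_le_sq' (abs_le.1 hrR).1 (abs_le.1 hrR).2
    linarith
  have q2 : 1/2 ≤ q r ^ 2 := by
    have : 3/4 ≤ q r := by rw [hq]; simp only; linarith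
    nlinarith
  rw [σe, one_mul] at h1
  have := mul_le_mul_of_nonneg_right q2 (hF0 (r, s0 + ϑ))
  linarith

section
variable {I : Set ℝ} {F G : ℝ × ℝ → ℝ}
theorem Sm.mul (hF : Sm I F) (hG : Sm I G) : Sm I (fun p => F p * G p) := ContDiffOn.mul hF hG
theorem Sm.add (hF : Sm I F) (hG : Sm I G) : Sm I (fun p => F p + G p) := ContDiffOn.add hF hG
theorem Sm.const (c : ℝ) : Sm I (fun _ => c) := contDiffOn_const
theorem Sm.dr_eq (h : Sm I F) {r s d : ℝ} (hr : 0 < r) (hs : s ∈ I) (hd : HasDerivAt (fun ρ => F (ρ, s)) d r) : _root_.dr I F (r, s) = d :=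
  (h.hr hr hs).unique hd
theorem Sm.ds_eq (h : Sm I F) (hI : IsOpen I) {r s d : ℝ} (hr : 0 ≤ r) (hs : s ∈ I) (hd : HasDerivAt (fun σ => F (r, σ)) d s) : _root_.ds I F (r, s) = d :=
  (h.hs hI hr hs).unique hd
theorem Sm.dr_cg {s : ℝ} (hF : Sm I F) (hs : s ∈ I) {E : ℝ → ℝ} (h : ∀ ρ, 0 < ρ → F (ρ, s) = E ρ) {r d : ℝ} (hr : 0 < r) (hd : HasDerivAt E d r) : _root_.dr I F (r, s) = d :=
  hF.dr_eq hr hs (hd.congr_of_eventuallyEq (by filter_upwards [lt_mem_nhds hr] with ρ hρ using h ρ hρ))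

/-- the parabolic operator -/
noncomputable def Lop (I : Set ℝ) (β : ℝ × ℝ → ℝ) (b : ℝ → ℝ) (F : ℝ × ℝ → ℝ) (r s : ℝ) : ℝ := β (r, s) * ds I F (r, s) - dr I (dr I F) (r, s) - b r * dr I F (r, s)

theorem dr_mul (hF : Sm I F) (hG : Sm I G) {r s : ℝ} (hr : 0 < r) (hs : s ∈ I) :
    dr I (fun p => F p * G p) (r, s) = dr I F (r, s) * G (r, s) + F (r, s) * dr I G (r, s) :=
  (hF.mul hG).dr_eq hr hs ((hF.hr hr hs).mul (hG.hr hr hs))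
theorem dr_cadd (hF : Sm I F) (c : ℝ) {r s : ℝ} (hr : 0 < r) (hs : s ∈ I) : dr I (fun p => c + F p) (r, s) = dr I F (r, s) :=
  ((Sm.const c).add hF).dr_eq hr hs ((hF.hr hr hs).const_add c)

theorem Lop_mul (hI : IsOpen I) (hF : Sm I F) (hG : Sm I G) (β : ℝ × ℝ → ℝ) (b : ℝ → ℝ) {r s : ℝ} (hr : 0 < r) (hs : s ∈ I) :
    Lop I β b (fun p => F p * G p) r s = F (r, s) * Lop I β b G r s + G (r, s) * Lop I β b F r s - 2 * (dr I F (r, s) * dr I G (r, s)) := by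
  have h2 : dr I (dr I (fun p => F p * G p)) (r, s) = dr I (dr I F) (r, s) * G (r, s) + dr I F (r, s) * dr I G (r, s) + (dr I F (r, s) * dr I G (r, s) + F (r, s) * dr I (dr I G) (r, s)) :=
    ((hF.mul hG).dr hI).dr_cg hs (fun ρ hρ => dr_mul hF hG hρ hs) hr ((((hF.dr hI).hr hr hs).mul (hG.hr hr hs)).add ((hF.hr hr hs).mul ((hG.dr hI).hr hr hs)))
  have h3 := (hF.mul hG).ds_eq hI hr.le hs ((hF.hs hI hr.le hs).mul (hG.hs hI hr.le hs))
  unfold Lop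
  rw [h2, h3, dr_mul hF hG hr hs]; ring

theorem Lop_cadd (hI : IsOpen I) (hF : Sm I F) (c : ℝ) (β : ℝ × ℝ → ℝ) (b : ℝ → ℝ) {r s : ℝ} (hr : 0 < r) (hs : s ∈ I) :
    Lop I β b (fun p => c + F p) r s = Lop I β b F r s := by
  have hc := (Sm.const (I := I) c).add hF
  have h2 := (hc.dr hI).dr_cg hs (fun ρ hρ => dr_cadd hF c hρ hs) hr ((hF.dr hI).hr hr hs)
  have h3 := hc.ds_eq hI hr.le hs ((hF.hs hI hr.le hs).const_add c)
  unfold Lop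
  rw [h2, h3, dr_cadd hF c hr hs]

theorem Lop_q (hI : IsOpen I) (hF : Sm I F) (hG : Sm I G) (c : ℝ) (β : ℝ × ℝ → ℝ) (b : ℝ → ℝ) {r s : ℝ} (hr : 0 < r) (hs : s ∈ I) :
    Lop I β b (fun p => (c + F p * F p) * (G p * G p)) r s = (c + F (r, s) ^ 2) * (2 * G (r, s) * Lop I β b G r s - 2 * dr I G (r, s) ^ 2)
      + G (r, s) ^ 2 * (2 * F (r, s) * Lop I β b F r s - 2 * dr I F (r, s) ^ 2) - 8 * F (r, s) * dr I F (r, s) * G (r, s) * dr I G (r, s) := by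
  rw [Lop_mul hI ((Sm.const c).add (hF.mul hF)) (hG.mul hG) β b hr hs, Lop_cadd hI (hF.mul hF) c β b hr hs, Lop_mul hI hF hF β b hr hs, Lop_mul hI hG hG β b hr hs,
    dr_cadd (hF.mul hF) c hr hs, dr_mul hF hF hr hs, dr_mul hG hG hr hs]
  ring

variable {z β γ : ℝ × ℝ → ℝ} {b b' : ℝ → ℝ}
/-- the equation -/
def Eqn (I : Set ℝ) (β γ : ℝ × ℝ → ℝ) (b : ℝ → ℝ) (z : ℝ × ℝ → ℝ) : Prop :=
  ∀ r s, 0 < r → s ∈ I → β (r, s) * ds I z (r, s) = dr I (dr I z) (r, s) + b r * dr I z (r, s) + γ (r, s)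

theorem Eqn.L0 (h : Eqn I β γ b z) {r s : ℝ} (hr : 0 < r) (hs : s ∈ I) : Lop I β b z r s = γ (r, s) := by
  unfold Lop; rw [h r s hr hs]; ring

theorem Eqn.Lr (h : Eqn I β γ b z) (hI : IsOpen I) (hz : Sm I z) (hβ : Sm I β) (hγ : Sm I γ) (hb : ∀ r, 0 < r → HasDerivAt b (b' r) r) {r s : ℝ} (hr : 0 < r) (hs : s ∈ I) :
    Lop I β b (dr I z) r s = b' r * dr I z (r, s) + dr I γ (r, s) - dr I β (r, s) * ds I z (r, s) := by
  have h1 := (hβ.hr hr hs).mul ((hz.ds hI).hr hr hs)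
  have h2 := ((((hz.dr hI).dr hI).hr hr hs).add ((hb r hr).mul ((hz.dr hI).hr hr hs))).add (hγ.hr hr hs)
  have h3 := h1.unique (h2.congr_of_eventuallyEq (by filter_upwards [lt_mem_nhds hr] with ρ hρ using h ρ s hρ hs))
  rw [hz.comm hI hr hs] at h3
  unfold Lop; linarith

theorem Eqn.Ls (h : Eqn I β γ b z) (hI : IsOpen I) (hz : Sm I z) (hβ : Sm I β) (hγ : Sm I γ) {r s : ℝ} (hr : 0 < r) (hs : s ∈ I) :
    Lop I β b (ds I z) r s = ds I γ (r, s) - ds I β (r, s) * ds I z (r, s) := by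
  have h1 := (hβ.hs hI hr.le hs).mul ((hz.ds hI).hs hI hr.le hs)
  have h2 := ((((hz.dr hI).dr hI).hs hI hr.le hs).add (((hz.dr hI).hs hI hr.le hs).const_mul (b r))).add (hγ.hs hI hr.le hs)
  have h3 := h1.unique (h2.congr_of_eventuallyEq (by filter_upwards [hI.mem_nhds hs] with σ hσ using h r σ hr hσ))
  have h4 : dr I (dr I (ds I z)) (r, s) = ds I (dr I (dr I z)) (r, s) := by
    rw [← (hz.dr hI).comm hI hr hs]
    exact ((hz.ds hI).dr hI).dr_cg hs (fun ρ hρ => hz.comm hI hρ hs) hr (((hz.dr hI).ds hI).hr hr hs)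
  unfold Lop; rw [h4, hz.comm hI hr hs]; linarith

theorem alg1 {z p q zs β βr b b' γ γr C δ : ℝ} (hC : 1 ≤ C) (δ0 : 0 < δ) (hδ : 1000 * C ^ 2 * δ ≤ 1) (hz : |z| ≤ δ) (hβ : 0 < β) (hβr : |βr| ≤ C * β * (1 + |p|))
    (hγ : |γ| ≤ C) (hγr : |γr| ≤ C * (1 + |p|)) (hb : b ^ 2 ≤ C * (C - b')) (e : β * zs = q + b * p + γ) :
    (32 * δ ^ 2 + z ^ 2) * (2 * p * (b' * p + γr - βr * zs) - 2 * q ^ 2) + p ^ 2 * (2 * z * γ - 2 * p ^ 2) - 8 * z * p * p * q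
      ≤ -(1/2) * ((32 * δ ^ 2 + z ^ 2) * (p * p)) ^ 2 + 100 := by
  obtain ⟨P, hP⟩ : ∃ P, P = |p| := ⟨_, rfl⟩
  obtain ⟨x, hx⟩ : ∃ x, x = P + P ^ 2 := ⟨_, rfl⟩
  obtain ⟨w, hw⟩ : ∃ w, w = 32 * δ ^ 2 + z ^ 2 := ⟨_, rfl⟩
  have P0 : 0 ≤ P := hP ▸ abs_nonneg p
  have x0 : 0 ≤ x := by rw [hx]; positivity
  have pP : p ^ 2 = P ^ 2 := by rw [hP, sq_abs]
  have z2 : z ^ 2 ≤ δ ^ 2 := sq_le_sq' (abs_le.1 hz).1 (abs_le.1 hz).2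
  have w1 : 32 * δ ^ 2 ≤ w := by rw [hw]; linarith [sq_nonneg z]
  have w2 : w ≤ 33 * δ ^ 2 := by rw [hw]; linarith
  have w0 : 0 ≤ w := (by positivity : 0 ≤ 32 * δ ^ 2).trans w1
  have d2 : δ ^ 2 * C ^ 4 * 1000000 ≤ 1 := by
    have := mul_le_one₀ hδ (by positivity) hδ
    calc _ = (1000 * C ^ 2 * δ) * (1000 * C ^ 2 * δ) := by ring
      _ ≤ 1 := this
  have wC : w * C ^ 3 * 30000 ≤ 1 := by
    have c4 : C ^ 3 ≤ C ^ 4 := pow_le_pow_right₀ hC (by norm_num)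
    calc w * C ^ 3 * 30000 ≤ (33 * δ ^ 2) * C ^ 4 * 30000 := by gcongr
      _ ≤ 1 := by linarith only [d2, (by positivity : 0 ≤ δ ^ 2 * C ^ 4)]
  have c3 : 1 ≤ C ^ 3 := one_le_pow₀ hC
  have k1 : |βr * zs| ≤ C * (1 + P) * (|q| + |b| * P + C) := by
    rw [abs_mul]
    have h1 : β * |zs| ≤ |q| + |b| * P + C := by
      rw [show β * |zs| = |β * zs| by rw [abs_mul, abs_of_pos hβ], e, hP, ← abs_mul]
      exact (abs_add_three _ _ _).trans (by linarith)
    calc |βr| * |zs| ≤ (C * β * (1 + P)) * |zs| := by rw [hP]; gcongr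
      _ = C * (1 + P) * (β * |zs|) := by ring
      _ ≤ _ := by gcongr
  have k2 : p * (γr - βr * zs) ≤ P * (C * (1 + P) + C * (1 + P) * (|q| + |b| * P + C)) := by
    calc p * (γr - βr * zs) ≤ |p * (γr - βr * zs)| := le_abs_self _
      _ = P * |γr - βr * zs| := by rw [abs_mul, hP]
      _ ≤ _ := by
        refine mul_le_mul_of_nonneg_left ?_ P0
        refine (abs_sub _ _).trans (add_le_add (by rw [hP]; exact hγr) k1)
  have k3 : 2 * C * x * |q| ≤ q ^ 2 + C ^ 2 * x ^ 2 := by have := sq_nonneg (|q| - C * x); have := sq_abs q; linarith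
  have k4 : C * (2 * C * x * (|b| * P)) ≤ 2 * (b ^ 2 * P ^ 2) + C ^ 4 * x ^ 2 := by
    have := sq_nonneg (|b| * P - C ^ 2 * x); have h2 := sq_abs b
    have : 2 * (|b| * P) * (C ^ 2 * x) ≤ b ^ 2 * P ^ 2 + C ^ 4 * x ^ 2 := by rw [← h2]; linarith
    have : 0 ≤ b ^ 2 * P ^ 2 := by positivity
    linarith
  have k5 : C * (b' * P ^ 2) ≤ C * (C * P ^ 2) - b ^ 2 * P ^ 2 := by
    have := mul_le_mul_of_nonneg_right hb (sq_nonneg P); linarith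
  have k6 : 2 * C * x * (|b| * P) + 2 * (b' * P ^ 2) ≤ 2 * (C * P ^ 2) + C ^ 3 * x ^ 2 := by
    refine le_of_mul_le_mul_left ?_ (by linarith : 0 < C)
    linarith
  have xP : P ^ 2 ≤ x := by rw [hx]; linarith
  have k7 : 2 * p * (b' * p + γr - βr * zs) - 2 * q ^ 2 ≤ C ^ 3 * (6 * x + 2 * x ^ 2) - q ^ 2 := by
    have e1 : 2 * p * (b' * p + γr - βr * zs) = 2 * (b' * P ^ 2) + 2 * (p * (γr - βr * zs)) := by rw [← pP]; ring
    have e2 : P * (C * (1 + P) + C * (1 + P) * (|q| + |b| * P + C)) = C * x + C * x * |q| + C * x * (|b| * P) + C ^ 2 * x := by rw [hx]; ring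
    rw [e2] at k2
    have c2 : C ^ 2 ≤ C ^ 3 := pow_le_pow_right₀ hC (by norm_num)
    have c1 : C ≤ C ^ 3 := le_self_pow₀ hC (by norm_num)
    have m1 : C * P ^ 2 ≤ C ^ 3 * x := mul_le_mul c1 xP (by positivity) (by positivity)
    have m2 : C * x ≤ C ^ 3 * x := mul_le_mul_of_nonneg_right c1 x0
    have m3 : C ^ 2 * x ≤ C ^ 3 * x := mul_le_mul_of_nonneg_right c2 x0
    have m4 : C ^ 2 * x ^ 2 ≤ C ^ 3 * x ^ 2 := mul_le_mul_of_nonneg_right c2 (by positivity)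
    linarith
  have k8 := mul_le_mul_of_nonneg_left k7 w0
  have k9 : w * (C ^ 3 * (6 * x + 2 * x ^ 2)) ≤ (6 * x + 2 * x ^ 2) / 30000 := by
    have := mul_le_mul_of_nonneg_right wC (by positivity : 0 ≤ 6 * x + 2 * x ^ 2)
    linarith
  have q1 : p ^ 2 * (2 * z * γ) ≤ P ^ 2 := by
    have : 2 * z * γ ≤ 1 := by
      calc 2 * z * γ ≤ |2 * z * γ| := le_abs_self _
        _ = 2 * (|z| * |γ|) := by rw [abs_mul, abs_mul]; norm_num; ring
        _ ≤ 2 * (δ * C ^ 2) := by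
          gcongr; exact hγ.trans (le_self_pow₀ hC (by norm_num))
        _ ≤ 1 := by linarith
    rw [pP]; exact mul_le_of_le_one_right (sq_nonneg P) this
  have q2 : -(8 * z * p * p * q) ≤ P ^ 4 / 2 + 32 * δ ^ 2 * q ^ 2 := by
    calc -(8 * z * p * p * q) = -(8 * z * q) * P ^ 2 := by rw [← pP]; ring
      _ ≤ (8 * (δ * |q|)) * P ^ 2 := by
        gcongr
        calc -(8 * z * q) ≤ |-(8 * z * q)| := le_abs_self _
          _ = 8 * (|z| * |q|) := by rw [abs_neg, abs_mul, abs_mul]; norm_num; ring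
          _ ≤ _ := by gcongr
      _ ≤ _ := by
        have h1 := sq_nonneg (P ^ 2 - 8 * (δ * |q|)); have h2 : (δ * |q|) ^ 2 = δ ^ 2 * q ^ 2 := by rw [mul_pow, sq_abs]
        linarith only [h1, h2]
  have q3 : 32 * δ ^ 2 * q ^ 2 ≤ w * q ^ 2 := mul_le_mul_of_nonneg_right w1 (sq_nonneg q)
  have q4 : (w * (p * p)) ^ 2 ≤ P ^ 4 := by
    have : w ≤ 1 := (le_mul_of_one_le_right w0 c3).trans (by linarith only [wC])
    calc (w * (p * p)) ^ 2 = w ^ 2 * P ^ 4 := by rw [← sq, pP]; ring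
      _ ≤ 1 * P ^ 4 := by gcongr; exact pow_le_one₀ w0 this
      _ = P ^ 4 := one_mul _
  have q5 : p ^ 2 * (2 * p ^ 2) = 2 * P ^ 4 := by rw [pP]; ring
  have x2 : x ^ 2 ≤ 2 * P ^ 2 + 2 * P ^ 4 := by rw [hx]; linarith only [sq_nonneg (P - P ^ 2)]
  have y1 : P ≤ P ^ 2 + 1 := by linarith only [sq_nonneg (P - 1), sq_nonneg P]
  have y2 : 8 * P ^ 2 ≤ P ^ 4 + 16 := by linarith only [sq_nonneg (P ^ 2 - 4)]
  have P4 : 0 ≤ P ^ 4 := by positivity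
  rw [← hw]
  linarith

theorem quart {e D : ℝ} (e0 : 0 < e) (D0 : 0 ≤ D) : ∃ C0, 0 ≤ C0 ∧ ∀ y, 0 ≤ y → D * (1 + y) ^ 3 ≤ e * y ^ 4 + C0 := by
  obtain ⟨R, hR⟩ : ∃ R, R = 1 + 8 * D / e := ⟨_, rfl⟩
  have R1 : 1 ≤ R := by rw [hR]; have : 0 ≤ 8 * D / e := by positivity
                        linarith
  refine ⟨D * (1 + R) ^ 3, by positivity, fun y hy => ?_⟩
  rcases le_total y R with h | h
  · have : D * (1 + y) ^ 3 ≤ D * (1 + R) ^ 3 := by gcongr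
    have : 0 ≤ e * y ^ 4 := by positivity
    linarith
  · have h1 : (1 + y) ^ 3 ≤ 8 * y ^ 3 := by
      calc (1 + y) ^ 3 ≤ (2 * y) ^ 3 := by gcongr; linarith
        _ = _ := by ring
    have h2 : 8 * D ≤ e * y := by
      have : e * R = e + 8 * D := by rw [hR]; field_simp
      nlinarith
    have h3 : 8 * D * y ^ 3 ≤ e * y * y ^ 3 := by gcongr
    have h4 : D * (1 + y) ^ 3 ≤ D * (8 * y ^ 3) := by gcongr
    have : 0 ≤ D * (1 + R) ^ 3 := by positivity
    nlinarith

theorem alg2 {C : ℝ} (hC : 1 ≤ C) : ∃ c0 C0, 0 < c0 ∧ 0 ≤ C0 ∧ ∀ {p q Y Yr k bz b b' γ γr gs βs : ℝ}, |p| ≤ C → 1 ≤ C * k → k * Y = q + b * p + γ → |γ| ≤ C → |γr| ≤ C →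
    |bz| ≤ C * |Y| → |gs| ≤ C * (1 + |Y|) → |βs| ≤ C * (1 + |Y|) → b ^ 2 ≤ C * (C - b') →
    (16 * C ^ 2 + p ^ 2) * (2 * Y * (gs - βs * Y) - 2 * Yr ^ 2) + Y ^ 2 * (2 * p * (b' * p + γr - bz) - 2 * q ^ 2) - 8 * p * q * Y * Yr ≤ -c0 * ((16 * C ^ 2 + p ^ 2) * (Y * Y)) ^ 2 + C0 := by
  have C0 : 0 < C := by linarith
  obtain ⟨D, D0, hD⟩ := quart (e := 1 / (6 * C ^ 3)) (D := 50 * C ^ 3) (by positivity) (by positivity)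
  refine ⟨1 / (6 * C ^ 3) / (17 * C ^ 2) ^ 2, D, by positivity, D0, fun {p q Y Yr k bz b b' γ γr gs βs} hp hk e hγ hγr hbz hgs hβs hb => ?_⟩
  obtain ⟨y, hy⟩ : ∃ y, y = |Y| := ⟨_, rfl⟩
  rw [← hy] at hbz hgs hβs
  have y0 : 0 ≤ y := hy ▸ abs_nonneg Y
  have yY : Y ^ 2 = y ^ 2 := by rw [hy, sq_abs]
  have p2 : p ^ 2 ≤ C ^ 2 := sq_le_sq' (abs_le.1 hp).1 (abs_le.1 hp).2
  have c2 : C ≤ C ^ 2 := le_self_pow₀ hC (by norm_num)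
  have c3 : C ^ 2 ≤ C ^ 3 := pow_le_pow_right₀ hC (by norm_num)
  have a1 : -(8 * p * q * Y * Yr) ≤ q ^ 2 * Y ^ 2 + 16 * p ^ 2 * Yr ^ 2 := by linarith only [sq_nonneg (q * Y + 4 * p * Yr)]
  have a2 : 16 * p ^ 2 * Yr ^ 2 ≤ 16 * C ^ 2 * Yr ^ 2 := by gcongr
  have a3 : Y * (gs - βs * Y) ≤ y * (C * (1 + y) + C * (1 + y) * y) := by
    calc Y * (gs - βs * Y) ≤ |Y * (gs - βs * Y)| := le_abs_self _
      _ = y * |gs - βs * Y| := by rw [abs_mul, hy]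
      _ ≤ _ := by
        refine mul_le_mul_of_nonneg_left ((abs_sub _ _).trans (add_le_add hgs ?_)) y0
        rw [abs_mul, ← hy]; exact mul_le_mul_of_nonneg_right hβs y0
  have a4 : (16 * C ^ 2 + p ^ 2) * (2 * (y * (C * (1 + y) + C * (1 + y) * y))) ≤ (17 * C ^ 2) * (2 * (y * (C * (1 + y) + C * (1 + y) * y))) := by gcongr; linarith
  have a5 : (17 * C ^ 2) * (2 * (y * (C * (1 + y) + C * (1 + y) * y))) ≤ 34 * C ^ 3 * (1 + y) ^ 3 := by
    calc _ = 34 * C ^ 3 * (y * (1 + y) ^ 2) := by ring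
      _ ≤ 34 * C ^ 3 * ((1 + y) * (1 + y) ^ 2) := by gcongr; linarith
      _ = _ := by ring
  have a6 : (16 * C ^ 2 + p ^ 2) * (Y * (gs - βs * Y)) ≤ (16 * C ^ 2 + p ^ 2) * (y * (C * (1 + y) + C * (1 + y) * y)) := mul_le_mul_of_nonneg_left a3 (by positivity)
  have b1 : p * (γr - bz) ≤ C * (C + C * y) := by
    calc p * (γr - bz) ≤ |p * (γr - bz)| := le_abs_self _
      _ = |p| * |γr - bz| := abs_mul _ _
      _ ≤ _ := mul_le_mul hp ((abs_sub _ _).trans (add_le_add hγr hbz)) (abs_nonneg _) (by linarith)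
  have b2 : C * (b' * p ^ 2) ≤ C * (C * p ^ 2) - b ^ 2 * p ^ 2 := by
    have := mul_le_mul_of_nonneg_right hb (sq_nonneg p); linarith
  have b3 : y ^ 2 ≤ C ^ 2 * (3 * (q ^ 2 + b ^ 2 * p ^ 2 + C ^ 2)) := by
    have h1 : y ^ 2 ≤ C ^ 2 * (k * Y) ^ 2 := by
      calc y ^ 2 = 1 ^ 2 * y ^ 2 := by ring
        _ ≤ (C * k) ^ 2 * y ^ 2 := by gcongr
        _ = _ := by rw [← yY]; ring
    have h2 : (k * Y) ^ 2 ≤ 3 * (q ^ 2 + b ^ 2 * p ^ 2 + C ^ 2) := by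
      have g2 : γ ^ 2 ≤ C ^ 2 := sq_le_sq' (abs_le.1 hγ).1 (abs_le.1 hγ).2
      rw [e]; linarith only [g2, sq_nonneg (q - b * p), sq_nonneg (q - γ), sq_nonneg (b * p - γ)]
    exact h1.trans (mul_le_mul_of_nonneg_left h2 (by positivity))
  have b4 : 2 * p * (b' * p + γr - bz) - q ^ 2 ≤ - (2 * (1 / (6 * C ^ 3))) * y ^ 2 + 8 * C ^ 3 * (1 + y) := by
    have e3 : C * (2 * (1 / (6 * C ^ 3)) * y ^ 2) = y ^ 2 / (3 * C ^ 2) := by field_simp; ring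
    have e4 : y ^ 2 / (3 * C ^ 2) ≤ q ^ 2 + b ^ 2 * p ^ 2 + C ^ 2 := by rw [div_le_iff₀ (by positivity)]; linarith
    refine le_of_mul_le_mul_left ?_ C0
    have i1 : 2 * C * (p * (γr - bz)) ≤ 2 * C * (C * (C + C * y)) := mul_le_mul_of_nonneg_left b1 (by linarith)
    have i2 : C * (C * p ^ 2) ≤ C * (C * C ^ 2) := by gcongr
    have i3 : q ^ 2 ≤ C * q ^ 2 := le_mul_of_one_le_left (sq_nonneg q) hC
    have i4 : 0 ≤ b ^ 2 * p ^ 2 := by positivity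
    have i5 : C ^ 3 * (1 + y) ≤ C ^ 4 * (1 + y) := by gcongr ?_ * _; exact pow_le_pow_right₀ hC (by norm_num)
    have i6 : C ^ 2 ≤ C ^ 4 * (1 + y) := by
      calc C ^ 2 ≤ C ^ 4 := pow_le_pow_right₀ hC (by norm_num)
        _ ≤ C ^ 4 * (1 + y) := le_mul_of_one_le_right (by positivity) (by linarith)
    have i7 : C ^ 4 ≤ C ^ 4 * (1 + y) := le_mul_of_one_le_right (by positivity) (by linarith)
    linarith
  have b5 := mul_le_mul_of_nonneg_left b4 (sq_nonneg y)
  have b6 : y ^ 2 * (8 * C ^ 3 * (1 + y)) ≤ 8 * C ^ 3 * (1 + y) ^ 3 := by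
    calc _ = 8 * C ^ 3 * (y ^ 2 * (1 + y)) := by ring
      _ ≤ 8 * C ^ 3 * ((1 + y) ^ 2 * (1 + y)) := by gcongr; linarith
      _ = _ := by ring
  have f1 : 1 / (6 * C ^ 3) / (17 * C ^ 2) ^ 2 * ((16 * C ^ 2 + p ^ 2) * (Y * Y)) ^ 2 ≤ 1 / (6 * C ^ 3) * y ^ 4 := by
    rw [← sq Y]
    have : 16 * C ^ 2 + p ^ 2 ≤ 17 * C ^ 2 := by linarith only [p2]
    calc _ ≤ 1 / (6 * C ^ 3) / (17 * C ^ 2) ^ 2 * ((17 * C ^ 2) * Y ^ 2) ^ 2 := by gcongr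
      _ = 1 / (6 * C ^ 3) * (Y ^ 2) ^ 2 := by field_simp
      _ = _ := by rw [yY]; ring
  have hDy := hD y y0
  have g1 : 0 ≤ C ^ 3 * (1 + y) ^ 3 := by positivity
  have g2 : 0 ≤ p ^ 2 * Yr ^ 2 := by positivity
  have g3 : 0 ≤ C ^ 2 * Yr ^ 2 := by positivity
  rw [yY] at a1 ⊢
  linarith
end

section
variable {I : Set ℝ} {F Z β Γ : ℝ × ℝ → ℝ} {Θ b b' ω : ℝ → ℝ} {K : ℝ}
theorem Sm.cmul (hF : Sm I F) (c : ℝ) : Sm I (fun p => c * F p) := (Sm.const c).mul hF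
theorem dr_cmul (hF : Sm I F) (c : ℝ) {r s : ℝ} (hr : 0 < r) (hs : s ∈ I) : dr I (fun p => c * F p) (r, s) = c * dr I F (r, s) :=
  (hF.cmul c).dr_eq hr hs ((hF.hr hr hs).const_mul c)
theorem ds_cmul (hI : IsOpen I) (hF : Sm I F) (c : ℝ) {r s : ℝ} (hr : 0 < r) (hs : s ∈ I) : ds I (fun p => c * F p) (r, s) = c * ds I F (r, s) :=
  (hF.cmul c).ds_eq hI hr.le hs ((hF.hs hI hr.le hs).const_mul c)
theorem drr_cmul (hI : IsOpen I) (hF : Sm I F) (c : ℝ) {r s : ℝ} (hr : 0 < r) (hs : s ∈ I) : dr I (dr I (fun p => c * F p)) (r, s) = c * dr I (dr I F) (r, s) :=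
  ((hF.cmul c).dr hI).dr_cg hs (fun ρ hρ => dr_cmul hF c hρ hs) hr (((hF.dr hI).hr hr hs).const_mul c)
theorem Eqn.cmul (h : Eqn I β Γ b Z) (hI : IsOpen I) (hZ : Sm I Z) (c : ℝ) : Eqn I β (fun p => c * Γ p) b (fun p => c * Z p) := fun r s hr hs => by
  rw [ds_cmul hI hZ c hr hs, drr_cmul hI hZ c hr hs, dr_cmul hZ c hr hs]
  have := h r s hr hs; linear_combination c * this

/-- background data -/
structure Bk (Θ b b' ω : ℝ → ℝ) (K : ℝ) : Prop where
  K1 : 1 ≤ K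
  pos : ∀ r, 0 ≤ r → 0 < Θ r
  le : ∀ r, 0 ≤ r → Θ r ≤ K
  cmp : ∀ r r', 0 ≤ r → 0 ≤ r' → |r - r'| ≤ 1 → Θ r ≤ K * Θ r'
  hω : ∀ r, 0 < r → HasDerivAt ω (b r * ω r) r
  ωp : ∀ r, 0 < r → 0 < ω r
  cω : ContinuousOn ω (Ici 0)
  ω0 : ω 0 = 0
  hb : ∀ r, 0 < r → HasDerivAt b (b' r) r
  b1 : ∀ r, 0 < r → b r ^ 2 ≤ K * (K - b' r)
  b2 : ∀ r, 0 < r → |b r| * r ≤ K * (1 + r)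

theorem Bk.win (h : Bk Θ b b' ω K) {r : ℝ} (hr : 0 < r) : ∃ R0 ν, 0 ≤ R0 ∧ 1/4 ≤ ν ∧ ν ≤ 1 ∧ (R0 = 0 ∨ ν < R0) ∧ |r - R0| ≤ ν/2 ∧ ∀ ρ, 0 < ρ → |ρ - R0| < ν → |b ρ| * |ρ - R0| ≤ 2 * K := by
  have K1 := h.K1
  rcases lt_or_ge r (1/2) with h1 | h1
  · refine ⟨0, 1, le_rfl, by norm_num, le_rfl, Or.inl rfl, by rw [sub_zero, abs_of_pos hr]; exact h1.le, fun ρ hρ hl => ?_⟩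
    rw [sub_zero, abs_of_pos hρ] at *
    exact (h.b2 ρ hρ).trans (by nlinarith)
  · refine ⟨r, 1/4, hr.le, le_rfl, by norm_num, Or.inr (by linarith), by norm_num, fun ρ hρ hl => ?_⟩
    have hρ4 : 1/4 ≤ ρ := by linarith [(abs_lt.1 hl).1]
    have h2 := h.b2 ρ hρ
    have h3 : |b ρ| ≤ 5 * K := by
      have : |b ρ| * ρ ≤ 5 * K * ρ := h2.trans (by nlinarith)
      exact le_of_mul_le_mul_right this hρ
    calc |b ρ| * |ρ - r| ≤ (5 * K) * (1/4) := by gcongr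
      _ ≤ 2 * K := by linarith

theorem Bk.pw (h : Bk Θ b b' ω K) {r r' x : ℝ} (i : ℕ) (hr : 0 ≤ r) (hr' : 0 ≤ r') (hd : |r - r'| ≤ 1) (hx : 0 ≤ x) : Θ r ^ i * x ≤ K ^ i * (Θ r' ^ i * x) := by
  have := pow_le_pow_left₀ (h.pos r hr).le (h.cmp r r' hr hr' hd) i
  rw [mul_pow] at this
  calc _ ≤ (K ^ i * Θ r' ^ i) * x := mul_le_mul_of_nonneg_right this hx
    _ = _ := by ring

theorem Bk.b1' (h : Bk Θ b b' ω K) {D r : ℝ} (hD : K ≤ D) (hr : 0 < r) : b r ^ 2 ≤ D * (D - b' r) := by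
  have h1 := h.b1 r hr
  have h2 : 0 ≤ K - b' r := by
    by_contra hc; push Not at hc
    nlinarith [sq_nonneg (b r), h.K1]
  nlinarith [h.K1]

theorem sI0 {s0 ϑ : ℝ} (h : 0 < s0) : Icc s0 (s0 + ϑ) ⊆ Ioi (0:ℝ) := fun _ hx => h.trans_le hx.1
theorem νb {ν K C : ℝ} (h : 1/4 ≤ ν) (hK : 0 ≤ K) : C + (4 * (2 * K) + 40) / ν ^ 2 ≤ C + (8 * K + 40) * 16 := by
  have : (4 * (2 * K) + 40) / ν ^ 2 ≤ (8 * K + 40) * 16 := by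
    rw [div_le_iff₀ (by positivity)]
    have : 1/16 ≤ ν ^ 2 := by nlinarith
    nlinarith
  linarith

theorem Bk.gl1 (h : Bk Θ b b' ω K) {C : ℝ} (hC : 1 ≤ C) (j : ℕ) : ∃ δ, 0 < δ ∧ ∀ {Z β Γ : ℝ × ℝ → ℝ}, Sm (Ioi 0) Z → Sm (Ioi 0) β → Sm (Ioi 0) Γ → Eqn (Ioi 0) β Γ b Z → ∀ {l S : ℝ}, 0 < l → l ≤ 1 → 0 ≤ S →
    (∀ r s, 0 < r → S < s → l * (Θ r ^ j * |Z (r, s)|) ≤ δ ∧ 0 < β (r, s) ∧ β (r, s) ≤ C * Θ r ∧ |dr (Ioi 0) β (r, s)| ≤ C * β (r, s) * (1 + l * (Θ r ^ j * |dr (Ioi 0) Z (r, s)|)) ∧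
      Θ r ^ j * |Γ (r, s)| ≤ C ∧ Θ r ^ j * |dr (Ioi 0) Γ (r, s)| ≤ C * (1 + Θ r ^ j * |dr (Ioi 0) Z (r, s)|)) →
    ∃ C', ∀ r s, 0 < r → S + K < s → Θ r ^ j * |dr (Ioi 0) Z (r, s)| ≤ C' := by
  have K1 := h.K1
  have hI : IsOpen (Ioi (0:ℝ)) := isOpen_Ioi
  obtain ⟨κ, hκ⟩ : ∃ κ, κ = K ^ j := ⟨_, rfl⟩
  have κ1 : 1 ≤ κ := by rw [hκ]; exact one_le_pow₀ K1
  obtain ⟨D, hD⟩ : ∃ D, D = C * K * (κ * κ) := ⟨_, rfl⟩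
  have κκ : 1 ≤ κ * κ := one_le_mul_of_one_le_of_one_le κ1 κ1
  have hCK : 1 ≤ C * K := one_le_mul_of_one_le_of_one_le hC K1
  have D1 : 1 ≤ D := by rw [hD]; exact one_le_mul_of_one_le_of_one_le hCK κκ
  have DK : K ≤ D := by rw [hD]; calc K ≤ C * K := le_mul_of_one_le_left (by linarith) hC
                                   _ ≤ _ := le_mul_of_one_le_right (by linarith) κκ
  have Dκ : C * κ * κ ≤ D := by
    rw [hD]; calc C * κ * κ = C * (κ * κ) * 1 := by ring
               _ ≤ C * (κ * κ) * K := by gcongr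
               _ = _ := by ring
  have Dκ1 : C * κ ≤ D := (le_mul_of_one_le_right (by positivity) κ1).trans Dκ
  obtain ⟨δ, hδ⟩ : ∃ δ, δ = 1 / (1000 * D ^ 2) := ⟨_, rfl⟩
  have δ0 : 0 < δ := by rw [hδ]; positivity
  have δD : 1000 * D ^ 2 * δ ≤ 1 := by rw [hδ]; field_simp; rfl
  refine ⟨δ / κ, by positivity, fun {Z β Γ} hZ hβ hΓ he {l S} l0 l1 S0 hyp => ?_⟩
  obtain ⟨Bd, hBd⟩ : ∃ Bd, Bd = 2 * (1 + (100 + (C * K + (8 * K + 40) * 16)) / (1/2)) := ⟨_, rfl⟩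
  have Bd0 : 0 ≤ Bd := by rw [hBd]; positivity
  refine ⟨κ * (Real.sqrt (Bd / (32 * δ ^ 2)) / l), fun r s hr hs => ?_⟩
  obtain ⟨R0, ν, R00, hν, ν1, hR, hrR, hbw⟩ := h.win hr
  obtain ⟨ϑ, hϑ⟩ : ∃ ϑ, ϑ = Θ R0 := ⟨_, rfl⟩
  have ϑ0 : 0 < ϑ := by rw [hϑ]; exact h.pos _ R00
  have ϑK : ϑ ≤ K := by rw [hϑ]; exact h.le _ R00
  obtain ⟨s0, hs0⟩ : ∃ s0, s0 = s - ϑ := ⟨_, rfl⟩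
  have es : s = s0 + ϑ := by rw [hs0]; ring
  have s0S : S < s0 := by linarith
  obtain ⟨μ, hμ⟩ : ∃ μ, μ = l * ϑ ^ j := ⟨_, rfl⟩
  have μ0 : 0 < μ := by rw [hμ]; positivity
  have dn : ∀ {ρ}, |ρ - R0| < ν → |R0 - ρ| ≤ 1 := fun h => by rw [abs_sub_comm]; linarith
  -- comparison
  have cp1 : ∀ {ρ x}, 0 < ρ → |ρ - R0| < ν → μ * |x| ≤ κ * (l * (Θ ρ ^ j * |x|)) := fun {ρ x} h1 h2 => by
    have := h.pw j R00 h1.le (dn h2) (abs_nonneg x)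
    rw [← hϑ, ← hκ] at this
    calc μ * |x| = l * (ϑ ^ j * |x|) := by rw [hμ]; ring
      _ ≤ l * (κ * (Θ ρ ^ j * |x|)) := by gcongr
      _ = _ := by ring
  have cp2 : ∀ {ρ x}, 0 < ρ → |ρ - R0| < ν → l * (Θ ρ ^ j * |x|) ≤ κ * (μ * |x|) := fun {ρ x} h1 h2 => by
    have := h.pw j h1.le R00 (by rw [abs_sub_comm]; exact dn h2) (abs_nonneg x)
    rw [← hϑ, ← hκ] at this
    calc l * (Θ ρ ^ j * |x|) ≤ l * (κ * (ϑ ^ j * |x|)) := by gcongr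
      _ = _ := by rw [hμ]; ring
  have hz := hZ.cmul μ
  have hγ := hΓ.cmul μ
  have hez := he.cmul hI hZ μ
  have aμ : ∀ x, |μ * x| = μ * |x| := fun x => by rw [abs_mul, abs_of_pos μ0]
  obtain ⟨z, zd⟩ : ∃ z : ℝ × ℝ → ℝ, z = fun p => μ * Z p := ⟨_, rfl⟩
  obtain ⟨γ, γd⟩ : ∃ γ : ℝ × ℝ → ℝ, γ = fun p => μ * Γ p := ⟨_, rfl⟩
  rw [← zd] at hz hez; rw [← γd] at hγ hez
  have hzr : ∀ {ρ σ}, 0 < ρ → σ ∈ Ioi (0:ℝ) → dr (Ioi 0) z (ρ, σ) = μ * dr (Ioi 0) Z (ρ, σ) := fun h1 h2 => by rw [zd]; exact dr_cmul hZ μ h1 h2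
  have hγr : ∀ {ρ σ}, 0 < ρ → σ ∈ Ioi (0:ℝ) → dr (Ioi 0) γ (ρ, σ) = μ * dr (Ioi 0) Γ (ρ, σ) := fun h1 h2 => by rw [γd]; exact dr_cmul hΓ μ h1 h2
  have hF : Sm (Ioi 0) (fun p => (32 * δ ^ 2 + z p * z p) * (dr (Ioi 0) z p * dr (Ioi 0) z p)) := ((Sm.const _).add (hz.mul hz)).mul ((hz.dr hI).mul (hz.dr hI))
  have key := maxl hI hF ϑ0 (by linarith : 0 < ν) hR (sI0 (by linarith : 0 < s0)) (fun p => mul_nonneg (add_nonneg (by positivity) (mul_self_nonneg _)) (mul_self_nonneg _))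
    (β := β) (b := b) (ω := ω) (c0 := 1/2) (C0 := 100) (K := C * K) (K' := 2 * K) (by norm_num) (by norm_num) (by positivity) h.hω h.ωp h.cω h.ω0
    (fun ρ σ h1 h2 h3 => ?_) hbw (fun ρ σ h1 h2 h3 => ?_) r hr hrR
  · rw [← es] at key
    have k2 : 2 * (1 + (100 + (C * K + (4 * (2 * K) + 40) / ν ^ 2)) / (1/2)) ≤ Bd := by rw [hBd]; have := νb (C := C * K) hν (by linarith : 0 ≤ K); gcongr
    have sI : s ∈ Ioi (0:ℝ) := by rw [mem_Ioi]; linarith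
    have k3 : (32 * δ ^ 2) * (dr (Ioi 0) z (r, s)) ^ 2 ≤ Bd := by
      refine le_trans ?_ (key.trans k2)
      rw [← sq (dr _ _ _)]; gcongr; exact le_add_of_nonneg_right (mul_self_nonneg _)
    have k4 : |dr (Ioi 0) z (r, s)| ≤ Real.sqrt (Bd / (32 * δ ^ 2)) := by
      refine Real.abs_le_sqrt ?_
      rw [le_div_iff₀ (by positivity)]; linarith
    rw [hzr hr sI, aμ] at k4
    have k5 := cp2 (x := dr (Ioi 0) Z (r, s)) hr (by linarith)
    rw [mul_div_assoc', le_div_iff₀ l0]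
    calc _ = l * (Θ r ^ j * |dr (Ioi 0) Z (r, s)|) := by ring
      _ ≤ κ * (μ * |dr (Ioi 0) Z (r, s)|) := k5
      _ ≤ _ := by gcongr
  · obtain ⟨-, b0, b3, -⟩ := hyp ρ σ h1 (by linarith [h3.1])
    refine ⟨b0.le, b3.trans ?_⟩
    have := h.cmp ρ R0 h1.le R00 (by linarith)
    rw [← hϑ] at this
    calc C * Θ ρ ≤ C * (K * ϑ) := by gcongr
      _ = _ := by ring
  · have hσ : σ ∈ Ioi (0:ℝ) := by rw [mem_Ioi]; linarith [h3.1]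
    obtain ⟨a1, a2, a3, a4, a5, a6⟩ := hyp ρ σ h1 (by linarith [h3.1])
    have q := Lop_q hI hz (hz.dr hI) (32 * δ ^ 2) β b h1 hσ
    rw [hez.L0 h1 hσ, hez.Lr hI hz hβ hγ h.hb h1 hσ] at q
    have al := alg1 (z := z (ρ, σ)) (p := dr (Ioi 0) z (ρ, σ)) (q := dr (Ioi 0) (dr (Ioi 0) z) (ρ, σ)) (zs := ds (Ioi 0) z (ρ, σ)) (β := β (ρ, σ)) (βr := dr (Ioi 0) β (ρ, σ)) (b := b ρ)
      (γ := γ (ρ, σ)) (γr := dr (Ioi 0) γ (ρ, σ)) D1 δ0 δD ?_ a2 ?_ ?_ ?_ (h.b1' DK h1) (hez ρ σ h1 hσ)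
    · exact q.le.trans (al.trans (le_of_eq (by ring)))
    · rw [zd]; simp only [aμ]
      refine (cp1 h1 h2).trans ?_
      calc _ ≤ κ * (δ / κ) := by gcongr
        _ = δ := by field_simp
    · rw [hzr h1 hσ, aμ]
      have c2 := cp2 (x := dr (Ioi 0) Z (ρ, σ)) h1 h2
      have n0 : 0 ≤ μ * |dr (Ioi 0) Z (ρ, σ)| := by positivity
      calc _ ≤ C * β (ρ, σ) * (1 + l * (Θ ρ ^ j * |dr (Ioi 0) Z (ρ, σ)|)) := a4
        _ ≤ C * β (ρ, σ) * (κ + κ * (μ * |dr (Ioi 0) Z (ρ, σ)|)) := by gcongr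
        _ = (C * κ) * (β (ρ, σ) * (1 + μ * |dr (Ioi 0) Z (ρ, σ)|)) := by ring
        _ ≤ D * (β (ρ, σ) * (1 + μ * |dr (Ioi 0) Z (ρ, σ)|)) := by gcongr
        _ = _ := by ring
    · rw [γd]; simp only [aμ]
      have g0 : 0 ≤ Θ ρ ^ j * |Γ (ρ, σ)| := mul_nonneg (pow_nonneg (h.pos ρ h1.le).le _) (abs_nonneg _)
      calc _ ≤ κ * (l * (Θ ρ ^ j * |Γ (ρ, σ)|)) := cp1 h1 h2
        _ ≤ κ * (1 * C) := by gcongr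
        _ ≤ D := by linarith
    · rw [hzr h1 hσ, hγr h1 hσ, aμ, aμ]
      have c2 := cp2 (x := dr (Ioi 0) Z (ρ, σ)) h1 h2
      have n0 : 0 ≤ μ * |dr (Ioi 0) Z (ρ, σ)| := by positivity
      calc _ ≤ κ * (l * (Θ ρ ^ j * |dr (Ioi 0) Γ (ρ, σ)|)) := cp1 h1 h2
        _ ≤ κ * (l * (C * (1 + Θ ρ ^ j * |dr (Ioi 0) Z (ρ, σ)|))) := by gcongr
        _ = C * κ * (l + l * (Θ ρ ^ j * |dr (Ioi 0) Z (ρ, σ)|)) := by ring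
        _ ≤ C * κ * (κ + κ * (μ * |dr (Ioi 0) Z (ρ, σ)|)) := by gcongr; linarith
        _ = C * κ * κ * (1 + μ * |dr (Ioi 0) Z (ρ, σ)|) := by ring
        _ ≤ _ := by gcongr

theorem Bk.gl2 (h : Bk Θ b b' ω K) {C : ℝ} (hC : 1 ≤ C) (j : ℕ) (hZ : Sm (Ioi 0) Z) (hβ : Sm (Ioi 0) β) (hΓ : Sm (Ioi 0) Γ) (he : Eqn (Ioi 0) β Γ b Z) {S : ℝ} (S0 : 0 ≤ S)
    (hyp : ∀ r s, 0 < r → S < s → Θ r ^ j * |dr (Ioi 0) Z (r, s)| ≤ C ∧ Θ r ≤ C * β (r, s) ∧ β (r, s) ≤ C * Θ r ∧ |dr (Ioi 0) β (r, s)| ≤ C * Θ r ∧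
      Θ r ^ j * |Γ (r, s)| ≤ C ∧ Θ r ^ j * |dr (Ioi 0) Γ (r, s)| ≤ C ∧ |ds (Ioi 0) β (r, s)| ≤ C * (1 + Θ r ^ (j+1) * |ds (Ioi 0) Z (r, s)|) ∧
      Θ r ^ (j+1) * |ds (Ioi 0) Γ (r, s)| ≤ C * (1 + Θ r ^ (j+1) * |ds (Ioi 0) Z (r, s)|)) :
    ∃ C', ∀ r s, 0 < r → S + K < s → Θ r ^ (j+1) * |ds (Ioi 0) Z (r, s)| ≤ C' := by
  have K1 := h.K1
  have hI : IsOpen (Ioi (0:ℝ)) := isOpen_Ioi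
  obtain ⟨κ, hκ⟩ : ∃ κ, κ = K ^ (j+1) := ⟨_, rfl⟩
  have κj : K ^ j ≤ κ := by rw [hκ]; exact pow_le_pow_right₀ K1 (by omega)
  have κ1 : 1 ≤ κ := by rw [hκ]; exact one_le_pow₀ K1
  obtain ⟨D, hD⟩ : ∃ D, D = C * K * (κ * κ) := ⟨_, rfl⟩
  have κκ : 1 ≤ κ * κ := one_le_mul_of_one_le_of_one_le κ1 κ1
  have hCK : 1 ≤ C * K := one_le_mul_of_one_le_of_one_le hC K1
  have D1 : 1 ≤ D := by rw [hD]; exact one_le_mul_of_one_le_of_one_le hCK κκ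
  have DCK : C * K ≤ D := by rw [hD]; exact le_mul_of_one_le_right (by linarith) κκ
  have DK : K ≤ D := (le_mul_of_one_le_left (by linarith) hC).trans DCK
  have Dκ : C * κ * κ ≤ D := by
    rw [hD]; calc C * κ * κ = C * (κ * κ) * 1 := by ring
               _ ≤ C * (κ * κ) * K := by gcongr
               _ = _ := by ring
  have Dκ1 : κ * C ≤ D := by rw [mul_comm]; exact (le_mul_of_one_le_right (by positivity) κ1).trans Dκ
  obtain ⟨c0, C0, c00, C00, hal⟩ := alg2 D1
  obtain ⟨Bd, hBd⟩ : ∃ Bd, Bd = 2 * (1 + (C0 + (C * K + (8 * K + 40) * 16)) / c0) := ⟨_, rfl⟩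
  refine ⟨κ * Real.sqrt (Bd / (16 * D ^ 2)), fun r s hr hs => ?_⟩
  obtain ⟨R0, ν, R00, hν, ν1, hR, hrR, hbw⟩ := h.win hr
  obtain ⟨ϑ, hϑ⟩ : ∃ ϑ, ϑ = Θ R0 := ⟨_, rfl⟩
  have ϑ0 : 0 < ϑ := by rw [hϑ]; exact h.pos _ R00
  have ϑK : ϑ ≤ K := by rw [hϑ]; exact h.le _ R00
  obtain ⟨s0, hs0⟩ : ∃ s0, s0 = s - ϑ := ⟨_, rfl⟩
  have es : s = s0 + ϑ := by rw [hs0]; ring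
  have s0S : S < s0 := by linarith
  have dn : ∀ {ρ}, |ρ - R0| < ν → |R0 - ρ| ≤ 1 := fun h => by rw [abs_sub_comm]; linarith
  have cpj : ∀ {ρ x}, 0 < ρ → |ρ - R0| < ν → |ϑ ^ j * x| ≤ κ * (Θ ρ ^ j * |x|) := fun {ρ x} h1 h2 => by
    have := h.pw j R00 h1.le (dn h2) (abs_nonneg x)
    rw [← hϑ] at this
    rw [abs_mul, abs_of_pos (by positivity : 0 < ϑ ^ j)]
    exact this.trans (mul_le_mul_of_nonneg_right κj (mul_nonneg (pow_nonneg (h.pos ρ h1.le).le _) (abs_nonneg _)))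
  have cp1 : ∀ {ρ x}, 0 < ρ → |ρ - R0| < ν → |ϑ ^ (j+1) * x| ≤ κ * (Θ ρ ^ (j+1) * |x|) := fun {ρ x} h1 h2 => by
    have := h.pw (j+1) R00 h1.le (dn h2) (abs_nonneg x)
    rw [← hϑ, ← hκ] at this
    rwa [abs_mul, abs_of_pos (by positivity : 0 < ϑ ^ (j+1))]
  have cp2 : ∀ {ρ x}, 0 < ρ → |ρ - R0| < ν → Θ ρ ^ (j+1) * |x| ≤ κ * |ϑ ^ (j+1) * x| := fun {ρ x} h1 h2 => by
    have := h.pw (j+1) h1.le R00 (by rw [abs_sub_comm]; exact dn h2) (abs_nonneg x)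
    rw [← hϑ, ← hκ] at this
    rwa [abs_mul, abs_of_pos (by positivity : 0 < ϑ ^ (j+1))]
  have hz := hZ.cmul (ϑ ^ j)
  have hγ := hΓ.cmul (ϑ ^ j)
  have hez := he.cmul hI hZ (ϑ ^ j)
  have hy := hZ.cmul (ϑ ^ (j+1))
  have hg := hΓ.cmul (ϑ ^ (j+1))
  have hey := he.cmul hI hZ (ϑ ^ (j+1))
  obtain ⟨z, zd⟩ : ∃ z : ℝ × ℝ → ℝ, z = fun p => ϑ ^ j * Z p := ⟨_, rfl⟩
  obtain ⟨γ, γd⟩ : ∃ γ : ℝ × ℝ → ℝ, γ = fun p => ϑ ^ j * Γ p := ⟨_, rfl⟩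
  obtain ⟨y, yd⟩ : ∃ z : ℝ × ℝ → ℝ, z = fun p => ϑ ^ (j+1) * Z p := ⟨_, rfl⟩
  obtain ⟨g, gd⟩ : ∃ γ : ℝ × ℝ → ℝ, γ = fun p => ϑ ^ (j+1) * Γ p := ⟨_, rfl⟩
  rw [← zd] at hz hez; rw [← γd] at hγ hez; rw [← yd] at hy hey; rw [← gd] at hg hey
  have hys : ∀ {ρ σ}, 0 < ρ → σ ∈ Ioi (0:ℝ) → ds (Ioi 0) y (ρ, σ) = ϑ ^ (j+1) * ds (Ioi 0) Z (ρ, σ) := fun h1 h2 => by rw [yd]; exact ds_cmul hI hZ _ h1 h2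
  have hF : Sm (Ioi 0) (fun p => (16 * D ^ 2 + dr (Ioi 0) z p * dr (Ioi 0) z p) * (ds (Ioi 0) y p * ds (Ioi 0) y p)) :=
    ((Sm.const _).add ((hz.dr hI).mul (hz.dr hI))).mul ((hy.ds hI).mul (hy.ds hI))
  have Θb : ∀ {ρ}, 0 < ρ → |ρ - R0| < ν → C * Θ ρ ≤ C * K * ϑ := fun {ρ} h1 h2 => by
    have := h.cmp ρ R0 h1.le R00 (by linarith)
    rw [← hϑ] at this
    calc C * Θ ρ ≤ C * (K * ϑ) := by gcongr
      _ = _ := by ring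
  have key := maxl hI hF ϑ0 (by linarith : 0 < ν) hR (sI0 (by linarith : 0 < s0)) (fun p => mul_nonneg (add_nonneg (by positivity) (mul_self_nonneg _)) (mul_self_nonneg _))
    (β := β) (b := b) (ω := ω) (c0 := c0) (C0 := C0) (K := C * K) (K' := 2 * K) c00 C00 (by positivity) h.hω h.ωp h.cω h.ω0
    (fun ρ σ h1 h2 h3 => ?_) hbw (fun ρ σ h1 h2 h3 => ?_) r hr hrR
  · rw [← es] at key
    have k2 : 2 * (1 + (C0 + (C * K + (4 * (2 * K) + 40) / ν ^ 2)) / c0) ≤ Bd := by rw [hBd]; have := νb (C := C * K) hν (by linarith : 0 ≤ K); gcongr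
    have sI : s ∈ Ioi (0:ℝ) := by rw [mem_Ioi]; linarith
    have k3 : (16 * D ^ 2) * (ds (Ioi 0) y (r, s)) ^ 2 ≤ Bd := by
      refine le_trans ?_ (key.trans k2)
      rw [← sq (ds _ _ _)]; gcongr; exact le_add_of_nonneg_right (mul_self_nonneg _)
    have k4 : |ds (Ioi 0) y (r, s)| ≤ Real.sqrt (Bd / (16 * D ^ 2)) := by
      refine Real.abs_le_sqrt ?_
      rw [le_div_iff₀ (by positivity)]; linarith
    rw [hys hr sI] at k4
    exact (cp2 hr (by linarith)).trans (by gcongr)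
  · obtain ⟨-, b0, b3, -⟩ := hyp ρ σ h1 (by linarith [h3.1])
    refine ⟨?_, b3.trans (Θb h1 h2)⟩
    have := h.pos ρ h1.le
    exact ((mul_pos_iff_of_pos_left (by linarith)).1 (this.trans_le b0)).le
  · have hσ : σ ∈ Ioi (0:ℝ) := by rw [mem_Ioi]; linarith [h3.1]
    obtain ⟨a0, a1, a2, a3, a4, a5, a6, a7⟩ := hyp ρ σ h1 (by linarith [h3.1])
    have q := Lop_q hI (hz.dr hI) (hy.ds hI) (16 * D ^ 2) β b h1 hσ
    rw [hez.Lr hI hz hβ hγ h.hb h1 hσ, hey.Ls hI hy hβ hg h1 hσ] at q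
    have eY := hys h1 hσ
    have ey : ds (Ioi 0) y (ρ, σ) = ϑ * ds (Ioi 0) z (ρ, σ) := by
      rw [eY, zd, ds_cmul hI hZ _ h1 hσ]; ring
    have c1 : Θ ρ ^ (j+1) * |ds (Ioi 0) Z (ρ, σ)| ≤ κ * |ds (Ioi 0) y (ρ, σ)| := by rw [eY]; exact cp2 h1 h2
    have eqz := hez ρ σ h1 hσ
    have al := hal (p := dr (Ioi 0) z (ρ, σ)) (q := dr (Ioi 0) (dr (Ioi 0) z) (ρ, σ)) (Y := ds (Ioi 0) y (ρ, σ)) (Yr := dr (Ioi 0) (ds (Ioi 0) y) (ρ, σ)) (k := β (ρ, σ) / ϑ)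
      (bz := dr (Ioi 0) β (ρ, σ) * ds (Ioi 0) z (ρ, σ)) (b := b ρ) (b' := b' ρ) (γ := γ (ρ, σ)) (γr := dr (Ioi 0) γ (ρ, σ)) (gs := ds (Ioi 0) g (ρ, σ)) (βs := ds (Ioi 0) β (ρ, σ))
      ?_ ?_ ?_ ?_ ?_ ?_ ?_ ?_ (h.b1' DK h1)
    · exact q.le.trans (al.trans (le_of_eq (by ring)))
    · rw [zd, dr_cmul hZ _ h1 hσ]; exact (cpj h1 h2).trans ((mul_le_mul_of_nonneg_left a0 (by linarith)).trans Dκ1)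
    · rw [mul_div_assoc', le_div_iff₀ ϑ0, one_mul]
      have := h.cmp R0 ρ R00 h1.le (dn h2)
      have β0 := (mul_pos_iff_of_pos_left (by linarith)).1 ((h.pos ρ h1.le).trans_le a1)
      rw [← hϑ] at this
      calc ϑ ≤ K * (C * β (ρ, σ)) := this.trans (by gcongr)
        _ = (C * K) * β (ρ, σ) := by ring
        _ ≤ _ := by gcongr
    · rw [← eqz, ey]; field_simp
    · rw [γd]; exact (cpj h1 h2).trans ((mul_le_mul_of_nonneg_left a4 (by linarith)).trans Dκ1)
    · rw [γd, dr_cmul hΓ _ h1 hσ]; exact (cpj h1 h2).trans ((mul_le_mul_of_nonneg_left a5 (by linarith)).trans Dκ1)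
    · rw [ey, abs_mul, abs_mul, abs_of_pos ϑ0, ← mul_assoc]
      exact mul_le_mul_of_nonneg_right ((a3.trans (Θb h1 h2)).trans (mul_le_mul_of_nonneg_right DCK ϑ0.le)) (abs_nonneg _)
    · rw [gd, ds_cmul hI hΓ _ h1 hσ]
      calc _ ≤ κ * (C * (1 + κ * |ds (Ioi 0) y (ρ, σ)|)) := (cp1 h1 h2).trans (mul_le_mul_of_nonneg_left (a7.trans (by gcongr)) (by linarith))
        _ ≤ κ * (C * (κ + κ * |ds (Ioi 0) y (ρ, σ)|)) := by gcongr
        _ = C * κ * κ * (1 + |ds (Ioi 0) y (ρ, σ)|) := by ring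
        _ ≤ _ := by gcongr
    · calc _ ≤ C * (1 + κ * |ds (Ioi 0) y (ρ, σ)|) := a6.trans (by gcongr)
        _ ≤ C * (κ + κ * |ds (Ioi 0) y (ρ, σ)|) := by gcongr
        _ = κ * C * (1 + |ds (Ioi 0) y (ρ, σ)|) := by ring
        _ ≤ _ := by gcongr
end

section
variable {Θ b b' ω : ℝ → ℝ} {K : ℝ} {A : Set ℝ} {X F G w : ℝ × ℝ → ℝ} {d e k J : ℕ}

/-- directional derivative -/
noncomputable def dd (v : ℝ × ℝ) (F : ℝ × ℝ → ℝ) : ℝ × ℝ → ℝ := fun q => fderivWithin ℝ F (Ici 0 ×ˢ Ioi 0) q v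
theorem Sm.dd (h : Sm (Ioi 0) F) (v : ℝ × ℝ) : Sm (Ioi 0) (dd v F) := h.fd isOpen_Ioi v
theorem udq {q : ℝ × ℝ} (hq : q ∈ Ici (0:ℝ) ×ˢ Ioi (0:ℝ)) : UniqueDiffWithinAt ℝ (Ici (0:ℝ) ×ˢ Ioi (0:ℝ)) q := Sm.ud isOpen_Ioi q hq
theorem dd_mul (hF : Sm (Ioi 0) F) (hG : Sm (Ioi 0) G) (v : ℝ × ℝ) {q : ℝ × ℝ} (hq : q ∈ Ici (0:ℝ) ×ˢ Ioi (0:ℝ)) :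
    dd v (fun q => F q * G q) q = dd v F q * G q + F q * dd v G q := by
  have := ((hF.diff hq).mul (hG.diff hq)).fderivWithin (udq hq)
  unfold dd; erw [this]; simp; ring
theorem dd_add (hF : Sm (Ioi 0) F) (hG : Sm (Ioi 0) G) (v : ℝ × ℝ) {q : ℝ × ℝ} (hq : q ∈ Ici (0:ℝ) ×ˢ Ioi (0:ℝ)) :
    dd v (fun q => F q + G q) q = dd v F q + dd v G q := by
  have := ((hF.diff hq).add (hG.diff hq)).fderivWithin (udq hq)
  unfold dd; erw [this]; simp
theorem dd_pow (hw : Sm (Ioi 0) w) (α : ℝ) (v : ℝ × ℝ) {q : ℝ × ℝ} (hq : q ∈ Ici (0:ℝ) ×ˢ Ioi (0:ℝ)) (h0 : 0 < 1 + w q) :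
    dd v (fun q => (1 + w q) ^ α) q = α * (1 + w q) ^ (α - 1) * dd v w q := by
  have := (((hw.diff hq).const_add 1).rpow_const (p := α) (Or.inl h0.ne')).fderivWithin (udq hq)
  unfold dd; rw [this]; simp
theorem dd_const (c : ℝ) (v q : ℝ × ℝ) : dd v (fun _ => c) q = 0 := by unfold dd; simp
theorem Sm.pow (hw : Sm (Ioi 0) w) (hp : ∀ q ∈ Ici (0:ℝ) ×ˢ Ioi (0:ℝ), 0 < 1 + w q) (α : ℝ) : Sm (Ioi 0) (fun q => (1 + w q) ^ α) :=
  ((Sm.const 1).add hw).rpow_const_of_ne (fun q hq => (hp q hq).ne')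

/-- weighted eventual bounds -/
def Bd (Θ : ℝ → ℝ) (A : Set ℝ) (d : ℕ) (X F : ℝ × ℝ → ℝ) : Prop := ∃ C, ∀ᶠ s in atTop, ∀ r ∈ A, Θ r ^ d * |F (r, s)| ≤ C * X (r, s)

theorem Bd.cg (hF : Bd Θ A d X F) (hA : A ⊆ Ioi 0) (h : ∀ q ∈ Ici (0:ℝ) ×ˢ Ioi (0:ℝ), G q = F q) : Bd Θ A d X G := by
  obtain ⟨C, h1⟩ := hF
  refine ⟨C, ?_⟩
  filter_upwards [h1, eventually_gt_atTop 0] with s h1 hs r hr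
  rw [h (r, s) ⟨le_of_lt (show (0:ℝ) < r from hA hr), hs⟩]; exact h1 r hr

theorem Bd.add (h : Bk Θ b b' ω K) (hA : A ⊆ Ioi 0) (hF : Bd Θ A d X F) (hG : Bd Θ A d X G) : Bd Θ A d X (fun q => F q + G q) := by
  obtain ⟨C, h1⟩ := hF
  obtain ⟨C', h2⟩ := hG
  refine ⟨C + C', ?_⟩
  filter_upwards [h1, h2] with s h1 h2 r hr
  have := mul_le_mul_of_nonneg_left (abs_add_le (F (r, s)) (G (r, s))) (pow_nonneg (h.pos r (hA hr).le).le d)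
  linarith [h1 r hr, h2 r hr]

theorem Bd.mul (h : Bk Θ b b' ω K) (hA : A ⊆ Ioi 0) (hF : Bd Θ A d X F) (hG : Bd Θ A e 1 G) (hk : d + e ≤ k) : Bd Θ A k X (fun q => F q * G q) := by
  obtain ⟨C, h1⟩ := hF
  obtain ⟨C', h2⟩ := hG
  refine ⟨K ^ (k - (d + e)) * (C * C'), ?_⟩
  filter_upwards [h1, h2] with s h1 h2 r hr
  have Θ0 := h.pos r (hA hr).le
  have h1 := h1 r hr
  have h2 := h2 r hr
  simp only [Pi.one_apply, mul_one] at h2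
  have e1 : Θ r ^ k * |F (r, s) * G (r, s)| = Θ r ^ (k - (d + e)) * ((Θ r ^ d * |F (r, s)|) * (Θ r ^ e * |G (r, s)|)) := by
    rw [abs_mul, show k = k - (d + e) + (d + e) by omega, Nat.add_sub_cancel, pow_add, pow_add]; ring
  have n1 : 0 ≤ Θ r ^ d * |F (r, s)| := by positivity
  have n2 : 0 ≤ Θ r ^ e * |G (r, s)| := by positivity
  rw [e1]
  calc _ ≤ K ^ (k - (d + e)) * ((C * X (r, s)) * C') := mul_le_mul (pow_le_pow_left₀ Θ0.le (h.le r (hA hr).le) _) (mul_le_mul h1 h2 n2 (n1.trans h1)) (mul_nonneg n1 n2) (pow_nonneg (by linarith [h.K1]) _)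
    _ = _ := by ring

theorem Bd.con (c : ℝ) : Bd Θ A 0 1 (fun _ => c) := ⟨|c|, Eventually.of_forall fun s r hr => by simp⟩

theorem Bd.mono (h : Bk Θ b b' ω K) (hA : A ⊆ Ioi 0) (hF : Bd Θ A d X F) (hk : d ≤ k) : Bd Θ A k X F :=
  (Bd.mul h hA hF (Bd.con 1) (by simpa using hk)).cg hA (fun q _ => by simp)

theorem pw_bd {x : ℝ} (h1 : |x - 1| ≤ 1/2) (α : ℝ) : |x ^ α| ≤ 2 ^ |α| := by
  have h2 : 1/2 ≤ x := by linarith [(abs_le.1 h1).1]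
  have h3 : x ≤ 2 := by linarith [(abs_le.1 h1).2]
  have x0 : 0 < x := by linarith
  rw [abs_of_pos (by positivity)]
  rcases le_total 1 x with h | h
  · calc x ^ α ≤ x ^ |α| := Real.rpow_le_rpow_of_exponent_le h (le_abs_self α)
      _ ≤ 2 ^ |α| := Real.rpow_le_rpow x0.le h3 (abs_nonneg α)
  · have e1 : x ^ α = (x⁻¹) ^ (-α) := by rw [Real.inv_rpow x0.le, Real.rpow_neg x0.le, inv_inv]
    have i1 : 1 ≤ x⁻¹ := (one_le_inv₀ x0).2 h
    have i2 : x⁻¹ ≤ 2 := by rw [inv_le_comm₀ x0 (by norm_num)]; linarith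
    rw [e1]
    calc _ ≤ (x⁻¹) ^ |α| := Real.rpow_le_rpow_of_exponent_le i1 (neg_le_abs α)
      _ ≤ 2 ^ |α| := Real.rpow_le_rpow (by positivity) i2 (abs_nonneg α)

/-- time derivatives -/
noncomputable def Zs (w : ℝ × ℝ → ℝ) (j : ℕ) : ℝ × ℝ → ℝ := (ds (Ioi 0))^[j] w
theorem Zs_succ (w : ℝ × ℝ → ℝ) (j : ℕ) : Zs w (j+1) = ds (Ioi 0) (Zs w j) := Function.iterate_succ_apply' _ _ _
theorem Zs_sm (hw : Sm (Ioi 0) w) (j : ℕ) : Sm (Ioi 0) (Zs w j) := by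
  induction j with
  | zero => exact hw
  | succ j ih => rw [Zs_succ]; exact ih.ds isOpen_Ioi

/-- polynomials in powers of f and its time derivatives -/
inductive TT (w : ℝ × ℝ → ℝ) (J : ℕ) : ℕ → (ℝ × ℝ → ℝ) → Prop
  | pw (α : ℝ) : TT w J 0 (fun q => (1 + w q) ^ α)
  | z (i : ℕ) (h1 : 1 ≤ i) (hi : i ≤ J) : TT w J i (Zs w i)
  | con (c : ℝ) : TT w J 0 (fun _ => c)
  | add {d : ℕ} {F G : ℝ × ℝ → ℝ} : TT w J d F → TT w J d G → TT w J d (fun q => F q + G q)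
  | mul {d e k : ℕ} {F G : ℝ × ℝ → ℝ} : TT w J d F → TT w J e G → d + e ≤ k → TT w J k (fun q => F q * G q)

theorem TT.mono (h : TT w J d F) {J' : ℕ} (hJ : J ≤ J') : TT w J' d F := by
  induction h with
  | pw α => exact .pw α
  | z i h1 hi => exact .z i h1 (hi.trans hJ)
  | con c => exact .con c
  | add _ _ a b => exact .add a b
  | mul _ _ hk a b => exact .mul a b hk

theorem TT.sm (h : TT w J d F) (hw : Sm (Ioi 0) w) (hp : ∀ q ∈ Ici (0:ℝ) ×ˢ Ioi (0:ℝ), 0 < 1 + w q) : Sm (Ioi 0) F := by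
  induction h with
  | pw α => exact hw.pow hp α
  | z i h1 hi => exact Zs_sm hw i
  | con c => exact Sm.const c
  | add _ _ a b => exact a.add b
  | mul _ _ hk a b => exact a.mul b

theorem TT.ds (h : TT w J d F) (hw : Sm (Ioi 0) w) (hp : ∀ q ∈ Ici (0:ℝ) ×ˢ Ioi (0:ℝ), 0 < 1 + w q) :
    ∃ F', TT w (J+1) (d+1) F' ∧ ∀ q ∈ Ici (0:ℝ) ×ˢ Ioi (0:ℝ), ds (Ioi 0) F q = F' q := by
  induction h with
  | pw α => exact ⟨_, .mul (.mul (.con α) (.pw (α - 1)) le_rfl) (.z 1 le_rfl (by omega)) (by omega), fun q hq => dd_pow hw α _ hq (hp q hq)⟩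
  | z i h1 hi => exact ⟨_, .z (i+1) (by omega) (by omega), fun q hq => by rw [Zs_succ]⟩
  | con c => exact ⟨_, .mul (.con 0) (.z 1 le_rfl (by omega)) (by omega), fun q hq => by rw [zero_mul]; exact dd_const c _ q⟩
  | add h1 h2 a b =>
    obtain ⟨F', a1, a2⟩ := a; obtain ⟨G', b1, b2⟩ := b
    exact ⟨_, .add a1 b1, fun q hq => by rw [← a2 q hq, ← b2 q hq]; exact dd_add (h1.sm hw hp) (h2.sm hw hp) _ hq⟩
  | mul h1 h2 hk a b =>
    obtain ⟨F', a1, a2⟩ := a; obtain ⟨G', b1, b2⟩ := b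
    exact ⟨_, .add (.mul a1 (h2.mono (by omega)) (by omega)) (.mul (h1.mono (by omega)) b1 (by omega)), fun q hq => by rw [← a2 q hq, ← b2 q hq]; exact dd_mul (h1.sm hw hp) (h2.sm hw hp) _ hq⟩

/-- the full system for w = f - 1 -/
structure FSys (Θ b b' ω : ℝ → ℝ) (K p c : ℝ) (w : ℝ × ℝ → ℝ) : Prop where
  bk : Bk Θ b b' ω K
  p1 : 1 < p
  sΘ : Sm (Ioi 0) (fun q => Θ q.1)
  Θr : ∀ r s, 0 < r → 0 < s → |dr (Ioi 0) (fun q => Θ q.1) (r, s)| ≤ K * Θ r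
  sw : Sm (Ioi 0) w
  fp : ∀ q ∈ Ici (0:ℝ) ×ˢ Ioi (0:ℝ), 0 < 1 + w q
  eq : Eqn (Ioi 0) (fun q => Θ q.1 * (p * (1 + w q) ^ (p - 1))) (fun q => Θ q.1 * (c * ((1 + w q) ^ p + -1 * (1 + w q) ^ (1:ℝ)))) b w
  small : ∀ δ, 0 < δ → ∀ᶠ s in atTop, ∀ r, 0 < r → |w (r, s)| ≤ δ

variable {p c : ℝ}
theorem FSys.pw (h : FSys Θ b b' ω K p c w) (hA : A ⊆ Ioi 0) (α : ℝ) : Bd Θ A 0 1 (fun q => (1 + w q) ^ α) := by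
  refine ⟨2 ^ |α|, ?_⟩
  filter_upwards [h.small (1/2) (by norm_num)] with s hs r hr
  simp only [pow_zero, one_mul, Pi.one_apply, mul_one]
  exact pw_bd (by rw [add_sub_cancel_left]; exact hs r (hA hr)) α

theorem FSys.bd (h : FSys Θ b b' ω K p c w) (hA : A ⊆ Ioi 0) (hZ : ∀ i, 1 ≤ i → i ≤ J → Bd Θ A i 1 (Zs w i)) (t : TT w J d F) : Bd Θ A d 1 F := by
  induction t with
  | pw α => exact h.pw hA α
  | z i h1 hi => exact hZ i h1 hi
  | con c => exact Bd.con c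
  | add _ _ a b => exact a.add h.bk hA b
  | mul _ _ hk a b => exact a.mul h.bk hA b hk

theorem FSys.bdD (h : FSys Θ b b' ω K p c w) (hA : A ⊆ Ioi 0) (hZ : ∀ i, 1 ≤ i → i ≤ J → Bd Θ A i 1 (Zs w i)) (v : ℝ × ℝ)
    (hD : ∀ i, i ≤ J → Bd Θ A (i+e) X (dd v (Zs w i))) (t : TT w J d F) : Bd Θ A (d+e) X (dd v F) := by
  have hB := h.bk
  induction t with
  | pw α => exact ((hD 0 (by omega)).mul hB hA (((Bd.con α)).mul hB hA (h.pw hA (α - 1)) le_rfl) (by omega)).cg hA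
              (fun q hq => by rw [dd_pow h.sw α v hq (h.fp q hq), mul_comm]; rfl)
  | z i h1 hi => exact hD i hi
  | con c => exact ((hD 0 (by omega)).mul hB hA (Bd.con 0) (by omega)).cg hA (fun q hq => by rw [dd_const]; simp)
  | add h1 h2 a b => exact (a.add hB hA b).cg hA (fun q hq => dd_add (h1.sm h.sw h.fp) (h2.sm h.sw h.fp) v hq)
  | mul h1 h2 hk a b =>
    exact ((a.mul hB hA (h.bd hA hZ h2) (by omega)).add hB hA (b.mul hB hA (h.bd hA hZ h1) (by omega))).cg hA
      (fun q hq => by rw [dd_mul (h1.sm h.sw h.fp) (h2.sm h.sw h.fp) v hq, mul_comm (dd v _ q) _, mul_comm (dd v _ q) _])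

/-- coefficient -/
noncomputable def bet (Θ : ℝ → ℝ) (p : ℝ) (w : ℝ × ℝ → ℝ) : ℝ × ℝ → ℝ := fun q => Θ q.1 * (p * (1 + w q) ^ (p - 1))

/-- the hierarchy of equations -/
theorem FSys.hier (h : FSys Θ b b' ω K p c w) (j : ℕ) : ∃ T, TT w j (j+1) T ∧ Eqn (Ioi 0) (bet Θ p w) (fun q => Θ q.1 * T q) b (Zs w j) := by
  have hI : IsOpen (Ioi (0:ℝ)) := isOpen_Ioi
  induction j with
  | zero =>
    refine ⟨_, .mul (d := 0) (e := 0) (.con c) (.add (.pw p) (.mul (.con (-1)) (.pw 1) le_rfl)) (by omega), h.eq⟩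
  | succ j ih =>
    obtain ⟨T, hT, he⟩ := ih
    obtain ⟨T', hT', hd⟩ := hT.ds h.sw h.fp
    have sT := hT.sm h.sw h.fp
    have sa : TT w (j+1) 1 (fun q => p * ((p - 1) * (1 + w q) ^ (p - 1 - 1) * Zs w 1 q)) :=
      .mul (d := 0) (e := 1) (.con p) (.mul (.mul (.con (p - 1)) (.pw _) le_rfl) (.z 1 le_rfl (by omega)) le_rfl) (by omega)
    refine ⟨_, .add hT' (.mul (d := j+2) (e := 0) (.mul (d := 1) (e := j+1) sa (.z (j+1) (by omega) le_rfl) (by omega)) (.con (-1)) (by omega)), ?_⟩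
    have sβ : Sm (Ioi 0) (bet Θ p w) := h.sΘ.mul ((Sm.const p).mul (h.sw.pow h.fp _))
    intro r s hr hs
    have hq : (r, s) ∈ Ici (0:ℝ) ×ˢ Ioi (0:ℝ) := ⟨hr.le, hs⟩
    have L := he.Ls hI (Zs_sm h.sw j) sβ (h.sΘ.mul sT) hr hs
    rw [← Zs_succ] at L
    have Θs : ds (Ioi 0) (fun q => Θ q.1) (r, s) = 0 := h.sΘ.ds_eq hI hr.le hs (hasDerivAt_const s (Θ r))
    have e1 : ds (Ioi 0) (fun q => Θ q.1 * T q) (r, s) = Θ r * T' (r, s) := by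
      have := dd_mul h.sΘ sT (0, 1) hq
      rw [← hd (r, s) hq]; refine this.trans ?_
      change ds (Ioi 0) (fun q => Θ q.1) (r, s) * _ + _ = _
      rw [Θs]; simp; left; rfl
    have e2 : ds (Ioi 0) (bet Θ p w) (r, s) = Θ r * (p * ((p - 1) * (1 + w (r, s)) ^ (p - 1 - 1) * Zs w 1 (r, s))) := by
      have := dd_mul h.sΘ ((Sm.const p).mul (h.sw.pow h.fp (p - 1))) (0, 1) hq
      refine this.trans ?_
      change ds (Ioi 0) (fun q => Θ q.1) (r, s) * _ + _ = _
      rw [Θs, dd_mul (Sm.const p) (h.sw.pow h.fp (p - 1)) (0, 1) hq, dd_const, dd_pow h.sw _ _ hq (h.fp _ hq)]; simp; left; left; left; rfl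
    rw [e1, e2] at L
    unfold Lop at L
    simp only
    linear_combination L
end

section
variable {Θ b b' ω : ℝ → ℝ} {K p c : ℝ} {A : Set ℝ} {X F G w : ℝ × ℝ → ℝ} {d e k J : ℕ}

theorem Bd.up (hF : Bd Θ A d 1 F) (hX : ∀ q, 1 ≤ X q) : Bd Θ A d X F := by
  obtain ⟨C, h⟩ := hF
  refine ⟨|C|, ?_⟩
  filter_upwards [h] with s h r hr
  have := h r hr
  simp only [Pi.one_apply, mul_one] at this
  exact (this.trans (le_abs_self C)).trans (le_mul_of_one_le_right (abs_nonneg C) (hX _))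

theorem Bd.Θm (h : Bk Θ b b' ω K) (hA : A ⊆ Ioi 0) (hF : Bd Θ A (d+1) X F) : Bd Θ A d X (fun q => Θ q.1 * F q) := by
  obtain ⟨C, h1⟩ := hF
  refine ⟨C, ?_⟩
  filter_upwards [h1] with s h1 r hr
  have Θ0 := h.pos r (le_of_lt (hA hr))
  refine le_trans (le_of_eq ?_) (h1 r hr)
  rw [abs_mul, abs_of_pos Θ0, pow_succ]; ring

theorem FSys.dΘ (h : FSys Θ b b' ω K p c w) (hA : A ⊆ Ioi 0) (hF : Bd Θ A (d+1) X F) : Bd Θ A d X (fun q => dr (Ioi 0) (fun q => Θ q.1) q * F q) := by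
  obtain ⟨C, h1⟩ := hF
  refine ⟨K * C, ?_⟩
  filter_upwards [h1, eventually_gt_atTop 0] with s h1 hs r hr
  have Θ0 := h.bk.pos r (le_of_lt (hA hr))
  have h2 := mul_le_mul_of_nonneg_left (h1 r hr) (zero_le_one.trans h.bk.K1)
  rw [abs_mul]
  calc _ ≤ Θ r ^ d * ((K * Θ r) * |F (r, s)|) := by
        gcongr; exact h.Θr r s (hA hr) hs
    _ = K * (Θ r ^ (d+1) * |F (r, s)|) := by ring
    _ ≤ _ := by rw [mul_assoc]; exact h2

theorem dd_dr (F : ℝ × ℝ → ℝ) : dd (1, 0) F = dr (Ioi 0) F := rfl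
theorem dd_ds (F : ℝ × ℝ → ℝ) : dd (0, 1) F = ds (Ioi 0) F := rfl

theorem FSys.Θs (h : FSys Θ b b' ω K p c w) {q : ℝ × ℝ} (hq : q ∈ Ici (0:ℝ) ×ˢ Ioi (0:ℝ)) : ds (Ioi 0) (fun q => Θ q.1) q = 0 :=
  h.sΘ.ds_eq isOpen_Ioi hq.1 hq.2 (hasDerivAt_const q.2 (Θ q.1))

/-- r-derivative of Θ F -/
theorem FSys.drΘ (h : FSys Θ b b' ω K p c w) (hA : A ⊆ Ioi 0) (sF : Sm (Ioi 0) F) (hX : ∀ q, 1 ≤ X q) (hF : Bd Θ A (d+1) 1 F) (hF' : Bd Θ A (d+1) X (dr (Ioi 0) F)) :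
    Bd Θ A d X (dr (Ioi 0) (fun q => Θ q.1 * F q)) :=
  ((h.dΘ hA (hF.up hX)).add h.bk hA (hF'.Θm h.bk hA)).cg hA (fun q hq => dd_mul h.sΘ sF (1, 0) hq)
theorem FSys.dsΘ (h : FSys Θ b b' ω K p c w) (hA : A ⊆ Ioi 0) (sF : Sm (Ioi 0) F) (hF' : Bd Θ A (d+1) X (ds (Ioi 0) F)) :
    Bd Θ A d X (ds (Ioi 0) (fun q => Θ q.1 * F q)) :=
  (hF'.Θm h.bk hA).cg hA (fun q hq => by
    refine (dd_mul h.sΘ sF (0, 1) hq).trans ?_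
    rw [dd_ds, dd_ds, h.Θs hq]; ring)

theorem FSys.ta (p : ℝ) : TT w 0 0 (fun q => p * (1 + w q) ^ (p - 1)) := .mul (d := 0) (e := 0) (.con p) (.pw _) le_rfl

theorem FSys.bβ (h : FSys Θ b b' ω K p c w) : ∃ C, 1 ≤ C ∧ ∀ᶠ s in atTop, ∀ r, 0 < r → 0 < bet Θ p w (r, s) ∧ Θ r ≤ C * bet Θ p w (r, s) ∧ bet Θ p w (r, s) ≤ C * Θ r := by
  have p0 : 0 < p := by linarith [h.p1]
  refine ⟨p * 2 ^ |p - 1| + 2 ^ |1 - p|, ?_, ?_⟩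
  · have : (1:ℝ) ≤ 2 ^ |1 - p| := Real.one_le_rpow (by norm_num) (abs_nonneg _)
    have : 0 < p * 2 ^ |p - 1| := by positivity
    linarith
  filter_upwards [h.small (1/2) (by norm_num)] with s hs r hr
  have h1 : |1 + w (r, s) - 1| ≤ 1/2 := by rw [add_sub_cancel_left]; exact hs r hr
  have f0 : 0 < 1 + w (r, s) := by linarith [(abs_le.1 h1).1]
  have Θ0 := h.bk.pos r hr.le
  have a1 := (le_abs_self _).trans (pw_bd h1 (p - 1))
  have a2 := (le_abs_self _).trans (pw_bd h1 (1 - p))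
  have e1 : (1 + w (r, s)) ^ (p - 1) * (1 + w (r, s)) ^ (1 - p) = 1 := by rw [← Real.rpow_add f0]; simp
  have c1 : 0 < (2:ℝ) ^ |p - 1| := by positivity
  have c2 : 0 < (2:ℝ) ^ |1 - p| := by positivity
  have x0 : 0 < (1 + w (r, s)) ^ (p - 1) := by positivity
  unfold bet
  simp only
  have β0 : 0 < Θ r * (p * (1 + w (r, s)) ^ (p - 1)) := by positivity
  refine ⟨β0, ?_, ?_⟩
  · calc Θ r = (1 * Θ r) * ((1 + w (r, s)) ^ (p - 1) * (1 + w (r, s)) ^ (1 - p)) := by rw [e1]; ring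
      _ ≤ (p * Θ r) * ((1 + w (r, s)) ^ (p - 1) * 2 ^ |1 - p|) := by gcongr; exact h.p1.le
      _ = 2 ^ |1 - p| * (Θ r * (p * (1 + w (r, s)) ^ (p - 1))) := by ring
      _ ≤ _ := mul_le_mul_of_nonneg_right (by linarith only [mul_pos p0 c1]) β0.le
  · calc _ ≤ Θ r * (p * 2 ^ |p - 1|) := by gcongr
      _ = (p * 2 ^ |p - 1|) * Θ r := by ring
      _ ≤ _ := mul_le_mul_of_nonneg_right (by linarith only [c2]) Θ0.le

theorem FSys.smβ (h : FSys Θ b b' ω K p c w) : Sm (Ioi 0) (bet Θ p w) := h.sΘ.mul ((FSys.ta p).sm h.sw h.fp)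

/-- |β_r| ≤ C Θ X -/
theorem FSys.βr (h : FSys Θ b b' ω K p c w) (hX : ∀ q, 1 ≤ X q) (h0 : Bd Θ (Ioi 0) 0 X (dr (Ioi 0) w)) :
    ∃ C, ∀ᶠ s in atTop, ∀ r, 0 < r → |dr (Ioi 0) (bet Θ p w) (r, s)| ≤ C * (Θ r * X (r, s)) := by
  have ta := FSys.ta (w := w) p
  obtain ⟨C1, h1⟩ := (h.bd (A := Ioi 0) Subset.rfl (by omega) ta).up hX
  obtain ⟨C2, h2⟩ := h.bdD (A := Ioi 0) (e := 0) Subset.rfl (by omega) (1, 0) (fun i hi => by obtain rfl : i = 0 := by omega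
                                                                                              exact h0) ta
  refine ⟨K * C1 + C2, ?_⟩
  filter_upwards [h1, h2, eventually_gt_atTop 0] with s h1 h2 hs r hr
  have h1 := h1 r hr
  have h2 := h2 r hr
  have Θ0 := h.bk.pos r hr.le
  have K0 := zero_le_one.trans h.bk.K1
  have e : dr (Ioi 0) (bet Θ p w) (r, s) = _ := dd_mul h.sΘ (ta.sm h.sw h.fp) (1, 0) ⟨hr.le, hs⟩
  simp only [pow_zero, one_mul, add_zero] at h1 h2
  rw [e]
  refine (abs_add_le _ _).trans ?_
  rw [abs_mul, abs_mul (Θ (r, s).1), abs_of_pos (show 0 < Θ (r, s).1 from Θ0)]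
  calc _ ≤ (K * Θ r) * (C1 * X (r, s)) + Θ r * (C2 * X (r, s)) := by
        refine add_le_add (mul_le_mul (h.Θr r s hr hs) h1 (abs_nonneg _) (by positivity)) (mul_le_mul_of_nonneg_left h2 Θ0.le)
    _ = _ := by ring

theorem ev0 {P : ℝ → Prop} (h : ∀ᶠ s in atTop, P s) : ∃ S, 0 ≤ S ∧ ∀ s, S < s → P s := by
  obtain ⟨S, hS⟩ := eventually_atTop.1 h
  exact ⟨max S 0, le_max_right _ _, fun s hs => hS s ((le_max_left _ _).trans hs.le)⟩
theorem upc {C C' x y : ℝ} (h : x ≤ C * y) (hy : 0 ≤ y) (hC : C ≤ C') : x ≤ C' * y := h.trans (mul_le_mul_of_nonneg_right hC hy)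

theorem FSys.pre (h : FSys Θ b b' ω K p c w) (j : ℕ) (hj : 1 ≤ j → Bd Θ (Ioi 0) j 1 (Zs w j)) (hR : ∀ i, i < j → Bd Θ (Ioi 0) i 1 (dr (Ioi 0) (Zs w i))) :
    ∃ C, 0 ≤ C ∧ ∀ δ, 0 < δ → ∃ l, 0 < l ∧ l ≤ 1 ∧ ∀ᶠ s in atTop, ∀ r, 0 < r → l * (Θ r ^ j * |Zs w j (r, s)|) ≤ δ ∧
      |dr (Ioi 0) (bet Θ p w) (r, s)| ≤ C * (Θ r * (1 + l * (Θ r ^ j * |dr (Ioi 0) (Zs w j) (r, s)|))) := by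
  rcases Nat.eq_zero_or_pos j with rfl | h1
  · obtain ⟨C, hC⟩ := h.βr (X := fun q => 1 + |dr (Ioi 0) w q|) (fun q => by linarith [abs_nonneg (dr (Ioi 0) w q)])
      ⟨1, Eventually.of_forall fun s r hr => by simp⟩
    refine ⟨|C|, abs_nonneg _, fun δ hδ => ⟨1, one_pos, le_rfl, ?_⟩⟩
    filter_upwards [hC, h.small δ hδ] with s a1 a2 r hr
    have Θ0 := h.bk.pos r hr.le
    refine ⟨by simpa [Zs] using a2 r hr, ?_⟩
    refine upc (C := C) ?_ (by positivity) (le_abs_self C)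
    simpa [Zs] using a1 r hr
  · obtain ⟨C, hC⟩ := h.βr (X := 1) (fun q => le_rfl) (hR 0 h1)
    obtain ⟨D, hD⟩ := hj h1
    refine ⟨|C|, abs_nonneg _, fun δ hδ => ?_⟩
    have D0 : 0 < |D| + 1 := by positivity
    refine ⟨min 1 (δ / (|D| + 1)), lt_min one_pos (by positivity), min_le_left _ _, ?_⟩
    have l0 : 0 < min 1 (δ / (|D| + 1)) := lt_min one_pos (by positivity)
    filter_upwards [hC, hD] with s a1 a2 r hr
    have Θ0 := h.bk.pos r hr.le
    have a2 := a2 r hr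
    have a1 := a1 r hr
    simp only [Pi.one_apply, mul_one] at a1 a2
    constructor
    · calc _ ≤ δ / (|D| + 1) * (|D| + 1) := by
            refine mul_le_mul (min_le_right _ _) (a2.trans ?_) (by positivity) (by positivity)
            linarith [le_abs_self D]
        _ = δ := by field_simp
    · refine (upc a1 Θ0.le (le_abs_self C)).trans (mul_le_mul_of_nonneg_left (le_mul_of_one_le_right Θ0.le ?_) (abs_nonneg _))
      have : 0 ≤ min 1 (δ / (|D| + 1)) * (Θ r ^ j * |dr (Ioi 0) (Zs w j) (r, s)|) := by positivity
      linarith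

theorem FSys.stepR (h : FSys Θ b b' ω K p c w) (j : ℕ) (hZ : ∀ i, 1 ≤ i → i ≤ j → Bd Θ (Ioi 0) i 1 (Zs w i)) (hR : ∀ i, i < j → Bd Θ (Ioi 0) i 1 (dr (Ioi 0) (Zs w i))) :
    Bd Θ (Ioi 0) j 1 (dr (Ioi 0) (Zs w j)) := by
  obtain ⟨T, hT, he⟩ := h.hier j
  have sT := hT.sm h.sw h.fp
  obtain ⟨X, hX⟩ : ∃ X : ℝ × ℝ → ℝ, X = fun q => 1 + Θ q.1 ^ j * |dr (Ioi 0) (Zs w j) q| := ⟨_, rfl⟩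
  obtain ⟨Y, hY⟩ : ∃ Y : ℝ × ℝ → ℝ, Y = fun q => max 1 (X q) := ⟨_, rfl⟩
  have Y1 : ∀ q, 1 ≤ Y q := fun q => by rw [hY]; exact le_max_left _ _
  have B1 := h.bd (A := Ioi 0) Subset.rfl hZ hT
  have B2 := h.bdD (A := Ioi 0) (X := Y) (e := 0) Subset.rfl hZ (1, 0) (fun i hi => by
    rcases hi.lt_or_eq with hi | rfl
    · exact (hR i hi).up Y1
    · refine ⟨1, Eventually.of_forall fun s r hr => ?_⟩
      rw [hY]
      refine le_trans ?_ (le_of_eq (one_mul _).symm)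
      refine le_trans ?_ (le_max_right _ _)
      rw [hX, add_zero, dd_dr]; simp) hT
  obtain ⟨C1, a1⟩ := B1.Θm h.bk Subset.rfl
  obtain ⟨C2, a2⟩ := h.drΘ Subset.rfl sT Y1 B1 B2
  obtain ⟨C3, C31, a3⟩ := h.bβ
  obtain ⟨C4, C40, a4⟩ := h.pre j (fun h1 => hZ j h1 le_rfl) hR
  obtain ⟨C, hC⟩ : ∃ C, C = 1 + |C1| + |C2| + C3 + C4 * C3 := ⟨_, rfl⟩
  have n1 := abs_nonneg C1
  have n2 := abs_nonneg C2
  have n4 : 0 ≤ C4 * C3 := by positivity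
  obtain ⟨δ, δ0, gl⟩ := h.bk.gl1 (C := C) (by linarith) j
  obtain ⟨l, l0, l1, a4⟩ := a4 δ δ0
  obtain ⟨S, S0, hS⟩ := ev0 (a1.and (a2.and (a3.and a4)))
  obtain ⟨C', hC'⟩ := gl (Zs_sm h.sw j) h.smβ (h.sΘ.mul sT) he l0 l1 S0 (fun r s hr hs => by
    obtain ⟨a1, a2, a3, a4⟩ := hS s hs
    have a1 := a1 r hr
    have a2 := a2 r hr
    obtain ⟨b0, b1, b2⟩ := a3 r hr
    obtain ⟨d1, d2⟩ := a4 r hr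
    have Θ0 := h.bk.pos r hr.le
    have X1 : 1 ≤ X (r, s) := by rw [hX]; simp only; have : 0 ≤ Θ r ^ j * |dr (Ioi 0) (Zs w j) (r, s)| := by positivity
                                 linarith
    have YX : Y (r, s) = X (r, s) := by rw [hY]; exact max_eq_right X1
    simp only [Pi.one_apply, mul_one] at a1
    rw [YX] at a2
    refine ⟨d1, b0, upc b2 Θ0.le (by linarith), ?_, a1.trans (by linarith [le_abs_self C1]), ?_⟩
    · have q0 : 0 ≤ 1 + l * (Θ r ^ j * |dr (Ioi 0) (Zs w j) (r, s)|) := by positivity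
      calc _ ≤ C4 * ((C3 * bet Θ p w (r, s)) * (1 + l * (Θ r ^ j * |dr (Ioi 0) (Zs w j) (r, s)|))) :=
            d2.trans (mul_le_mul_of_nonneg_left (mul_le_mul_of_nonneg_right b1 q0) C40)
        _ = (C4 * C3) * (bet Θ p w (r, s) * (1 + l * (Θ r ^ j * |dr (Ioi 0) (Zs w j) (r, s)|))) := by ring
        _ ≤ C * (bet Θ p w (r, s) * (1 + l * (Θ r ^ j * |dr (Ioi 0) (Zs w j) (r, s)|))) := mul_le_mul_of_nonneg_right (by linarith) (by positivity)
        _ = _ := by ring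
    · have := upc a2 (by linarith) ((le_abs_self C2).trans (show |C2| ≤ C by linarith))
      rw [hX] at this; exact this)
  exact ⟨C', by filter_upwards [eventually_gt_atTop (S + K)] with s hs r hr; simpa using hC' r s hr hs⟩

theorem FSys.stepS (h : FSys Θ b b' ω K p c w) (j : ℕ) (hZ : ∀ i, 1 ≤ i → i ≤ j → Bd Θ (Ioi 0) i 1 (Zs w i)) (hR : ∀ i, i ≤ j → Bd Θ (Ioi 0) i 1 (dr (Ioi 0) (Zs w i))) :
    Bd Θ (Ioi 0) (j+1) 1 (Zs w (j+1)) := by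
  obtain ⟨T, hT, he⟩ := h.hier j
  have sT := hT.sm h.sw h.fp
  have ta := FSys.ta (w := w) p
  obtain ⟨Y, hY⟩ : ∃ Y : ℝ × ℝ → ℝ, Y = fun q => max 1 (1 + Θ q.1 ^ (j+1) * |ds (Ioi 0) (Zs w j) q|) := ⟨_, rfl⟩
  have Y1 : ∀ q, 1 ≤ Y q := fun q => by rw [hY]; exact le_max_left _ _
  have B1 := h.bd (A := Ioi 0) Subset.rfl hZ hT
  have B2 := h.bdD (A := Ioi 0) (X := 1) (e := 0) Subset.rfl hZ (1, 0) (fun i hi => hR i hi) hT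
  have hD : ∀ i, i ≤ j → Bd Θ (Ioi 0) (i+1) Y (dd (0, 1) (Zs w i)) := fun i hi => by
    rcases hi.lt_or_eq with hi | rfl
    · rw [dd_ds, ← Zs_succ]; exact (hZ (i+1) (by omega) (by omega)).up Y1
    · refine ⟨1, Eventually.of_forall fun s r hr => ?_⟩
      rw [hY]
      refine le_trans ?_ (le_of_eq (one_mul _).symm)
      refine le_trans ?_ (le_max_right _ _)
      rw [dd_ds]; simp
  have B3 := h.bdD (A := Ioi 0) (X := Y) (e := 1) Subset.rfl hZ (0, 1) hD hT
  have B4 := h.bdD (A := Ioi 0) (X := Y) (e := 1) (J := 0) Subset.rfl (by omega) (0, 1) (fun i hi => hD i (by omega)) ta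
  obtain ⟨C1, a1⟩ := B1.Θm h.bk Subset.rfl
  obtain ⟨C2, a2⟩ := h.drΘ Subset.rfl sT (fun _ => le_rfl) B1 B2
  obtain ⟨C3, C31, a3⟩ := h.bβ
  obtain ⟨C4, a4⟩ := h.βr (X := 1) (fun _ => le_rfl) (hR 0 (by omega))
  obtain ⟨C5, a5⟩ := h.dsΘ (d := j+1) Subset.rfl sT B3
  obtain ⟨C6, a6⟩ := h.dsΘ (d := 0) Subset.rfl (ta.sm h.sw h.fp) B4
  obtain ⟨C7, a7⟩ := hR j le_rfl
  obtain ⟨C, hC⟩ : ∃ C, C = 1 + |C1| + |C2| + C3 + |C4| + |C5| + |C6| + |C7| := ⟨_, rfl⟩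
  have n1 := abs_nonneg C1
  have n2 := abs_nonneg C2
  have n4 := abs_nonneg C4
  have n5 := abs_nonneg C5
  have n6 := abs_nonneg C6
  have n7 := abs_nonneg C7
  obtain ⟨S, S0, hS⟩ := ev0 (a1.and (a2.and (a3.and (a4.and (a5.and (a6.and a7))))))
  obtain ⟨C', hC'⟩ := h.bk.gl2 (C := C) (by linarith) j (Zs_sm h.sw j) h.smβ (h.sΘ.mul sT) he S0 (fun r s hr hs => by
    obtain ⟨a1, a2, a3, a4, a5, a6, a7⟩ := hS s hs
    have a1 := a1 r hr
    have a2 := a2 r hr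
    obtain ⟨b0, b1, b2⟩ := a3 r hr
    have a4 := a4 r hr
    have a5 := a5 r hr
    have a6 := a6 r hr
    have a7 := a7 r hr
    have Θ0 := h.bk.pos r hr.le
    have Y0 : 0 ≤ 1 + Θ r ^ (j+1) * |ds (Ioi 0) (Zs w j) (r, s)| := by positivity
    have YX : Y (r, s) = 1 + Θ r ^ (j+1) * |ds (Ioi 0) (Zs w j) (r, s)| := by
      rw [hY]; refine max_eq_right ?_
      have : 0 ≤ Θ r ^ (j+1) * |ds (Ioi 0) (Zs w j) (r, s)| := by positivity
      simp only; linarith only [this]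
    simp only [Pi.one_apply, mul_one, pow_zero, one_mul] at a1 a2 a4 a6 a7
    rw [YX] at a5 a6
    refine ⟨a7.trans ((le_abs_self C7).trans (by linarith)), upc b1 b0.le (by linarith), upc b2 Θ0.le (by linarith), upc a4 Θ0.le ((le_abs_self C4).trans (by linarith)),
      a1.trans ((le_abs_self C1).trans (by linarith)), a2.trans ((le_abs_self C2).trans (by linarith)), upc a6 Y0 ((le_abs_self C6).trans (by linarith)),
      upc a5 Y0 ((le_abs_self C5).trans (by linarith))⟩)
  rw [Zs_succ]
  exact ⟨C', by filter_upwards [eventually_gt_atTop (S + K)] with s hs r hr; simpa using hC' r s hr hs⟩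

theorem FSys.all (h : FSys Θ b b' ω K p c w) (j : ℕ) : (∀ i, 1 ≤ i → i ≤ j → Bd Θ (Ioi 0) i 1 (Zs w i)) ∧ ∀ i, i < j → Bd Θ (Ioi 0) i 1 (dr (Ioi 0) (Zs w i)) := by
  induction j with
  | zero => exact ⟨by omega, by omega⟩
  | succ j ih =>
    obtain ⟨a, b⟩ := ih
    have r := h.stepR j a b
    have b' : ∀ i, i < j + 1 → Bd Θ (Ioi 0) i 1 (dr (Ioi 0) (Zs w i)) := fun i hi => by
      rcases (Nat.lt_succ_iff.1 hi).lt_or_eq with h | rfl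
      exacts [b i h, r]
    refine ⟨fun i h1 hi => ?_, b'⟩
    rcases hi.lt_or_eq with h2 | rfl
    · exact a i h1 (by omega)
    · exact h.stepS j a (fun i hi => b' i (by omega))

theorem FSys.bZ (h : FSys Θ b b' ω K p c w) (j : ℕ) : Bd Θ (Ioi 0) j 1 (Zs w j) := by
  rcases Nat.eq_zero_or_pos j with rfl | hj
  · exact ⟨1, by filter_upwards [h.small 1 one_pos] with s hs r hr; simpa [Zs] using hs r hr⟩
  · exact (h.all j).1 j hj le_rfl
theorem FSys.bR (h : FSys Θ b b' ω K p c w) (j : ℕ) : Bd Θ (Ioi 0) j 1 (dr (Ioi 0) (Zs w j)) := (h.all (j+1)).2 j (by omega)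
end

section
variable {n : ℕ} {p c : ℝ} {V : ℝ → ℝ}

noncomputable def bV (n : ℕ) (V : ℝ → ℝ) (r : ℝ) : ℝ := n * (Real.cosh r / Real.sinh r) + 2 * (Vd V 1 r / V r)
noncomputable def bV' (n : ℕ) (V : ℝ → ℝ) (r : ℝ) : ℝ := n * (1 - (Real.cosh r / Real.sinh r) ^ 2) + 2 * (Vd V 2 r / V r - (Vd V 1 r / V r) ^ 2)
noncomputable def ΘV (p : ℝ) (V : ℝ → ℝ) (r : ℝ) : ℝ := V r ^ (p - 1)

theorem coth_d {r : ℝ} (hr : 0 < r) : HasDerivAt (fun r => Real.cosh r / Real.sinh r) (1 - (Real.cosh r / Real.sinh r) ^ 2) r := by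
  have h := (Real.sinh_pos_iff.2 hr).ne'
  refine ((Real.hasDerivAt_cosh r).div (Real.hasDerivAt_sinh r) h).congr_deriv ?_
  field_simp
theorem coth_r {r : ℝ} (hr : 0 < r) : 0 < Real.cosh r / Real.sinh r ∧ Real.cosh r / Real.sinh r * r ≤ 1 + r := by
  have h := Real.sinh_pos_iff.2 hr
  refine ⟨div_pos (Real.cosh_pos r) h, ?_⟩
  rw [div_mul_eq_mul_div, div_le_iff₀ h]
  have h1 := Real.self_lt_sinh_iff.2 hr
  have h2 := Real.cosh_sub_sinh r
  have h3 : Real.exp (-r) ≤ 1 := Real.exp_le_one_iff.2 (by linarith)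
  nlinarith

theorem PV.hV (h : PV n p c V) {r : ℝ} (hr : 0 < r) : HasDerivAt V (Vd V 1 r) r := by
  have := h.hd 0 r hr; rwa [Vd0] at this

theorem PV.quo (h : PV n p c V) (k : ℕ) {r : ℝ} (hr : 0 < r) : HasDerivAt (fun r => Vd V k r / V r) (Vd V (k+1) r / V r - Vd V k r / V r * (Vd V 1 r / V r)) r := by
  have v0 := (h.pos r hr.le).ne'
  refine ((h.hd k r hr).div (h.hV hr) v0).congr_deriv ?_
  field_simp

theorem PV.qb (h : PV n p c V) (k : ℕ) : ∃ C, 0 ≤ C ∧ ∀ r, 0 ≤ r → |Vd V k r / V r| ≤ C := by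
  obtain ⟨C, hC⟩ := h.bd k
  refine ⟨|C|, abs_nonneg _, fun r hr => ?_⟩
  have v0 := h.pos r hr
  rw [abs_div, abs_of_pos v0, div_le_iff₀ v0]
  exact upc (hC r hr) v0.le (le_abs_self C)

theorem b1_alg {n C1 C2 K x l y : ℝ} (n0 : 0 ≤ n) (h1 : |l| ≤ C1) (h2 : |y| ≤ C2) (C20 : 0 ≤ C2) (hK : 1 + 2 * n + 2 * C2 + 8 * C1 ^ 2 ≤ K) : (n * x + 2 * l) ^ 2 ≤ K * (K - (n * (1 - x ^ 2) + 2 * (y - l ^ 2))) := by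
  have a1 : l ^ 2 ≤ C1 ^ 2 := sq_le_sq' (by linarith [(abs_le.1 h1).1]) (abs_le.1 h1).2
  have a2 : y ≤ C2 := (abs_le.1 h2).2
  have q : 0 ≤ C1 ^ 2 := sq_nonneg _
  have K0 : 1 ≤ K := by linarith
  have s1 : (n * x + 2 * l) ^ 2 ≤ 2 * n * (n * x ^ 2) + 8 * C1 ^ 2 := by nlinarith [sq_nonneg (n * x - 2 * l)]
  have s2 : 2 * n * (n * x ^ 2) ≤ K * (n * x ^ 2) := mul_le_mul_of_nonneg_right (by linarith) (by positivity)
  have s3 : 8 * C1 ^ 2 ≤ K * (K - n - 2 * (y - l ^ 2)) := by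
    have : 8 * C1 ^ 2 ≤ K - n - 2 * (y - l ^ 2) := by linarith [sq_nonneg l]
    nlinarith
  linarith

theorem PV.bk (h : PV n p c V) : ∃ K, Bk (ΘV p V) (bV n V) (bV' n V) (fun r => Real.sinh r ^ n * V r ^ 2) K ∧ ∀ r, 0 < r → |(p - 1) * V r ^ (p - 1 - 1) * Vd V 1 r| ≤ K * ΘV p V r := by
  obtain ⟨C1, C10, hC1⟩ := h.qb 1
  obtain ⟨C2, C20, hC2⟩ := h.qb 2
  obtain ⟨Cu, Cu0, hu⟩ := h.up
  obtain ⟨Cl, Cl0, hl⟩ := h.lo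
  have p1 : 0 < p - 1 := by linarith [h.p1]
  have n0 : (0:ℝ) ≤ n := Nat.cast_nonneg n
  obtain ⟨D, hD⟩ : ∃ D, D = Cu / Cl * Real.exp n := ⟨_, rfl⟩
  have D0 : 0 < D := by rw [hD]; positivity
  obtain ⟨K, hK⟩ : ∃ K, K = (1 + 2 * n + 2 * C2 + 8 * C1 ^ 2) + 2 * C1 + Cu ^ (p - 1) + D ^ (p - 1) + (p - 1) * C1 := ⟨_, rfl⟩
  have q1 : 0 < Cu ^ (p - 1) := by positivity
  have q2 : 0 < D ^ (p - 1) := by positivity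
  have q3 : 0 ≤ (p - 1) * C1 := by positivity
  have q4 : 0 ≤ C1 ^ 2 := by positivity
  refine ⟨K, ⟨by linarith, fun r hr => Real.rpow_pos_of_pos (h.pos r hr) _, fun r hr => ?_, fun r r' hr hr' hd => ?_, fun r hr => ?_, fun r hr => ?_, ?_, ?_, fun r hr => ?_, fun r hr => ?_, fun r hr => ?_⟩, fun r hr => ?_⟩
  · have nr : 0 ≤ n * r := mul_nonneg n0 hr
    have : V r ≤ Cu := (hu r hr).trans (mul_le_of_le_one_right Cu0.le (Real.exp_le_one_iff.2 (by linarith only [nr])))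
    exact (Real.rpow_le_rpow (h.pos r hr).le this p1.le).trans (by linarith)
  · have v0 := h.pos r' hr'
    have h1 : V r ≤ D * V r' := by
      calc V r ≤ Cu * Real.exp (-(n * r)) := hu r hr
        _ ≤ Cu * (Real.exp n * Real.exp (-(n * r'))) := by
            rw [← Real.exp_add]; gcongr; nlinarith [(abs_le.1 hd).1]
        _ = D * (Cl * Real.exp (-(n * r'))) := by rw [hD]; field_simp
        _ ≤ _ := by gcongr; exact hl r' hr'
    have h2 := Real.rpow_le_rpow (h.pos r hr).le h1 p1.le
    rw [Real.mul_rpow D0.le v0.le] at h2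
    exact upc h2 (Real.rpow_nonneg v0.le _) (by linarith)
  · have v0 := (h.pos r hr.le).ne'
    have s0 := (Real.sinh_pos_iff.2 hr).ne'
    refine (((Real.hasDerivAt_sinh r).pow n).mul ((h.hV hr).pow 2)).congr_deriv ?_
    obtain ⟨k, rfl⟩ : ∃ k, n = k + 1 := ⟨n - 1, by have := h.n1; omega⟩
    unfold bV
    simp only [Nat.add_sub_cancel, pow_succ, Pi.pow_apply]
    push_cast
    field_simp
  · have := h.pos r hr.le
    have := Real.sinh_pos_iff.2 hr
    positivity
  · exact ((Real.continuous_sinh.pow n).continuousOn).mul (h.sm.continuousOn.pow 2)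
  · simp [show n ≠ 0 from by have := h.n1; omega]
  · refine (((coth_d hr).const_mul (n:ℝ)).add ((h.quo 1 hr).const_mul 2)).congr_deriv ?_
    unfold bV'; ring
  · exact b1_alg n0 (hC1 r hr.le) (hC2 r hr.le) C20 (by linarith)
  · obtain ⟨c0, c1⟩ := coth_r hr
    have h1 := hC1 r hr.le
    have e := abs_add_le (n * (Real.cosh r / Real.sinh r)) (2 * (Vd V 1 r / V r))
    rw [abs_of_nonneg (show 0 ≤ n * (Real.cosh r / Real.sinh r) by positivity), abs_mul, abs_two] at e
    calc |bV n V r| * r ≤ (n * (Real.cosh r / Real.sinh r) + 2 * |Vd V 1 r / V r|) * r := mul_le_mul_of_nonneg_right e hr.le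
      _ = n * (Real.cosh r / Real.sinh r * r) + 2 * |Vd V 1 r / V r| * r := by ring
      _ ≤ n * (1 + r) + 2 * C1 * (1 + r) := by gcongr; linarith
      _ = (n + 2 * C1) * (1 + r) := by ring
      _ ≤ _ := by gcongr; linarith
  · have v0 := h.pos r hr.le
    have e : (p - 1) * V r ^ (p - 1 - 1) * Vd V 1 r = (p - 1) * (Vd V 1 r / V r) * ΘV p V r := by
      unfold ΘV; rw [Real.rpow_sub_one v0.ne']; field_simp
    have t0 : 0 < ΘV p V r := Real.rpow_pos_of_pos v0 _
    rw [e, abs_mul, abs_mul, abs_of_pos p1, abs_of_pos t0]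
    refine mul_le_mul_of_nonneg_right ?_ t0.le
    have := mul_le_mul_of_nonneg_left (hC1 r hr.le) p1.le
    linarith

theorem PV.smV (h : PV n p c V) : Sm (Ioi 0) (fun q => V q.1) := h.sm.comp contDiffOn_fst (fun q hq => hq.1)
theorem PV.smΘ (h : PV n p c V) : Sm (Ioi 0) (fun q => ΘV p V q.1) := h.smV.rpow_const_of_ne (fun q hq => (h.pos q.1 hq.1).ne')
theorem PV.drΘ (h : PV n p c V) {r s : ℝ} (hr : 0 < r) (hs : 0 < s) : dr (Ioi 0) (fun q => ΘV p V q.1) (r, s) = (p - 1) * V r ^ (p - 1 - 1) * Vd V 1 r :=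
  h.smΘ.dr_eq hr hs (((h.hV hr).rpow_const (Or.inl (h.pos r hr.le).ne')).congr_deriv (by ring))

/-- time change -/
noncomputable def tt (T s : ℝ) : ℝ := T * (1 - Real.exp (-(s / T)))
theorem tt_mem {T s : ℝ} (hT : 0 < T) (hs : 0 < s) : tt T s ∈ Ioo 0 T := by
  have h1 : Real.exp (-(s / T)) < 1 := by rw [Real.exp_lt_one_iff]; have : 0 < s / T := by positivity
                                          linarith
  have h2 := Real.exp_pos (-(s / T))
  unfold tt; constructor <;> nlinarith
theorem tt_g {T s : ℝ} (hT : 0 < T) : 1 - tt T s / T = Real.exp (-(s / T)) := by unfold tt; field_simp; ring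
theorem tt_d {T s : ℝ} (hT : 0 < T) : HasDerivAt (tt T) (Real.exp (-(s / T))) s := by
  refine ((((((hasDerivAt_id s).div_const T).neg).exp).const_sub 1).const_mul T).congr_deriv ?_
  field_simp; simp
theorem tt_g2 {m T s : ℝ} (hT : 0 < T) : gg m T (tt T s) = Real.exp (-(1 / ((1 - m) * T) * s)) := by
  unfold gg; rw [tt_g hT, ← Real.exp_mul]; congr 1; rw [one_div, one_div, mul_inv]; field_simp

noncomputable def wV (m T : ℝ) (u : ℝ → ℝ → ℝ) (V : ℝ → ℝ) : ℝ × ℝ → ℝ := fun q => u q.1 (tt T q.2) ^ m * Real.exp (1 / ((1 - m) * T) * m * q.2) / V q.1 + -1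

theorem f_id {m T r s : ℝ} {u : ℝ → ℝ → ℝ} (hv : 0 < V r) : u r (tt T s) ^ m = (1 + wV m T u V (r, s)) * V r * Real.exp (-(1 / ((1 - m) * T) * m * s)) := by
  unfold wV
  rw [add_comm (1:ℝ), neg_add_cancel_right, div_mul_cancel₀ _ hv.ne', mul_assoc, ← Real.exp_add, add_neg_cancel, Real.exp_zero, mul_one]

theorem u_id {m T r s : ℝ} {u : ℝ → ℝ → ℝ} (hm : 0 < m) (hv : 0 < V r) (hu : 0 < u r (tt T s)) :
    0 < 1 + wV m T u V (r, s) ∧ u r (tt T s) = (1 + wV m T u V (r, s)) ^ (1 / m) * V r ^ (1 / m) * Real.exp (-(1 / ((1 - m) * T) * s)) := by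
  have hf := f_id (m := m) (T := T) (u := u) (s := s) hv
  have f0 : 0 < 1 + wV m T u V (r, s) := by
    unfold wV; rw [add_comm (1:ℝ), neg_add_cancel_right]; positivity
  refine ⟨f0, ?_⟩
  have := congrArg (fun x => x ^ (1/m)) hf
  rw [← Real.rpow_mul hu.le, mul_one_div_cancel hm.ne', Real.rpow_one, Real.mul_rpow (by positivity) (by positivity), Real.mul_rpow f0.le hv.le, ← Real.exp_mul] at this
  rw [this]; congr 2; field_simp

theorem pde_alg {V p Vp f fr frr fs fp fq c V1 V2 co n E e1 ut E' x : ℝ} (v0 : V ≠ 0) (hE : E' ≠ 0) (x0 : x * E = E') (hode : V2 + n * co * V1 + c * Vp = 0)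
    (h1 : ut * x = (p * fq * fs) * Vp * E' - c * (fp * Vp * E')) (h2 : ut = E * (frr * V + 2 * fr * V1 + f * V2) + n * co * (E * (fr * V + f * V1))) :
    (Vp / V) * (p * fq) * fs = frr + (n * co + 2 * (V1 / V)) * fr + (Vp / V) * (c * (fp + -1 * f)) := by
  have : Vp * (p * fq) * fs * E' = (frr * V + (n * co * V + 2 * V1) * fr + Vp * (c * (fp + -1 * f))) * E' := by
    have h3 : ut * x = E' * (frr * V + 2 * fr * V1 + f * V2) + n * co * (E' * (fr * V + f * V1)) := by rw [h2, ← x0]; ring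
    linear_combination h3 - h1 + E' * f * hode
  have := mul_right_cancel₀ hE this
  field_simp
  linear_combination this

theorem fs_of {N : ℕ} {m T : ℝ} {u : ℝ → ℝ → ℝ} (hN : 2 ≤ N) (hm : m ∈ Ioo (((N : ℝ) - 2) / ((N : ℝ) + 2)) 1) (hT : 0 < T) (h : IsRadialEnergySolution N m T u) (hV : PV (N-1) (1/m) (1/((1-m)*T)) V) :
    ∃ K, FSys (ΘV (1/m) V) (bV (N-1) V) (bV' (N-1) V) (fun r => Real.sinh r ^ (N-1) * V r ^ 2) K (1/m) (1/((1-m)*T)) (wV m T u V) := by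
  have hN2 : (2:ℝ) ≤ N := by exact_mod_cast hN
  have m0 : 0 < m := lt_of_le_of_lt (by apply div_nonneg <;> linarith) hm.1
  have m1 := hm.2
  have hI : IsOpen (Ioi (0:ℝ)) := isOpen_Ioi
  have hNc : ((N-1:ℕ):ℝ) = (N:ℝ) - 1 := by rw [Nat.cast_sub (by omega)]; simp
  obtain ⟨K, hB, hΘ⟩ := hV.bk
  have sU : Sm (Ioo 0 T) (fun p => u p.1 p.2) := h.smooth
  have hu0 : ∀ q ∈ Ici (0:ℝ) ×ˢ Ioi (0:ℝ), 0 < u q.1 (tt T q.2) := fun q hq => h.pos _ hq.1 _ (tt_mem hT hq.2)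
  have sτ : ContDiff ℝ (⊤:ℕ∞) (tt T) := by
    have : tt T = fun s => T * (1 - Real.exp (-(s / T))) := rfl
    rw [this]; fun_prop
  have sw : Sm (Ioi 0) (wV m T u V) := by
    have a1 : Sm (Ioi 0) (fun q => u q.1 (tt T q.2)) :=
      sU.comp (contDiffOn_fst.prodMk (sτ.comp_contDiffOn contDiffOn_snd)) (fun q hq => ⟨hq.1, tt_mem hT hq.2⟩)
    have a2 : Sm (Ioi 0) (fun q => u q.1 (tt T q.2) ^ m) := a1.rpow_const_of_ne (fun q hq => (hu0 q hq).ne')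
    have a3 : Sm (Ioi 0) (fun q => Real.exp (1 / ((1 - m) * T) * m * q.2)) := by
      refine ContDiff.contDiffOn ?_; fun_prop
    exact ((a2.mul a3).div hV.smV (fun q hq => (hV.pos q.1 hq.1).ne')).add (Sm.const (-1))
  have fp : ∀ q ∈ Ici (0:ℝ) ×ˢ Ioi (0:ℝ), 0 < 1 + wV m T u V q := fun q hq => (u_id (r := q.1) (s := q.2) m0 (hV.pos q.1 hq.1) (hu0 q hq)).1
  refine ⟨K, hB, hV.p1, hV.smΘ, fun r s hr hs => by rw [hV.drΘ hr hs]; exact hΘ r hr, sw, fp, fun r s hr hs => ?_, fun δ δ0 => ?_⟩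
  · have v0 := hV.pos r hr.le
    have hs' : (0:ℝ) < s := hs
    obtain ⟨w, hw⟩ : ∃ w, w = wV m T u V := ⟨_, rfl⟩
    obtain ⟨c, hc⟩ : ∃ c, c = 1 / ((1 - m) * T) := ⟨_, rfl⟩
    have hid : ∀ ρ, 0 < ρ → u ρ (tt T s) ^ m = (1 + w (ρ, s)) * V ρ * Real.exp (-(c * m * s)) := fun ρ hρ => by
      rw [hw, hc]; exact f_id (hV.pos ρ hρ.le)
    have tm := tt_mem hT hs'
    have d1 : ∀ ρ, 0 < ρ → HasDerivAt (fun ρ => u ρ (tt T s) ^ m) ((dr (Ioi 0) w (ρ, s) * V ρ + (1 + w (ρ, s)) * Vd V 1 ρ) * Real.exp (-(c * m * s))) ρ := fun ρ hρ => by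
      refine HasDerivAt.congr_of_eventuallyEq ((((hw ▸ sw).hr hρ hs).const_add 1).mul (hV.hV hρ) |>.mul_const _) ?_
      filter_upwards [lt_mem_nhds hρ] with x hx using hid x hx
    have d2 : HasDerivAt (deriv (fun ρ => u ρ (tt T s) ^ m)) (((dr (Ioi 0) (dr (Ioi 0) w) (r, s) * V r + dr (Ioi 0) w (r, s) * Vd V 1 r) + (dr (Ioi 0) w (r, s) * Vd V 1 r + (1 + w (r, s)) * Vd V 2 r)) * Real.exp (-(c * m * s))) r := by
      have sw' : Sm (Ioi 0) w := hw ▸ sw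
      refine HasDerivAt.congr_of_eventuallyEq (((((sw'.dr hI).hr hr hs).mul (hV.hV hr)).add (((sw'.hr hr hs).const_add 1).mul (hV.hd 1 r hr))).mul_const _) ?_
      filter_upwards [lt_mem_nhds hr] with x hx using (d1 x hx).deriv
    have dt := sU.hs isOpen_Ioo hr.le tm
    have pde := h.pde r hr _ tm
    rw [dt.deriv, d2.deriv, (d1 r hr).deriv] at pde
    have e1 := dt.comp s (tt_d (s := s) hT)
    have hfs := (hw ▸ sw : Sm (Ioi 0) w).hs hI hr.le hs
    have f0 : 0 < 1 + w (r, s) := hw ▸ fp (r, s) ⟨hr.le, hs⟩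
    have e2 : HasDerivAt (fun σ => (1 + w (r, σ)) ^ (1/m) * V r ^ (1/m) * Real.exp (-(c * σ)))
        ((ds (Ioi 0) w (r, s) * (1/m) * (1 + w (r, s)) ^ (1/m - 1) * V r ^ (1/m)) * Real.exp (-(c * s)) + (1 + w (r, s)) ^ (1/m) * V r ^ (1/m) * (Real.exp (-(c * s)) * -(c * 1))) s :=
      (((hfs.const_add 1).rpow_const (Or.inl f0.ne')).mul_const _).mul ((((hasDerivAt_id s).const_mul c).neg).exp)
    have e3 := e1.unique (e2.congr_of_eventuallyEq (by
      filter_upwards [lt_mem_nhds hs'] with σ hσ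
      have := (u_id (m := m) (T := T) (u := u) (V := V) (r := r) (s := σ) m0 v0 (hu0 (r, σ) ⟨hr.le, hσ⟩)).2
      rw [hw, hc]; exact this))
    have o := hV.ode r hr
    rw [← hc] at o ⊢
    rw [hNc] at o
    have A := pde_alg (V := V r) (p := 1/m) (Vp := V r ^ (1/m)) (f := 1 + w (r, s)) (fr := dr (Ioi 0) w (r, s)) (frr := dr (Ioi 0) (dr (Ioi 0) w) (r, s)) (fs := ds (Ioi 0) w (r, s))
      (fp := (1 + w (r, s)) ^ (1/m)) (fq := (1 + w (r, s)) ^ (1/m-1)) (co := Real.cosh r / Real.sinh r) (E := Real.exp (-(c * m * s))) (E' := Real.exp (-(c * s))) (x := Real.exp (-(s / T)))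
      (e1 := 0) v0.ne' (Real.exp_pos _).ne' (by
        rw [← Real.exp_add]; congr 1; rw [hc]
        have : (1 - m) ≠ 0 := by linarith
        field_simp; ring) o (e3.trans (by ring)) (pde.trans (by ring))
    have eΘ : ΘV (1/m) V r = V r ^ (1/m) / V r := by unfold ΘV; rw [Real.rpow_sub_one v0.ne']
    simp only [Real.rpow_one]
    rw [eΘ, ← hw]
    unfold bV; rw [hNc]
    exact A
  · obtain ⟨Cl, Cl0, hl⟩ := hV.lo
    have hsub : 1/m * (((N-1:ℕ):ℝ) - 1) < ((N-1:ℕ):ℝ) + 3 := by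
      rw [hNc, one_div, inv_mul_lt_iff₀ m0]
      have := hm.1
      rw [div_lt_iff₀ (by linarith)] at this
      linarith
    obtain ⟨t0, ht0, hu⟩ := (FD.of hN m0 hT h).unif hV.n1 m0 m1 hT hsub hV.os Cl0 (fun r hr => hl r hr.le) δ0
    have lim : Tendsto (tt T) atTop (𝓝 T) := by
      have : Tendsto (fun s => T * (1 - Real.exp (-(s / T)))) atTop (𝓝 (T * (1 - 0))) :=
        ((Real.tendsto_exp_neg_atTop_nhds_zero.comp (tendsto_id.atTop_div_const hT)).const_sub 1).const_mul T
      rw [sub_zero, mul_one] at this; exact this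
    filter_upwards [lim.eventually (lt_mem_nhds ht0.2), eventually_gt_atTop 0] with s hs s0 r hr
    have tm := tt_mem hT s0
    have := hu (tt T s) ⟨hs.le, tm.2⟩ r hr
    have v0 := hV.pos r hr.le
    rw [cU_eq hr.le tm.1.le tm.2.le, tt_g2 hT, ← Real.exp_mul, f_id v0, show -(1 / ((1 - m) * T) * s) * m = -(1 / ((1 - m) * T) * m * s) by ring, mul_div_assoc, div_self (Real.exp_pos _).ne',
      show (1 + wV m T u V (r, s)) * V r * 1 - V r = wV m T u V (r, s) * V r by ring, abs_mul, abs_of_pos v0] at this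
    exact le_of_mul_le_mul_right this v0
end

section
variable {Θ b b' ω : ℝ → ℝ} {K p c : ℝ} {A : Set ℝ} {F G w : ℝ × ℝ → ℝ} {d e k J n : ℕ} {V : ℝ → ℝ}

/-- radial derivative -/
noncomputable def pd (F : ℝ × ℝ → ℝ) : ℝ × ℝ → ℝ := fun q => deriv (fun ρ => F (ρ, q.2)) q.1

/-- weighted bounds for k radial derivatives -/
def BD (Θ : ℝ → ℝ) (A : Set ℝ) (d : ℕ) : ℕ → (ℝ × ℝ → ℝ) → Prop
  | 0, F => Bd Θ A d 1 F
  | k+1, F => Bd Θ A d 1 F ∧ (∀ r ∈ A, ∀ s, 0 < s → DifferentiableAt ℝ (fun ρ => F (ρ, s)) r) ∧ BD Θ A d k (pd F)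

theorem BD.bd (h : BD Θ A d k F) : Bd Θ A d 1 F := by
  cases k with
  | zero => exact h
  | succ k => exact h.1

theorem Bd.cg' {X : ℝ × ℝ → ℝ} (hF : Bd Θ A d X F) (h : ∀ r ∈ A, ∀ s, 0 < s → G (r, s) = F (r, s)) : Bd Θ A d X G := by
  obtain ⟨C, h1⟩ := hF
  refine ⟨C, ?_⟩
  filter_upwards [h1, eventually_gt_atTop 0] with s h1 hs r hr
  rw [h r hr s hs]; exact h1 r hr

theorem evA (oA : IsOpen A) {r s : ℝ} (hr : r ∈ A) (hs : 0 < s) (h : ∀ r ∈ A, ∀ s, 0 < s → G (r, s) = F (r, s)) : (fun ρ => G (ρ, s)) =ᶠ[𝓝 r] (fun ρ => F (ρ, s)) := by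
  filter_upwards [oA.mem_nhds hr] with ρ hρ using h ρ hρ s hs

theorem BD.cg (oA : IsOpen A) (hF : BD Θ A d k F) (h : ∀ r ∈ A, ∀ s, 0 < s → G (r, s) = F (r, s)) : BD Θ A d k G := by
  induction k generalizing F G with
  | zero => exact Bd.cg' hF h
  | succ k ih =>
    obtain ⟨a1, a2, a3⟩ := hF
    exact ⟨a1.cg' h, fun r hr s hs => (a2 r hr s hs).congr_of_eventuallyEq (evA oA hr hs h), ih a3 (fun r hr s hs => (evA oA hr hs h).deriv_eq)⟩

theorem BD.mk (oA : IsOpen A) (hF : Bd Θ A d 1 F) (hd : ∀ r ∈ A, ∀ s, 0 < s → HasDerivAt (fun ρ => F (ρ, s)) (G (r, s)) r) (hG : BD Θ A d k G) : BD Θ A d (k+1) F :=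
  ⟨hF, fun r hr s hs => (hd r hr s hs).differentiableAt, hG.cg oA (fun r hr s hs => (hd r hr s hs).deriv)⟩

theorem BD.out (h : BD Θ A d (k+1) F) : BD Θ A d k (pd F) ∧ ∀ r ∈ A, ∀ s, 0 < s → HasDerivAt (fun ρ => F (ρ, s)) (pd F (r, s)) r :=
  ⟨h.2.2, fun r hr s hs => (h.2.1 r hr s hs).hasDerivAt⟩

theorem BD.le (h : BD Θ A d (k+1) F) : BD Θ A d k F := by
  induction k generalizing F with
  | zero => exact h.1
  | succ k ih => exact ⟨h.1, h.2.1, ih h.2.2⟩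

theorem BD.add (hB : Bk Θ b b' ω K) (oA : IsOpen A) (hA : A ⊆ Ioi 0) (hF : BD Θ A d k F) (hG : BD Θ A d k G) : BD Θ A d k (fun q => F q + G q) := by
  induction k generalizing F G with
  | zero => exact Bd.add hB hA hF hG
  | succ k ih => exact BD.mk oA (hF.1.add hB hA hG.1) (fun r hr s hs => (hF.out.2 r hr s hs).add (hG.out.2 r hr s hs)) (ih hF.2.2 hG.2.2)

theorem BD.mul (hB : Bk Θ b b' ω K) (oA : IsOpen A) (hA : A ⊆ Ioi 0) (hF : BD Θ A d k F) (hG : BD Θ A e k G) {l : ℕ} (hl : d + e ≤ l) : BD Θ A l k (fun q => F q * G q) := by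
  induction k generalizing F G with
  | zero => exact Bd.mul hB hA hF hG hl
  | succ k ih => exact BD.mk oA (hF.1.mul hB hA hG.1 hl) (fun r hr s hs => (hF.out.2 r hr s hs).mul (hG.out.2 r hr s hs)) (BD.add hB oA hA (ih hF.2.2 hG.le) (ih hF.le hG.2.2))

theorem BD.con (oA : IsOpen A) (c : ℝ) : BD Θ A 0 k (fun _ => c) := by
  induction k generalizing c with
  | zero => exact Bd.con c
  | succ k ih => exact BD.mk oA (Bd.con c) (fun r hr s hs => hasDerivAt_const r c) (ih 0)

theorem BD.cm (hB : Bk Θ b b' ω K) (oA : IsOpen A) (hA : A ⊆ Ioi 0) (c : ℝ) (hF : BD Θ A d k F) : BD Θ A d k (fun q => c * F q) :=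
  BD.mul hB oA hA (BD.con oA c) hF (by omega)

theorem Bd.fn {a : ℝ → ℝ} {C : ℝ} (h : ∀ r ∈ A, |a r| ≤ C) : Bd Θ A 0 1 (fun q => a q.1) := ⟨C, Eventually.of_forall fun s r hr => by simpa using h r hr⟩

/-- V-quotients -/
theorem PV.BL (h : PV n p c V) (hB : Bk Θ b b' ω K) (oA : IsOpen A) (hA : A ⊆ Ioi 0) (i : ℕ) : BD Θ A 0 k (fun q => Vd V i q.1 / V q.1) := by
  have hb : ∀ i, Bd Θ A 0 1 (fun q => Vd V i q.1 / V q.1) := fun i => by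
    obtain ⟨C, _, hC⟩ := h.qb i
    exact Bd.fn (a := fun r => Vd V i r / V r) (fun r hr => hC r (le_of_lt (hA hr)))
  induction k generalizing i with
  | zero => exact hb i
  | succ k ih =>
    refine BD.mk (G := fun q => Vd V (i+1) q.1 / V q.1 + -1 * (Vd V i q.1 / V q.1 * (Vd V 1 q.1 / V q.1))) oA (hb i) (fun r hr s hs => (h.quo i (hA hr)).congr_deriv (by ring)) ?_
    exact (ih (i+1)).add hB oA hA (((ih i).mul hB oA hA (ih 1) le_rfl).cm hB oA hA (-1))

theorem PV.BΘ (h : PV n p c V) (hB : Bk (ΘV p V) b b' ω K) (oA : IsOpen A) (hA : A ⊆ Ioi 0) (hF : BD (ΘV p V) A (d+1) k F) : BD (ΘV p V) A d k (fun q => ΘV p V q.1 * F q) := by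
  induction k generalizing F with
  | zero => exact Bd.Θm hB hA hF
  | succ k ih =>
    refine BD.mk (G := fun q => ΘV p V q.1 * ((p - 1) * (Vd V 1 q.1 / V q.1 * F q) + pd F q)) oA (hF.1.Θm hB hA) (fun r hr s hs => ?_) (ih ?_)
    · have v0 := h.pos r (le_of_lt (hA hr))
      refine ((((h.hV (hA hr)).rpow_const (p := p - 1) (Or.inl v0.ne'))).mul (hF.out.2 r hr s hs)).congr_deriv ?_
      simp only [ΘV]
      rw [Real.rpow_sub_one v0.ne' (p - 1)]; field_simp
    · exact (((h.BL hB oA hA 1).mul hB oA hA hF.le (by omega)).cm hB oA hA (p - 1)).add hB oA hA hF.2.2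

theorem FSys.Bpw (h : FSys Θ b b' ω K p c w) (oA : IsOpen A) (hA : A ⊆ Ioi 0) (hw : BD Θ A 0 k w) (α : ℝ) : BD Θ A 0 k (fun q => (1 + w q) ^ α) := by
  induction k generalizing α with
  | zero => exact h.pw hA α
  | succ k ih =>
    refine BD.mk (G := fun q => α * ((1 + w q) ^ (α - 1) * pd w q)) oA (h.pw hA α) (fun r hr s hs => ?_) (((ih hw.le (α - 1)).mul h.bk oA hA hw.2.2 le_rfl).cm h.bk oA hA α)
    refine (((hw.out.2 r hr s hs).const_add 1).rpow_const (Or.inl (h.fp (r, s) ⟨le_of_lt (show (0:ℝ) < r from hA hr), hs⟩).ne')).congr_deriv (by ring)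

theorem FSys.BTT (h : FSys Θ b b' ω K p c w) (oA : IsOpen A) (hA : A ⊆ Ioi 0) (hZ : ∀ i, BD Θ A i k (Zs w i)) (t : TT w J d F) : BD Θ A d k F := by
  induction t with
  | pw α => exact h.Bpw oA hA (hZ 0) α
  | z i h1 hi => exact hZ i
  | con c => exact BD.con oA c
  | add _ _ a b => exact a.add h.bk oA hA b
  | mul _ _ hk a b => exact a.mul h.bk oA hA b hk

theorem Sm.toBD (oA : IsOpen A) (hA : A ⊆ Ioi 0) (sF : Sm (Ioi 0) F) (h1 : Bd Θ A d 1 F) (h2 : BD Θ A d k (_root_.dr (Ioi 0) F)) : BD Θ A d (k+1) F :=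
  BD.mk oA h1 (fun r hr s hs => sF.hr (hA hr) hs) h2

theorem Sm.fromBD (oA : IsOpen A) (hA : A ⊆ Ioi 0) (sF : Sm (Ioi 0) F) (h : BD Θ A d (k+1) F) : BD Θ A d k (_root_.dr (Ioi 0) F) :=
  h.2.2.cg oA (fun r hr s hs => ((sF.hr (hA hr) hs).deriv).symm)

theorem Sm.itBD (oA : IsOpen A) (hA : A ⊆ Ioi 0) (sF : Sm (Ioi 0) F) (h : BD Θ A d k F) : Bd Θ A d 1 ((_root_.dr (Ioi 0))^[k] F) := by
  induction k generalizing F with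
  | zero => exact h
  | succ k ih => rw [Function.iterate_succ_apply]; exact ih (sF.dr isOpen_Ioi) (sF.fromBD oA hA h)

/-- the right-hand side H = βZ_{j+1} - Γ -/
theorem FSys.BH (h : FSys (ΘV p V) b b' ω K p c w) (hV : PV n p c V) (oA : IsOpen A) (hA : A ⊆ Ioi 0) (hZ : ∀ i, BD (ΘV p V) A i k (Zs w i)) (j : ℕ) :
    ∃ H, BD (ΘV p V) A j k H ∧ Sm (Ioi 0) H ∧ ∀ r s, 0 < r → 0 < s → dr (Ioi 0) (dr (Ioi 0) (Zs w j)) (r, s) + b r * dr (Ioi 0) (Zs w j) (r, s) = H (r, s) := by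
  obtain ⟨T, hT, he⟩ := h.hier j
  have B1 := h.BTT oA hA hZ hT
  have B2 := (h.BTT oA hA hZ (FSys.ta (w := w) p)).mul h.bk oA hA (hZ (j+1)) (l := j+1) (by omega)
  have sT := hT.sm h.sw h.fp
  have sa := (FSys.ta (w := w) p).sm h.sw h.fp
  refine ⟨_, (hV.BΘ h.bk oA hA B2).add h.bk oA hA ((hV.BΘ h.bk oA hA B1).cm h.bk oA hA (-1)), (h.sΘ.mul (sa.mul (Zs_sm h.sw (j+1)))).add ((Sm.const (-1)).mul (h.sΘ.mul sT)), fun r s hr hs => ?_⟩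
  have := he r s hr hs
  rw [← Zs_succ] at this
  unfold bet at this
  simp only at this ⊢
  linear_combination -this

theorem coth_BD (hB : Bk Θ b b' ω K) : BD Θ (Ioi (1/2)) 0 k (fun q => Real.cosh q.1 / Real.sinh q.1) := by
  have hA : Ioi (1/2:ℝ) ⊆ Ioi 0 := Ioi_subset_Ioi (by norm_num)
  have hb : Bd Θ (Ioi (1/2)) 0 1 (fun q => Real.cosh q.1 / Real.sinh q.1) := Bd.fn (a := fun r => Real.cosh r / Real.sinh r) (C := 3) (fun r hr => by
    have hr : (1/2:ℝ) < r := hr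
    obtain ⟨c0, c1⟩ := coth_r (show 0 < r by linarith)
    rw [abs_of_pos c0]
    by_contra hc; push Not at hc
    nlinarith)
  induction k with
  | zero => exact hb
  | succ k ih =>
    refine BD.mk (G := fun q => 1 + -1 * (Real.cosh q.1 / Real.sinh q.1 * (Real.cosh q.1 / Real.sinh q.1))) isOpen_Ioi hb (fun r hr s hs => (coth_d (hA hr)).congr_deriv (by ring)) ?_
    exact (BD.con isOpen_Ioi 1).add hB isOpen_Ioi hA ((ih.mul hB isOpen_Ioi hA ih le_rfl).cm hB isOpen_Ioi hA (-1))

theorem sc_BD (hB : Bk Θ b b' ω K) : BD Θ (Ioo 0 1) 0 k (fun q => Real.sinh q.1) ∧ BD Θ (Ioo 0 1) 0 k (fun q => Real.cosh q.1) := by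
  have hs : Bd Θ (Ioo 0 1) 0 1 (fun q => Real.sinh q.1) := by
    obtain ⟨C, hC⟩ := (isCompact_Icc (a := (0:ℝ)) (b := 1)).exists_bound_of_continuousOn Real.continuous_sinh.continuousOn
    exact Bd.fn (a := Real.sinh) (fun r hr => hC r (Ioo_subset_Icc_self hr))
  have hc : Bd Θ (Ioo 0 1) 0 1 (fun q => Real.cosh q.1) := by
    obtain ⟨C, hC⟩ := (isCompact_Icc (a := (0:ℝ)) (b := 1)).exists_bound_of_continuousOn Real.continuous_cosh.continuousOn
    exact Bd.fn (a := Real.cosh) (fun r hr => hC r (Ioo_subset_Icc_self hr))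
  induction k with
  | zero => exact ⟨hs, hc⟩
  | succ k ih => exact ⟨BD.mk isOpen_Ioo hs (fun r hr s hs => Real.hasDerivAt_sinh r) ih.2, BD.mk isOpen_Ioo hc (fun r hr s hs => Real.hasDerivAt_cosh r) ih.1⟩

/-- far region -/
theorem FSys.far (h : FSys (ΘV p V) (bV n V) b' ω K p c w) (hV : PV n p c V) (k : ℕ) : ∀ j, BD (ΘV p V) (Ioi (1/2)) j (k+1) (Zs w j) := by
  have hA : Ioi (1/2:ℝ) ⊆ Ioi 0 := Ioi_subset_Ioi (by norm_num)
  have oA : IsOpen (Ioi (1/2:ℝ)) := isOpen_Ioi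
  have sub : ∀ {d F}, Bd (ΘV p V) (Ioi 0) d 1 F → Bd (ΘV p V) (Ioi (1/2)) d 1 F := fun ⟨C, h⟩ => ⟨C, by filter_upwards [h] with s h r hr using h r (hA hr)⟩
  induction k with
  | zero => exact fun j => (Zs_sm h.sw j).toBD oA hA (sub (h.bZ j)) (sub (h.bR j))
  | succ k ih =>
    intro j
    have sZ := Zs_sm h.sw j
    obtain ⟨H, h1, h2, h3⟩ := h.BH hV oA hA ih j
    refine sZ.toBD oA hA (sub (h.bZ j)) ((sZ.dr isOpen_Ioi).toBD oA hA (sub (h.bR j)) ?_)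
    have B1 : BD (ΘV p V) (Ioi (1/2)) 0 k (fun q => n * (Real.cosh q.1 / Real.sinh q.1) + 2 * (Vd V 1 q.1 / V q.1)) :=
      ((coth_BD h.bk).cm h.bk oA hA n).add h.bk oA hA ((hV.BL h.bk oA hA 1).cm h.bk oA hA 2)
    refine (h1.le.add h.bk oA hA ((B1.mul h.bk oA hA (sZ.fromBD oA hA (ih j)) (l := j) (by omega)).cm h.bk oA hA (-1))).cg oA (fun r hr s hs => ?_)
    have := h3 r s (hA hr) hs
    unfold bV at this
    linear_combination this

theorem w_d (h : PV n p c V) (q : ℕ) {r : ℝ} (hr : 0 < r) :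
    HasDerivAt (fun r => Real.sinh r ^ (q+1) * V r ^ 2) (Real.sinh r ^ q * V r ^ 2 * (((q+1:ℕ):ℝ) * Real.cosh r + 2 * (Vd V 1 r / V r) * Real.sinh r)) r := by
  have v0 := (h.pos r hr.le).ne'
  refine (((Real.hasDerivAt_sinh r).pow (q+1)).mul ((h.hV hr).pow 2)).congr_deriv ?_
  simp only [Nat.add_sub_cancel, pow_succ, Pi.pow_apply]
  field_simp
  norm_num
  ring

theorem mono0 {f f' : ℝ → ℝ} {R : ℝ} (hR : 0 ≤ R) (hc : ContinuousOn f (Icc 0 R)) (hd : ∀ r ∈ Ioo 0 R, HasDerivAt f (f' r) r) (hn : ∀ r ∈ Ioo 0 R, 0 ≤ f' r) : f 0 ≤ f R := by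
  refine monotoneOn_of_deriv_nonneg (convex_Icc 0 R) hc ?_ ?_ (left_mem_Icc.2 hR) (right_mem_Icc.2 hR) hR
  · rw [interior_Icc]; exact fun r hr => (hd r hr).differentiableAt.differentiableWithinAt
  · rw [interior_Icc]; exact fun r hr => by rw [(hd r hr).deriv]; exact hn r hr

/-- singular ODE estimate -/
theorem PV.sing (h : PV n p c V) : ∃ D, 0 < D ∧ ∀ (q : ℕ) (g g' E : ℝ → ℝ) (M R : ℝ), R ∈ Ioo 0 1 → ContinuousOn g (Icc 0 R) → (∀ r ∈ Ioo 0 R, HasDerivAt g (g' r) r) →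
    (∀ r ∈ Ioo 0 R, Real.sinh r * g' r + (((q+1:ℕ):ℝ) * Real.cosh r + 2 * (Vd V 1 r / V r) * Real.sinh r) * g r = E r) → (∀ r ∈ Ioo 0 R, |E r| ≤ M) → 0 ≤ M → |g R| ≤ D * M := by
  obtain ⟨Cu, Cu0, hu⟩ := h.up
  obtain ⟨Cl, Cl0, hl⟩ := h.lo
  obtain ⟨a, ha⟩ : ∃ a, a = Cl * Real.exp (-n) := ⟨_, rfl⟩
  have a0 : 0 < a := by rw [ha]; positivity
  refine ⟨Cu ^ 2 / a ^ 2, by positivity, fun q g g' E M R hR hc hd he hE M0 => ?_⟩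
  have n0 : (0:ℝ) ≤ n := Nat.cast_nonneg n
  have vc : ContinuousOn V (Icc 0 R) := h.sm.continuousOn.mono Icc_subset_Ici_self
  have key : ∀ σ : ℝ, |σ| = 1 → 0 ≤ Cu ^ 2 * M * Real.sinh R ^ (q+1) + σ * (Real.sinh R ^ (q+1) * V R ^ 2 * g R) := fun σ hσ => by
    have := mono0 (f := fun r => Cu ^ 2 * M * Real.sinh r ^ (q+1) + σ * (Real.sinh r ^ (q+1) * V r ^ 2 * g r))
      (f' := fun r => Cu ^ 2 * M * (((q+1:ℕ):ℝ) * Real.sinh r ^ q * Real.cosh r) + σ * (Real.sinh r ^ q * V r ^ 2 * E r)) hR.1.le ?_ (fun r hr => ?_) (fun r hr => ?_)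
    · simpa using this
    · have := Real.continuous_sinh.continuousOn (s := Icc 0 R)
      fun_prop
    · refine ((((Real.hasDerivAt_sinh r).pow (q+1)).const_mul _).add ((((w_d h q hr.1).mul (hd r hr))).const_mul σ)).congr_deriv ?_
      rw [← he r hr]
      simp only [Nat.add_sub_cancel, pow_succ]
      ring
    · have s0 := Real.sinh_pos_iff.2 hr.1
      have nr : 0 ≤ n * r := mul_nonneg n0 hr.1.le
      have v0 := h.pos r hr.1.le
      have v1 : V r ≤ Cu := (hu r hr.1.le).trans (mul_le_of_le_one_right Cu0.le (Real.exp_le_one_iff.2 (by linarith only [nr])))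
      have x1 : |σ * (Real.sinh r ^ q * V r ^ 2 * E r)| ≤ Real.sinh r ^ q * Cu ^ 2 * M := by
        rw [abs_mul, hσ, one_mul, abs_mul, abs_of_pos (show 0 < Real.sinh r ^ q * V r ^ 2 by positivity)]
        have := hE r hr
        gcongr
      have x2 : 1 ≤ ((q+1:ℕ):ℝ) * Real.cosh r := one_le_mul_of_one_le_of_one_le (by push_cast; linarith [Nat.cast_nonneg (α := ℝ) q]) (Real.one_le_cosh r)
      have x3 : Real.sinh r ^ q * Cu ^ 2 * M ≤ (Real.sinh r ^ q * Cu ^ 2 * M) * (((q+1:ℕ):ℝ) * Real.cosh r) := le_mul_of_one_le_right (by positivity) x2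
      have := (abs_le.1 x1).1
      calc (0:ℝ) ≤ (Real.sinh r ^ q * Cu ^ 2 * M) * (((q+1:ℕ):ℝ) * Real.cosh r) + σ * (Real.sinh r ^ q * V r ^ 2 * E r) := by linarith only [this, x3]
        _ = _ := by ring
  have s0 := pow_pos (Real.sinh_pos_iff.2 hR.1) (q+1)
  have v0 := h.pos R hR.1.le
  have v1 : a ≤ V R := by
    refine le_trans ?_ (hl R hR.1.le)
    rw [ha]; gcongr; nlinarith [hR.2]
  have k1 := key 1 (by simp)
  have k2 := key (-1) (by simp)
  have : |V R ^ 2 * g R| ≤ Cu ^ 2 * M := by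
    rw [abs_le]; constructor
    · refine le_of_mul_le_mul_left (a := Real.sinh R ^ (q+1)) ?_ s0; linarith only [k1]
    · refine le_of_mul_le_mul_left (a := Real.sinh R ^ (q+1)) ?_ s0; linarith only [k2]
  rw [abs_mul, abs_of_pos (by positivity)] at this
  rw [div_mul_eq_mul_div, le_div_iff₀ (by positivity)]
  calc |g R| * a ^ 2 ≤ |g R| * V R ^ 2 := by gcongr
    _ ≤ _ := by linarith only [this]

theorem PV.N0 (h : PV n p c V) (hB : Bk Θ b b' ω K) (q : ℕ) {g E : ℝ × ℝ → ℝ} (sg : Sm (Ioi 0) g)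
    (he : ∀ r ∈ Ioo (0:ℝ) 1, ∀ s, 0 < s → Real.sinh r * dr (Ioi 0) g (r, s) + (((q+1:ℕ):ℝ) * Real.cosh r + 2 * (Vd V 1 r / V r) * Real.sinh r) * g (r, s) = E (r, s))
    (hE : Bd Θ (Ioo 0 1) d 1 E) : Bd Θ (Ioo 0 1) d 1 g := by
  obtain ⟨D, D0, hD⟩ := h.sing
  obtain ⟨C, hC⟩ := hE
  refine ⟨D * (K ^ d * |C|), ?_⟩
  filter_upwards [hC, eventually_gt_atTop 0] with s hC hs R hR
  have Θ0 := hB.pos R hR.1.le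
  have K0 := zero_lt_one.trans_le hB.K1
  have := hD q (fun r => Θ R ^ d * g (r, s)) (fun r => Θ R ^ d * dr (Ioi 0) g (r, s)) (fun r => Θ R ^ d * E (r, s)) (K ^ d * |C|) R hR ?_ (fun r hr => ?_) (fun r hr => ?_) (fun r hr => ?_) (by positivity)
  · rw [abs_mul, abs_of_pos (by positivity)] at this
    simpa using this
  · refine ContinuousOn.mul continuousOn_const ?_
    exact sg.continuousOn.comp (by fun_prop) (fun r hr => ⟨hr.1, hs⟩)
  · exact (sg.hr hr.1 hs).const_mul _
  · rw [← he r ⟨hr.1, hr.2.trans hR.2⟩ s hs]; ring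
  · have h1 := hC r ⟨hr.1, hr.2.trans hR.2⟩
    simp only [Pi.one_apply, mul_one] at h1
    rw [abs_mul, abs_of_pos (by positivity)]
    refine (hB.pw d hR.1.le hr.1.le ?_ (abs_nonneg _)).trans (mul_le_mul_of_nonneg_left (h1.trans (le_abs_self C)) (by positivity))
    rw [abs_le]; constructor <;> linarith [hr.1, hr.2, hR.2]

theorem PV.Nk (h : PV n p c V) (hB : Bk Θ b b' ω K) (q : ℕ) {g E : ℝ × ℝ → ℝ} (sg : Sm (Ioi 0) g)
    (he : ∀ r ∈ Ioo (0:ℝ) 1, ∀ s, 0 < s → Real.sinh r * dr (Ioi 0) g (r, s) + (((q+1:ℕ):ℝ) * Real.cosh r + 2 * (Vd V 1 r / V r) * Real.sinh r) * g (r, s) = E (r, s))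
    (hE : BD Θ (Ioo 0 1) d k E) : BD Θ (Ioo 0 1) d k g := by
  have hA : Ioo (0:ℝ) 1 ⊆ Ioi 0 := Ioo_subset_Ioi_self
  have oA : IsOpen (Ioo (0:ℝ) 1) := isOpen_Ioo
  have hI : IsOpen (Ioi (0:ℝ)) := isOpen_Ioi
  induction k generalizing q g E with
  | zero => exact h.N0 hB q sg he hE
  | succ k ih =>
    have gk := ih q sg he hE.le
    refine sg.toBD oA hA (h.N0 hB q sg he hE.1) ?_
    obtain ⟨S, Co⟩ := sc_BD (k := k) hB
    have L1 := h.BL (k := k) hB oA hA 1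
    have L2 := h.BL (k := k) hB oA hA 2
    have cf : BD Θ (Ioo 0 1) 0 k (fun q' => ((q+1:ℕ):ℝ) * Real.sinh q'.1 + 2 * ((Vd V 2 q'.1 / V q'.1 + -1 * (Vd V 1 q'.1 / V q'.1 * (Vd V 1 q'.1 / V q'.1))) * Real.sinh q'.1 + Vd V 1 q'.1 / V q'.1 * Real.cosh q'.1)) :=
      (S.cm hB oA hA _).add hB oA hA (((((L2.add hB oA hA ((L1.mul hB oA hA L1 le_rfl).cm hB oA hA (-1))).mul hB oA hA S le_rfl)).add hB oA hA (L1.mul hB oA hA Co le_rfl)).cm hB oA hA 2)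
    refine ih (q+1) (sg.dr hI) (fun r hr s hs => ?_) (hE.2.2.add hB oA hA ((cf.mul hB oA hA gk (l := d) (by omega)).cm hB oA hA (-1)))
    have d1 := (((Real.hasDerivAt_sinh r).mul ((sg.dr hI).hr hr.1 hs))).add ((((Real.hasDerivAt_cosh r).const_mul ((q+1:ℕ):ℝ)).add (((h.quo 1 hr.1).const_mul 2).mul (Real.hasDerivAt_sinh r))).mul (sg.hr hr.1 hs))
    have d2 := d1.unique ((hE.out.2 r hr s hs).congr_of_eventuallyEq (by filter_upwards [oA.mem_nhds hr] with ρ hρ using he ρ hρ s hs))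
    simp only [Pi.mul_apply, Pi.add_apply] at d2
    push_cast at d2 ⊢
    linear_combination d2

/-- near region -/
theorem FSys.near (h : FSys (ΘV p V) (bV n V) b' ω K p c w) (hV : PV n p c V) (k : ℕ) : ∀ j, BD (ΘV p V) (Ioo 0 1) j k (Zs w j) := by
  have hA : Ioo (0:ℝ) 1 ⊆ Ioi 0 := Ioo_subset_Ioi_self
  have oA : IsOpen (Ioo (0:ℝ) 1) := isOpen_Ioo
  have hI : IsOpen (Ioi (0:ℝ)) := isOpen_Ioi
  have sub : ∀ {d F}, Bd (ΘV p V) (Ioi 0) d 1 F → Bd (ΘV p V) (Ioo 0 1) d 1 F := fun ⟨C, h⟩ => ⟨C, by filter_upwards [h] with s h r hr using h r (hA hr)⟩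
  induction k with
  | zero => exact fun j => sub (h.bZ j)
  | succ k ih =>
    intro j
    have sZ := Zs_sm h.sw j
    obtain ⟨H, h1, h2, h3⟩ := h.BH hV oA hA ih j
    refine sZ.toBD oA hA (sub (h.bZ j)) ?_
    obtain ⟨m, rfl⟩ : ∃ m, n = m + 1 := ⟨n - 1, by have := hV.n1; omega⟩
    refine hV.Nk h.bk m (sZ.dr hI) (fun r hr s hs => ?_) ((sc_BD h.bk).1.mul h.bk oA hA h1 (l := j) (by omega))
    have := h3 r s hr.1 hs
    unfold bV at this
    have s0 := (Real.sinh_pos_iff.2 hr.1).ne'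
    simp only
    rw [← this]
    field_simp

/-- all radial derivatives of powers are bounded -/
theorem FSys.Gb (h : FSys (ΘV p V) (bV n V) b' ω K p c w) (hV : PV n p c V) (k : ℕ) : ∃ C, ∀ᶠ s in atTop, ∀ r, 0 < r → |(dr (Ioi 0))^[k] (fun q => (1 + w q) ^ p) (r, s)| ≤ C := by
  have sF := h.sw.pow h.fp p
  obtain ⟨C1, h1⟩ := sF.itBD isOpen_Ioi (Ioi_subset_Ioi (by norm_num)) (h.Bpw isOpen_Ioi (Ioi_subset_Ioi (by norm_num)) (h.far hV k 0).le p)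
  obtain ⟨C2, h2⟩ := sF.itBD isOpen_Ioo Ioo_subset_Ioi_self (h.Bpw isOpen_Ioo Ioo_subset_Ioi_self (h.near hV k 0) p)
  refine ⟨max C1 C2, ?_⟩
  filter_upwards [h1, h2] with s h1 h2 r hr
  rcases lt_or_ge (1/2) r with hc | hc
  · have := h1 r hc; simp only [pow_zero, one_mul, Pi.one_apply, mul_one] at this
    exact this.trans (le_max_left _ _)
  · have := h2 r ⟨hr, by linarith⟩; simp only [pow_zero, one_mul, Pi.one_apply, mul_one] at this
    exact this.trans (le_max_right _ _)
end

section
variable {n : ℕ} {p c K : ℝ} {V b' ω : ℝ → ℝ} {w : ℝ × ℝ → ℝ}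

theorem Sm.it {F : ℝ × ℝ → ℝ} (h : Sm (Ioi 0) F) (k : ℕ) : Sm (Ioi 0) ((_root_.dr (Ioi 0))^[k] F) := by
  induction k with
  | zero => exact h
  | succ k ih => rw [Function.iterate_succ_apply']; exact ih.dr isOpen_Ioi

theorem Sm.itd {F : ℝ × ℝ → ℝ} (h : Sm (Ioi 0) F) (k : ℕ) {s : ℝ} (hs : 0 < s) : ∀ r, 0 < r → iteratedDeriv k (fun ρ => F (ρ, s)) r = (_root_.dr (Ioi 0))^[k] F (r, s) := by
  induction k with
  | zero => intro r hr; simp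
  | succ k ih =>
    intro r hr
    rw [iteratedDeriv_succ, Function.iterate_succ_apply', ← ((h.it k).hr hr hs).deriv]
    exact Filter.EventuallyEq.deriv_eq (by filter_upwards [lt_mem_nhds hr] with ρ hρ using ih ρ hρ)

/-- interpolation step -/
theorem landau {F : ℝ × ℝ → ℝ} (h : Sm (Ioi 0) F) {a : ℝ} (h0 : ∀ δ, 0 < δ → ∀ᶠ s in atTop, ∀ r, 0 < r → |F (r, s) - a| ≤ δ)
    (h2 : ∃ C, ∀ᶠ s in atTop, ∀ r, 0 < r → |dr (Ioi 0) (dr (Ioi 0) F) (r, s)| ≤ C) :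
    ∀ ε, 0 < ε → ∀ᶠ s in atTop, ∀ r, 0 < r → |dr (Ioi 0) F (r, s) - 0| ≤ ε := by
  intro ε he
  obtain ⟨C, hC⟩ := h2
  have D0 : 0 < |C| + 1 := by positivity
  obtain ⟨l, l0, hl⟩ : ∃ l, 0 < l ∧ (|C| + 1) * l = ε / 2 := ⟨ε / 2 / (|C| + 1), by positivity, by field_simp⟩
  filter_upwards [hC, h0 (ε * l / 4) (by positivity), eventually_gt_atTop 0] with s hC h0 hs r hr
  have h1 := h.dr isOpen_Ioi
  have dF : ∀ ρ, 0 < ρ → HasDerivAt (fun ρ => F (ρ, s)) (dr (Ioi 0) F (ρ, s)) ρ := fun ρ hρ => h.hr hρ hs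
  have dG : ∀ ρ, 0 < ρ → HasDerivAt (fun ρ => dr (Ioi 0) F (ρ, s)) (dr (Ioi 0) (dr (Ioi 0) F) (ρ, s)) ρ := fun ρ hρ => h1.hr hρ hs
  obtain ⟨x, hx, ex⟩ := exists_hasDerivAt_eq_slope (fun ρ => F (ρ, s)) (fun ρ => dr (Ioi 0) F (ρ, s)) (show r < r + l by linarith)
    (fun ρ hρ => (dF ρ (hr.trans_le hρ.1)).continuousAt.continuousWithinAt) (fun ρ hρ => dF ρ (hr.trans hρ.1))
  obtain ⟨y, hy, ey⟩ := exists_hasDerivAt_eq_slope (fun ρ => dr (Ioi 0) F (ρ, s)) (fun ρ => dr (Ioi 0) (dr (Ioi 0) F) (ρ, s)) hx.1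
    (fun ρ hρ => (dG ρ (hr.trans_le hρ.1)).continuousAt.continuousWithinAt) (fun ρ hρ => dG ρ (hr.trans hρ.1))
  have xr : 0 < x - r := sub_pos.2 hx.1
  rw [add_sub_cancel_left, eq_div_iff l0.ne'] at ex
  rw [eq_div_iff xr.ne'] at ey
  have a1 := abs_le.1 (h0 r hr)
  have a2 := abs_le.1 (h0 (r + l) (by linarith))
  have b1 : |dr (Ioi 0) F (x, s)| ≤ ε / 2 := by
    rw [abs_le]
    constructor <;> refine le_of_mul_le_mul_right ?_ l0 <;> rw [ex] <;> linarith [a1.1, a1.2, a2.1, a2.2]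
  have b2 : |dr (Ioi 0) F (x, s) - dr (Ioi 0) F (r, s)| ≤ ε / 2 := by
    rw [← ey, abs_mul, abs_of_pos xr, ← hl]
    exact mul_le_mul ((hC y (hr.trans hy.1)).trans (by linarith [le_abs_self C])) (by linarith [hx.2]) xr.le D0.le
  rw [sub_zero]
  rw [abs_le] at *
  constructor <;> linarith [b1.1, b1.2, b2.1, b2.2]

theorem FSys.conv (h : FSys (ΘV p V) (bV n V) b' ω K p c w) (hV : PV n p c V) (k : ℕ) :
    ∀ ε, 0 < ε → ∀ᶠ s in atTop, ∀ r, 0 < r → |(dr (Ioi 0))^[k+1] (fun q => (1 + w q) ^ p) (r, s) - 0| ≤ ε := by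
  have sF := h.sw.pow h.fp p
  induction k with
  | zero =>
    refine landau (a := 1) sF (fun δ hδ => ?_) (h.Gb hV 2)
    have ct : ContinuousAt (fun x : ℝ => (1 + x) ^ p) 0 := (continuousAt_const.add continuousAt_id).rpow_const (Or.inl (by norm_num))
    obtain ⟨η, η0, hη⟩ := Metric.continuousAt_iff.1 ct δ hδ
    filter_upwards [h.small (η/2) (by positivity)] with s hs r hr
    have := hη (x := w (r, s)) (by rw [Real.dist_eq, sub_zero]; linarith [hs r hr])
    rw [Real.dist_eq, add_zero, Real.one_rpow] at this
    exact this.le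
  | succ k ih =>
    rw [Function.iterate_succ_apply']
    refine landau (sF.it (k+1)) ih ?_
    have := h.Gb hV (k+1+1+1)
    rwa [Function.iterate_succ_apply', Function.iterate_succ_apply'] at this

end

theorem main_thm
    (N : ℕ) (hN : 2 ≤ N) (m T : ℝ)
    (hm : m ∈ Set.Ioo (((N : ℝ) - 2) / ((N : ℝ) + 2)) 1) (hT : 0 < T)
    (u : ℝ → ℝ → ℝ) (hu : IsRadialEnergySolution N m T u)
    (V : ℝ → ℝ) (hV : IsStationaryProfile N m T V) :
    ∀ k : ℕ, 1 ≤ k → ∀ ε > (0:ℝ), ∃ t₀ ∈ Set.Ioo 0 T, ∀ t ∈ Set.Ico t₀ T, ∀ r > (0:ℝ),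
      |iteratedDeriv k
          (fun ρ => u ρ t / ((1 - t / T) ^ (1 / (1 - m)) * V ρ ^ (1 / m))) r| ≤ ε := by
  intro k hk ε he
  obtain ⟨k, rfl⟩ : ∃ j, k = j + 1 := ⟨k - 1, by omega⟩
  have hN' : (2:ℝ) ≤ N := by exact_mod_cast hN
  have m0 : 0 < m := lt_of_le_of_lt (div_nonneg (by linarith) (by linarith)) hm.1
  have P := PV.of hN m0 hm.2 hT hV
  obtain ⟨K, F⟩ := fs_of hN hm hT hu P
  obtain ⟨S, S0, hS⟩ := ev0 (F.conv P k ε he)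
  refine ⟨tt T (S+1), tt_mem hT (by linarith), fun t ht r hr => ?_⟩
  have g0 : 0 < 1 - t / T := by rw [sub_pos, div_lt_one hT]; exact ht.2
  obtain ⟨s, es⟩ : ∃ s, Real.exp (-(s/T)) = 1 - t / T := ⟨-(T * Real.log (1 - t/T)), by
    rw [neg_div, neg_neg, mul_div_cancel_left₀ _ hT.ne', Real.exp_log g0]⟩
  have et : tt T s = t := by unfold tt; rw [es]; field_simp; ring
  have hs : S + 1 ≤ s := by
    have h1 := ht.1
    rw [← et] at h1
    unfold tt at h1
    have h2 := le_of_mul_le_mul_left h1 hT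
    have h3 : Real.exp (-(s/T)) ≤ Real.exp (-((S+1)/T)) := by linarith
    have h4 := Real.exp_le_exp.1 h3
    exact (div_le_div_iff_of_pos_right hT).1 (by linarith)
  have s0 : 0 < s := by linarith
  have key := hS s (by linarith) r hr
  rw [sub_zero, ← (F.sw.pow F.fp (1/m)).itd (k+1) s0 r hr] at key
  convert key using 2
  refine Filter.EventuallyEq.iteratedDeriv_eq _ ?_
  filter_upwards [lt_mem_nhds hr] with ρ hρ
  have v0 := hV.pos ρ hρ.le
  have q := (u_id (T := T) (s := s) m0 v0 (hu.pos ρ hρ.le _ (tt_mem hT s0))).2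
  have g2 : (1 - t / T) ^ (1 / (1 - m)) = Real.exp (-(1/((1-m)*T)*s)) := by
    rw [← tt_g2 hT, et]; rfl
  rw [et] at q
  rw [g2, q]
  have := (Real.rpow_pos_of_pos v0 (1/m)).ne'
  have := (Real.exp_pos (-(1/((1-m)*T)*s))).ne'
  field_simp

/-- Convergence to zero of all spatial derivatives of the relative quotient. -/
theorem convergence_of_derivatives_of_quotient
    (N : ℕ) (hN : 2 ≤ N) (m T : ℝ)
    (hm : m ∈ Set.Ioo (((N : ℝ) - 2) / ((N : ℝ) + 2)) 1) (hT : 0 < T)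
    (u : ℝ → ℝ → ℝ) (hu : IsRadialEnergySolution N m T u)
    (V : ℝ → ℝ) (hV : IsStationaryProfile N m T V) :
    ∀ k : ℕ, 1 ≤ k → ∀ ε > (0:ℝ), ∃ t₀ ∈ Set.Ioo 0 T, ∀ t ∈ Set.Ico t₀ T, ∀ r > (0:ℝ),
      |iteratedDeriv k
          (fun ρ => u ρ t / ((1 - t / T) ^ (1 / (1 - m)) * V ρ ^ (1 / m))) r| ≤ ε := by
  exact main_thm N hN m T hm hT u hu V hV
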